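/- Local boundedness with L¹ tail (Lemma 3.2). Let v be a local weak solution of the homogeneous equation ∂_t v − div(𝒜(t,x,Dv)) + ℒv = 0 in Ω_T. Then for every R ∈ (0,1] and (t₀,x₀) with I_{2R}^⊖(t₀) × B_{2R}(x₀) compactly contained in I × Ω, there exists C > 0 depending only on d, s, Λ such that ess sup_{Q_{R/2}(t₀,x₀)} |v| ≤ C ( ⨍_{Q_R(t₀,x₀)} |v| dx dt + ⨍_{I_R^⊖(t₀)} Tail(v(t); x₀, R) dt ). -/

import Mathlib

open MeasureTheory Set Filter Metric
open scoped ENNReal NNReal Topology RealInnerProductSpace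

noncomputable section

/-- Euclidean space `ℝ^d`. -/
abbrev Ed (d : ℕ) : Type := EuclideanSpace ℝ (Fin d)

variable {d : ℕ}

/-- Backward time interval `I_r^⊖(t₀) = (t₀ - r², t₀)`. -/
def Iminus (t₀ r : ℝ) : Set ℝ := Set.Ioo (t₀ - r ^ 2) t₀

/-- Parabolic cylinder `Q_r(t₀,x₀) = I_r^⊖(t₀) × B_r(x₀)`. -/
def pCyl (t₀ : ℝ) (x₀ : Ed d) (r : ℝ) : Set (ℝ × Ed d) :=
  (Iminus t₀ r) ×ˢ (Metric.ball x₀ r)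

/-- Nonlocal tail `Tail(v; x₀, R) = R² ∫_{ℝ^d ∖ B_R(x₀)} |v(y)| |x₀ - y|^{-d-2s} dy`. -/
def Tail (s : ℝ) (v : Ed d → ℝ) (x₀ : Ed d) (R : ℝ) : ℝ :=
  R ^ 2 * ∫ y in (Metric.ball x₀ R)ᶜ, |v y| / ‖x₀ - y‖ ^ ((d : ℝ) + 2 * s)

/-- Caloric Riesz potential `ℐ^ν_α(t₀,x₀;R) = ∫₀^R ν(Q_ρ(t₀,x₀)) ρ^{-(d+2-α)} dρ/ρ`
for a nonnegative measure `ν`. -/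
def RieszPot (ν : Measure (ℝ × Ed d)) (α : ℝ) (t₀ : ℝ) (x₀ : Ed d) (R : ℝ) : ℝ :=
  ∫ ρ in Set.Ioo (0 : ℝ) R, (ν (pCyl t₀ x₀ ρ)).toReal / ρ ^ ((d : ℝ) + 2 - α) / ρ

/-- The structure conditions (1.2)-(1.3) on the vector field `𝒜`. -/
structure VectorFieldHyp (d : ℕ) (Λ : ℝ) (A : ℝ → Ed d → Ed d → Ed d) : Prop where
  meas : ∀ ξ : Ed d, Measurable fun p : ℝ × Ed d => A p.1 p.2 ξ
  cont : ∀ t x, Continuous (A t x)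
  growth : ∀ t x ξ, ‖A t x ξ‖ ≤ Λ * ‖ξ‖
  monotone : ∀ t x ξ η, Λ⁻¹ * ‖η - ξ‖ ^ 2 ≤ ⟪A t x η - A t x ξ, η - ξ⟫

/-- The ellipticity and symmetry conditions on the jump kernel `K`. -/
structure KernelHyp (d : ℕ) (s Λ : ℝ) (K : ℝ → Ed d → Ed d → ℝ) : Prop where
  meas : Measurable fun p : ℝ × Ed d × Ed d => K p.1 p.2.1 p.2.2
  symm : ∀ t x y, K t x y = K t y x
  lower : ∀ t x y, x ≠ y → Λ⁻¹ / ‖x - y‖ ^ ((d : ℝ) + 2 * s) ≤ K t x y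
  upper : ∀ t x y, x ≠ y → K t x y ≤ Λ / ‖x - y‖ ^ ((d : ℝ) + 2 * s)

/-- Membership of `v` (with weak spatial gradient `Dv`) in the function space
`L²_loc(J; W^{1,2}_loc(Ω)) ∩ L^∞_loc(J; L²_loc(Ω)) ∩ L²_loc(J; 𝓛¹_{2s}(ℝ^d))`. -/
structure LocalWeakReg (d : ℕ) (s : ℝ) (J : Set ℝ) (Ω : Set (Ed d))
    (v : ℝ → Ed d → ℝ) (Dv : ℝ → Ed d → Ed d) : Prop where
  meas : Measurable (Function.uncurry v)
  measD : Measurable (Function.uncurry Dv)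
  grad : ∀ t ∈ J, ∀ φ : Ed d → ℝ, ContDiff ℝ (⊤ : ℕ∞) φ → HasCompactSupport φ →
    tsupport φ ⊆ Ω → ∀ e : Ed d,
      ∫ x, v t x * (fderiv ℝ φ x) e = - ∫ x, φ x * ⟪Dv t x, e⟫
  l2w12 : ∀ t₁ t₂ : ℝ, Set.Icc t₁ t₂ ⊆ J → ∀ Kc : Set (Ed d), IsCompact Kc → Kc ⊆ Ω →
    MeasureTheory.IntegrableOn
      (fun p : ℝ × Ed d => (v p.1 p.2) ^ 2 + ‖Dv p.1 p.2‖ ^ 2) ((Set.Ioo t₁ t₂) ×ˢ Kc)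
  linfl2 : ∀ t₁ t₂ : ℝ, Set.Icc t₁ t₂ ⊆ J → ∀ Kc : Set (Ed d), IsCompact Kc → Kc ⊆ Ω →
    ∃ M : ℝ, ∀ᵐ t ∂(volume.restrict (Set.Ioo t₁ t₂)), (∫ x in Kc, (v t x) ^ 2) ≤ M
  tail_ae : ∀ᵐ t : ℝ, t ∈ J →
    MeasureTheory.Integrable fun y : Ed d => |v t y| / (1 + ‖y‖ ^ ((d : ℝ) + 2 * s))
  tail_l2 : ∀ t₁ t₂ : ℝ, Set.Icc t₁ t₂ ⊆ J →
    MeasureTheory.IntegrableOn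
      (fun t => (∫ y : Ed d, |v t y| / (1 + ‖y‖ ^ ((d : ℝ) + 2 * s))) ^ 2) (Set.Ioo t₁ t₂)

/-- Smooth test functions with compact spatial support contained in `Ω`. -/
def IsTestFunction (Ω : Set (Ed d)) (φ : ℝ → Ed d → ℝ) : Prop :=
  ContDiff ℝ (⊤ : ℕ∞) (Function.uncurry φ) ∧
    ∃ Kc : Set (Ed d), IsCompact Kc ∧ Kc ⊆ Ω ∧ ∀ t, tsupport (φ t) ⊆ Kc

/-- The left-hand side of the weak formulation of
`∂_t u - div(𝒜(t,x,Du)) + ℒu` tested against `φ` on `(t₁,t₂] × Ω`. -/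
def mixedLHS (A : ℝ → Ed d → Ed d → Ed d) (K : ℝ → Ed d → Ed d → ℝ)
    (Ω : Set (Ed d)) (u : ℝ → Ed d → ℝ) (Du : ℝ → Ed d → Ed d)
    (φ : ℝ → Ed d → ℝ) (t₁ t₂ : ℝ) : ℝ :=
  -(∫ t in Set.Ioc t₁ t₂, ∫ x in Ω, u t x * deriv (fun τ => φ τ x) t)
    + (∫ x in Ω, u t₂ x * φ t₂ x) - (∫ x in Ω, u t₁ x * φ t₁ x)
    + (∫ t in Set.Ioc t₁ t₂, ∫ x in Ω, ⟪A t x (Du t x), gradient (φ t) x⟫)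
    + ∫ t in Set.Ioc t₁ t₂, ∫ x : Ed d, ∫ y : Ed d,
        (u t x - u t y) * (φ t x - φ t y) * K t x y

/-- Integral of a function against a finite signed measure. -/
def signedIntegral (μ : MeasureTheory.SignedMeasure (ℝ × Ed d)) (f : ℝ × Ed d → ℝ) : ℝ :=
  (∫ p, f p ∂μ.toJordanDecomposition.posPart)
    - ∫ p, f p ∂μ.toJordanDecomposition.negPart

/-- Local weak solution of `∂_t u - div(𝒜(t,x,Du)) + ℒu = μ` in `J × Ω`. -/
def IsLocalWeakSolution (A : ℝ → Ed d → Ed d → Ed d) (K : ℝ → Ed d → Ed d → ℝ)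
    (J : Set ℝ) (Ω : Set (Ed d)) (μ : MeasureTheory.SignedMeasure (ℝ × Ed d))
    (u : ℝ → Ed d → ℝ) (Du : ℝ → Ed d → Ed d) : Prop :=
  ∀ t₁ t₂ : ℝ, t₁ ≤ t₂ → Set.Icc t₁ t₂ ⊆ J →
    ∀ φ : ℝ → Ed d → ℝ, IsTestFunction Ω φ →
      mixedLHS A K Ω u Du φ t₁ t₂ =
        signedIntegral μ (Set.indicator ((Set.Ioc t₁ t₂) ×ˢ Ω) fun p => φ p.1 p.2)

/-- Local weak solution of the homogeneous equation
`∂_t v - div(𝒜(t,x,Dv)) + ℒv = 0` in `J × Ω`. -/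
def IsLocalWeakSolutionHom (A : ℝ → Ed d → Ed d → Ed d) (K : ℝ → Ed d → Ed d → ℝ)
    (J : Set ℝ) (Ω : Set (Ed d))
    (v : ℝ → Ed d → ℝ) (Dv : ℝ → Ed d → Ed d) : Prop :=
  ∀ t₁ t₂ : ℝ, t₁ ≤ t₂ → Set.Icc t₁ t₂ ⊆ J →
    ∀ φ : ℝ → Ed d → ℝ, IsTestFunction Ω φ → mixedLHS A K Ω v Dv φ t₁ t₂ = 0

/-- Local weak subsolution of the homogeneous equation in `J × Ω`. -/
def IsLocalWeakSubsolutionHom (A : ℝ → Ed d → Ed d → Ed d) (K : ℝ → Ed d → Ed d → ℝ)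
    (J : Set ℝ) (Ω : Set (Ed d))
    (v : ℝ → Ed d → ℝ) (Dv : ℝ → Ed d → Ed d) : Prop :=
  ∀ t₁ t₂ : ℝ, t₁ ≤ t₂ → Set.Icc t₁ t₂ ⊆ J →
    ∀ φ : ℝ → Ed d → ℝ, IsTestFunction Ω φ → (∀ t x, 0 ≤ φ t x) →
      mixedLHS A K Ω v Dv φ t₁ t₂ ≤ 0

/-- Local weak supersolution of the homogeneous equation in `J × Ω`. -/
def IsLocalWeakSupersolutionHom (A : ℝ → Ed d → Ed d → Ed d) (K : ℝ → Ed d → Ed d → ℝ)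
    (J : Set ℝ) (Ω : Set (Ed d))
    (v : ℝ → Ed d → ℝ) (Dv : ℝ → Ed d → Ed d) : Prop :=
  ∀ t₁ t₂ : ℝ, t₁ ≤ t₂ → Set.Icc t₁ t₂ ⊆ J →
    ∀ φ : ℝ → Ed d → ℝ, IsTestFunction Ω φ → (∀ t x, φ t x ≤ 0) →
      mixedLHS A K Ω v Dv φ t₁ t₂ ≤ 0

/-- The global excess functional `E(u,t₀,x₀,R)`. -/
def Excess (s q : ℝ) (u : ℝ → Ed d → ℝ) (t₀ : ℝ) (x₀ : Ed d) (R : ℝ) : ℝ :=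
  (⨍ t in Iminus t₀ R, (⨍ x in Metric.ball x₀ R,
      |u t x - ⨍ p in pCyl t₀ x₀ R, u p.1 p.2|) ^ q) ^ (1 / q)
  + (⨍ t in Iminus t₀ R,
      (Tail s (fun y => u t y - ⨍ p in pCyl t₀ x₀ R, u p.1 p.2) x₀ R) ^ q) ^ (1 / q)

set_option linter.unusedSectionVars false

open scoped Convolution

section Mollification

variable {V : Type*} [NormedAddCommGroup V] [NormedSpace ℝ V] [FiniteDimensional ℝ V]
  [MeasurableSpace V] [BorelSpace V] {μ : Measure V} [μ.IsAddHaarMeasure]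
  {X : Type*} [NormedAddCommGroup X] [NormedSpace ℝ X] [CompleteSpace X]

theorem eLpNorm_two_sq {α Y : Type*} [MeasurableSpace α] {ν : Measure α} [NormedAddCommGroup Y]
    (f : α → Y) : eLpNorm f 2 ν ^ 2 = ∫⁻ x, ‖f x‖ₑ ^ 2 ∂ν := by
  have h := eLpNorm_nnreal_pow_eq_lintegral (μ := ν) (f := f) (p := 2) (by norm_num)
  simpa using h

theorem sq_lintegral_mul_le {α : Type*} [MeasurableSpace α] {ν : Measure α} {w f : α → ℝ≥0∞}
    (hw : AEMeasurable w ν) (hf : AEMeasurable f ν) :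
    (∫⁻ x, w x * f x ∂ν) ^ 2 ≤ (∫⁻ x, w x ∂ν) * ∫⁻ x, w x * f x ^ 2 ∂ν := by
  have h := ENNReal.lintegral_mul_le_Lp_mul_Lq ν (p := 2) (q := 2) (by
    constructor <;> norm_num) (f := fun x => w x ^ (1 / 2 : ℝ))
    (g := fun x => w x ^ (1 / 2 : ℝ) * f x) (hw.pow_const _) ((hw.pow_const _).mul hf)
  have e1 : ∀ x, ((fun x => w x ^ (1 / 2 : ℝ)) * fun x => w x ^ (1 / 2 : ℝ) * f x) x = w x * f x := by
    intro x
    simp only [Pi.mul_apply]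
    rw [← mul_assoc, ← ENNReal.rpow_add_of_nonneg _ _ (by norm_num) (by norm_num)]
    norm_num
  have e2 : ∀ x, (w x ^ (1 / 2 : ℝ)) ^ (2 : ℝ) = w x := fun x => by
    rw [← ENNReal.rpow_mul]; norm_num
  have e3 : ∀ x, (w x ^ (1 / 2 : ℝ) * f x) ^ (2 : ℝ) = w x * f x ^ 2 := fun x => by
    rw [ENNReal.mul_rpow_of_nonneg _ _ (by norm_num), e2]; norm_num
  simp only [e1, e2, e3] at h
  calc _ ≤ ((∫⁻ x, w x ∂ν) ^ (1 / 2 : ℝ) * (∫⁻ x, w x * f x ^ 2 ∂ν) ^ (1 / 2 : ℝ)) ^ 2 := by gcongr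
    _ = _ := by
      rw [mul_pow]
      simp only [← ENNReal.rpow_natCast, ← ENNReal.rpow_mul]
      norm_num

theorem ContDiffBump.lintegral_ofReal_normed (φ : ContDiffBump (0 : V)) :
    ∫⁻ x, ENNReal.ofReal (φ.normed μ x) ∂μ = 1 := by
  rw [← ofReal_integral_eq_lintegral_ofReal φ.integrable_normed
    (Eventually.of_forall fun x => φ.nonneg_normed x), φ.integral_normed, ENNReal.ofReal_one]

/-- Young's inequality for mollification in `L²`. -/
theorem ContDiffBump.eLpNorm_convolution_le (φ : ContDiffBump (0 : V)) {f : V → X}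
    (hf : AEStronglyMeasurable f μ) :
    eLpNorm (φ.normed μ ⋆[ContinuousLinearMap.lsmul ℝ ℝ, μ] f) 2 μ ≤ eLpNorm f 2 μ := by
  have hρ : Measurable fun x => ENNReal.ofReal (φ.normed μ x) :=
    (φ.continuous_normed.measurable).ennreal_ofReal
  have hfn : AEMeasurable (fun x => ‖f x‖ₑ) μ := hf.enorm
  have key : eLpNorm (φ.normed μ ⋆[ContinuousLinearMap.lsmul ℝ ℝ, μ] f) 2 μ ^ 2
      ≤ eLpNorm f 2 μ ^ 2 := by
    rw [eLpNorm_two_sq, eLpNorm_two_sq]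
    calc _ ≤ ∫⁻ x, ∫⁻ t, ENNReal.ofReal (φ.normed μ t) * ‖f (x - t)‖ₑ ^ 2 ∂μ ∂μ := by
          refine lintegral_mono fun x => ?_
          have h1 : ‖(φ.normed μ ⋆[ContinuousLinearMap.lsmul ℝ ℝ, μ] f) x‖ₑ
              ≤ ∫⁻ t, ENNReal.ofReal (φ.normed μ t) * ‖f (x - t)‖ₑ ∂μ := by
            refine (enorm_integral_le_lintegral_enorm _).trans (le_of_eq ?_)
            refine lintegral_congr fun t => ?_
            simp only [ContinuousLinearMap.lsmul_apply, enorm_smul]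
            rw [Real.enorm_eq_ofReal (φ.nonneg_normed t)]
          have h2 := sq_lintegral_mul_le (ν := μ) (w := fun t => ENNReal.ofReal (φ.normed μ t))
            (f := fun t => ‖f (x - t)‖ₑ) hρ.aemeasurable
            (hfn.comp_quasiMeasurePreserving
              (quasiMeasurePreserving_sub_left_of_right_invariant μ x))
          rw [φ.lintegral_ofReal_normed, one_mul] at h2
          calc _ ≤ _ := by gcongr
            _ ≤ _ := h2
      _ = ∫⁻ t, ∫⁻ x, ENNReal.ofReal (φ.normed μ t) * ‖f (x - t)‖ₑ ^ 2 ∂μ ∂μ := by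
          refine lintegral_lintegral_swap ?_
          refine (hρ.comp measurable_snd).aemeasurable.mul ?_
          refine AEMeasurable.pow_const ?_ _
          exact hfn.comp_quasiMeasurePreserving
            (quasiMeasurePreserving_sub_of_right_invariant μ μ)
      _ = ∫⁻ t, ENNReal.ofReal (φ.normed μ t) * ∫⁻ x, ‖f x‖ₑ ^ 2 ∂μ ∂μ := by
          refine lintegral_congr fun t => ?_
          rw [lintegral_const_mul' _ _ ENNReal.ofReal_ne_top,
            lintegral_sub_right_eq_self (fun x => ‖f x‖ₑ ^ 2) t]
      _ = _ := by
          rw [lintegral_mul_const _ hρ, φ.lintegral_ofReal_normed, one_mul]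
  exact (ENNReal.pow_le_pow_left_iff (by norm_num)).1 key

/-- The standard mollifying sequence. -/
def mollifier (V : Type*) [NormedAddCommGroup V] (n : ℕ) : ContDiffBump (0 : V) where
  rIn := 1 / (2 * ((n : ℝ) + 1))
  rOut := 1 / ((n : ℝ) + 1)
  rIn_pos := by positivity
  rIn_lt_rOut := by
    apply one_div_lt_one_div_of_lt <;> nlinarith [(Nat.cast_nonneg n : (0 : ℝ) ≤ n)]

theorem mollifier_rOut_tendsto : Tendsto (fun n => (mollifier V n).rOut) atTop (𝓝 0) :=
  tendsto_one_div_add_atTop_nhds_zero_nat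

theorem mollifier_rOut_le (n : ℕ) : (mollifier V n).rOut ≤ 1 := by
  simp only [mollifier]
  rw [div_le_one (by positivity)]
  linarith [(Nat.cast_nonneg n : (0 : ℝ) ≤ n)]

variable (μ) in
/-- Mollification of `f` at scale `1 / (n + 1)`. -/
def mollify (n : ℕ) (f : V → X) : V → X :=
  (mollifier V n).normed μ ⋆[ContinuousLinearMap.lsmul ℝ ℝ, μ] f

theorem ae_tendsto_mollify {f : V → X} (hf : LocallyIntegrable f μ) :
    ∀ᵐ x ∂μ, Tendsto (fun n => mollify μ n f x) atTop (𝓝 (f x)) := by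
  refine ContDiffBump.ae_convolution_tendsto_right_of_locallyIntegrable (K := 2)
    mollifier_rOut_tendsto (Eventually.of_forall fun n => ?_) hf
  simp only [mollifier]
  rw [mul_one_div, div_le_div_iff₀ (by positivity) (by positivity)]
  linarith

theorem contDiff_mollify {f : V → X} (hf : LocallyIntegrable f μ) (n : ℕ) :
    ContDiff ℝ (⊤ : ℕ∞) (mollify μ n f) :=
  (mollifier V n).hasCompactSupport_normed.contDiff_convolution_left _
    (mollifier V n).contDiff_normed hf

theorem hasCompactSupport_mollify {f : V → X} (hf : HasCompactSupport f) (n : ℕ) :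
    HasCompactSupport (mollify μ n f) :=
  HasCompactSupport.convolution _ (mollifier V n).hasCompactSupport_normed hf

theorem support_mollify_subset {f : V → X} (n : ℕ) :
    Function.support (mollify μ n f) ⊆ Metric.thickening (mollifier V n).rOut (Function.support f) := by
  refine (support_convolution_subset _).trans ?_
  rintro _ ⟨a, ha, b, hb, rfl⟩
  rw [(mollifier V n).support_normed_eq, mem_ball_zero_iff] at ha
  refine Metric.mem_thickening_iff.2 ⟨b, hb, ?_⟩
  simpa [dist_eq_norm] using ha

theorem eLpNorm_mollify_le {f : V → X} (hf : AEStronglyMeasurable f μ) (n : ℕ) :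
    eLpNorm (mollify μ n f) 2 μ ≤ eLpNorm f 2 μ :=
  (mollifier V n).eLpNorm_convolution_le hf

theorem mollify_sub {f g : V → X} (hf : LocallyIntegrable f μ) (hg : LocallyIntegrable g μ)
    (n : ℕ) : mollify μ n (f - g) = mollify μ n f - mollify μ n g := by
  have hc : Continuous ((mollifier V n).normed μ) := (mollifier V n).continuous_normed
  have hs := (mollifier V n).hasCompactSupport_normed (μ := μ)
  have h1 := hs.convolutionExists_left (ContinuousLinearMap.lsmul ℝ ℝ) hc hf
  have h2 := hs.convolutionExists_left (ContinuousLinearMap.lsmul ℝ ℝ) hc hg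
  funext x
  simp only [mollify, convolution_def, Pi.sub_apply, map_sub]
  exact integral_sub (h1 x) (h2 x)

theorem locallyIntegrable_of_memLp_two {f : V → X} (hf : MemLp f 2 μ) : LocallyIntegrable f μ :=
  hf.locallyIntegrable (by norm_num)

theorem tendsto_eLpNorm_mollify_sub_of_continuous {g : V → X} (hg : Continuous g)
    (hc : HasCompactSupport g) :
    Tendsto (fun n => eLpNorm (mollify μ n g - g) 2 μ) atTop (𝓝 0) := by
  set K := Metric.cthickening 1 (tsupport g) with hK
  have hKc : IsCompact K := hc.isCompact.cthickening
  have hKm : μ K ≠ ⊤ := hKc.measure_lt_top.ne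
  have huc := hc.uniformContinuous_of_continuous hg
  have hsupp : ∀ n, ∀ x ∉ K, (mollify μ n g - g) x = 0 := by
    intro n x hx
    have h1 : g x = 0 := by
      by_contra h
      exact hx (Metric.self_subset_cthickening _ (subset_tsupport _ h))
    have h2 : mollify μ n g x = 0 := by
      by_contra h
      apply hx
      have := support_mollify_subset n h
      exact Metric.thickening_subset_cthickening _ _ (Metric.thickening_mono (mollifier_rOut_le n) _
        (Metric.thickening_subset_of_subset _ (subset_tsupport _) this))
    simp [h1, h2]
  rw [ENNReal.tendsto_nhds_zero]
  intro ε hε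
  obtain ⟨c, hc0, hcε⟩ : ∃ c : ℝ≥0, 0 < c ∧ c * μ K ^ (1 / 2 : ℝ) ≤ ε := by
    by_cases hεt : ε = ⊤
    · exact ⟨1, one_pos, hεt ▸ le_top⟩
    have hM : μ K ^ (1 / 2 : ℝ) ≠ ⊤ := ENNReal.rpow_ne_top_of_nonneg (by norm_num) hKm
    obtain ⟨c, hc0, hc⟩ := ENNReal.exists_nnreal_pos_mul_lt hM hε.ne'
    exact ⟨c, hc0, hc.le⟩
  obtain ⟨δ, hδ, hu⟩ := Metric.uniformContinuous_iff.1 huc c hc0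
  filter_upwards [mollifier_rOut_tendsto (V := V) |>.eventually (gt_mem_nhds hδ)] with n hn
  have hb : ∀ x, ‖(mollify μ n g - g) x‖ ≤ c := by
    intro x
    rw [Pi.sub_apply, ← dist_eq_norm]
    refine (mollifier V n).dist_normed_convolution_le hg.aestronglyMeasurable fun y hy => ?_
    exact (hu (lt_trans hy hn)).le
  have e : mollify μ n g - g = K.indicator (mollify μ n g - g) := by
    symm
    rw [Set.indicator_eq_self]
    intro x hx
    by_contra h
    exact hx (hsupp n x h)
  rw [e, eLpNorm_indicator_eq_eLpNorm_restrict hKc.isClosed.measurableSet]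
  refine (eLpNorm_le_of_ae_bound (C := c) (Eventually.of_forall hb)).trans ?_
  rw [Measure.restrict_apply_univ, mul_comm]
  simpa using hcε

theorem tendsto_eLpNorm_mollify_sub {f : V → X} (hf : MemLp f 2 μ) :
    Tendsto (fun n => eLpNorm (mollify μ n f - f) 2 μ) atTop (𝓝 0) := by
  rw [ENNReal.tendsto_nhds_zero]
  intro ε hε
  have h3 : ε / 3 ≠ 0 := (ENNReal.div_pos hε.ne' (by norm_num)).ne'
  obtain ⟨g, hgc, hgf, hg, hgm⟩ := hf.exists_hasCompactSupport_eLpNorm_sub_le (by norm_num) h3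
  filter_upwards [(ENNReal.tendsto_nhds_zero.1
    (tendsto_eLpNorm_mollify_sub_of_continuous (μ := μ) hg hgc)) (ε / 3) (pos_iff_ne_zero.2 h3)]
    with n hn
  have hfl := locallyIntegrable_of_memLp_two hf
  have hgl := locallyIntegrable_of_memLp_two hgm
  have e : mollify μ n f - f = mollify μ n (f - g) + ((mollify μ n g - g) + (g - f)) := by
    rw [mollify_sub hfl hgl]; abel
  have hm : AEStronglyMeasurable (mollify μ n g - g) μ :=
    ((contDiff_mollify hgl n).continuous.aestronglyMeasurable).sub hg.aestronglyMeasurable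
  have hm' : AEStronglyMeasurable (g - f) μ := hgm.1.sub hf.1
  have hm'' : AEStronglyMeasurable (mollify μ n (f - g)) μ :=
    (contDiff_mollify (hfl.sub hgl) n).continuous.aestronglyMeasurable
  rw [e]
  calc _ ≤ ε / 3 + (ε / 3 + ε / 3) := by
        refine (eLpNorm_add_le hm'' (hm.add hm') (by norm_num)).trans (add_le_add ?_ ?_)
        · exact (eLpNorm_mollify_le (hf.1.sub hgm.1) n).trans hgf
        · refine (eLpNorm_add_le hm hm' (by norm_num)).trans (add_le_add hn ?_)
          rw [eLpNorm_sub_comm]; exact hgf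
    _ = ε := by rw [← add_assoc, ENNReal.add_thirds]

theorem memLp_mollify {f : V → X} (hf : MemLp f 2 μ) (n : ℕ) : MemLp (mollify μ n f) 2 μ :=
  ⟨(contDiff_mollify (locallyIntegrable_of_memLp_two hf) n).continuous.aestronglyMeasurable,
    (eLpNorm_mollify_le hf.1 n).trans_lt hf.2⟩

/-- Mollification commutes with `L²` limits. -/
theorem tendsto_eLpNorm_mollify_seq {f : V → X} {g : ℕ → V → X} (hf : MemLp f 2 μ)
    (hg : ∀ n, MemLp (g n) 2 μ) (h : Tendsto (fun n => eLpNorm (g n - f) 2 μ) atTop (𝓝 0)) :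
    Tendsto (fun n => eLpNorm (mollify μ n (g n) - f) 2 μ) atTop (𝓝 0) := by
  refine tendsto_of_tendsto_of_tendsto_of_le_of_le tendsto_const_nhds
    (by simpa using h.add (tendsto_eLpNorm_mollify_sub hf)) (fun _ => zero_le) fun n => ?_
  have hfl := locallyIntegrable_of_memLp_two hf
  have hgl := locallyIntegrable_of_memLp_two (hg n)
  have e : mollify μ n (g n) - f = mollify μ n (g n - f) + (mollify μ n f - f) := by
    rw [mollify_sub hgl hfl]; abel
  simp only []
  rw [e]
  refine (eLpNorm_add_le (memLp_mollify ((hg n).sub hf) n).1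
    ((memLp_mollify hf n).sub hf).1 (by norm_num)).trans (add_le_add ?_ le_rfl)
  exact eLpNorm_mollify_le ((hg n).sub hf).1 n

end Mollification

section WeakDerivatives

variable {V : Type*} [NormedAddCommGroup V] [NormedSpace ℝ V] [FiniteDimensional ℝ V]
  [MeasurableSpace V] [BorelSpace V] {μ : Measure V} [μ.IsAddHaarMeasure]

/-- The derivative of the mollification is the mollification of the weak derivative. -/
theorem fderiv_mollify_of_weak {f g : V → ℝ} (hf : LocallyIntegrable f μ) {w : V}
    (h : ∀ φ : V → ℝ, ContDiff ℝ (⊤ : ℕ∞) φ → HasCompactSupport φ →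
      ∫ z, f z * fderiv ℝ φ z w ∂μ = -∫ z, φ z * g z ∂μ) (n : ℕ) (z : V) :
    fderiv ℝ (mollify μ n f) z w = mollify μ n g z := by
  set ρ := (mollifier V n).normed μ with hρ
  have hρs : ContDiff ℝ (⊤ : ℕ∞) ρ := (mollifier V n).contDiff_normed
  have hρc : HasCompactSupport ρ := (mollifier V n).hasCompactSupport_normed
  have h1 := hρc.hasFDerivAt_convolution_left (ContinuousLinearMap.lsmul ℝ ℝ)
    (hρs.of_le (by exact_mod_cast le_top)) hf z
  have hc' : HasCompactSupport (fderiv ℝ ρ) := hρc.fderiv ℝ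
  have hcont' : Continuous (fderiv ℝ ρ) := hρs.continuous_fderiv (by simp)
  have hex := (hc'.convolutionExists_left (μ := μ)
    (ContinuousLinearMap.precompL V (ContinuousLinearMap.lsmul ℝ ℝ : ℝ →L[ℝ] ℝ →L[ℝ] ℝ)) hcont' hf) z
  have e1 : fderiv ℝ (mollify μ n f) z w
      = ∫ t, fderiv ℝ ρ t w * f (z - t) ∂μ := by
    rw [mollify, h1.fderiv, convolution_def, ContinuousLinearMap.integral_apply hex]
    simp [ContinuousLinearMap.precompL_apply]
  have e2 : ∫ t, fderiv ℝ ρ t w * f (z - t) ∂μ = ∫ t, fderiv ℝ ρ (z - t) w * f t ∂μ := by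
    rw [← integral_sub_left_eq_self _ μ z]
    simp
  have hφs : ContDiff ℝ (⊤ : ℕ∞) fun t => ρ (z - t) := hρs.comp (contDiff_const.sub contDiff_id)
  have hφc : HasCompactSupport fun t => ρ (z - t) :=
    hρc.comp_homeomorph (Homeomorph.subLeft z)
  have hd : ∀ t, fderiv ℝ (fun t => ρ (z - t)) t w = - fderiv ℝ ρ (z - t) w := by
    intro t
    have : HasFDerivAt (fun t => ρ (z - t)) ((fderiv ℝ ρ (z - t)).comp (-ContinuousLinearMap.id ℝ V)) t := by
      have h0 : HasFDerivAt (fun t : V => z - t) (-ContinuousLinearMap.id ℝ V) t := by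
        simpa using (hasFDerivAt_id t).const_sub z
      exact ((hρs.differentiable (by simp)) (z - t)).hasFDerivAt.comp t h0
    rw [this.fderiv]; simp
  have h2 := h _ hφs hφc
  simp only [hd] at h2
  rw [e1, e2, mollify, convolution_eq_swap]
  simp only [ContinuousLinearMap.lsmul_apply, smul_eq_mul]
  have : ∫ t, fderiv ℝ ρ (z - t) w * f t ∂μ = - ∫ t, f t * -fderiv ℝ ρ (z - t) w ∂μ := by
    rw [← integral_neg]; congr 1; funext t; ring
  rw [this, h2, neg_neg]

theorem weak_of_contDiff {f : V → ℝ} (hf : ContDiff ℝ 1 f) (hfc : HasCompactSupport f) (w : V)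
    {φ : V → ℝ} (hφ : ContDiff ℝ 1 φ) :
    ∫ z, f z * fderiv ℝ φ z w ∂μ = -∫ z, φ z * fderiv ℝ f z w ∂μ := by
  have hf' : Continuous fun z => fderiv ℝ f z w := (hf.continuous_fderiv (by simp)).clm_apply continuous_const
  have hφ' : Continuous fun z => fderiv ℝ φ z w := (hφ.continuous_fderiv (by simp)).clm_apply continuous_const
  have hfc' : HasCompactSupport fun z => fderiv ℝ f z w := hfc.fderiv_apply ℝ w
  rw [integral_mul_fderiv_eq_neg_fderiv_mul_of_integrable
    ((hf'.mul hφ.continuous).integrable_of_hasCompactSupport hfc'.mul_right)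
    ((hf.continuous.mul hφ').integrable_of_hasCompactSupport hfc.mul_right)
    ((hf.continuous.mul hφ.continuous).integrable_of_hasCompactSupport hfc.mul_right)
    (fun x _ => (hf.differentiable (by simp)) x) (fun x _ => (hφ.differentiable (by simp)) x)]
  congr 2; funext z; ring

theorem fderiv_mollify_of_contDiff {f : V → ℝ} (hf : ContDiff ℝ 1 f) (hfc : HasCompactSupport f)
    (w : V) (n : ℕ) (z : V) :
    fderiv ℝ (mollify μ n f) z w = mollify μ n (fun y => fderiv ℝ f y w) z :=
  fderiv_mollify_of_weak hf.continuous.locallyIntegrable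
    (fun _ hφ _ => weak_of_contDiff hf hfc w (hφ.of_le (by exact_mod_cast le_top))) n z

open scoped Pointwise in
theorem integral_mul_mollify_comm {f g : V → ℝ} (hf : LocallyIntegrable f μ) (hg : Continuous g)
    (hgc : HasCompactSupport g) (n : ℕ) :
    ∫ z, f z * mollify μ n g z ∂μ = ∫ z, mollify μ n f z * g z ∂μ := by
  set ρ := (mollifier V n).normed μ with hρ
  have hρs : Continuous ρ := (mollifier V n).continuous_normed
  have hρc : HasCompactSupport ρ := (mollifier V n).hasCompactSupport_normed
  have hsym : ∀ x, ρ (-x) = ρ x := (mollifier V n).normed_neg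
  have e1 : ∀ z, f z * mollify μ n g z = ∫ t, f z * (ρ (z - t) * g t) ∂μ := by
    intro z
    rw [mollify, convolution_eq_swap, integral_const_mul]; simp [hρ]
  have e2 : ∀ t, mollify μ n f t * g t = ∫ z, f z * (ρ (z - t) * g t) ∂μ := by
    intro t
    rw [mollify, convolution_eq_swap, ← integral_mul_const]
    congr 1; funext z
    simp only [ContinuousLinearMap.lsmul_apply, smul_eq_mul]
    have h3 : ρ (t - z) = ρ (z - t) := by rw [← hsym (t - z), neg_sub]
    rw [← hρ, h3]; ring
  simp_rw [e1, e2]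
  rw [integral_integral_swap]
  -- integrability on the product
  have hcg : HasCompactSupport (fun p : V × V => ρ (p.1 - p.2) * g p.2) := by
    refine HasCompactSupport.intro (K := (tsupport ρ + tsupport g) ×ˢ tsupport g)
      ((hρc.isCompact.add hgc.isCompact).prod hgc.isCompact) ?_
    rintro ⟨x, y⟩ hxy
    by_contra hne
    have h1 : g y ≠ 0 := fun h0 => hne (by simp [h0])
    have h2 : ρ (x - y) ≠ 0 := fun h0 => hne (by simp [h0])
    exact hxy ⟨⟨x - y, subset_tsupport _ h2, y, subset_tsupport _ h1, by simp⟩, subset_tsupport _ h1⟩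
  have hcc : Continuous (fun p : V × V => ρ (p.1 - p.2) * g p.2) :=
    (hρs.comp (continuous_fst.sub continuous_snd)).mul (hg.comp continuous_snd)
  obtain ⟨C, hC⟩ := hcc.bounded_above_of_compact_support hcg
  set K := (tsupport ρ + tsupport g) with hK
  have hKc : IsCompact K := hρc.isCompact.add hgc.isCompact
  have hint : Integrable (fun p : V × V => K.indicator f p.1 * (tsupport g).indicator (fun _ => (1 : ℝ)) p.2) (μ.prod μ) := by
    apply Integrable.mul_prod
    · exact (hf.integrableOn_isCompact hKc).integrable_indicator hKc.measurableSet
    · exact (integrable_indicator_iff hgc.isCompact.measurableSet).2 (by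
        simp [hgc.isCompact.measure_lt_top])
  have : (Function.uncurry fun z t => f z * (ρ (z - t) * g t)) = fun p : V × V =>
      (ρ (p.1 - p.2) * g p.2) * (K.indicator f p.1 * (tsupport g).indicator (fun _ => (1 : ℝ)) p.2) := by
    funext ⟨x, y⟩
    simp only [Function.uncurry]
    by_cases h1 : g y = 0
    · simp [h1]
    by_cases h2 : ρ (x - y) = 0
    · simp [h2]
    have hy := subset_tsupport g h1
    have hx : x ∈ K := ⟨x - y, subset_tsupport _ h2, y, hy, by simp⟩
    rw [indicator_of_mem hx, indicator_of_mem hy]; ring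
  rw [this]
  exact hint.bdd_mul hcc.aestronglyMeasurable (c := C) (Eventually.of_forall hC)

end WeakDerivatives

section Pairing

variable {α : Type*} [MeasurableSpace α] {ν : Measure α} {E : Type*} [NormedAddCommGroup E]
  [InnerProductSpace ℝ E]

theorem MemLp.integrable_inner_two {f g : α → E} (hf : MemLp f 2 ν) (hg : MemLp g 2 ν) :
    Integrable (fun x => ⟪f x, g x⟫) ν := by
  have h := L2.integrable_inner (𝕜 := ℝ) (hf.toLp f) (hg.toLp g)
  refine h.congr ?_
  filter_upwards [hf.coeFn_toLp, hg.coeFn_toLp] with x h1 h2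
  rw [h1, h2]

theorem tendsto_integral_inner {ι : Type*} {l : Filter ι} {f g : α → E} {fn gn : ι → α → E}
    (hf : MemLp f 2 ν) (hg : MemLp g 2 ν) (hfn : ∀ n, MemLp (fn n) 2 ν) (hgn : ∀ n, MemLp (gn n) 2 ν)
    (h1 : Tendsto (fun n => eLpNorm (fn n - f) 2 ν) l (𝓝 0))
    (h2 : Tendsto (fun n => eLpNorm (gn n - g) 2 ν) l (𝓝 0)) :
    Tendsto (fun n => ∫ x, ⟪fn n x, gn n x⟫ ∂ν) l (𝓝 (∫ x, ⟪f x, g x⟫ ∂ν)) := by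
  have e : ∀ {f g : α → E} (hf : MemLp f 2 ν) (hg : MemLp g 2 ν),
      ∫ x, ⟪f x, g x⟫ ∂ν = ⟪hf.toLp f, hg.toLp g⟫ := by
    intro f g hf hg
    rw [L2.inner_def]
    refine integral_congr_ae ?_
    filter_upwards [hf.coeFn_toLp, hg.coeFn_toLp] with x h1 h2
    rw [h1, h2]
  rw [e hf hg]
  simp_rw [fun n => e (hfn n) (hgn n)]
  refine Tendsto.inner ?_ ?_
  · rw [Lp.tendsto_Lp_iff_tendsto_eLpNorm'' _ hfn _ hf]; exact h1
  · rw [Lp.tendsto_Lp_iff_tendsto_eLpNorm'' _ hgn _ hg]; exact h2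

theorem tendsto_integral_mul {ι : Type*} {l : Filter ι} {f g : α → ℝ} {fn gn : ι → α → ℝ}
    (hf : MemLp f 2 ν) (hg : MemLp g 2 ν) (hfn : ∀ n, MemLp (fn n) 2 ν) (hgn : ∀ n, MemLp (gn n) 2 ν)
    (h1 : Tendsto (fun n => eLpNorm (fn n - f) 2 ν) l (𝓝 0))
    (h2 : Tendsto (fun n => eLpNorm (gn n - g) 2 ν) l (𝓝 0)) :
    Tendsto (fun n => ∫ x, fn n x * gn n x ∂ν) l (𝓝 (∫ x, f x * g x ∂ν)) := by
  have := tendsto_integral_inner hf hg hfn hgn h1 h2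
  simpa [mul_comm] using this

end Pairing

section SpaceTime

/-- Space-time `ℝ × ℝ^d`. -/
abbrev Gd (d : ℕ) : Type := ℝ × Ed d

instance isAddHaarMeasure_volume_prod : (volume : Measure (Gd d)).IsAddHaarMeasure := by
  rw [Measure.volume_eq_prod]; infer_instance

/-- Spatial gradient of a function on space-time. -/
def gx (f : Gd d → ℝ) (z : Gd d) : Ed d :=
  (InnerProductSpace.toDual ℝ (Ed d)).symm
    ((fderiv ℝ f z).comp (ContinuousLinearMap.inr ℝ ℝ (Ed d)))

theorem inner_gx (f : Gd d → ℝ) (z : Gd d) (e : Ed d) : ⟪gx f z, e⟫ = fderiv ℝ f z (0, e) := by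
  simp [gx]

theorem gx_eq_of_inner {f : Gd d → ℝ} {z : Gd d} {a : Ed d}
    (h : ∀ e, fderiv ℝ f z (0, e) = ⟪a, e⟫) : gx f z = a := by
  refine ext_inner_right ℝ fun e => ?_
  rw [inner_gx, h]

theorem continuous_gx {f : Gd d → ℝ} (hf : ContDiff ℝ 1 f) : Continuous (gx f) := by
  unfold gx
  exact (InnerProductSpace.toDual ℝ (Ed d)).symm.continuous.comp
    ((hf.continuous_fderiv (by simp)).clm_comp continuous_const)

theorem hasCompactSupport_gx {f : Gd d → ℝ} (hf : HasCompactSupport f) :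
    HasCompactSupport (gx f) :=
  (hf.fderiv ℝ).comp_left (g := fun L : Gd d →L[ℝ] ℝ => (InnerProductSpace.toDual ℝ (Ed d)).symm
    (L.comp (ContinuousLinearMap.inr ℝ ℝ (Ed d)))) (by simp)

theorem gx_mul {f g : Gd d → ℝ} (hf : Differentiable ℝ f) (hg : Differentiable ℝ g) (z : Gd d) :
    gx (fun y => f y * g y) z = f z • gx g z + g z • gx f z := by
  refine gx_eq_of_inner fun e => ?_
  rw [fderiv_fun_mul (hf z) (hg z)]
  simp [inner_add_left, inner_smul_left, inner_gx]

theorem gx_comp {h h' : ℝ → ℝ} {f : Gd d → ℝ} {z : Gd d} (hh : HasDerivAt h (h' (f z)) (f z))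
    (hf : DifferentiableAt ℝ f z) : gx (fun y => h (f y)) z = h' (f z) • gx f z := by
  refine gx_eq_of_inner fun e => ?_
  have h1 := hh.comp_hasFDerivAt z hf.hasFDerivAt
  rw [show (fun y => h (f y)) = h ∘ f from rfl, h1.fderiv]
  simp [inner_smul_left, inner_gx]

theorem inner_mollify {F : Gd d → Ed d} (hF : LocallyIntegrable F) (n : ℕ) (z : Gd d) (e : Ed d) :
    ⟪mollify volume n F z, e⟫ = mollify volume n (fun y => ⟪F y, e⟫) z := by
  have hex := ((mollifier (Gd d) n).hasCompactSupport_normed (μ := volume)).convolutionExists_left (μ := volume)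
    (ContinuousLinearMap.lsmul ℝ ℝ) (mollifier (Gd d) n).continuous_normed hF z
  simp only [mollify, convolution_def]
  rw [real_inner_comm, ← integral_inner hex]
  congr 1; funext t
  simp [inner_smul_right, real_inner_comm]

/-- `F` is the weak spatial gradient of `f` on the set `O`. -/
def HasWeakGx (f : Gd d → ℝ) (F : Gd d → Ed d) (O : Set (Gd d)) : Prop :=
  ∀ φ : Gd d → ℝ, ContDiff ℝ (⊤ : ℕ∞) φ → HasCompactSupport φ → tsupport φ ⊆ O →
    ∀ e : Ed d, ∫ z, f z * fderiv ℝ φ z (0, e) = -∫ z, φ z * ⟪F z, e⟫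

theorem gx_mollify_of_weak {f : Gd d → ℝ} {F : Gd d → Ed d} (hf : LocallyIntegrable f)
    (hF : LocallyIntegrable F) (h : HasWeakGx f F univ) (n : ℕ) (z : Gd d) :
    gx (mollify volume n f) z = mollify volume n F z := by
  refine gx_eq_of_inner fun e => ?_
  rw [inner_mollify hF]
  exact fderiv_mollify_of_weak hf (fun φ h1 h2 => h φ h1 h2 (subset_univ _) e) n z

theorem gx_mollify_of_contDiff {f : Gd d → ℝ} (hf : ContDiff ℝ 1 f) (hfc : HasCompactSupport f)
    (n : ℕ) (z : Gd d) : gx (mollify volume n f) z = mollify volume n (gx f) z := by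
  refine gx_eq_of_inner fun e => ?_
  rw [inner_mollify (continuous_gx hf).locallyIntegrable, fderiv_mollify_of_contDiff hf hfc]
  simp only [inner_gx]

theorem memLp_of_contDiff {f : Gd d → ℝ} (hf : ContDiff ℝ 1 f) (hfc : HasCompactSupport f) :
    MemLp f 2 volume ∧ MemLp (gx f) 2 volume :=
  ⟨hf.continuous.memLp_of_hasCompactSupport hfc,
    (continuous_gx hf).memLp_of_hasCompactSupport (hasCompactSupport_gx hfc)⟩

/-- The closure of `C¹_c` functions with respect to `‖f‖₂ + ‖∇ₓ f‖₂`. -/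
structure SobW (f : Gd d → ℝ) (F : Gd d → Ed d) : Prop where
  meas : Measurable f
  memf : MemLp f 2 volume
  memF : MemLp F 2 volume
  approx : ∃ fn : ℕ → Gd d → ℝ, (∀ n, ContDiff ℝ 1 (fn n)) ∧ (∀ n, HasCompactSupport (fn n)) ∧
    Tendsto (fun n => eLpNorm (fn n - f) 2 volume) atTop (𝓝 0) ∧
    Tendsto (fun n => eLpNorm (gx (fn n) - F) 2 volume) atTop (𝓝 0)

theorem sobW_of_weak {f : Gd d → ℝ} {F : Gd d → Ed d} (hm : Measurable f) (hf : MemLp f 2 volume)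
    (hF : MemLp F 2 volume) (hc : HasCompactSupport f) (h : HasWeakGx f F univ) : SobW f F where
  meas := hm
  memf := hf
  memF := hF
  approx := by
    have hfl := locallyIntegrable_of_memLp_two hf
    have hFl := locallyIntegrable_of_memLp_two hF
    refine ⟨fun n => mollify volume n f, fun n => (contDiff_mollify hfl n).of_le
      (by exact_mod_cast le_top), fun n => hasCompactSupport_mollify hc n,
      tendsto_eLpNorm_mollify_sub hf, ?_⟩
    have e : ∀ n, gx (mollify volume n f) = mollify volume n F := fun n =>
      funext (gx_mollify_of_weak hfl hFl h n)
    simp_rw [e]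
    exact tendsto_eLpNorm_mollify_sub hF

end SpaceTime

section KernelConstants

theorem lintegral_kernel_far_lt_top {s : ℝ} (hs : 0 < s) :
    ∫⁻ h in (ball (0 : Ed d) 1)ᶜ, ENNReal.ofReal (1 / ‖h‖ ^ ((d : ℝ) + 2 * s)) < ⊤ := by
  have h1 : ∫⁻ x : Ed d, ENNReal.ofReal ((1 + ‖x‖) ^ (-((d : ℝ) + 2 * s))) < ⊤ :=
    finite_integral_one_add_norm (by simp; linarith)
  have hp : 0 ≤ (d : ℝ) + 2 * s := by positivity
  calc _ ≤ ∫⁻ h in (ball (0 : Ed d) 1)ᶜ, ENNReal.ofReal (2 ^ ((d : ℝ) + 2 * s)) *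
        ENNReal.ofReal ((1 + ‖h‖) ^ (-((d : ℝ) + 2 * s))) := by
        refine setLIntegral_mono' measurableSet_ball.compl fun h hh => ?_
        have hh : 1 ≤ ‖h‖ := by simpa using hh
        rw [← ENNReal.ofReal_mul (by positivity)]
        refine ENNReal.ofReal_le_ofReal ?_
        rw [Real.rpow_neg (by positivity), ← div_eq_mul_inv, div_le_div_iff₀ (by positivity) (by positivity),
          one_mul, ← Real.mul_rpow (by norm_num) (by positivity)]
        exact Real.rpow_le_rpow (by positivity) (by linarith) hp
    _ ≤ ∫⁻ h : Ed d, ENNReal.ofReal (2 ^ ((d : ℝ) + 2 * s)) *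
        ENNReal.ofReal ((1 + ‖h‖) ^ (-((d : ℝ) + 2 * s))) := setLIntegral_le_lintegral _ _
    _ < ⊤ := by
      rw [lintegral_const_mul _ (by fun_prop)]
      exact ENNReal.mul_lt_top ENNReal.ofReal_lt_top h1

theorem lintegral_kernel_near_lt_top (hd : 1 ≤ d) {s : ℝ} (hs : s < 1) :
    ∫⁻ h in ball (0 : Ed d) 1, ENNReal.ofReal (‖h‖ ^ 2 / ‖h‖ ^ ((d : ℝ) + 2 * s)) < ⊤ := by
  have h := integrableOn_ball_of_norm_le_rpow (E := Ed d) (F := ℝ) (μ := volume)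
    (f := fun h => ‖h‖ ^ 2 / ‖h‖ ^ ((d : ℝ) + 2 * s)) (C := 1) (α := (d : ℝ) + 2 * s - 2) (r := 1)
    (by simpa using hd) (by simp; linarith) (Eventually.of_forall fun x => ?_)
    (by fun_prop : Measurable _).aestronglyMeasurable
  · have h2 := h.2
    rw [hasFiniteIntegral_iff_enorm] at h2
    refine (lintegral_congr fun x => ?_).trans_lt h2
    rw [Real.enorm_eq_ofReal (by positivity)]
  · rcases eq_or_ne x 0 with rfl | hx
    · simp; positivity
    have hx : 0 < ‖x‖ := norm_pos_iff.2 hx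
    rw [Real.norm_of_nonneg (by positivity), one_mul, neg_sub, Real.rpow_sub hx, Real.rpow_ofNat]
end KernelConstants

section DifferenceQuotients

theorem enorm_sq_eq (a : ℝ) : ‖a‖ₑ ^ 2 = ENNReal.ofReal (a ^ 2) := by
  rw [Real.enorm_eq_ofReal_abs, ← ENNReal.ofReal_pow (abs_nonneg _), sq_abs]

theorem enorm_sub_sq_le (a b : ℝ) : ‖a - b‖ₑ ^ 2 ≤ 2 * ‖a‖ₑ ^ 2 + 2 * ‖b‖ₑ ^ 2 := by
  have h2 : (2 : ℝ≥0∞) = ENNReal.ofReal (2 : ℝ) := by simp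
  simp only [enorm_sq_eq]
  rw [h2, ← ENNReal.ofReal_mul (by norm_num), ← ENNReal.ofReal_mul (by norm_num),
    ← ENNReal.ofReal_add (by positivity) (by positivity)]
  exact ENNReal.ofReal_le_ofReal (by nlinarith [sq_nonneg (a + b)])

theorem enorm_sub_le_lintegral {f : Gd d → ℝ} (hf : ContDiff ℝ 1 f) (z : Gd d) (h : Ed d) :
    ‖f (z + (0, h)) - f z‖ₑ ≤ ∫⁻ τ in Ioc (0 : ℝ) 1, ‖h‖ₑ * ‖gx f (z + τ • ((0 : ℝ), h))‖ₑ := by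
  have hd : ∀ τ : ℝ, HasDerivAt (fun τ : ℝ => f (z + τ • ((0 : ℝ), h)))
      (fderiv ℝ f (z + τ • ((0 : ℝ), h)) (0, h)) τ := by
    intro τ
    have h1 : HasDerivAt (fun τ : ℝ => z + τ • ((0 : ℝ), h)) ((0 : ℝ), h) τ := by
      simpa using ((hasDerivAt_id τ).smul_const ((0 : ℝ), h)).const_add z
    exact ((hf.differentiable (by simp)) _).hasFDerivAt.comp_hasDerivAt τ h1
  have hc : Continuous fun τ : ℝ => fderiv ℝ f (z + τ • ((0 : ℝ), h)) (0, h) :=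
    ((hf.continuous_fderiv (by simp)).comp (by fun_prop)).clm_apply continuous_const
  have h2 := intervalIntegral.integral_eq_sub_of_hasDerivAt (fun τ _ => hd τ)
    (hc.intervalIntegrable 0 1)
  simp only [one_smul, zero_smul, add_zero] at h2
  rw [← h2, intervalIntegral.integral_of_le zero_le_one]
  refine (enorm_integral_le_lintegral_enorm _).trans (lintegral_mono fun τ => ?_)
  rw [← inner_gx]
  rw [Real.enorm_eq_ofReal_abs, ← ofReal_norm, ← ofReal_norm, ← ENNReal.ofReal_mul (norm_nonneg _)]
  exact ENNReal.ofReal_le_ofReal ((abs_real_inner_le_norm _ _).trans_eq (mul_comm _ _))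

theorem lintegral_sub_translate_le {f : Gd d → ℝ} (hf : ContDiff ℝ 1 f) (h : Ed d) :
    ∫⁻ z, ‖f (z + (0, h)) - f z‖ₑ ^ 2 ≤ ‖h‖ₑ ^ 2 * ∫⁻ z, ‖gx f z‖ₑ ^ 2 := by
  have hg : Measurable fun z => ‖gx f z‖ₑ := (continuous_gx hf).enorm.measurable
  calc _ ≤ ∫⁻ z, ∫⁻ τ in Ioc (0 : ℝ) 1, ‖h‖ₑ ^ 2 * ‖gx f (z + τ • ((0 : ℝ), h))‖ₑ ^ 2 := by
        refine lintegral_mono fun z => ?_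
        refine (pow_le_pow_left' (enorm_sub_le_lintegral hf z h) 2).trans ?_
        have := sq_lintegral_mul_le (ν := volume.restrict (Ioc (0 : ℝ) 1)) (w := fun _ => 1)
          (f := fun τ => ‖h‖ₑ * ‖gx f (z + τ • ((0 : ℝ), h))‖ₑ) aemeasurable_const
          (Measurable.aemeasurable ((hg.comp (by fun_prop)).const_mul _))
        simpa [mul_pow] using this
    _ = ∫⁻ τ in Ioc (0 : ℝ) 1, ∫⁻ z, ‖h‖ₑ ^ 2 * ‖gx f (z + τ • ((0 : ℝ), h))‖ₑ ^ 2 := by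
        refine lintegral_lintegral_swap (Measurable.aemeasurable ?_)
        exact ((hg.comp (by fun_prop)).pow_const 2).const_mul _
    _ = ‖h‖ₑ ^ 2 * ∫⁻ z, ‖gx f z‖ₑ ^ 2 := by
        have : ∀ τ : ℝ, ∫⁻ z, ‖h‖ₑ ^ 2 * ‖gx f (z + τ • ((0 : ℝ), h))‖ₑ ^ 2
            = ‖h‖ₑ ^ 2 * ∫⁻ z, ‖gx f z‖ₑ ^ 2 := by
          intro τ
          rw [lintegral_add_right_eq_self (fun z => ‖h‖ₑ ^ 2 * ‖gx f z‖ₑ ^ 2),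
            lintegral_const_mul _ (hg.pow_const 2)]
        simp only [this]
        simp

theorem lintegral_sub_translate_le' {f : Gd d → ℝ} (hf : Measurable f) (h : Ed d) :
    ∫⁻ z, ‖f (z + (0, h)) - f z‖ₑ ^ 2 ≤ 4 * ∫⁻ z, ‖f z‖ₑ ^ 2 := by
  calc _ ≤ ∫⁻ z, (2 * ‖f (z + (0, h))‖ₑ ^ 2 + 2 * ‖f z‖ₑ ^ 2) := by
        refine lintegral_mono fun z => ?_
        exact enorm_sub_sq_le _ _
    _ = 4 * ∫⁻ z, ‖f z‖ₑ ^ 2 := by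
        rw [lintegral_add_right _ (by fun_prop), lintegral_const_mul _ (by fun_prop),
          lintegral_const_mul _ (by fun_prop), lintegral_add_right_eq_self (fun z => ‖f z‖ₑ ^ 2),
          ← add_mul]
        norm_num

/-- The kernel `|h|^{-d-2s}`. -/
def kerS (s : ℝ) (h : Ed d) : ℝ := 1 / ‖h‖ ^ ((d : ℝ) + 2 * s)

@[fun_prop]
theorem measurable_kerS (s : ℝ) : Measurable (kerS s : Ed d → ℝ) := by
  unfold kerS; fun_prop

/-- The spatial difference `f(t,x) - f(t,y)`. -/
def diffXY (f : Gd d → ℝ) (p : ℝ × Ed d × Ed d) : ℝ := f (p.1, p.2.1) - f (p.1, p.2.2)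

variable (d) in
/-- The measure `|x - y|^{-d-2s} dt dx dy`. -/
def nuS (s : ℝ) : Measure (ℝ × Ed d × Ed d) :=
  volume.withDensity fun p => ENNReal.ofReal (kerS s (p.2.2 - p.2.1))

variable (d) in
/-- The constant in the embedding of `SobW` into the fractional space. -/
def cS (s : ℝ) : ℝ≥0∞ :=
  (∫⁻ h in ball (0 : Ed d) 1, ENNReal.ofReal (‖h‖ ^ 2 * kerS s h))
    + 4 * ∫⁻ h in (ball (0 : Ed d) 1)ᶜ, ENNReal.ofReal (kerS s h)

theorem cS_lt_top (hd : 1 ≤ d) {s : ℝ} (hs : s ∈ Ioo (0 : ℝ) 1) : cS d s < ⊤ := by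
  refine ENNReal.add_lt_top.2 ⟨?_, ENNReal.mul_lt_top (by simp) (lintegral_kernel_far_lt_top hs.1)⟩
  have := lintegral_kernel_near_lt_top hd hs.2
  simpa [kerS, div_eq_mul_inv] using this

theorem lintegral_nuS_sub {f : Gd d → ℝ} (hf : Measurable f) (s : ℝ) :
    ∫⁻ p, ‖diffXY f p‖ₑ ^ 2 ∂(nuS d s)
      = ∫⁻ h, ENNReal.ofReal (kerS s h) * ∫⁻ z, ‖f (z + (0, h)) - f z‖ₑ ^ 2 := by
  have hm : Measurable fun p : ℝ × Ed d × Ed d => ‖diffXY f p‖ₑ ^ 2 := by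
    unfold diffXY; fun_prop
  rw [nuS, lintegral_withDensity_eq_lintegral_mul _ (by fun_prop) hm]
  simp only [Pi.mul_apply]
  have hm2 : Measurable fun p : ℝ × Ed d × Ed d =>
      ENNReal.ofReal (kerS s (p.2.2 - p.2.1)) * ‖diffXY f p‖ₑ ^ 2 := by
    unfold diffXY; fun_prop
  have hm3 : Measurable fun q : (ℝ × Ed d) × Ed d =>
      ENNReal.ofReal (kerS s q.2) * ‖f (q.1.1, q.1.2 + q.2) - f (q.1.1, q.1.2)‖ₑ ^ 2 := by
    fun_prop
  have e1 : ∀ t : ℝ, ∫⁻ q : Ed d × Ed d, ENNReal.ofReal (kerS s (q.2 - q.1)) * ‖diffXY f (t, q)‖ₑ ^ 2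
      = ∫⁻ x, ∫⁻ h, ENNReal.ofReal (kerS s h) * ‖f (t, x + h) - f (t, x)‖ₑ ^ 2 := by
    intro t
    have hm4 : Measurable fun q : Ed d × Ed d =>
        ENNReal.ofReal (kerS s (q.2 - q.1)) * ‖diffXY f (t, q)‖ₑ ^ 2 :=
      by
      unfold diffXY; fun_prop
    rw [Measure.volume_eq_prod, lintegral_prod _ hm4.aemeasurable]
    refine lintegral_congr fun x => ?_
    rw [← lintegral_add_left_eq_self _ x]
    refine lintegral_congr fun h => ?_
    simp only [add_sub_cancel_left, diffXY]
    rw [← enorm_neg, neg_sub]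
  have e2 : ∀ h, ENNReal.ofReal (kerS s h) * ∫⁻ z, ‖f (z + (0, h)) - f z‖ₑ ^ 2
      = ∫⁻ z : Gd d, ENNReal.ofReal (kerS s h) * ‖f (z.1, z.2 + h) - f (z.1, z.2)‖ₑ ^ 2 := by
    intro h
    rw [lintegral_const_mul _ (by fun_prop)]
    refine congrArg _ (lintegral_congr fun z => ?_)
    have : z + ((0 : ℝ), h) = (z.1, z.2 + h) := by ext1 <;> simp
    rw [this]
  calc _ = ∫⁻ t, ∫⁻ q : Ed d × Ed d, ENNReal.ofReal (kerS s (q.2 - q.1)) * ‖diffXY f (t, q)‖ₑ ^ 2 := by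
        rw [Measure.volume_eq_prod, lintegral_prod _ hm2.aemeasurable]
    _ = ∫⁻ t, ∫⁻ x, ∫⁻ h, ENNReal.ofReal (kerS s h) * ‖f (t, x + h) - f (t, x)‖ₑ ^ 2 :=
        lintegral_congr e1
    _ = ∫⁻ z : ℝ × Ed d, ∫⁻ h, ENNReal.ofReal (kerS s h) * ‖f (z.1, z.2 + h) - f (z.1, z.2)‖ₑ ^ 2 := by
        rw [Measure.volume_eq_prod, lintegral_prod _ hm3.lintegral_prod_right'.aemeasurable]
    _ = ∫⁻ h, ∫⁻ z : ℝ × Ed d, ENNReal.ofReal (kerS s h) * ‖f (z.1, z.2 + h) - f (z.1, z.2)‖ₑ ^ 2 :=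
        lintegral_lintegral_swap hm3.aemeasurable
    _ = _ := (lintegral_congr e2).symm

theorem gx_sub {f g : Gd d → ℝ} (hf : ContDiff ℝ 1 f) (hg : ContDiff ℝ 1 g) :
    gx (f - g) = gx f - gx g := by
  funext z
  refine gx_eq_of_inner fun e => ?_
  rw [fderiv_sub (hf.differentiable (by simp) z) (hg.differentiable (by simp) z)]
  simp [inner_sub_left, inner_gx]

theorem SobW.sub_left {f g : Gd d → ℝ} {F : Gd d → Ed d} (h : SobW f F) (hg : ContDiff ℝ 1 g)
    (hgc : HasCompactSupport g) : SobW (g - f) (gx g - F) where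
  meas := hg.continuous.measurable.sub h.meas
  memf := (memLp_of_contDiff hg hgc).1.sub h.memf
  memF := (memLp_of_contDiff hg hgc).2.sub h.memF
  approx := by
    obtain ⟨fn, h1, h2, h3, h4⟩ := h.approx
    refine ⟨fun n => g - fn n, fun n => hg.sub (h1 n), fun n => ?_, ?_, ?_⟩
    · exact hgc.sub (h2 n)
    · refine h3.congr fun n => ?_
      rw [← eLpNorm_neg]; congr 1; funext z; simp
    · refine h4.congr fun n => ?_
      rw [← eLpNorm_neg, gx_sub hg (h1 n)]; congr 1; funext z; simp

theorem eLpNorm_translate {X : Type*} [NormedAddCommGroup X] {f : Gd d → X}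
    (hf : AEStronglyMeasurable f) (w : Gd d) :
    eLpNorm (fun z => f (z + w)) 2 volume = eLpNorm f 2 volume :=
  eLpNorm_comp_measurePreserving (p := 2) hf (measurePreserving_add_right volume w)

theorem SobW.lintegral_sub_translate_le {f : Gd d → ℝ} {F : Gd d → Ed d} (hf : SobW f F) (h : Ed d) :
    ∫⁻ z, ‖f (z + (0, h)) - f z‖ₑ ^ 2 ≤ ‖h‖ₑ ^ 2 * ∫⁻ z, ‖F z‖ₑ ^ 2 := by
  rw [← eLpNorm_two_sq, ← eLpNorm_two_sq, ← mul_pow]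
  refine pow_le_pow_left' ?_ 2
  obtain ⟨fn, h1, h2, h3, h4⟩ := hf.approx
  have hb : ∀ n, eLpNorm (fun z => f (z + (0, h)) - f z) 2 volume ≤
      ‖h‖ₑ * (eLpNorm (gx (fn n) - F) 2 volume + eLpNorm F 2 volume)
        + (eLpNorm (fn n - f) 2 volume + eLpNorm (fn n - f) 2 volume) := by
    intro n
    have hs : AEStronglyMeasurable (fn n - f) :=
      ((h1 n).continuous.measurable.sub hf.meas).aestronglyMeasurable
    have e : (fun z => f (z + (0, h)) - f z) = (fun z => fn n (z + (0, h)) - fn n z) -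
        ((fun z => (fn n - f) (z + (0, h))) - (fn n - f)) := by
      funext z; simp only [Pi.sub_apply]; ring
    have hm1 : Measurable (fn n) := (h1 n).continuous.measurable
    have hm2 := hf.meas
    rw [e]
    refine (eLpNorm_sub_le (Measurable.aestronglyMeasurable (by fun_prop))
      (Measurable.aestronglyMeasurable (by fun_prop)) (by norm_num)).trans (add_le_add ?_ ?_)
    · have h5 : eLpNorm (fun z => fn n (z + (0, h)) - fn n z) 2 volume ≤ ‖h‖ₑ * eLpNorm (gx (fn n)) 2 volume := by
        refine (ENNReal.pow_le_pow_left_iff (n := 2) (by norm_num)).1 ?_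
        rw [mul_pow, eLpNorm_two_sq, eLpNorm_two_sq]
        exact _root_.lintegral_sub_translate_le (h1 n) h
      refine h5.trans (mul_le_mul_right ?_ _)
      have e2 : gx (fn n) = (gx (fn n) - F) + F := by abel
      conv_lhs => rw [e2]
      exact eLpNorm_add_le ((continuous_gx (h1 n)).aestronglyMeasurable.sub hf.memF.1) hf.memF.1 (by norm_num)
    · refine (eLpNorm_sub_le (Measurable.aestronglyMeasurable (by fun_prop)) hs (by norm_num)).trans ?_
      rw [eLpNorm_translate hs]
  have hlim := ((ENNReal.Tendsto.const_mul (h4.add_const (eLpNorm F 2 volume)) (Or.inr enorm_ne_top :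
    _ ∨ ‖h‖ₑ ≠ ⊤)).add (h3.add h3))
  simpa using ge_of_tendsto' hlim hb

theorem SobW.lintegral_nuS_le {f : Gd d → ℝ} {F : Gd d → Ed d} (hf : SobW f F) (s : ℝ) :
    ∫⁻ p, ‖diffXY f p‖ₑ ^ 2 ∂(nuS d s)
      ≤ cS d s * ((∫⁻ z, ‖f z‖ₑ ^ 2) + ∫⁻ z, ‖F z‖ₑ ^ 2) := by
  rw [lintegral_nuS_sub hf.meas,
    ← lintegral_add_compl _ (measurableSet_ball (x := (0 : Ed d)) (ε := 1)), cS, add_mul]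
  refine add_le_add ?_ ?_
  · rw [← lintegral_mul_const _ (by fun_prop)]
    refine lintegral_mono fun h => ?_
    refine (mul_le_mul_right (hf.lintegral_sub_translate_le h) _).trans ?_
    rw [ENNReal.ofReal_mul (by positivity), ENNReal.ofReal_pow (by positivity),
      ofReal_norm]
    calc _ = ‖h‖ₑ ^ 2 * ENNReal.ofReal (kerS s h) * ∫⁻ z, ‖F z‖ₑ ^ 2 := by ring
      _ ≤ _ := mul_le_mul_right le_add_self _
  · rw [mul_assoc, ← lintegral_mul_const _ (by fun_prop), ← lintegral_const_mul _ (by fun_prop)]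
    refine lintegral_mono fun h => ?_
    refine (mul_le_mul_right (lintegral_sub_translate_le' hf.meas h) _).trans ?_
    calc _ = 4 * (ENNReal.ofReal (kerS s h) * ∫⁻ z, ‖f z‖ₑ ^ 2) := by ring
      _ ≤ _ := mul_le_mul_right (mul_le_mul_right le_self_add _) _

theorem measurable_diffXY {f : Gd d → ℝ} (hf : Measurable f) : Measurable (diffXY f) := by
  unfold diffXY; fun_prop

theorem SobW.eLpNorm_diffXY_sq_le {f : Gd d → ℝ} {F : Gd d → Ed d} (hf : SobW f F) (s : ℝ) :
    eLpNorm (diffXY f) 2 (nuS d s) ^ 2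
      ≤ cS d s * (eLpNorm f 2 volume ^ 2 + eLpNorm F 2 volume ^ 2) := by
  rw [eLpNorm_two_sq, eLpNorm_two_sq, eLpNorm_two_sq]; exact hf.lintegral_nuS_le s

theorem SobW.memLp_diffXY {f : Gd d → ℝ} {F : Gd d → Ed d} (hf : SobW f F) (hd : 1 ≤ d) {s : ℝ}
    (hs : s ∈ Ioo (0 : ℝ) 1) : MemLp (diffXY f) 2 (nuS d s) := by
  refine ⟨(measurable_diffXY hf.meas).aestronglyMeasurable, ?_⟩
  have h := hf.eLpNorm_diffXY_sq_le s
  have h2 : eLpNorm (diffXY f) 2 (nuS d s) ^ 2 < ⊤ := h.trans_lt (ENNReal.mul_lt_top (cS_lt_top hd hs)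
    (ENNReal.add_lt_top.2 ⟨ENNReal.pow_lt_top hf.memf.2, ENNReal.pow_lt_top hf.memF.2⟩))
  by_contra hc
  rw [not_lt, top_le_iff] at hc
  simp [hc] at h2

theorem SobW.tendsto_diffXY {f : Gd d → ℝ} {F : Gd d → Ed d} (hf : SobW f F) (hd : 1 ≤ d) {s : ℝ}
    (hs : s ∈ Ioo (0 : ℝ) 1) {fn : ℕ → Gd d → ℝ} (h1 : ∀ n, ContDiff ℝ 1 (fn n))
    (h2 : ∀ n, HasCompactSupport (fn n))
    (h3 : Tendsto (fun n => eLpNorm (fn n - f) 2 volume) atTop (𝓝 0))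
    (h4 : Tendsto (fun n => eLpNorm (gx (fn n) - F) 2 volume) atTop (𝓝 0)) :
    Tendsto (fun n => eLpNorm (diffXY (fn n) - diffXY f) 2 (nuS d s)) atTop (𝓝 0) := by
  have hsq : Tendsto (fun n => eLpNorm (diffXY (fn n) - diffXY f) 2 (nuS d s) ^ 2) atTop (𝓝 0) := by
    have hlim : Tendsto (fun n => cS d s * (eLpNorm (fn n - f) 2 volume ^ 2 +
        eLpNorm (gx (fn n) - F) 2 volume ^ 2)) atTop (𝓝 0) := by
      have := ENNReal.Tendsto.const_mul ((ENNReal.Tendsto.pow (n := 2) h3).add (ENNReal.Tendsto.pow (n := 2) h4))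
        (Or.inr (cS_lt_top hd hs).ne : _ ∨ cS d s ≠ ⊤)
      simpa using this
    refine tendsto_of_tendsto_of_tendsto_of_le_of_le tendsto_const_nhds hlim (fun _ => zero_le)
      fun n => ?_
    have e : diffXY (fn n) - diffXY f = diffXY (fn n - f) := by
      funext p; simp [diffXY]; ring
    simp only [e]
    exact (hf.sub_left (h1 n) (h2 n)).eLpNorm_diffXY_sq_le s
  have := (ENNReal.continuous_rpow_const (y := (1 / 2 : ℝ))).tendsto 0 |>.comp hsq
  simp only [Function.comp_def, ← ENNReal.rpow_natCast, ← ENNReal.rpow_mul] at this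
  norm_num at this
  exact this

end DifferenceQuotients

section FaberKrahn

variable (d) in
/-- The constant in the Faber-Krahn inequality. -/
def cFK : ℝ≥0∞ :=
  2 * (lintegralPowLePowLIntegralFDerivConst (volume : Measure (Ed d)) (Real.conjExponent d) : ℝ≥0∞)
    ^ (1 / Real.conjExponent d)

theorem cFK_ne_top (hd : 2 ≤ d) : cFK d ≠ ⊤ := by
  have h : (1 : ℝ) < d := by exact_mod_cast hd
  refine ENNReal.mul_ne_top (by simp) (ENNReal.rpow_ne_top_of_nonneg ?_ ENNReal.coe_ne_top)
  exact one_div_nonneg.2 (Real.HolderConjugate.conjExponent h).symm.nonneg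

theorem setLIntegral_sq_le_of_contDiff (hd : 2 ≤ d) {f : Ed d → ℝ} (hf : ContDiff ℝ 1 f)
    (hfc : HasCompactSupport f) {A : Set (Ed d)} (hA : MeasurableSet A) :
    ∫⁻ x in A, ‖f x‖ₑ ^ 2 ≤ cFK d * volume A ^ (1 / (d : ℝ)) *
      ∫⁻ x, ‖f x‖ₑ * ‖fderiv ℝ f x‖ₑ := by
  have h : (1 : ℝ) < d := by exact_mod_cast hd
  set p := Real.conjExponent d with hp
  have hpq : (d : ℝ).HolderConjugate p := Real.HolderConjugate.conjExponent h
  have hp0 : 0 < p := hpq.symm.pos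
  have hg : ContDiff ℝ 1 (fun x => f x ^ 2) := hf.pow 2
  have hgc : HasCompactSupport (fun x => f x ^ 2) :=
    hfc.comp_left (g := fun a : ℝ => a ^ 2) (by simp)
  have hgns := lintegral_pow_le_pow_lintegral_fderiv (E := Ed d) volume hg hgc (p := p) (by simpa using hpq)
  set c := (lintegralPowLePowLIntegralFDerivConst (volume : Measure (Ed d)) p : ℝ≥0∞) with hc
  have hfm : Measurable f := hf.continuous.measurable
  have hder : ∀ x, ‖fderiv ℝ (fun x => f x ^ 2) x‖ₑ = 2 * (‖f x‖ₑ * ‖fderiv ℝ f x‖ₑ) := by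
    intro x
    have := ((hf.differentiable (by simp) x).hasFDerivAt.pow 2).fderiv
    rw [this, enorm_smul]
    simp [enorm_mul, mul_assoc]
    rw [Real.enorm_eq_ofReal (by norm_num)]; simp
  have h1 : ∫⁻ x in A, ‖f x‖ₑ ^ 2 = ∫⁻ x, ((fun x => ‖f x ^ 2‖ₑ) * A.indicator (fun _ => (1 : ℝ≥0∞))) x := by
    rw [← lintegral_indicator hA]
    refine lintegral_congr fun x => ?_
    by_cases hx : x ∈ A <;> simp [hx, enorm_pow]
  have h2 := ENNReal.lintegral_mul_le_Lp_mul_Lq volume hpq.symm (f := fun x => ‖f x ^ 2‖ₑ)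
    (g := A.indicator (fun _ => (1 : ℝ≥0∞))) (by fun_prop) (by fun_prop (disch := assumption))
  have h3 : ∫⁻ x, A.indicator (fun _ => (1 : ℝ≥0∞)) x ^ (d : ℝ) = volume A := by
    rw [← setLIntegral_one, ← lintegral_indicator hA]
    refine lintegral_congr fun x => ?_
    by_cases hx : x ∈ A
    · simp [hx]
    · simp [hx]; linarith
  rw [h1]
  refine h2.trans ?_
  rw [h3]
  have h4 : (∫⁻ x, ‖f x ^ 2‖ₑ ^ p) ^ (1 / p) ≤ c ^ (1 / p) * (2 * ∫⁻ x, ‖f x‖ₑ * ‖fderiv ℝ f x‖ₑ) := by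
    refine (ENNReal.rpow_le_rpow hgns (by positivity)).trans ?_
    rw [ENNReal.mul_rpow_of_nonneg _ _ (by positivity), ← ENNReal.rpow_mul, mul_one_div_cancel hp0.ne',
      ENNReal.rpow_one]
    simp only [hder]
    rw [lintegral_const_mul _ (by fun_prop)]
  calc _ ≤ c ^ (1 / p) * (2 * ∫⁻ x, ‖f x‖ₑ * ‖fderiv ℝ f x‖ₑ) * volume A ^ (1 / (d : ℝ)) :=
        mul_le_mul_left h4 _
    _ = _ := by rw [cFK, ← hp, ← hc]; ring

theorem fderiv_slice_enorm {f : Gd d → ℝ} (hf : ContDiff ℝ 1 f) (t : ℝ) (x : Ed d) :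
    ‖fderiv ℝ (fun x => f (t, x)) x‖ₑ = ‖gx f (t, x)‖ₑ := by
  have h : fderiv ℝ (fun x => f (t, x)) x
      = (fderiv ℝ f (t, x)).comp (ContinuousLinearMap.inr ℝ ℝ (Ed d)) :=
    ((hf.differentiable (by simp) _).hasFDerivAt.comp x (hasFDerivAt_prodMk_right t x)).fderiv
  rw [h, gx, ← ofReal_norm, ← ofReal_norm, LinearIsometryEquiv.norm_map]

theorem eLpNorm_indicator_sq_le_of_contDiff (hd : 2 ≤ d) {f : Gd d → ℝ} (hf : ContDiff ℝ 1 f)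
    (hfc : HasCompactSupport f) {A : Set (Gd d)} (hA : MeasurableSet A) {S : Set ℝ} {m : ℝ≥0∞}
    (hm : ∀ᵐ t ∂(volume.restrict S), volume (Prod.mk t ⁻¹' A) ≤ m) :
    eLpNorm (A.indicator f) 2 ((volume.restrict S).prod volume) ^ 2 ≤ cFK d * m ^ (1 / (d : ℝ)) *
      (eLpNorm f 2 ((volume.restrict S).prod volume) *
        eLpNorm (gx f) 2 ((volume.restrict S).prod volume)) := by
  have hfm : Measurable f := hf.continuous.measurable
  have hgm : Measurable fun z => ‖gx f z‖ₑ := (continuous_gx hf).enorm.measurable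
  have hsl : ∀ t, ∫⁻ x, ‖A.indicator f (t, x)‖ₑ ^ 2 ≤
      cFK d * volume (Prod.mk t ⁻¹' A) ^ (1 / (d : ℝ)) * ∫⁻ x, ‖f (t, x)‖ₑ * ‖gx f (t, x)‖ₑ := by
    intro t
    have h1 : ContDiff ℝ 1 fun x => f (t, x) := hf.comp (contDiff_const.prodMk contDiff_id)
    have h2 : HasCompactSupport fun x => f (t, x) :=
      hfc.comp_isClosedEmbedding (Topology.IsClosedEmbedding.of_continuous_injective_isClosedMap
        (by fun_prop) (Prod.mk_right_injective t) (isClosedMap_prodMk_left t))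
    have h3 := setLIntegral_sq_le_of_contDiff hd h1 h2 (measurable_prodMk_left (x := t) hA)
    simp only [fderiv_slice_enorm hf] at h3
    refine le_trans (le_of_eq ?_) h3
    rw [← lintegral_indicator (measurable_prodMk_left (x := t) hA)]
    refine lintegral_congr fun x => ?_
    by_cases hx : (t, x) ∈ A
    · have hx' : x ∈ Prod.mk t ⁻¹' A := hx
      simp [hx, hx']
    · have hx' : x ∉ Prod.mk t ⁻¹' A := hx
      simp [hx, hx']
  have hfA : Measurable (A.indicator f) := hfm.indicator hA
  rw [eLpNorm_two_sq, lintegral_prod _ (by fun_prop)]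
  calc _ ≤ ∫⁻ t in S, cFK d * m ^ (1 / (d : ℝ)) * ∫⁻ x, ‖f (t, x)‖ₑ * ‖gx f (t, x)‖ₑ := by
        refine lintegral_mono_ae ?_
        filter_upwards [hm] with t ht
        refine (hsl t).trans ?_
        gcongr
    _ = cFK d * m ^ (1 / (d : ℝ)) * ∫⁻ z, ‖f z‖ₑ * ‖gx f z‖ₑ ∂((volume.restrict S).prod volume) := by
        rw [lintegral_const_mul _ (Measurable.lintegral_prod_right' (f := fun z : ℝ × Ed d => ‖f z‖ₑ * ‖gx f z‖ₑ)
          (by fun_prop)), lintegral_prod _ (by fun_prop)]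
    _ ≤ _ := by
        refine mul_le_mul_right ?_ _
        have := ENNReal.lintegral_mul_le_Lp_mul_Lq ((volume.restrict S).prod (volume : Measure (Ed d)))
          (p := 2) (q := 2) (by constructor <;> norm_num) (f := fun z => ‖f z‖ₑ)
          (g := fun z => ‖gx f z‖ₑ) (by fun_prop) hgm.aemeasurable
        rw [eLpNorm_eq_lintegral_rpow_enorm_toReal (by simp) (by simp),
          eLpNorm_eq_lintegral_rpow_enorm_toReal (by simp) (by simp)]
        simpa using this

/-- Faber-Krahn inequality on space-time slabs. -/
theorem SobW.eLpNorm_le_of_volume_support_le (hd : 2 ≤ d) {g : Gd d → ℝ} {G : Gd d → Ed d}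
    (hg : SobW g G) {S : Set ℝ} {m : ℝ≥0∞} (hmt : m ≠ ⊤)
    (hm : ∀ᵐ t ∂(volume.restrict S), volume {x | g (t, x) ≠ 0} ≤ m) :
    eLpNorm g 2 ((volume.restrict S).prod volume) ≤ cFK d * m ^ (1 / (d : ℝ)) *
      eLpNorm G 2 ((volume.restrict S).prod volume) := by
  set ν := (volume.restrict S).prod (volume : Measure (Ed d)) with hν
  have hle : ν ≤ volume := by
    rw [hν, Measure.volume_eq_prod]
    exact Measure.prod_mono Measure.restrict_le_self le_rfl
  set A := {z : Gd d | g z ≠ 0} with hA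
  have hAm : MeasurableSet A := (measurableSet_singleton (0 : ℝ)).compl.preimage hg.meas
  set c := cFK d * m ^ (1 / (d : ℝ)) with hc
  have hct : c ≠ ⊤ := ENNReal.mul_ne_top (cFK_ne_top hd)
    (ENNReal.rpow_ne_top_of_nonneg (by positivity) hmt)
  obtain ⟨fn, h1, h2, h3, h4⟩ := hg.approx
  set a := eLpNorm g 2 ν
  set b := eLpNorm G 2 ν
  have ha : a ≠ ⊤ := (hg.memf.mono_measure hle).2.ne
  have hb : b ≠ ⊤ := (hg.memF.mono_measure hle).2.ne
  have hgm := hg.meas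
  have hsq : ∀ n, a ≤ (c * ((eLpNorm (fn n - g) 2 volume + a) *
      (eLpNorm (gx (fn n) - G) 2 volume + b))) ^ (1 / 2 : ℝ) + eLpNorm (fn n - g) 2 volume := by
    intro n
    have hfm : Measurable (fn n) := (h1 n).continuous.measurable
    have e1 : g = A.indicator (fn n) - A.indicator (fn n - g) := by
      funext z
      by_cases hz : z ∈ A
      · simp [hz]
      · have : g z = 0 := by simpa [hA] using hz
        simp [hz, this]
    have hX := eLpNorm_indicator_sq_le_of_contDiff hd (h1 n) (h2 n) hAm hm
    have i1 : eLpNorm (fn n) 2 ν ≤ eLpNorm (fn n - g) 2 volume + a := by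
      have e2 : fn n = (fn n - g) + g := by simp
      conv_lhs => rw [e2]
      exact (eLpNorm_add_le (by fun_prop) (by fun_prop) (by norm_num)).trans
        (add_le_add_left (eLpNorm_mono_measure _ hle) _)
    have i2 : eLpNorm (gx (fn n)) 2 ν ≤ eLpNorm (gx (fn n) - G) 2 volume + b := by
      have e2 : gx (fn n) = (gx (fn n) - G) + G := by simp
      have hGm := hg.memF.1.mono_measure hle
      conv_lhs => rw [e2]
      exact (eLpNorm_add_le ((continuous_gx (h1 n)).aestronglyMeasurable.sub hGm) hGm (by norm_num)).trans
        (add_le_add_left (eLpNorm_mono_measure _ hle) _)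
    calc a = eLpNorm (A.indicator (fn n) - A.indicator (fn n - g)) 2 ν := by rw [← e1]
      _ ≤ eLpNorm (A.indicator (fn n)) 2 ν + eLpNorm (A.indicator (fn n - g)) 2 ν :=
        eLpNorm_sub_le (hfm.indicator hAm).aestronglyMeasurable
          ((hfm.sub hgm).indicator hAm).aestronglyMeasurable (by norm_num)
      _ ≤ _ := by
        refine add_le_add ?_ ((eLpNorm_indicator_le _).trans (eLpNorm_mono_measure _ hle))
        have h5 := hX.trans (mul_le_mul_right (mul_le_mul' i1 i2) _)
        have h6 := ENNReal.rpow_le_rpow h5 (z := 1 / 2) (by norm_num)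
        rwa [← ENNReal.rpow_natCast, ← ENNReal.rpow_mul, show ((2 : ℕ) : ℝ) * (1 / 2) = 1 by norm_num,
          ENNReal.rpow_one] at h6
  have hlim : a ≤ (c * (a * b)) ^ (1 / 2 : ℝ) := by
    have l1 := h3.add_const a
    have l2 := h4.add_const b
    rw [zero_add] at l1 l2
    have l3 := ENNReal.Tendsto.const_mul (ENNReal.Tendsto.mul l1 (Or.inr hb) l2 (Or.inr ha))
      (Or.inr hct : _ ∨ c ≠ ⊤)
    have l4 := ((ENNReal.continuous_rpow_const (y := (1 / 2 : ℝ))).tendsto _ |>.comp l3).add h3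
    rw [add_zero] at l4
    exact ge_of_tendsto' l4 hsq
  have hlim2 : a ^ 2 ≤ c * (a * b) := by
    have := ENNReal.rpow_le_rpow hlim (z := 2) (by norm_num)
    rw [← ENNReal.rpow_mul] at this
    norm_num at this
    exact this
  rcases eq_or_ne a 0 with h0 | h0
  · rw [h0]; exact zero_le
  · rw [sq, show c * (a * b) = a * (c * b) by ring] at hlim2
    exact (ENNReal.mul_le_mul_iff_right h0 ha).1 hlim2

end FaberKrahn

section Truncation

theorem hasDerivAt_max_zero_pow (n : ℕ) (u : ℝ) :
    HasDerivAt (fun u : ℝ => max u 0 ^ (n + 2)) ((n + 2 : ℝ) * max u 0 ^ (n + 1)) u := by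
  rcases lt_trichotomy u 0 with h | h | h
  · have h1 : (fun u : ℝ => max u 0 ^ (n + 2)) =ᶠ[𝓝 u] fun _ => 0 := by
      filter_upwards [gt_mem_nhds h] with a ha
      simp [max_eq_right ha.le]
    simpa [max_eq_right h.le] using (hasDerivAt_const u (0 : ℝ)).congr_of_eventuallyEq h1
  · subst h
    rw [max_self, zero_pow (by omega), mul_zero]
    rw [hasDerivAt_iff_isLittleO]
    simp only [max_self, ne_eq, Nat.add_eq_zero_iff, OfNat.ofNat_ne_zero, and_false,
      not_false_eq_true, zero_pow, sub_zero, smul_eq_mul, mul_zero]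
    refine Asymptotics.IsBigO.trans_isLittleO (g := fun x : ℝ => x ^ (n + 2)) ?_ ?_
    · refine Asymptotics.IsBigO.of_bound 1 (Eventually.of_forall fun x => ?_)
      rw [norm_pow, norm_pow, one_mul]
      refine pow_le_pow_left₀ (norm_nonneg _) ?_ _
      rw [Real.norm_eq_abs, Real.norm_eq_abs, abs_of_nonneg (le_max_right _ _)]
      exact max_le (le_abs_self x) (abs_nonneg x)
    · have := Asymptotics.isLittleO_pow_pow (𝕜 := ℝ) (m := 1) (n := n + 2) (by omega)
      simpa using this
  · have h1 : (fun u : ℝ => max u 0 ^ (n + 2)) =ᶠ[𝓝 u] fun a => a ^ (n + 2) := by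
      filter_upwards [lt_mem_nhds h] with a ha
      simp [max_eq_left ha.le]
    have := (hasDerivAt_pow (n + 2) u).congr_of_eventuallyEq h1
    simpa [max_eq_left h.le] using this

/-- Piecewise linear approximation of the Heaviside function. -/
def heav (δ u : ℝ) : ℝ := (max u 0 - max (u - δ) 0) / δ

/-- Primitive of `heav`: a `C¹` approximation of the positive part. -/
def rampT (δ u : ℝ) : ℝ := (max u 0 ^ 2 - max (u - δ) 0 ^ 2) / (2 * δ)

/-- Primitive of `rampT`. -/
def quadT (δ u : ℝ) : ℝ := (max u 0 ^ 3 - max (u - δ) 0 ^ 3) / (6 * δ)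

variable {δ : ℝ}

theorem continuous_heav : Continuous (heav δ) := by unfold heav; fun_prop
theorem continuous_quadT : Continuous (quadT δ) := by unfold quadT; fun_prop

theorem hasDerivAt_rampT (hδ : 0 < δ) (u : ℝ) : HasDerivAt (rampT δ) (heav δ u) u := by
  have h1 := hasDerivAt_max_zero_pow 0 u
  have h2 := (hasDerivAt_max_zero_pow 0 (u - δ)).comp_sub_const u δ
  refine ((h1.sub h2).div_const (2 * δ)).congr_deriv ?_
  rw [heav]; push_cast; field_simp; ring

theorem hasDerivAt_quadT (hδ : 0 < δ) (u : ℝ) : HasDerivAt (quadT δ) (rampT δ u) u := by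
  have h1 := hasDerivAt_max_zero_pow 1 u
  have h2 := (hasDerivAt_max_zero_pow 1 (u - δ)).comp_sub_const u δ
  refine ((h1.sub h2).div_const (6 * δ)).congr_deriv ?_
  rw [rampT]; push_cast; field_simp; ring

theorem contDiff_rampT (hδ : 0 < δ) : ContDiff ℝ 1 (rampT δ) := by
  rw [contDiff_one_iff_deriv]
  refine ⟨fun u => (hasDerivAt_rampT hδ u).differentiableAt, ?_⟩
  rw [show deriv (rampT δ) = heav δ from funext fun u => (hasDerivAt_rampT hδ u).deriv]
  exact continuous_heav

theorem trunc_of_nonpos (hδ : 0 < δ) {u : ℝ} (hu : u ≤ 0) :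
    heav δ u = 0 ∧ rampT δ u = 0 ∧ quadT δ u = 0 := by
  have : u - δ ≤ 0 := by linarith
  simp [heav, rampT, quadT, max_eq_right hu, max_eq_right this]

theorem trunc_of_le (_hδ : 0 < δ) {u : ℝ} (hu : 0 ≤ u) (hu' : u ≤ δ) :
    heav δ u = u / δ ∧ rampT δ u = u ^ 2 / (2 * δ) ∧ quadT δ u = u ^ 3 / (6 * δ) := by
  have : u - δ ≤ 0 := by linarith
  simp [heav, rampT, quadT, max_eq_left hu, max_eq_right this]

theorem trunc_of_ge (hδ : 0 < δ) {u : ℝ} (hu : δ ≤ u) :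
    heav δ u = 1 ∧ rampT δ u = u - δ / 2 ∧ quadT δ u = (3 * u ^ 2 - 3 * u * δ + δ ^ 2) / 6 := by
  have h1 : 0 ≤ u := by linarith
  have h2 : 0 ≤ u - δ := by linarith
  simp only [heav, rampT, quadT, max_eq_left h1, max_eq_left h2]
  refine ⟨?_, ?_, ?_⟩ <;> field_simp <;> ring

theorem heav_nonneg (hδ : 0 < δ) (u : ℝ) : 0 ≤ heav δ u := by
  rcases le_total u 0 with h | h
  · rw [(trunc_of_nonpos hδ h).1]
  rcases le_total u δ with h' | h'
  · rw [(trunc_of_le hδ h h').1]; positivity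
  · rw [(trunc_of_ge hδ h').1]; norm_num

theorem heav_le_one (hδ : 0 < δ) (u : ℝ) : heav δ u ≤ 1 := by
  rcases le_total u 0 with h | h
  · rw [(trunc_of_nonpos hδ h).1]; norm_num
  rcases le_total u δ with h' | h'
  · rw [(trunc_of_le hδ h h').1, div_le_one hδ]; exact h'
  · rw [(trunc_of_ge hδ h').1]

theorem rampT_nonneg (hδ : 0 < δ) (u : ℝ) : 0 ≤ rampT δ u := by
  rcases le_total u 0 with h | h
  · rw [(trunc_of_nonpos hδ h).2.1]
  rcases le_total u δ with h' | h'
  · rw [(trunc_of_le hδ h h').2.1]; positivity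
  · rw [(trunc_of_ge hδ h').2.1]; linarith

theorem rampT_le_mul_heav (hδ : 0 < δ) (u : ℝ) : rampT δ u ≤ max u 0 * heav δ u := by
  rcases le_total u 0 with h | h
  · rw [(trunc_of_nonpos hδ h).2.1, (trunc_of_nonpos hδ h).1]; simp
  rcases le_total u δ with h' | h'
  · rw [(trunc_of_le hδ h h').2.1, (trunc_of_le hδ h h').1, max_eq_left h, ← mul_div_assoc, ← sq]
    gcongr
    linarith
  · rw [(trunc_of_ge hδ h').2.1, (trunc_of_ge hδ h').1, max_eq_left h]; linarith

theorem rampT_le (hδ : 0 < δ) (u : ℝ) : rampT δ u ≤ max u 0 :=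
  (rampT_le_mul_heav hδ u).trans (mul_le_of_le_one_right (le_max_right _ _) (heav_le_one hδ u))

theorem le_rampT (hδ : 0 < δ) (u : ℝ) : max (u - δ) 0 ≤ rampT δ u := by
  refine max_le ?_ (rampT_nonneg hδ u)
  rcases le_total u δ with h' | h'
  · exact le_trans (by linarith) (rampT_nonneg hδ u)
  · rw [(trunc_of_ge hδ h').2.1]; linarith

theorem quadT_nonneg (hδ : 0 < δ) (u : ℝ) : 0 ≤ quadT δ u := by
  rcases le_total u 0 with h | h
  · rw [(trunc_of_nonpos hδ h).2.2]
  rcases le_total u δ with h' | h'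
  · rw [(trunc_of_le hδ h h').2.2]; positivity
  · rw [(trunc_of_ge hδ h').2.2]; nlinarith [sq_nonneg δ]

theorem quadT_le (hδ : 0 < δ) (u : ℝ) : quadT δ u ≤ max u 0 ^ 2 / 2 := by
  rcases le_total u 0 with h | h
  · rw [(trunc_of_nonpos hδ h).2.2]; positivity
  rcases le_total u δ with h' | h'
  · rw [(trunc_of_le hδ h h').2.2, max_eq_left h, div_le_div_iff₀ (by positivity) (by norm_num)]
    nlinarith [sq_nonneg u, mul_nonneg (sq_nonneg u) (sub_nonneg.2 h'), mul_nonneg (sq_nonneg u) hδ.le]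
  · rw [(trunc_of_ge hδ h').2.2, max_eq_left h]; nlinarith [sq_nonneg δ]

theorem le_quadT (hδ : 0 < δ) (u : ℝ) : max (u - δ) 0 ^ 2 / 2 ≤ quadT δ u := by
  rcases le_total u δ with h' | h'
  · rw [max_eq_right (by linarith)]; simpa using quadT_nonneg hδ u
  · rw [(trunc_of_ge hδ h').2.2, max_eq_left (by linarith)]; nlinarith [sq_nonneg δ]

theorem rampT_mul_le (hδ : 0 < δ) {a b : ℝ} (hb : 0 < b) (hab : b ≤ a) :
    rampT δ b * a ≤ rampT δ a * b := by
  have ha : 0 < a := hb.trans_le hab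
  rcases le_total b δ with h1 | h1
  · rw [(trunc_of_le hδ hb.le h1).2.1]
    rcases le_total a δ with h2 | h2
    · rw [(trunc_of_le hδ ha.le h2).2.1, div_mul_eq_mul_div, div_mul_eq_mul_div]
      gcongr ?_ / _
      nlinarith [mul_pos ha hb]
    · rw [(trunc_of_ge hδ h2).2.1, div_mul_eq_mul_div, div_le_iff₀ (by positivity)]
      have e1 : b * a ≤ (a - δ / 2) * (2 * δ) := by nlinarith
      nlinarith
  · rw [(trunc_of_ge hδ h1).2.1, (trunc_of_ge hδ (h1.trans hab)).2.1]; nlinarith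

theorem sub_mul_sub_rampT_ge (hδ : 0 < δ) (a b p q : ℝ) :
    -((p - q) ^ 2 * (max a 0 * max b 0)) ≤ (a - b) * (p ^ 2 * rampT δ a - q ^ 2 * rampT δ b) := by
  wlog hab : b ≤ a generalizing a b p q
  · have := this b a q p (le_of_not_ge hab)
    rw [mul_comm (max b 0)] at this
    linarith [show (q - p) ^ 2 = (p - q) ^ 2 by ring,
      show (b - a) * (q ^ 2 * rampT δ b - p ^ 2 * rampT δ a)
        = (a - b) * (p ^ 2 * rampT δ a - q ^ 2 * rampT δ b) by ring,
      show (q - p) ^ 2 * (max a 0 * max b 0) = (p - q) ^ 2 * (max a 0 * max b 0) by ring]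
  rcases le_or_gt b 0 with hb | hb
  · rw [max_eq_right hb, (trunc_of_nonpos hδ hb).2.1]
    have := mul_nonneg (sub_nonneg.2 hab) (mul_nonneg (sq_nonneg p) (rampT_nonneg hδ a))
    linarith
  · have ha := hb.trans_le hab
    rw [max_eq_left hb.le, max_eq_left ha.le]
    have h1 := rampT_mul_le hδ hb hab
    have h2 : rampT δ b ≤ b := by simpa [max_eq_left hb.le] using rampT_le hδ b
    have h3 := rampT_nonneg hδ b
    set c := rampT δ b / b with hc
    have hc0 : 0 ≤ c := by positivity
    have hc1 : c ≤ 1 := (div_le_one hb).2 h2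
    have hcb : rampT δ b = c * b := by rw [hc]; field_simp
    have h4 : c * a ≤ rampT δ a := by
      rw [hc, div_mul_eq_mul_div, div_le_iff₀ hb]; exact h1
    have h5 : c * ((p * a - q * b) ^ 2 - a * b * (p - q) ^ 2)
        ≤ (a - b) * (p ^ 2 * rampT δ a - q ^ 2 * rampT δ b) := by
      rw [hcb]
      have := mul_nonneg (mul_nonneg (sub_nonneg.2 hab) (sq_nonneg p)) (sub_nonneg.2 h4)
      nlinarith
    have h6 : c * (a * b * (p - q) ^ 2) ≤ a * b * (p - q) ^ 2 :=
      mul_le_of_le_one_left (by positivity) hc1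
    have h7 := mul_nonneg hc0 (sq_nonneg (p * a - q * b))
    nlinarith

end Truncation

section ChainRule

theorem eLpNorm_le_of_norm_le {α X Y : Type*} [MeasurableSpace α] [NormedAddCommGroup X]
    [NormedAddCommGroup Y] {ν : Measure α} {f : α → X} {g : α → Y} {c : ℝ}
    (h : ∀ z, ‖f z‖ ≤ c * ‖g z‖) : eLpNorm f 2 ν ≤ ENNReal.ofReal c * eLpNorm g 2 ν :=
  eLpNorm_le_mul_eLpNorm_of_ae_le_mul (Eventually.of_forall h) 2

theorem tendsto_eLpNorm_of_norm_le {α X Y : Type*} [MeasurableSpace α] [NormedAddCommGroup X]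
    [NormedAddCommGroup Y] {ν : Measure α} {f : ℕ → α → X} {g : ℕ → α → Y} {c : ℝ}
    (h : ∀ n z, ‖f n z‖ ≤ c * ‖g n z‖) (hg : Tendsto (fun n => eLpNorm (g n) 2 ν) atTop (𝓝 0)) :
    Tendsto (fun n => eLpNorm (f n) 2 ν) atTop (𝓝 0) := by
  have := ENNReal.Tendsto.const_mul hg (Or.inr ENNReal.ofReal_ne_top : _ ∨ ENNReal.ofReal c ≠ ⊤)
  rw [mul_zero] at this
  exact tendsto_of_tendsto_of_tendsto_of_le_of_le tendsto_const_nhds this (fun _ => zero_le)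
    fun n => eLpNorm_le_of_norm_le (h n)

theorem tendsto_eLpNorm_add {α X : Type*} [MeasurableSpace α] [NormedAddCommGroup X]
    {ν : Measure α} {f g : ℕ → α → X} (hfm : ∀ n, AEStronglyMeasurable (f n) ν)
    (hgm : ∀ n, AEStronglyMeasurable (g n) ν)
    (hf : Tendsto (fun n => eLpNorm (f n) 2 ν) atTop (𝓝 0))
    (hg : Tendsto (fun n => eLpNorm (g n) 2 ν) atTop (𝓝 0)) :
    Tendsto (fun n => eLpNorm (f n + g n) 2 ν) atTop (𝓝 0) := by
  have := hf.add hg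
  rw [add_zero] at this
  exact tendsto_of_tendsto_of_tendsto_of_le_of_le tendsto_const_nhds this (fun _ => zero_le)
    fun n => eLpNorm_add_le (hfm n) (hgm n) (by norm_num)

theorem tendsto_eLpNorm_of_dominated {α X Y : Type*} [MeasurableSpace α] [NormedAddCommGroup X]
    [NormedAddCommGroup Y] {ν : Measure α} {f : ℕ → α → X} {F : α → Y} (hF : MemLp F 2 ν)
    (hfm : ∀ n, AEStronglyMeasurable (f n) ν) {c : ℝ} (h : ∀ n z, ‖f n z‖ ≤ c * ‖F z‖)
    (hl : ∀ᵐ z ∂ν, Tendsto (fun n => f n z) atTop (𝓝 0)) :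
    Tendsto (fun n => eLpNorm (f n) 2 ν) atTop (𝓝 0) := by
  have h0 : Tendsto (fun n => eLpNorm (f n) 2 ν ^ 2) atTop (𝓝 0) := by
    simp only [eLpNorm_two_sq]
    have := tendsto_lintegral_of_dominated_convergence' (μ := ν) (F := fun n z => ‖f n z‖ₑ ^ 2)
      (f := fun _ => 0) (fun z => (ENNReal.ofReal c * ‖F z‖ₑ) ^ 2)
      (fun n => (hfm n).enorm.pow_const 2) ?_ ?_ ?_
    · simpa using this
    · intro n
      refine Eventually.of_forall fun z => ?_
      refine pow_le_pow_left' ?_ 2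
      rw [← ofReal_norm, ← ofReal_norm]
      refine (ENNReal.ofReal_le_ofReal (h n z)).trans ?_
      rw [ENNReal.ofReal_mul' (norm_nonneg _)]
    · simp only [mul_pow]
      rw [lintegral_const_mul'' _ (hF.1.enorm.pow_const 2), ← eLpNorm_two_sq]
      exact ENNReal.mul_ne_top (by simp) (ENNReal.pow_ne_top hF.2.ne)
    · filter_upwards [hl] with z hz
      have h1 := (ENNReal.continuous_pow 2).tendsto _ |>.comp hz.enorm
      simpa [Function.comp_def] using h1
  have h1 := (ENNReal.continuous_rpow_const (y := (1 / 2 : ℝ))).tendsto _ |>.comp h0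
  rw [ENNReal.zero_rpow_of_pos (by norm_num)] at h1
  refine h1.congr fun n => ?_
  simp only [Function.comp]
  rw [← ENNReal.rpow_natCast, ← ENNReal.rpow_mul]; norm_num

theorem abs_sub_le_of_hasDerivAt {h h' : ℝ → ℝ} (hh : ∀ u, HasDerivAt h (h' u) u)
    (hb : ∀ u, |h' u| ≤ 1) (a b : ℝ) : |h a - h b| ≤ |a - b| := by
  have := Convex.norm_image_sub_le_of_norm_hasDerivWithin_le (f := h) (f' := h') (C := 1)
    (s := univ) (x := b) (y := a) (fun x _ => (hh x).hasDerivWithinAt) (fun x _ => hb x)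
    convex_univ (mem_univ _) (mem_univ _)
  simpa using this

/-- Chain and product rule: the gradient of `Z h(f)` given the gradient `F` of `f`. -/
def chainGrad (Z : Gd d → ℝ) (h h' : ℝ → ℝ) (f : Gd d → ℝ) (F : Gd d → Ed d) (z : Gd d) : Ed d :=
  h (f z) • gx Z z + (Z z * h' (f z)) • F z

variable {Z : Gd d → ℝ} {h h' : ℝ → ℝ} {f : Gd d → ℝ} {F : Gd d → Ed d} {fn : ℕ → Gd d → ℝ}

theorem gx_mul_comp (hZ : ContDiff ℝ 1 Z) (hh : ∀ u, HasDerivAt h (h' u) u)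
    (hf : ContDiff ℝ 1 f) : gx (fun z => Z z * h (f z)) = chainGrad Z h h' f (gx f) := by
  funext z
  have hd1 : Differentiable ℝ fun z => h (f z) := fun z =>
    (hh (f z)).differentiableAt.comp z (hf.differentiable (by simp) z)
  rw [gx_mul (hZ.differentiable (by simp)) hd1, gx_comp (hh _) (hf.differentiable (by simp) z),
    chainGrad, add_comm, smul_smul]

theorem exists_norm_le_of_hasCompactSupport {X Y : Type*} [TopologicalSpace X]
    [NormedAddCommGroup Y] {f : X → Y} (hf : Continuous f) (hc : HasCompactSupport f) :
    ∃ C : ℝ, 0 ≤ C ∧ ∀ z, ‖f z‖ ≤ C := by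
  obtain ⟨C, hC⟩ := hc.exists_bound_of_continuous hf
  exact ⟨max C 0, le_max_right _ _, fun z => (hC z).trans (le_max_left _ _)⟩

theorem tendsto_mul_comp (hZ : Continuous Z) (hZc : HasCompactSupport Z)
    (hh : ∀ u, HasDerivAt h (h' u) u) (hb : ∀ u, |h' u| ≤ 1)
    (h3 : Tendsto (fun n => eLpNorm (fn n - f) 2 volume) atTop (𝓝 0)) :
    Tendsto (fun n => eLpNorm ((fun z => Z z * h (fn n z)) - fun z => Z z * h (f z)) 2 volume)
      atTop (𝓝 0) := by
  obtain ⟨C, hC0, hC⟩ := exists_norm_le_of_hasCompactSupport hZ hZc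
  refine tendsto_eLpNorm_of_norm_le (c := C) (fun n z => ?_) h3
  simp only [Pi.sub_apply]
  rw [← mul_sub, norm_mul]
  exact mul_le_mul (hC z) (abs_sub_le_of_hasDerivAt hh hb _ _) (norm_nonneg _) hC0

theorem tendsto_gx_mul_comp (hZ : ContDiff ℝ 1 Z) (hZc : HasCompactSupport Z)
    (hh : ∀ u, HasDerivAt h (h' u) u) (hb : ∀ u, |h' u| ≤ 1) (hc : Continuous h')
    (hfm : Measurable f) (hF : MemLp F 2 volume) (h1 : ∀ n, ContDiff ℝ 1 (fn n))
    (h3 : Tendsto (fun n => eLpNorm (fn n - f) 2 volume) atTop (𝓝 0))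
    (h4 : Tendsto (fun n => eLpNorm (gx (fn n) - F) 2 volume) atTop (𝓝 0))
    (hae : ∀ᵐ z, Tendsto (fun n => fn n z) atTop (𝓝 (f z))) :
    Tendsto (fun n => eLpNorm (gx (fun z => Z z * h (fn n z)) - chainGrad Z h h' f F) 2 volume)
      atTop (𝓝 0) := by
  obtain ⟨C, hC0, hC⟩ := exists_norm_le_of_hasCompactSupport hZ.continuous hZc
  obtain ⟨L, hL0, hL⟩ := exists_norm_le_of_hasCompactSupport (continuous_gx hZ)
    (hasCompactSupport_gx hZc)
  have hhc : Continuous h := continuous_iff_continuousAt.2 fun u => (hh u).continuousAt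
  have hZm := hZ.continuous
  have hgZ := continuous_gx hZ
  have hfn := fun n => (h1 n).continuous
  have hgn := fun n => continuous_gx (h1 n)
  have e : ∀ n, gx (fun z => Z z * h (fn n z)) - chainGrad Z h h' f F =
      (fun z => (h (fn n z) - h (f z)) • gx Z z) +
      ((fun z => (Z z * h' (fn n z)) • (gx (fn n) z - F z)) +
        fun z => (Z z * (h' (fn n z) - h' (f z))) • F z) := by
    intro n
    rw [gx_mul_comp hZ hh (h1 n)]
    funext z
    simp only [chainGrad, Pi.add_apply, Pi.sub_apply]
    module
  have hfS : AEStronglyMeasurable f volume := hfm.aestronglyMeasurable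
  have hA : ∀ n, AEStronglyMeasurable (fun z => (h (fn n z) - h (f z)) • gx Z z) volume := fun n =>
    ((hhc.comp (hfn n)).aestronglyMeasurable.sub (hhc.comp_aestronglyMeasurable hfS)).smul
      hgZ.aestronglyMeasurable
  have hB : ∀ n, AEStronglyMeasurable (fun z => (Z z * h' (fn n z)) • (gx (fn n) z - F z)) volume :=
    fun n => (hZm.mul (hc.comp (hfn n))).aestronglyMeasurable.smul
      ((hgn n).aestronglyMeasurable.sub hF.1)
  have hD : ∀ n, AEStronglyMeasurable (fun z => (Z z * (h' (fn n z) - h' (f z))) • F z) volume :=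
    fun n => (hZm.aestronglyMeasurable.mul ((hc.comp (hfn n)).aestronglyMeasurable.sub
      (hc.comp_aestronglyMeasurable hfS))).smul hF.1
  simp_rw [e]
  refine tendsto_eLpNorm_add hA (fun n => (hB n).add (hD n)) ?_ (tendsto_eLpNorm_add hB hD ?_ ?_)
  · refine tendsto_eLpNorm_of_norm_le (c := L) (fun n z => ?_) h3
    rw [norm_smul, mul_comm]
    exact mul_le_mul (hL z) (abs_sub_le_of_hasDerivAt hh hb _ _) (norm_nonneg _) hL0
  · refine tendsto_eLpNorm_of_norm_le (c := C) (fun n z => ?_) h4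
    rw [norm_smul, norm_mul]
    refine mul_le_mul_of_nonneg_right ?_ (norm_nonneg _)
    exact (mul_le_mul (hC z) (hb _) (abs_nonneg _) hC0).trans (mul_one C).le
  · refine tendsto_eLpNorm_of_dominated hF hD (c := C * 2) (fun n z => ?_) ?_
    · rw [norm_smul, norm_mul]
      refine mul_le_mul_of_nonneg_right (mul_le_mul (hC z) ?_ (norm_nonneg _) hC0) (norm_nonneg _)
      refine (norm_sub_le _ _).trans ?_
      have := hb (fn n z); have := hb (f z)
      simp only [Real.norm_eq_abs]; linarith
    · filter_upwards [hae] with z hz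
      have l1 := (hc.tendsto (f z)).comp hz
      have l2 := ((l1.sub_const (h' (f z))).const_mul (Z z)).smul_const (F z)
      simpa using l2

/-- Product with a smooth function composed with a `C¹` function with bounded derivative. -/
theorem SobW.mul_comp (hZ : ContDiff ℝ 1 Z) (hZc : HasCompactSupport Z)
    (hh : ∀ u, HasDerivAt h (h' u) u) (hb : ∀ u, |h' u| ≤ 1) (hc : Continuous h')
    (hfm : Measurable f) (hF : MemLp F 2 volume)
    (h1 : ∀ n, ContDiff ℝ 1 (fn n))
    (h3 : Tendsto (fun n => eLpNorm (fn n - f) 2 volume) atTop (𝓝 0))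
    (h4 : Tendsto (fun n => eLpNorm (gx (fn n) - F) 2 volume) atTop (𝓝 0))
    (hae : ∀ᵐ z, Tendsto (fun n => fn n z) atTop (𝓝 (f z))) :
    SobW (fun z => Z z * h (f z)) (chainGrad Z h h' f F) := by
  obtain ⟨C, hC0, hC⟩ := exists_norm_le_of_hasCompactSupport hZ.continuous hZc
  obtain ⟨L, hL0, hL⟩ := exists_norm_le_of_hasCompactSupport (continuous_gx hZ)
    (hasCompactSupport_gx hZc)
  have hhc : Continuous h := continuous_iff_continuousAt.2 fun u => (hh u).continuousAt
  have hcd : ContDiff ℝ 1 h := by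
    rw [contDiff_one_iff_deriv]
    refine ⟨fun u => (hh u).differentiableAt, ?_⟩
    rwa [show deriv h = h' from funext fun u => (hh u).deriv]
  have hZm := hZ.continuous.measurable
  have k1 : ∀ n, ContDiff ℝ 1 (fun z => Z z * h (fn n z)) := fun n => hZ.mul (hcd.comp (h1 n))
  have k2 : ∀ n, HasCompactSupport (fun z => Z z * h (fn n z)) := fun n => hZc.mul_right
  have m1 : MemLp (fun z => Z z * h (f z)) 2 volume := by
    have t := tendsto_mul_comp hZ.continuous hZc hh hb h3
    obtain ⟨n, hn⟩ := ((tendsto_order.1 t).2 1 (by norm_num)).exists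
    have hmm : AEStronglyMeasurable (fun z => Z z * h (f z)) volume :=
      (hZm.mul (hhc.measurable.comp hfm)).aestronglyMeasurable
    have hd : MemLp ((fun z => Z z * h (fn n z)) - fun z => Z z * h (f z)) 2 volume :=
      ⟨(k1 n).continuous.aestronglyMeasurable.sub hmm, hn.trans ENNReal.one_lt_top⟩
    have := (memLp_of_contDiff (k1 n) (k2 n)).1.sub hd
    simpa using this
  have m2 : MemLp (chainGrad Z h h' f F) 2 volume := by
    have t := tendsto_gx_mul_comp hZ hZc hh hb hc hfm hF h1 h3 h4 hae
    obtain ⟨n, hn⟩ := ((tendsto_order.1 t).2 1 (by norm_num)).exists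
    have hmm : AEStronglyMeasurable (chainGrad Z h h' f F) volume :=
      ((hhc.measurable.comp hfm).aestronglyMeasurable.smul
        (continuous_gx hZ).aestronglyMeasurable).add
        ((hZm.mul (hc.measurable.comp hfm)).aestronglyMeasurable.smul hF.1)
    have hd : MemLp (gx (fun z => Z z * h (fn n z)) - chainGrad Z h h' f F) 2 volume :=
      ⟨(continuous_gx (k1 n)).aestronglyMeasurable.sub hmm, hn.trans ENNReal.one_lt_top⟩
    have := (memLp_of_contDiff (k1 n) (k2 n)).2.sub hd
    simpa using this
  exact ⟨hZm.mul (hhc.measurable.comp hfm), m1, m2, fun n z => Z z * h (fn n z), k1, k2,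
    tendsto_mul_comp hZ.continuous hZc hh hb h3,
    tendsto_gx_mul_comp hZ hZc hh hb hc hfm hF h1 h3 h4 hae⟩

end ChainRule

section Localization

/-- Localisation of weak gradients by a smooth cutoff. -/
theorem HasWeakGx.mul_cutoff {w : Gd d → ℝ} {W : Gd d → Ed d} {O : Set (Gd d)}
    (h : HasWeakGx w W O) (hw : MemLp w 2 (volume.restrict O))
    (hW : MemLp W 2 (volume.restrict O)) {ζ : Gd d → ℝ} (hζ : ContDiff ℝ (⊤ : ℕ∞) ζ)
    (hζc : HasCompactSupport ζ) (hζO : tsupport ζ ⊆ O) :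
    HasWeakGx (fun z => ζ z * w z) (fun z => ζ z • W z + w z • gx ζ z) univ := by
  intro φ hφ hφc _ e
  have hζ1 : ContDiff ℝ 1 ζ := hζ.of_le (by exact_mod_cast le_top)
  have hφ1 : ContDiff ℝ 1 φ := hφ.of_le (by exact_mod_cast le_top)
  have hdζ := hζ1.differentiable (by simp)
  have hdφ := hφ1.differentiable (by simp)
  have key := h (fun z => ζ z * φ z) (hζ.mul hφ) hζc.mul_right
    ((tsupport_mul_subset_left).trans hζO) e
  have hder : ∀ z, fderiv ℝ (fun z => ζ z * φ z) z (0, e)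
      = ζ z * fderiv ℝ φ z (0, e) + φ z * ⟪gx ζ z, e⟫ := by
    intro z
    rw [inner_gx, fderiv_fun_mul (hdζ z) (hdφ z)]
    simp
  have hz : ∀ z ∉ O, ζ z = 0 := fun z hz => by
    by_contra hne; exact hz (hζO (subset_tsupport _ hne))
  have hgz : ∀ z ∉ O, gx ζ z = 0 := fun z hz => by
    have : fderiv ℝ ζ z = 0 := by
      by_contra hne
      exact hz (hζO (support_fderiv_subset ℝ hne))
    simp [gx, this]
  have hi : ∀ (g : Gd d → ℝ), Continuous g → HasCompactSupport g → (∀ z ∉ O, g z = 0) →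
      Integrable (fun z => w z * g z) := by
    intro g hg hgc hg0
    have h1 : Integrable (fun z => w z * g z) (volume.restrict O) :=
      hw.integrable_mul (q := 2) ((hg.memLp_of_hasCompactSupport hgc).restrict O)
    rw [← integrableOn_univ]
    refine IntegrableOn.of_forall_sdiff_eq_zero (s := O) h1 MeasurableSet.univ fun z hz => ?_
    rw [hg0 z hz.2, mul_zero]
  have hcg := continuous_gx hζ1
  have hcf : Continuous fun z => fderiv ℝ φ z (0, e) :=
    (hφ1.continuous_fderiv (by simp)).clm_apply continuous_const
  have i1 : Integrable (fun z => w z * (ζ z * fderiv ℝ φ z (0, e))) :=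
    hi _ (hζ1.continuous.mul hcf) hζc.mul_right fun z hzO => by rw [hz z hzO, zero_mul]
  have i2 : Integrable (fun z => w z * (φ z * ⟪gx ζ z, e⟫)) :=
    hi _ (hφ1.continuous.mul (hcg.inner continuous_const)) hφc.mul_right fun z hzO => by
      rw [hgz z hzO, inner_zero_left, mul_zero]
  have i3 : Integrable (fun z => ζ z * φ z * ⟪W z, e⟫) := by
    have h1 : Integrable (fun z => ⟪W z, (ζ z * φ z) • e⟫) (volume.restrict O) := by
      refine MemLp.integrable_inner_two hW (MemLp.restrict O ?_)
      exact ((hζ1.continuous.mul hφ1.continuous).smul continuous_const).memLp_of_hasCompactSupport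
        (HasCompactSupport.smul_right (hζc.mul_right))
    have h2 : Integrable (fun z => ⟪W z, (ζ z * φ z) • e⟫) := by
      rw [← integrableOn_univ]
      refine IntegrableOn.of_forall_sdiff_eq_zero (s := O) h1 MeasurableSet.univ fun z hzO => ?_
      rw [hz z hzO.2]; simp
    refine h2.congr (Eventually.of_forall fun z => ?_)
    simp only [inner_smul_right]
  simp only [hder, mul_add] at key
  rw [integral_add i1 i2] at key
  calc ∫ z, ζ z * w z * fderiv ℝ φ z (0, e) = ∫ z, w z * (ζ z * fderiv ℝ φ z (0, e)) :=
        integral_congr_ae (Eventually.of_forall fun z => by ring)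
    _ = -(∫ z, ζ z * φ z * ⟪W z, e⟫) - ∫ z, w z * (φ z * ⟪gx ζ z, e⟫) := by linarith
    _ = -∫ z, (ζ z * φ z * ⟪W z, e⟫ + w z * (φ z * ⟪gx ζ z, e⟫)) := by
        rw [integral_add i3 i2]; ring
    _ = _ := by
        congr 1
        refine integral_congr_ae (Eventually.of_forall fun z => ?_)
        simp only [inner_add_left, real_inner_smul_left]; ring

theorem memLp_mul_cutoff {X : Type*} [NormedAddCommGroup X] [NormedSpace ℝ X] {w : Gd d → X}
    {O : Set (Gd d)} (hO : MeasurableSet O) (hw : MemLp w 2 (volume.restrict O)) {ζ : Gd d → ℝ}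
    (hζ : Continuous ζ) (hζc : HasCompactSupport ζ) (hz : ∀ z ∉ O, ζ z = 0) :
    MemLp (fun z => ζ z • w z) 2 volume := by
  obtain ⟨C, hC0, hC⟩ := exists_norm_le_of_hasCompactSupport hζ hζc
  have h1 : MemLp (fun z => ζ z • w z) 2 (volume.restrict O) :=
    hw.of_le_mul (c := C) (hζ.aestronglyMeasurable.smul hw.1) (Eventually.of_forall fun z => by
      rw [norm_smul]; exact mul_le_mul_of_nonneg_right (hC z) (norm_nonneg _))
  rw [← memLp_indicator_iff_restrict hO] at h1
  refine (memLp_congr_ae (Eventually.of_forall fun z => ?_)).1 h1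
  by_cases hzO : z ∈ O
  · simp [hzO]
  · simp [hzO, hz z hzO]

end Localization

section Tails

/-- The tail integral at time `t`, as an extended nonnegative real. -/
def tauS (s : ℝ) (v : Gd d → ℝ) (r t : ℝ) : ℝ≥0∞ :=
  ∫⁻ y in (ball (0 : Ed d) r)ᶜ, ‖v (t, y)‖ₑ * ENNReal.ofReal (kerS s y)

theorem measurable_tauS {v : Gd d → ℝ} (hv : Measurable v) (s r : ℝ) :
    Measurable (tauS s v r) := by
  unfold tauS
  exact Measurable.lintegral_prod_right'
    (f := fun z : ℝ × Ed d => ‖v z‖ₑ * ENNReal.ofReal (kerS s z.2)) (by fun_prop)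

/-- Pairs `(x, y)` with `x` in a small ball and `y` outside a larger one. -/
def farA (d : ℕ) (ρ r : ℝ) : Set (ℝ × Ed d × Ed d) :=
  {p | p.2.1 ∈ ball (0 : Ed d) ρ ∧ p.2.2 ∉ ball (0 : Ed d) r}

theorem measurableSet_farA (ρ r : ℝ) : MeasurableSet (farA d ρ r) :=
  (measurableSet_ball.preimage (by fun_prop)).inter
    (measurableSet_ball.preimage (by fun_prop)).compl

theorem kerS_far_le {s ρ r : ℝ} (hs : 0 < s) (hρ : ρ < r) (hr : r ≤ 1) {x y : Ed d}
    (hx : x ∈ ball (0 : Ed d) ρ) (hy : y ∉ ball (0 : Ed d) r) :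
    kerS s (y - x) ≤ 1 / (r - ρ) ^ ((d : ℝ) + 2 * s) * kerS s y := by
  rw [mem_ball_zero_iff] at hx hy
  rw [not_lt] at hy
  have h0 : 0 ≤ ‖x‖ := norm_nonneg x
  have h1 : (r - ρ) * ‖y‖ ≤ ‖y - x‖ := by
    have := norm_sub_norm_le y x
    nlinarith
  have hy0 : 0 < ‖y‖ := by linarith
  have hrρ : 0 < r - ρ := by linarith
  rw [kerS, kerS, div_mul_div_comm, one_mul, ← Real.mul_rpow hrρ.le hy0.le]
  refine one_div_le_one_div_of_le (by positivity) ?_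
  exact Real.rpow_le_rpow (by positivity) h1 (by positivity)

theorem lintegral_far_le {s ρ r : ℝ} (hs : 0 < s) (hρ : ρ < r) (hr : r ≤ 1) {v : Gd d → ℝ}
    (hv : Measurable v) {w : Gd d → ℝ≥0∞} (hw : Measurable w) :
    ∫⁻ p in farA d ρ r, w (p.1, p.2.1) * ‖v (p.1, p.2.2)‖ₑ ∂(nuS d s)
      ≤ ENNReal.ofReal (1 / (r - ρ) ^ ((d : ℝ) + 2 * s)) *
        ∫⁻ z in univ ×ˢ ball (0 : Ed d) ρ, w z * tauS s v r z.1 := by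
  set c := ENNReal.ofReal (1 / (r - ρ) ^ ((d : ℝ) + 2 * s)) with hc
  have hker : Measurable fun p : ℝ × Ed d × Ed d => ENNReal.ofReal (kerS s (p.2.2 - p.2.1)) := by
    fun_prop
  rw [nuS, setLIntegral_withDensity_eq_setLIntegral_mul _ hker (by fun_prop) (measurableSet_farA ρ r)]
  set w' : Gd d → ℝ≥0∞ := (univ ×ˢ ball (0 : Ed d) ρ).indicator w with hw'
  have hS : MeasurableSet ((univ : Set ℝ) ×ˢ ball (0 : Ed d) ρ) :=
    MeasurableSet.univ.prod measurableSet_ball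
  have hw'm : Measurable w' := hw.indicator hS
  set k : Gd d → ℝ≥0∞ := fun z => (ball (0 : Ed d) r)ᶜ.indicator
    (fun y => ‖v (z.1, y)‖ₑ * ENNReal.ofReal (kerS s y)) z.2 with hk
  have hkm : Measurable k := by
    have : k = (univ ×ˢ (ball (0 : Ed d) r)ᶜ).indicator
        fun z => ‖v z‖ₑ * ENNReal.ofReal (kerS s z.2) := by
      funext z
      by_cases hz : z.2 ∈ (ball (0 : Ed d) r)ᶜ
      · rw [indicator_of_mem (by exact ⟨mem_univ _, hz⟩), hk]
        exact indicator_of_mem hz _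
      · rw [indicator_of_notMem (by exact fun h => hz h.2), hk]
        exact indicator_of_notMem hz _
    rw [this]
    exact Measurable.indicator (by fun_prop) (MeasurableSet.univ.prod measurableSet_ball.compl)
  have h1 : ∫⁻ p in farA d ρ r, ((fun p : ℝ × Ed d × Ed d => ENNReal.ofReal (kerS s (p.2.2 - p.2.1))) *
      fun p : ℝ × Ed d × Ed d => w (p.1, p.2.1) * ‖v (p.1, p.2.2)‖ₑ) p
      ≤ ∫⁻ p : ℝ × Ed d × Ed d, c * w' (p.1, p.2.1) * k (p.1, p.2.2) := by
    rw [← lintegral_indicator (measurableSet_farA ρ r)]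
    refine lintegral_mono fun p => ?_
    by_cases hp : p ∈ farA d ρ r
    · have hp1 := hp.1
      have hp2 := hp.2
      have e1 : w' (p.1, p.2.1) = w (p.1, p.2.1) := by
        rw [hw']; exact indicator_of_mem (by exact ⟨mem_univ _, hp1⟩) _
      have e2 : k (p.1, p.2.2) = ‖v (p.1, p.2.2)‖ₑ * ENNReal.ofReal (kerS s p.2.2) := by
        rw [hk]; exact indicator_of_mem (by exact hp2) _
      rw [indicator_of_mem hp, e1, e2]
      simp only [Pi.mul_apply]
      have h2 := ENNReal.ofReal_le_ofReal (kerS_far_le hs hρ hr hp1 hp2)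
      rw [ENNReal.ofReal_mul (by have : 0 < r - ρ := by linarith
                                 positivity)] at h2
      calc _ ≤ c * ENNReal.ofReal (kerS s p.2.2) * (w (p.1, p.2.1) * ‖v (p.1, p.2.2)‖ₑ) :=
            mul_le_mul_left h2 _
        _ = _ := by ring
    · rw [indicator_of_notMem hp]; exact zero_le
  refine h1.trans (le_of_eq ?_)
  have e3 : ∫⁻ z in univ ×ˢ ball (0 : Ed d) ρ, w z * tauS s v r z.1
      = ∫⁻ z : Gd d, w' z * tauS s v r z.1 := by
    rw [← lintegral_indicator hS]
    refine lintegral_congr fun z => ?_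
    by_cases hz : z ∈ (univ : Set ℝ) ×ˢ ball (0 : Ed d) ρ
    · rw [indicator_of_mem hz, hw', indicator_of_mem hz]
    · rw [indicator_of_notMem hz, hw', indicator_of_notMem hz, zero_mul]
  have hτ := measurable_tauS hv s r
  have e4 : ∫⁻ z : Gd d, c * (w' z * tauS s v r z.1)
      = ∫⁻ t, ∫⁻ x, c * (w' (t, x) * tauS s v r t) := by
    rw [Measure.volume_eq_prod, lintegral_prod _ (by fun_prop)]
  rw [e3, ← lintegral_const_mul _ (by fun_prop), e4, Measure.volume_eq_prod,
    lintegral_prod _ (by fun_prop)]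
  refine lintegral_congr fun t => ?_
  rw [Measure.volume_eq_prod, lintegral_prod _ (by fun_prop)]
  refine lintegral_congr fun x => ?_
  simp only
  rw [lintegral_const_mul _ (by fun_prop), mul_assoc]
  congr 2
  rw [tauS, ← lintegral_indicator measurableSet_ball.compl]

end Tails

section TimePrimitive

variable {g : ℝ → ℝ}

theorem continuous_primitive_Iic (hg : Integrable g) : Continuous fun t => ∫ s in Iic t, g s := by
  have h : (fun t => ∫ s in Iic t, g s)
      = fun t => (∫ s in Iic (0 : ℝ), g s) + ∫ s in (0 : ℝ)..t, g s := by
    funext t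
    rw [← intervalIntegral.integral_Iic_sub_Iic hg.integrableOn hg.integrableOn]; ring
  rw [h]
  exact continuous_const.add (intervalIntegral.continuous_primitive
    (fun a b => hg.intervalIntegrable) 0)

theorem abs_primitive_Iic_le (hg : Integrable g) (t : ℝ) :
    |∫ s in Iic t, g s| ≤ ∫ s, |g s| :=
  (abs_integral_le_integral_abs).trans
    (setIntegral_le_integral hg.abs (Eventually.of_forall fun _ => abs_nonneg _))

theorem integral_primitive_mul_deriv (hg : Integrable g) {f : ℝ → ℝ} (hf : ContDiff ℝ 1 f)
    (hfc : HasCompactSupport f) :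
    ∫ t, (∫ s in Iic t, g s) * deriv f t = -∫ s, g s * f s := by
  have hf' : Continuous (deriv f) := hf.continuous_deriv le_rfl
  have hf'i : Integrable (deriv f) := hf'.integrable_of_hasCompactSupport hfc.deriv
  have hint : Integrable (Function.uncurry fun t s => (Iic t).indicator g s * deriv f t)
      (volume.prod volume) := by
    have h1 : Integrable (fun p : ℝ × ℝ => deriv f p.1 * g p.2) (volume.prod volume) :=
      hf'i.mul_prod hg
    refine (h1.indicator (s := {p : ℝ × ℝ | p.2 ≤ p.1})
      (measurableSet_le measurable_snd measurable_fst)).congr (Eventually.of_forall fun p => ?_)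
    by_cases hp : p.2 ≤ p.1 <;> simp [Function.uncurry, indicator, hp, mul_comm]
  calc ∫ t, (∫ s in Iic t, g s) * deriv f t = ∫ t, ∫ s, (Iic t).indicator g s * deriv f t := by
        refine integral_congr_ae (Eventually.of_forall fun t => ?_)
        simp only
        rw [integral_mul_const, integral_indicator measurableSet_Iic]
    _ = ∫ s, ∫ t, (Iic t).indicator g s * deriv f t := integral_integral_swap hint
    _ = ∫ s, -(g s * f s) := by
        refine integral_congr_ae (Eventually.of_forall fun s => ?_)
        have e : ∀ t, (Iic t).indicator g s * deriv f t = (Ici s).indicator (fun t => g s * deriv f t) t := by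
          intro t
          by_cases hst : s ≤ t <;> simp [indicator, hst]
        simp only [e]
        rw [integral_indicator measurableSet_Ici, integral_Ici_eq_integral_Ioi, integral_const_mul,
          hfc.integral_Ioi_deriv_eq hf]
        ring
    _ = _ := integral_neg _

variable {φ : Gd d → ℝ}

theorem integrable_primitive_mul (hg : Integrable g) {ψ : Gd d → ℝ} (hψ : Continuous ψ)
    (hψc : HasCompactSupport ψ) : Integrable fun z : Gd d => (∫ s in Iic z.1, g s) * ψ z := by
  refine Continuous.integrable_of_hasCompactSupport ?_ hψc.mul_left
  exact ((continuous_primitive_Iic hg).comp continuous_fst).mul hψ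

theorem integrable_fst_mul (hg : Integrable g) {ψ : Gd d → ℝ} (hψ : Continuous ψ)
    (hψc : HasCompactSupport ψ) : Integrable fun z : Gd d => g z.1 * ψ z := by
  obtain ⟨C, hC0, hC⟩ := exists_norm_le_of_hasCompactSupport hψ hψc
  have hK : IsCompact (Prod.snd '' tsupport ψ) := hψc.isCompact.image continuous_snd
  have h1 : Integrable (fun z : ℝ × Ed d => g z.1 * (Prod.snd '' tsupport ψ).indicator
      (fun _ => (1 : ℝ)) z.2) (volume.prod volume) := by
    refine hg.mul_prod ?_
    exact (integrable_indicator_iff hK.measurableSet).2 (integrableOn_const hK.measure_lt_top.ne)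
  have h2 := h1.bdd_mul (c := C) hψ.aestronglyMeasurable (Eventually.of_forall hC)
  refine h2.congr (Eventually.of_forall fun z => ?_)
  by_cases hz : z ∈ tsupport ψ
  · have : z.2 ∈ Prod.snd '' tsupport ψ := ⟨z, hz, rfl⟩
    simp only [indicator_of_mem this]; ring
  · simp [image_eq_zero_of_notMem_tsupport hz]

theorem hasDerivAt_slice_fst (hφ : ContDiff ℝ 1 φ) (t : ℝ) (x : Ed d) :
    HasDerivAt (fun t => φ (t, x)) (fderiv ℝ φ (t, x) (1, 0)) t := by
  have h := ((hφ.differentiable (by simp) (t, x)).hasFDerivAt.comp t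
    (hasFDerivAt_prodMk_left t x)).hasDerivAt
  simpa [Function.comp_def] using h

theorem integral_primitive_mul_fderiv (hg : Integrable g) (hφ : ContDiff ℝ 1 φ)
    (hφc : HasCompactSupport φ) :
    ∫ z : Gd d, (∫ s in Iic z.1, g s) * fderiv ℝ φ z (1, 0) = -∫ z : Gd d, g z.1 * φ z := by
  have hcf : Continuous fun z => fderiv ℝ φ z (1, 0) :=
    (hφ.continuous_fderiv (by simp)).clm_apply continuous_const
  have hcc : HasCompactSupport fun z => fderiv ℝ φ z (1, 0) := hφc.fderiv_apply ℝ (1, 0)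
  have i1 := integrable_primitive_mul hg hcf hcc
  have i2 := integrable_fst_mul hg hφ.continuous hφc
  rw [Measure.volume_eq_prod] at i1 i2 ⊢
  rw [integral_prod_symm _ i1, integral_prod_symm _ i2, ← integral_neg]
  refine integral_congr_ae (Eventually.of_forall fun x => ?_)
  have h1 : ContDiff ℝ 1 fun t => φ (t, x) := hφ.comp (contDiff_id.prodMk contDiff_const)
  have h2 : HasCompactSupport fun t => φ (t, x) :=
    hφc.comp_isClosedEmbedding (Topology.IsClosedEmbedding.of_continuous_injective_isClosedMap
      (by fun_prop) (Prod.mk_left_injective x) (isClosedMap_prodMk_right x))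
  have h3 := integral_primitive_mul_deriv hg h1 h2
  simpa only [(hasDerivAt_slice_fst hφ _ x).deriv] using h3

theorem hasWeakGx_primitive (hg : Integrable g) (O : Set (Gd d)) :
    HasWeakGx (fun z : Gd d => ∫ s in Iic z.1, g s) 0 O := by
  intro φ hφ hφc _ e
  have hφ1 : ContDiff ℝ 1 φ := hφ.of_le (by exact_mod_cast le_top)
  have hcf : Continuous fun z => fderiv ℝ φ z (0, e) :=
    (hφ1.continuous_fderiv (by simp)).clm_apply continuous_const
  have hcc : HasCompactSupport fun z => fderiv ℝ φ z (0, e) := hφc.fderiv_apply ℝ (0, e)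
  have i1 := integrable_primitive_mul hg hcf hcc
  rw [Measure.volume_eq_prod] at i1 ⊢
  rw [integral_prod _ i1]
  simp only [Pi.zero_apply, inner_zero_left, mul_zero, integral_zero, neg_zero]
  refine integral_eq_zero_of_ae (Eventually.of_forall fun t => ?_)
  simp only [Pi.zero_apply]
  rw [integral_const_mul]
  have h1 : ContDiff ℝ 1 fun x => φ (t, x) := hφ1.comp (contDiff_const.prodMk contDiff_id)
  have h2 : HasCompactSupport fun x => φ (t, x) :=
    hφc.comp_isClosedEmbedding (Topology.IsClosedEmbedding.of_continuous_injective_isClosedMap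
      (by fun_prop) (Prod.mk_right_injective t) (isClosedMap_prodMk_left t))
  have h3 := weak_of_contDiff (μ := volume) h1 h2 e (φ := fun _ => 1) contDiff_const
  have h4 : ∀ x, fderiv ℝ (fun x => φ (t, x)) x e = fderiv ℝ φ (t, x) (0, e) := by
    intro x
    have h : fderiv ℝ (fun x => φ (t, x)) x
        = (fderiv ℝ φ (t, x)).comp (ContinuousLinearMap.inr ℝ ℝ (Ed d)) :=
      ((hφ1.differentiable (by simp) _).hasFDerivAt.comp x (hasFDerivAt_prodMk_right t x)).fderiv
    rw [h]; simp
  simp only [h4, one_mul] at h3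
  have h5 : ∫ x, fderiv ℝ φ (t, x) (0, e) = 0 := by
    simpa using h3.symm
  rw [h5, mul_zero]

end TimePrimitive

section Solutions

/-- Exchange of the two space variables. -/
def swapXY (p : ℝ × Ed d × Ed d) : ℝ × Ed d × Ed d := (p.1, p.2.2, p.2.1)

theorem measurable_swapXY : Measurable (swapXY : ℝ × Ed d × Ed d → _) := by
  unfold swapXY; fun_prop

variable (d) in
/-- Pairs of points of `B_r` at times in `(-1, 0)`. -/
def nearA (r : ℝ) : Set (ℝ × Ed d × Ed d) := Ioo (-1) 0 ×ˢ (ball 0 r ×ˢ ball 0 r)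

theorem measurableSet_nearA (r : ℝ) : MeasurableSet (nearA d r) :=
  measurableSet_Ioo.prod (measurableSet_ball.prod measurableSet_ball)

/-- Weak solutions of `∂ₜ v - div a + ℒ v = 0` in the unit cylinder `(-1, 0) × B₁`, where `a` is
elliptic with respect to the gradient `Dv` and `ν` is the jump measure. -/
structure USol (s Λ : ℝ) (v : Gd d → ℝ) (Dv a : Gd d → Ed d) (ν : Measure (ℝ × Ed d × Ed d)) :
    Prop where
  mv : Measurable v
  mD : Measurable Dv
  ma : Measurable a
  loc : ∃ O, IsOpen O ∧ volume O ≠ ⊤ ∧ Icc (-1) 0 ×ˢ closedBall 0 1 ⊆ O ∧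
    MemLp v 2 (volume.restrict O) ∧ MemLp Dv 2 (volume.restrict O) ∧ HasWeakGx v Dv O
  grow : ∀ z, ‖a z‖ ≤ Λ * ‖Dv z‖
  ell : ∀ z, Λ⁻¹ * ‖Dv z‖ ^ 2 ≤ ⟪a z, Dv z⟫
  symm : ν.map swapXY = ν
  le : ν ≤ ENNReal.ofReal Λ • nuS d s
  tail : ∀ r, 0 < r → ∫⁻ t in Ioo (-1) 0, tauS s v r t ^ 2 < ⊤
  weak : ∀ φ : Gd d → ℝ, ContDiff ℝ (⊤ : ℕ∞) φ → HasCompactSupport φ →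
    tsupport φ ⊆ Ioo (-1) 0 ×ˢ ball 0 1 →
    -(∫ z, v z * fderiv ℝ φ z (1, 0)) + (∫ z, ⟪a z, gx φ z⟫)
      + ∫ p, diffXY v p * diffXY φ p ∂ν = 0

variable {s Λ : ℝ} {ν : Measure (ℝ × Ed d × Ed d)}

theorem tauS_one_lt_top (hs : 0 < s) {r : ℝ} (hr : 0 < r) (t : ℝ) :
    tauS s (fun _ : Gd d => 1) r t < ⊤ := by
  have h1 := lintegral_kernel_far_lt_top (d := d) hs
  have hsub : (ball (0 : Ed d) r)ᶜ ⊆ (ball (0 : Ed d) 1)ᶜ ∪ (ball 0 1 \ ball 0 r) := by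
    intro y hy
    by_cases h : y ∈ ball (0 : Ed d) 1
    · exact Or.inr ⟨h, hy⟩
    · exact Or.inl h
  unfold tauS
  simp only [enorm_one, one_mul]
  refine (lintegral_mono_set hsub).trans_lt ((lintegral_union_le _ _ _).trans_lt
    (ENNReal.add_lt_top.2 ⟨h1, ?_⟩))
  calc _ ≤ ∫⁻ y in ball (0 : Ed d) 1 \ ball 0 r, ENNReal.ofReal (1 / r ^ ((d : ℝ) + 2 * s)) := by
        refine setLIntegral_mono' (measurableSet_ball.diff measurableSet_ball) fun y hy => ?_
        refine ENNReal.ofReal_le_ofReal ?_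
        have h2 : r ≤ ‖y‖ := by simpa using hy.2
        unfold kerS
        gcongr
    _ < ⊤ := by
        rw [setLIntegral_const]
        exact ENNReal.mul_lt_top ENNReal.ofReal_lt_top
          ((measure_mono sdiff_subset).trans_lt measure_ball_lt_top)

theorem tauS_one_eq (r t : ℝ) : tauS s (fun _ : Gd d => 1) r t = tauS s (fun _ : Gd d => 1) r 0 :=
  rfl

theorem lintegral_le_of_le (hν : ν ≤ ENNReal.ofReal Λ • nuS d s) (S : Set (ℝ × Ed d × Ed d))
    (f : ℝ × Ed d × Ed d → ℝ≥0∞) :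
    ∫⁻ p in S, f p ∂ν ≤ ENNReal.ofReal Λ * ∫⁻ p in S, f p ∂nuS d s := by
  calc _ ≤ ∫⁻ p in S, f p ∂(ENNReal.ofReal Λ • nuS d s) :=
        lintegral_mono' (Measure.restrict_mono subset_rfl hν) le_rfl
    _ = _ := by rw [Measure.restrict_smul, lintegral_smul_measure, smul_eq_mul]

theorem measurable_tauS_fst {v : Gd d → ℝ} (hv : Measurable v) (s r : ℝ) :
    Measurable fun z : Gd d => tauS s v r z.1 :=
  (measurable_tauS hv s r).comp (g := tauS s v r) (f := fun z : Gd d => z.1) measurable_fst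

theorem ENNReal_add_sq_le (a b : ℝ≥0∞) : (a + b) ^ 2 ≤ 4 * a ^ 2 + 4 * b ^ 2 := by
  wlog h : a ≤ b generalizing a b
  · rw [add_comm a b, add_comm (4 * a ^ 2)]; exact this b a (le_of_not_ge h)
  calc (a + b) ^ 2 ≤ (b + b) ^ 2 := by gcongr
    _ = 4 * b ^ 2 := by ring
    _ ≤ _ := le_add_self

theorem sq_lintegral_mul_le_mul {α : Type*} [MeasurableSpace α] {μ : Measure α} {w f : α → ℝ≥0∞}
    (hw : AEMeasurable w μ) (hf : AEMeasurable f μ) :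
    (∫⁻ x, w x * f x ∂μ) ^ 2 ≤ (∫⁻ x, w x ^ 2 ∂μ) * ∫⁻ x, f x ^ 2 ∂μ := by
  have h := ENNReal.lintegral_mul_le_Lp_mul_Lq μ (p := 2) (q := 2) (by
    constructor <;> norm_num) hw hf
  simp only [Pi.mul_apply, ENNReal.rpow_two] at h
  refine (pow_le_pow_left' h 2).trans (le_of_eq ?_)
  rw [mul_pow, ← ENNReal.rpow_two, ← ENNReal.rpow_two, ← ENNReal.rpow_mul, ← ENNReal.rpow_mul]
  norm_num

/-- The weight controlling the long range interaction of a test function. -/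
def farW (s : ℝ) (v : Gd d → ℝ) (r : ℝ) (z : Gd d) : ℝ≥0∞ :=
  ‖v z‖ₑ * tauS s (fun _ : Gd d => 1) r 0 + tauS s v r z.1

theorem measurable_farW {v : Gd d → ℝ} (hv : Measurable v) (r : ℝ) : Measurable (farW s v r) := by
  unfold farW
  exact (hv.enorm.mul_const _).add (measurable_tauS_fst hv s r)

theorem lintegral_far_diffXY_le (hν : ν ≤ ENNReal.ofReal Λ • nuS d s) (hs : 0 < s) {ρ r : ℝ}
    (hρ : ρ < r) (hr : r ≤ 1) {v φ : Gd d → ℝ} (hv : Measurable v) (hφ : Measurable φ) :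
    ∫⁻ p in farA d ρ r, ‖diffXY v p * φ (p.1, p.2.1)‖ₑ ∂ν
      ≤ ENNReal.ofReal Λ * (ENNReal.ofReal (1 / (r - ρ) ^ ((d : ℝ) + 2 * s)) *
        ∫⁻ z in univ ×ˢ ball (0 : Ed d) ρ, ‖φ z‖ₑ * farW s v r z) := by
  refine (lintegral_le_of_le hν _ _).trans (mul_le_mul_right ?_ _)
  have h1 := lintegral_far_le hs hρ hr (v := fun _ : Gd d => 1) (w := fun z => ‖φ z‖ₑ * ‖v z‖ₑ)
    measurable_const (by fun_prop)
  have h2 := lintegral_far_le hs hρ hr (w := fun z => ‖φ z‖ₑ) hv (by fun_prop)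
  calc _ ≤ ∫⁻ p in farA d ρ r, (‖φ (p.1, p.2.1)‖ₑ * ‖v (p.1, p.2.1)‖ₑ * ‖(1 : ℝ)‖ₑ
        + ‖φ (p.1, p.2.1)‖ₑ * ‖v (p.1, p.2.2)‖ₑ) ∂nuS d s := by
        refine lintegral_mono fun p => ?_
        rw [enorm_mul, mul_comm, enorm_one, mul_one, ← mul_add]
        exact mul_le_mul_right (enorm_sub_le) _
    _ ≤ _ := by
        rw [lintegral_add_left (by fun_prop)]
        refine (add_le_add h1 h2).trans (le_of_eq ?_)
        have hm := measurable_tauS hv s r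
        have hm' : Measurable fun z : Gd d => tauS s v r z.1 := measurable_tauS_fst hv s r
        rw [← mul_add, ← lintegral_add_left (by simp only [tauS_one_eq]; fun_prop)]
        congr 2; funext z
        rw [tauS_one_eq, farW]; ring

theorem lintegral_mul_farW_sq_le {v φ : Gd d → ℝ} (hv : Measurable v) (hφ : Measurable φ)
    {ρ r : ℝ} (hφs : ∀ z, z.1 ∉ Ioo (-1 : ℝ) 0 → φ z = 0) :
    (∫⁻ z in univ ×ˢ ball (0 : Ed d) ρ, ‖φ z‖ₑ * farW s v r z) ^ 2
      ≤ eLpNorm φ 2 volume ^ 2 * ∫⁻ z in Ioo (-1 : ℝ) 0 ×ˢ ball (0 : Ed d) ρ, farW s v r z ^ 2 := by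
  have e : ∫⁻ z in univ ×ˢ ball (0 : Ed d) ρ, ‖φ z‖ₑ * farW s v r z
      = ∫⁻ z in Ioo (-1 : ℝ) 0 ×ˢ ball (0 : Ed d) ρ, ‖φ z‖ₑ * farW s v r z := by
    rw [← lintegral_indicator (MeasurableSet.univ.prod measurableSet_ball),
      ← lintegral_indicator (measurableSet_Ioo.prod measurableSet_ball)]
    congr 1; funext z
    by_cases hz : z.1 ∈ Ioo (-1 : ℝ) 0
    · have hi : z ∈ (univ : Set ℝ) ×ˢ ball (0 : Ed d) ρ ↔ z ∈ Ioo (-1 : ℝ) 0 ×ˢ ball (0 : Ed d) ρ :=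
        ⟨fun h => ⟨hz, h.2⟩, fun h => ⟨mem_univ _, h.2⟩⟩
      by_cases hb : z ∈ Ioo (-1 : ℝ) 0 ×ˢ ball (0 : Ed d) ρ
      · rw [indicator_of_mem hb, indicator_of_mem (hi.2 hb)]
      · rw [indicator_of_notMem hb, indicator_of_notMem (fun h => hb (hi.1 h))]
    · simp only [indicator, hφs z hz, enorm_zero, zero_mul, ite_self]
  rw [e]
  refine (sq_lintegral_mul_le_mul hφ.enorm.aemeasurable (measurable_farW hv r).aemeasurable).trans ?_
  refine mul_le_mul_left ?_ _
  rw [eLpNorm_two_sq]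
  exact setLIntegral_le_lintegral _ _

theorem lintegral_farW_sq_lt_top (hs : 0 < s) {v : Gd d → ℝ} (hv : Measurable v) {ρ r : ℝ}
    (hr : 0 < r) (hv2 : MemLp v 2 (volume.restrict (Ioo (-1 : ℝ) 0 ×ˢ ball (0 : Ed d) ρ)))
    (ht : ∫⁻ t in Ioo (-1) 0, tauS s v r t ^ 2 < ⊤) :
    ∫⁻ z in Ioo (-1 : ℝ) 0 ×ˢ ball (0 : Ed d) ρ, farW s v r z ^ 2 < ⊤ := by
  have hm := measurable_tauS hv s r
  have hm' : Measurable fun z : Gd d => tauS s v r z.1 := measurable_tauS_fst hv s r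
  set k := tauS s (fun _ : Gd d => 1) r 0 with hk
  have hkt : k < ⊤ := tauS_one_lt_top hs hr 0
  have h1 : ∫⁻ z in Ioo (-1 : ℝ) 0 ×ˢ ball (0 : Ed d) ρ, ‖v z‖ₑ ^ 2 < ⊤ := by
    rw [← eLpNorm_two_sq]; exact ENNReal.pow_lt_top hv2.2
  have h2 : ∫⁻ z in Ioo (-1 : ℝ) 0 ×ˢ ball (0 : Ed d) ρ, tauS s v r z.1 ^ 2 < ⊤ := by
    rw [Measure.volume_eq_prod, ← Measure.prod_restrict, lintegral_prod _ (by fun_prop)]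
    simp only [lintegral_const, Measure.restrict_apply_univ]
    rw [lintegral_mul_const _ (by fun_prop)]
    exact ENNReal.mul_lt_top ht measure_ball_lt_top
  calc _ ≤ ∫⁻ z in Ioo (-1 : ℝ) 0 ×ˢ ball (0 : Ed d) ρ,
        (4 * k ^ 2 * ‖v z‖ₑ ^ 2 + 4 * tauS s v r z.1 ^ 2) := by
        refine lintegral_mono fun z => ?_
        refine (ENNReal_add_sq_le _ _).trans (le_of_eq ?_)
        ring
    _ < ⊤ := by
        rw [lintegral_add_left (by fun_prop), lintegral_const_mul _ (by fun_prop),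
          lintegral_const_mul _ (by fun_prop)]
        exact ENNReal.add_lt_top.2 ⟨ENNReal.mul_lt_top
          (ENNReal.mul_lt_top (by simp) (ENNReal.pow_lt_top hkt)) h1,
          ENNReal.mul_lt_top (by simp) h2⟩

end Solutions

section NonlocalForm

variable {s Λ : ℝ} {ν : Measure (ℝ × Ed d × Ed d)} {v φ : Gd d → ℝ} {ρ r : ℝ}

theorem integral_diffXY_split (hsym : ν.map swapXY = ν) (hv : Measurable v) (hφ : Measurable φ)
    (hρ : ρ ≤ r) (hφ0 : ∀ z : Gd d, z ∉ Ioo (-1) 0 ×ˢ ball (0 : Ed d) ρ → φ z = 0)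
    (hN : IntegrableOn (fun p => diffXY v p * diffXY φ p) (nearA d r) ν)
    (hF : IntegrableOn (fun p => diffXY v p * φ (p.1, p.2.1)) (farA d ρ r) ν) :
    Integrable (fun p => diffXY v p * diffXY φ p) ν ∧
      ∫ p, diffXY v p * diffXY φ p ∂ν = (∫ p in nearA d r, diffXY v p * diffXY φ p ∂ν)
        + 2 * ∫ p in farA d ρ r, diffXY v p * φ (p.1, p.2.1) ∂ν := by
  set N := (nearA d r).indicator fun p => diffXY v p * diffXY φ p with hNd
  set F := (farA d ρ r).indicator fun p => diffXY v p * φ (p.1, p.2.1) with hFd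
  have hNi : Integrable N ν := hN.integrable_indicator (measurableSet_nearA r)
  have hFi : Integrable F ν := hF.integrable_indicator (measurableSet_farA ρ r)
  have hmF : Measurable F := by
    refine Measurable.indicator ?_ (measurableSet_farA ρ r)
    unfold diffXY; fun_prop
  have hFi' : Integrable (fun p => F (swapXY p)) ν := by
    have : Integrable F (ν.map swapXY) := by rw [hsym]; exact hFi
    exact this.comp_measurable measurable_swapXY
  have hFe : ∫ p, F (swapXY p) ∂ν = ∫ p, F p ∂ν := by
    conv_rhs => rw [← hsym]
    rw [integral_map measurable_swapXY.aemeasurable hmF.aestronglyMeasurable]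
  have key : (fun p => diffXY v p * diffXY φ p) = fun p => N p + (F p + F (swapXY p)) := by
    funext ⟨t, x, y⟩
    have h0 : ∀ x : Ed d, φ (t, x) ≠ 0 → t ∈ Ioo (-1 : ℝ) 0 ∧ x ∈ ball (0 : Ed d) ρ ∧
        x ∈ ball (0 : Ed d) r := by
      intro x hx
      by_contra hc
      refine hx (hφ0 _ fun h => hc ⟨h.1, h.2, ball_subset_ball hρ h.2⟩)
    simp only [mem_ball_zero_iff, mem_Ioo] at h0
    have hr' : ∀ x : Ed d, ‖x‖ < r → ¬ (r ≤ ‖x‖) := fun x h => not_le.2 h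
    have hr'' : ∀ x : Ed d, ¬ ‖x‖ < r → r ≤ ‖x‖ := fun x h => not_lt.1 h
    simp only [hNd, hFd, indicator, nearA, farA, mem_prod, mem_ofPred_eq, swapXY, diffXY,
      mem_ball_zero_iff, mem_Ioo, not_lt]
    by_cases hx : φ (t, x) = 0 <;> by_cases hy : φ (t, y) = 0
    · simp [hx, hy]
    · obtain ⟨h1, h2, h3⟩ := h0 y hy
      by_cases hxr : ‖x‖ < r
      · simp [h1, hxr, h2, h3, hx, hr' _ hxr]
      · simp [h1, hxr, h2, h3, hx, hr'' _ hxr]; ring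
    · obtain ⟨h1, h2, h3⟩ := h0 x hx
      by_cases hxr : ‖y‖ < r
      · simp [h1, hxr, h2, h3, hy, hr' _ hxr]
      · simp [h1, hxr, h2, h3, hy, hr'' _ hxr]
    · obtain ⟨h1, h2, h3⟩ := h0 x hx
      obtain ⟨h1', h2', h3'⟩ := h0 y hy
      simp [h1, h2, h3, h2', h3', hr' _ h3, hr' _ h3']
  refine ⟨by rw [key]; exact hNi.add (hFi.add hFi'), ?_⟩
  have e1 : ∫ p, diffXY v p * diffXY φ p ∂ν = ∫ p, N p + (F p + F (swapXY p)) ∂ν := by rw [← key]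
  have e2 : ∫ p, N p + (F p + F (swapXY p)) ∂ν = (∫ p, N p ∂ν) + ∫ p, F p + F (swapXY p) ∂ν :=
    integral_add hNi (hFi.add hFi')
  rw [e1, e2, integral_add hFi hFi', hFe, hNd, hFd,
    integral_indicator (measurableSet_nearA r), integral_indicator (measurableSet_farA ρ r)]
  ring

theorem lintegral_far_diffXY_sq_le (hν : ν ≤ ENNReal.ofReal Λ • nuS d s) (hs : 0 < s)
    (hρ : ρ < r) (hr : r ≤ 1) (hv : Measurable v) (hφ : Measurable φ)
    (hφ0 : ∀ z : Gd d, z.1 ∉ Ioo (-1 : ℝ) 0 → φ z = 0) :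
    (∫⁻ p in farA d ρ r, ‖diffXY v p * φ (p.1, p.2.1)‖ₑ ∂ν) ^ 2
      ≤ (ENNReal.ofReal Λ * ENNReal.ofReal (1 / (r - ρ) ^ ((d : ℝ) + 2 * s))) ^ 2 *
        (∫⁻ z in Ioo (-1 : ℝ) 0 ×ˢ ball (0 : Ed d) ρ, farW s v r z ^ 2) *
        eLpNorm φ 2 volume ^ 2 := by
  refine (pow_le_pow_left' (lintegral_far_diffXY_le hν hs hρ hr hv hφ) 2).trans ?_
  rw [← mul_assoc, mul_pow]
  refine (mul_le_mul_right (lintegral_mul_farW_sq_le hv hφ hφ0) _).trans (le_of_eq ?_)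
  ring

theorem integrableOn_far (hν : ν ≤ ENNReal.ofReal Λ • nuS d s) (hs : 0 < s)
    (hρ : ρ < r) (hr : r ≤ 1) (hv : Measurable v) (hφ : Measurable φ)
    (hφ0 : ∀ z : Gd d, z.1 ∉ Ioo (-1 : ℝ) 0 → φ z = 0)
    (hW : ∫⁻ z in Ioo (-1 : ℝ) 0 ×ˢ ball (0 : Ed d) ρ, farW s v r z ^ 2 < ⊤)
    (hφ2 : eLpNorm φ 2 volume < ⊤) :
    IntegrableOn (fun p => diffXY v p * φ (p.1, p.2.1)) (farA d ρ r) ν := by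
  refine ⟨Measurable.aestronglyMeasurable (by unfold diffXY; fun_prop), ?_⟩
  rw [hasFiniteIntegral_iff_enorm]
  have h1 := lintegral_far_diffXY_sq_le hν hs hρ hr hv hφ hφ0
  have h2 := h1.trans_lt (ENNReal.mul_lt_top (ENNReal.mul_lt_top (ENNReal.pow_lt_top
    (ENNReal.mul_lt_top ENNReal.ofReal_lt_top ENNReal.ofReal_lt_top)) hW) (ENNReal.pow_lt_top hφ2))
  by_contra hc
  rw [not_lt, top_le_iff] at hc
  rw [hc] at h2
  simp at h2

theorem tendsto_integral_far (hν : ν ≤ ENNReal.ofReal Λ • nuS d s) (hs : 0 < s)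
    (hρ : ρ < r) (hr : r ≤ 1) (hv : Measurable v) (hφ : Measurable φ)
    (hφ0 : ∀ z : Gd d, z.1 ∉ Ioo (-1 : ℝ) 0 → φ z = 0)
    (hW : ∫⁻ z in Ioo (-1 : ℝ) 0 ×ˢ ball (0 : Ed d) ρ, farW s v r z ^ 2 < ⊤)
    (hφ2 : eLpNorm φ 2 volume < ⊤) {φn : ℕ → Gd d → ℝ} (hφn : ∀ n, Measurable (φn n))
    (hφn0 : ∀ᶠ n in atTop, ∀ z : Gd d, z.1 ∉ Ioo (-1 : ℝ) 0 → φn n z = 0)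
    (hφn2 : ∀ n, eLpNorm (φn n) 2 volume < ⊤)
    (h : Tendsto (fun n => eLpNorm (φn n - φ) 2 volume) atTop (𝓝 0)) :
    Tendsto (fun n => ∫ p in farA d ρ r, diffXY v p * φn n (p.1, p.2.1) ∂ν) atTop
      (𝓝 (∫ p in farA d ρ r, diffXY v p * φ (p.1, p.2.1) ∂ν)) := by
  refine tendsto_integral_of_L1 _ (integrableOn_far hν hs hρ hr hv hφ hφ0 hW hφ2).1
    (hφn0.mono fun n hn => integrableOn_far hν hs hρ hr hv (hφn n) hn hW (hφn2 n)) ?_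
  set c := (ENNReal.ofReal Λ * ENNReal.ofReal (1 / (r - ρ) ^ ((d : ℝ) + 2 * s))) ^ 2 *
        (∫⁻ z in Ioo (-1 : ℝ) 0 ×ˢ ball (0 : Ed d) ρ, farW s v r z ^ 2) with hc
  have hct : c ≠ ⊤ := (ENNReal.mul_lt_top (ENNReal.pow_lt_top
    (ENNReal.mul_lt_top ENNReal.ofReal_lt_top ENNReal.ofReal_lt_top)) hW).ne
  have hlim : Tendsto (fun n => c * eLpNorm (φn n - φ) 2 volume ^ 2) atTop (𝓝 0) := by
    simpa using ENNReal.Tendsto.const_mul (ENNReal.Tendsto.pow (n := 2) h)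
      (Or.inr hct : _ ∨ c ≠ ⊤)
  have hsq : Tendsto (fun n => (∫⁻ p in farA d ρ r,
      ‖diffXY v p * φn n (p.1, p.2.1) - diffXY v p * φ (p.1, p.2.1)‖ₑ ∂ν) ^ 2) atTop (𝓝 0) := by
    refine tendsto_of_tendsto_of_tendsto_of_le_of_le' tendsto_const_nhds hlim
      (Eventually.of_forall fun _ => zero_le) (hφn0.mono fun n hn => ?_)
    have := lintegral_far_diffXY_sq_le hν hs hρ hr hv ((hφn n).sub hφ) (fun z hz => by
      rw [Pi.sub_apply, hn z hz, hφ0 z hz, sub_zero])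
    simpa only [Pi.sub_apply, mul_sub] using this
  have h3 := (ENNReal.continuous_rpow_const (y := (1 / 2 : ℝ))).tendsto 0 |>.comp hsq
  rw [ENNReal.zero_rpow_of_pos (by norm_num)] at h3
  refine h3.congr fun n => ?_
  simp only [Function.comp_apply]
  rw [← ENNReal.rpow_two, ← ENNReal.rpow_mul]
  norm_num

end NonlocalForm

section Extension

theorem exists_smooth_cutoff {V : Type*} [NormedAddCommGroup V] [NormedSpace ℝ V]
    [FiniteDimensional ℝ V] {K O : Set V} (hK : IsCompact K) (hO : IsOpen O) (hKO : K ⊆ O) :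
    ∃ ζ : V → ℝ, ContDiff ℝ (⊤ : ℕ∞) ζ ∧ HasCompactSupport ζ ∧ tsupport ζ ⊆ O ∧
      (∀ᶠ z in 𝓝ˢ K, ζ z = 1) ∧ ∀ z, ζ z ∈ Icc (0 : ℝ) 1 := by
  obtain ⟨L, hL, hKL, hLO⟩ := exists_compact_between hK hO hKO
  obtain ⟨f, h1, h2, h3⟩ := exists_contMDiffMap_one_nhds_of_subset_interior
    (I := modelWithCornersSelf ℝ V) (n := (⊤ : ℕ∞)) hK.isClosed hKL
  have hts : tsupport f ⊆ L := closure_minimal (fun z hz => by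
    by_contra hc; exact hz (h2 z hc)) hL.isClosed
  exact ⟨f, f.contMDiff.contDiff, HasCompactSupport.of_support_subset_isCompact hL
    ((subset_tsupport _).trans hts), hts.trans hLO, h1, h3⟩

variable {s Λ : ℝ} {ν : Measure (ℝ × Ed d × Ed d)} {v : Gd d → ℝ} {Dv a : Gd d → Ed d}

theorem MemLp.integrable_mul_of_eq_zero {w g : Gd d → ℝ} {O : Set (Gd d)}
    (hw : MemLp w 2 (volume.restrict O)) (hg : Continuous g) (hgc : HasCompactSupport g)
    (hg0 : ∀ z ∉ O, g z = 0) : Integrable fun z => w z * g z := by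
  have h1 : Integrable (fun z => w z * g z) (volume.restrict O) :=
    MemLp.integrable_mul (q := 2) hw ((hg.memLp_of_hasCompactSupport hgc).restrict O)
  rw [← integrableOn_univ]
  refine IntegrableOn.of_forall_sdiff_eq_zero (s := O) h1 MeasurableSet.univ fun z hz => ?_
  rw [hg0 z hz.2, mul_zero]

theorem fderiv_eq_zero_of_tsupport {φ : Gd d → ℝ} {O : Set (Gd d)} (h : tsupport φ ⊆ O) {z : Gd d}
    (hz : z ∉ O) : fderiv ℝ φ z = 0 := by
  by_contra hne
  exact hz (h (support_fderiv_subset ℝ hne))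

/-- A solution minus a function of time, extended from the unit cylinder to all of space-time. -/
theorem exists_extension_of_loc (hm : Measurable v)
    (hloc : ∃ O, IsOpen O ∧ volume O ≠ ⊤ ∧ Icc (-1) 0 ×ˢ closedBall 0 1 ⊆ O ∧
      MemLp v 2 (volume.restrict O) ∧ MemLp Dv 2 (volume.restrict O) ∧ HasWeakGx v Dv O)
    {g : ℝ → ℝ} (hg : Integrable g) :
    ∃ (f : Gd d → ℝ) (F : Gd d → Ed d), Measurable f ∧ MemLp f 2 volume ∧ MemLp F 2 volume ∧
      HasCompactSupport f ∧ HasWeakGx f F univ ∧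
      ∀ z ∈ Icc (-1) 0 ×ˢ closedBall (0 : Ed d) 1,
        f z = v z - (∫ τ in Iic z.1, g τ) ∧ F z = Dv z := by
  obtain ⟨O, hO, hOv, hKO, hv, hD, hw⟩ := hloc
  set G : Gd d → ℝ := fun z => ∫ τ in Iic z.1, g τ with hG
  have hGc : Continuous G := (continuous_primitive_Iic hg).comp continuous_fst
  have hG2 : MemLp G 2 (volume.restrict O) := by
    have : IsFiniteMeasure (volume.restrict O) := ⟨by simpa using hOv.lt_top⟩
    exact MemLp.of_bound hGc.aestronglyMeasurable (∫ τ, |g τ|)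
      (Eventually.of_forall fun z => abs_primitive_Iic_le hg z.1)
  have hu2 : MemLp (fun z => v z - G z) 2 (volume.restrict O) := hv.sub hG2
  have hwu : HasWeakGx (fun z => v z - G z) Dv O := by
    intro φ hφ hφc hφO e
    have hφ1 : ContDiff ℝ 1 φ := hφ.of_le (by exact_mod_cast le_top)
    have hcf : Continuous fun z => fderiv ℝ φ z (0, e) :=
      (hφ1.continuous_fderiv (by simp)).clm_apply continuous_const
    have hfc : HasCompactSupport fun z => fderiv ℝ φ z (0, e) := hφc.fderiv_apply ℝ _
    have h0 : ∀ z ∉ O, fderiv ℝ φ z (0, e) = 0 := fun z hz => by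
      rw [fderiv_eq_zero_of_tsupport hφO hz]; rfl
    have h1 := hw φ hφ hφc hφO e
    have h2 := hasWeakGx_primitive hg O φ hφ hφc hφO e
    simp only [Pi.zero_apply, inner_zero_left, mul_zero, integral_zero, neg_zero] at h2
    simp only [sub_mul]
    rw [integral_sub (MemLp.integrable_mul_of_eq_zero hv hcf hfc h0)
      (MemLp.integrable_mul_of_eq_zero hG2 hcf hfc h0), h1, h2, sub_zero]
  obtain ⟨ζ, hζ, hζc, hζO, hζ1, hζI⟩ := exists_smooth_cutoff
    (isCompact_Icc.prod (isCompact_closedBall (0 : Ed d) 1)) hO hKO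
  have hζd : ContDiff ℝ 1 ζ := hζ.of_le (by exact_mod_cast le_top)
  have hz : ∀ z ∉ O, ζ z = 0 := fun z hz => by
    by_contra hne; exact hz (hζO (subset_tsupport _ hne))
  have hgz : ∀ z ∉ O, gx ζ z = 0 := fun z hz => by simp [gx, fderiv_eq_zero_of_tsupport hζO hz]
  refine ⟨fun z => ζ z * (v z - G z), fun z => ζ z • Dv z + (v z - G z) • gx ζ z,
    hζ.continuous.measurable.mul (hm.sub hGc.measurable),
    memLp_mul_cutoff hO.measurableSet hu2 hζ.continuous hζc hz, ?_, hζc.mul_right,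
    hwu.mul_cutoff hu2 hD hζ hζc hζO, ?_⟩
  · refine (memLp_mul_cutoff hO.measurableSet hD hζ.continuous hζc hz).add ?_
    obtain ⟨C, hC0, hC⟩ := exists_norm_le_of_hasCompactSupport (continuous_gx hζd)
      (hasCompactSupport_gx hζc)
    have h1 : MemLp (fun z => (v z - G z) • gx ζ z) 2 (volume.restrict O) :=
      hu2.of_le_mul (c := C) (hu2.1.smul (continuous_gx hζd).aestronglyMeasurable)
        (Eventually.of_forall fun z => by
          rw [norm_smul, mul_comm]
          exact mul_le_mul_of_nonneg_right (hC z) (norm_nonneg _))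
    rw [← memLp_indicator_iff_restrict hO.measurableSet] at h1
    refine (memLp_congr_ae (Eventually.of_forall fun z => ?_)).1 h1
    by_cases hzO : z ∈ O
    · simp [hzO]
    · simp [hzO, hgz z hzO]
  · intro z hzK
    have h1 : ζ =ᶠ[𝓝 z] fun _ => 1 := by
      rw [eventually_nhdsSet_iff_forall] at hζ1
      exact hζ1 z hzK
    have h2 : gx ζ z = 0 := by
      simp [gx, h1.fderiv_eq]
    simp [h1.eq_of_nhds, h2, hG]

theorem USol.exists_extension (U : USol s Λ v Dv a ν) {g : ℝ → ℝ} (hg : Integrable g) :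
    ∃ (f : Gd d → ℝ) (F : Gd d → Ed d), Measurable f ∧ MemLp f 2 volume ∧ MemLp F 2 volume ∧
      HasCompactSupport f ∧ HasWeakGx f F univ ∧
      ∀ z ∈ Icc (-1) 0 ×ˢ closedBall (0 : Ed d) 1,
        f z = v z - (∫ τ in Iic z.1, g τ) ∧ F z = Dv z :=
  exists_extension_of_loc U.mv U.loc hg

end Extension

section Truncated

theorem eventually_tsupport_mollify_subset {V X : Type*} [NormedAddCommGroup V] [NormedSpace ℝ V]
    [FiniteDimensional ℝ V] [MeasurableSpace V] [BorelSpace V]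
    (μ : Measure V) [μ.IsAddHaarMeasure] [NormedAddCommGroup X] [NormedSpace ℝ X] [CompleteSpace X]
    {K O : Set V} (hK : IsCompact K)
    (hO : IsOpen O) (hKO : K ⊆ O) :
    ∀ᶠ n in atTop, ∀ ψ : V → X, Function.support ψ ⊆ K → tsupport (mollify μ n ψ) ⊆ O := by
  obtain ⟨ε, hε, hεO⟩ := hK.exists_cthickening_subset_open hO hKO
  filter_upwards [(mollifier_rOut_tendsto (V := V)).eventually_lt_const hε] with n hn ψ hψ
  refine (closure_mono (support_mollify_subset n)).trans ?_
  refine (closure_thickening_subset_cthickening _ _).trans (Subset.trans ?_ hεO)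
  exact (cthickening_mono hn.le _).trans (cthickening_subset_of_subset _ hψ)

variable {f : Gd d → ℝ} {Z : Gd d → ℝ} {h H h' : ℝ → ℝ}

theorem integral_mul_fderiv_mollify_comp (hf : LocallyIntegrable f) (hZ : ContDiff ℝ 1 Z)
    (hZc : HasCompactSupport Z) (hh : ContDiff ℝ 1 h) (hH : ∀ u, HasDerivAt H (h u) u) (n : ℕ) :
    ∫ z, f z * fderiv ℝ (mollify volume n fun y => Z y * h (mollify volume n f y)) z (1, 0)
      = ∫ z, fderiv ℝ Z z (1, 0) * H (mollify volume n f z) := by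
  set g := mollify volume n f with hg
  have hg1 : ContDiff ℝ 1 g := (contDiff_mollify hf n).of_le (by exact_mod_cast le_top)
  have hHC : ContDiff ℝ 1 H := contDiff_one_iff_deriv.2
    ⟨fun u => (hH u).differentiableAt, by
      rw [show deriv H = h from funext fun u => (hH u).deriv]; exact hh.continuous⟩
  have hψ : ContDiff ℝ 1 fun y => Z y * h (g y) := hZ.mul (hh.comp hg1)
  have hψc : HasCompactSupport fun y => Z y * h (g y) := hZc.mul_right
  have hcd : Continuous fun z => fderiv ℝ (fun y => Z y * h (g y)) z (1, 0) :=
    (hψ.continuous_fderiv (by simp)).clm_apply continuous_const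
  rw [show (fun z => f z * fderiv ℝ (mollify volume n fun y => Z y * h (g y)) z (1, 0))
    = fun z => f z * mollify volume n (fun y => fderiv ℝ (fun y => Z y * h (g y)) y (1, 0)) z from
      funext fun z => by rw [fderiv_mollify_of_contDiff hψ hψc],
    integral_mul_mollify_comm hf hcd (hψc.fderiv_apply ℝ _), ← hg]
  have h1 := weak_of_contDiff (μ := volume) hψ hψc (1, 0) hg1
  have h2 := weak_of_contDiff (μ := volume) hZ hZc (1, 0) (hHC.comp hg1)
  have h3 : ∀ z, fderiv ℝ (H ∘ g) z (1, 0) = h (g z) * fderiv ℝ g z (1, 0) := fun z => by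
    have := (hH (g z)).comp_hasFDerivAt z (hg1.differentiable (by simp) z).hasFDerivAt
    rw [this.fderiv]; simp
  rw [show (fun z => Z z * fderiv ℝ (H ∘ g) z (1, 0))
    = fun z => Z z * h (g z) * fderiv ℝ g z (1, 0) from funext fun z => by rw [h3]; ring] at h2
  rw [h2] at h1
  rw [← neg_inj, ← h1, neg_inj]
  exact integral_congr_ae (Eventually.of_forall fun z => mul_comm _ _)

theorem abs_sub_le_of_hasDerivAt_of_abs_le (hH : ∀ u, HasDerivAt H (h u) u)
    (hu : ∀ u, |h u| ≤ |u|) (a b : ℝ) : |H a - H b| ≤ |a - b| * (|a| + |b|) := by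
  have := (convex_uIcc b a).norm_image_sub_le_of_norm_hasDerivWithin_le (f := H) (f' := h)
    (C := |a| + |b|) (fun x _ => (hH x).hasDerivWithinAt) (fun x hx => ?_)
    left_mem_uIcc right_mem_uIcc
  · simpa [mul_comm] using this
  · refine (hu x).trans ?_
    rcases mem_uIcc.1 hx with h1 | h1
    · rcases abs_cases x with h2 | h2 <;> rcases abs_cases a with h3 | h3 <;>
        rcases abs_cases b with h4 | h4 <;> linarith
    · rcases abs_cases x with h2 | h2 <;> rcases abs_cases a with h3 | h3 <;>
        rcases abs_cases b with h4 | h4 <;> linarith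

theorem tendsto_integral_mul_quadratic {α : Type*} [MeasurableSpace α] {μ : Measure α}
    {f : α → ℝ} {fn : ℕ → α → ℝ} {w : α → ℝ} {C : ℝ}
    (hH : ∀ u, HasDerivAt H (h u) u) (hu : ∀ u, |h u| ≤ |u|) (hH0 : H 0 = 0)
    (hw : AEStronglyMeasurable w μ) (hwC : ∀ z, |w z| ≤ C)
    (hf : MemLp f 2 μ) (hfn : ∀ n, MemLp (fn n) 2 μ)
    (h1 : Tendsto (fun n => eLpNorm (fn n - f) 2 μ) atTop (𝓝 0)) :
    Tendsto (fun n => ∫ z, w z * H (fn n z) ∂μ) atTop (𝓝 (∫ z, w z * H (f z) ∂μ)) := by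
  have hHc : Continuous H := continuous_iff_continuousAt.2 fun u => (hH u).continuousAt
  have hint : ∀ g : α → ℝ, MemLp g 2 μ → Integrable (fun z => w z * H (g z)) μ := fun g hg => by
    refine Integrable.mono' ((hg.integrable_sq.const_mul C)) 
      (hw.mul (hHc.comp_aestronglyMeasurable hg.1)) (Eventually.of_forall fun z => ?_)
    have := abs_sub_le_of_hasDerivAt_of_abs_le hH hu (g z) 0
    rw [hH0, sub_zero, sub_zero, abs_zero, add_zero, abs_mul_abs_self] at this
    rw [norm_mul, Real.norm_eq_abs, Real.norm_eq_abs, pow_two]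
    exact mul_le_mul (hwC z) this (abs_nonneg _) ((abs_nonneg _).trans (hwC z))
  have hdiff : ∀ n, MemLp (fn n - f) 2 μ := fun n => (hfn n).sub hf
  have key := tendsto_integral_mul (ν := μ) (l := atTop) (f := fun _ => (0 : ℝ))
    (g := fun z => |f z| + |f z|) (fn := fun n z => |fn n z - f z|)
    (gn := fun n z => |fn n z| + |f z|) (by simp) (hf.abs.add hf.abs)
    (fun n => (hdiff n).abs) (fun n => (hfn n).abs.add hf.abs) ?_ ?_
  · rw [tendsto_iff_norm_sub_tendsto_zero]
    simp only [zero_mul, integral_zero] at key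
    have key2 := key.const_mul C
    rw [mul_zero] at key2
    refine squeeze_zero (fun n => norm_nonneg _) (fun n => ?_) key2
    rw [← integral_sub (hint _ (hfn n)) (hint _ hf), ← integral_const_mul]
    refine norm_integral_le_of_norm_le ?_ (Eventually.of_forall fun z => ?_)
    · exact (MemLp.integrable_mul (q := 2) (hdiff n).abs ((hfn n).abs.add hf.abs)).const_mul C
    · rw [← mul_sub, norm_mul, Real.norm_eq_abs, Real.norm_eq_abs]
      exact mul_le_mul (hwC z) (abs_sub_le_of_hasDerivAt_of_abs_le hH hu _ _) (abs_nonneg _)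
        ((abs_nonneg _).trans (hwC z))
  · refine tendsto_eLpNorm_of_norm_le (c := 1) (fun n z => ?_) h1
    simp
  · refine tendsto_eLpNorm_of_norm_le (c := 1) (fun n z => ?_) h1
    simp only [Pi.sub_apply, Real.norm_eq_abs, one_mul, add_sub_add_right_eq_sub]
    exact abs_abs_sub_abs_le_abs_sub _ _

end Truncated

section WeakTruncated

variable {s Λ : ℝ} {ν : Measure (ℝ × Ed d × Ed d)} {v : Gd d → ℝ} {Dv a : Gd d → Ed d}

theorem USol.memLp_v (U : USol s Λ v Dv a ν) :
    MemLp v 2 (volume.restrict (Ioo (-1) 0 ×ˢ ball (0 : Ed d) 1)) := by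
  obtain ⟨O, -, -, hKO, hv, -, -⟩ := U.loc
  exact hv.mono_measure (Measure.restrict_mono
    ((Set.prod_mono Ioo_subset_Icc_self ball_subset_closedBall).trans hKO) le_rfl)

theorem USol.memLp_Dv (U : USol s Λ v Dv a ν) :
    MemLp Dv 2 (volume.restrict (Ioo (-1) 0 ×ˢ ball (0 : Ed d) 1)) := by
  obtain ⟨O, -, -, hKO, -, hv, -⟩ := U.loc
  exact hv.mono_measure (Measure.restrict_mono
    ((Set.prod_mono Ioo_subset_Icc_self ball_subset_closedBall).trans hKO) le_rfl)

theorem USol.memLp_a (U : USol s Λ v Dv a ν) :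
    MemLp a 2 (volume.restrict (Ioo (-1) 0 ×ˢ ball (0 : Ed d) 1)) :=
  U.memLp_Dv.of_le_mul U.ma.aestronglyMeasurable (Eventually.of_forall U.grow)

theorem memLp_fst_restrict {g : ℝ → ℝ} (hg : MemLp g 2 volume) (ρ : ℝ) :
    MemLp (fun z : Gd d => g z.1) 2 (volume.restrict (univ ×ˢ ball (0 : Ed d) ρ)) := by
  rw [Measure.volume_eq_prod, ← Measure.prod_restrict, Measure.restrict_univ]
  have : IsFiniteMeasure ((volume : Measure (Ed d)).restrict (ball 0 ρ)) :=
    ⟨by simpa using measure_ball_lt_top⟩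
  exact hg.comp_fst _

theorem tendsto_eLpNorm_of_measure_le {α X : Type*} [MeasurableSpace α] [NormedAddCommGroup X]
    {μ ν : Measure α} {c : ℝ≥0∞} (hc : c ≠ ⊤) (h : ν ≤ c • μ) {f : ℕ → α → X}
    (hf : Tendsto (fun n => eLpNorm (f n) 2 μ) atTop (𝓝 0)) :
    Tendsto (fun n => eLpNorm (f n) 2 ν) atTop (𝓝 0) := by
  refine tendsto_of_tendsto_of_tendsto_of_le_of_le tendsto_const_nhds ?_ (fun _ => zero_le)
    (fun n => eLpNorm_le_of_measure_le_smul h)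
  have := ENNReal.Tendsto.const_mul hf (a := c ^ (1 / (2 : ℝ≥0∞).toReal))
    (Or.inr (by simp [hc]) : _ ∨ c ^ (1 / (2 : ℝ≥0∞).toReal) ≠ ⊤)
  simpa using this

variable {h H h' : ℝ → ℝ}

theorem chainGrad_eq_zero {Z : Gd d → ℝ} {f : Gd d → ℝ} {F : Gd d → Ed d} {z : Gd d}
    (hz : z ∉ tsupport Z) : chainGrad Z h h' f F z = 0 := by
  have h1 : fderiv ℝ Z z = 0 := fderiv_eq_zero_of_tsupport subset_rfl hz
  simp [chainGrad, gx, h1, image_eq_zero_of_notMem_tsupport hz]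

/-- The weak formulation tested with `Z * h(u)`, where `u` differs from the solution by a
primitive of `g`. -/
theorem USol.weak_truncated (U : USol s Λ v Dv a ν) (hd : 1 ≤ d) (hs : s ∈ Ioo (0 : ℝ) 1)
    {g : ℝ → ℝ} (hg : Integrable g) (hg2 : MemLp g 2 volume) {u : Gd d → ℝ}
    (hu : ∀ z, u z = v z - ∫ τ in Iic z.1, g τ)
    (hh : ∀ u, HasDerivAt h (h' u) u) (hhC : ContDiff ℝ 1 h) (hb : ∀ u, |h' u| ≤ 1)
    (hc : Continuous h') (hH : ∀ u, HasDerivAt H (h u) u) (hhu : ∀ u, |h u| ≤ |u|) (hH0 : H 0 = 0)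
    {Z : Gd d → ℝ} (hZ : ContDiff ℝ 1 Z) (hZc : HasCompactSupport Z) {ρ r : ℝ} (hr0 : 0 < r)
    (hρr : ρ < r) (hr : r ≤ 1) (hZt : tsupport Z ⊆ Ioo (-1) 0 ×ˢ ball 0 ρ) :
    SobW (fun z => Z z * h (u z)) (chainGrad Z h h' u Dv) ∧
    -(∫ z, fderiv ℝ Z z (1, 0) * H (u z)) + (∫ z, ⟪a z, chainGrad Z h h' u Dv z⟫)
      + (∫ p in nearA d r, diffXY u p * diffXY (fun z => Z z * h (u z)) p ∂ν)
      + 2 * (∫ p in farA d ρ r, diffXY v p * (Z (p.1, p.2.1) * h (u (p.1, p.2.1))) ∂ν)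
      + ∫ z, g z.1 * (Z z * h (u z)) = 0 := by
  obtain ⟨f, F, hfm, hf2, hF2, hfc, hfw, hfK⟩ := U.exists_extension hg
  have hfl := locallyIntegrable_of_memLp_two hf2
  have hFl := locallyIntegrable_of_memLp_two hF2
  set B : Set (Gd d) := Ioo (-1) 0 ×ˢ ball 0 1 with hB
  set S : Set (Gd d) := Ioo (-1) 0 ×ˢ ball 0 ρ with hS
  have hSo : IsOpen S := isOpen_Ioo.prod isOpen_ball
  have hSB : S ⊆ B := Set.prod_mono subset_rfl (ball_subset_ball (hρr.le.trans hr))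
  have hBK : B ⊆ Icc (-1) 0 ×ˢ closedBall (0 : Ed d) 1 :=
    Set.prod_mono Ioo_subset_Icc_self ball_subset_closedBall
  have hfB : ∀ z ∈ B, f z = u z ∧ F z = Dv z := fun z hz => by
    rw [hu]; exact hfK z (hBK hz)
  have hZ0 : ∀ z ∉ S, Z z = 0 := fun z hz => by
    by_contra hne; exact hz (hZt (subset_tsupport _ hne))
  have hfS : SobW f F := sobW_of_weak hfm hf2 hF2 hfc hfw
  set fn : ℕ → Gd d → ℝ := fun n => mollify volume n f with hfn
  have hfn1 : ∀ n, ContDiff ℝ 1 (fn n) := fun n =>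
    (contDiff_mollify hfl n).of_le (by exact_mod_cast le_top)
  have hfn2 : Tendsto (fun n => eLpNorm (fn n - f) 2 volume) atTop (𝓝 0) :=
    tendsto_eLpNorm_mollify_sub hf2
  have hgfn : ∀ n, gx (fn n) = mollify volume n F := fun n =>
    funext fun z => gx_mollify_of_weak hfl hFl hfw n z
  have hfnD : Tendsto (fun n => eLpNorm (gx (fn n) - F) 2 volume) atTop (𝓝 0) := by
    simp only [hgfn]
    exact tendsto_eLpNorm_mollify_sub hF2
  have hae : ∀ᵐ z, Tendsto (fun n => fn n z) atTop (𝓝 (f z)) := ae_tendsto_mollify hfl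
  -- the limiting test function
  set ψ : Gd d → ℝ := fun z => Z z * h (f z) with hψ
  have hψS : SobW ψ (chainGrad Z h h' f F) :=
    SobW.mul_comp hZ hZc hh hb hc hfm hF2 hfn1 hfn2 hfnD hae
  have hψu : (fun z => Z z * h (u z)) = ψ := funext fun z => by
    by_cases hz : z ∈ S
    · simp only [hψ, (hfB z (hSB hz)).1]
    · simp only [hψ, hZ0 z hz, zero_mul]
  have hcg : chainGrad Z h h' u Dv = chainGrad Z h h' f F := funext fun z => by
    by_cases hz : z ∈ S
    · simp only [chainGrad, (hfB z (hSB hz)).1, (hfB z (hSB hz)).2]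
    · rw [chainGrad_eq_zero fun h => hz (hZt h), chainGrad_eq_zero fun h => hz (hZt h)]
  -- smooth test functions
  set ψn : ℕ → Gd d → ℝ := fun n z => Z z * h (fn n z) with hψn
  have hψn1 : ∀ n, ContDiff ℝ 1 (ψn n) := fun n => hZ.mul (hhC.comp (hfn1 n))
  have hψnc : ∀ n, HasCompactSupport (ψn n) := fun n => hZc.mul_right
  have hψnL := fun n => memLp_of_contDiff (hψn1 n) (hψnc n)
  have hψnt := tendsto_mul_comp hZ.continuous hZc hh hb hfn2
  have hψnD := tendsto_gx_mul_comp hZ hZc hh hb hc hfm hF2 hfn1 hfn2 hfnD hae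
  set φ : ℕ → Gd d → ℝ := fun n => mollify volume n (ψn n) with hφ
  have hφs : ∀ n, ContDiff ℝ (⊤ : ℕ∞) (φ n) := fun n =>
    contDiff_mollify (locallyIntegrable_of_memLp_two (hψnL n).1) n
  have hφ1 : ∀ n, ContDiff ℝ 1 (φ n) := fun n => (hφs n).of_le (by exact_mod_cast le_top)
  have hφc : ∀ n, HasCompactSupport (φ n) := fun n => hasCompactSupport_mollify (hψnc n) n
  have hφL := fun n => memLp_of_contDiff (hφ1 n) (hφc n)
  have hφt : Tendsto (fun n => eLpNorm (φ n - ψ) 2 volume) atTop (𝓝 0) :=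
    tendsto_eLpNorm_mollify_seq hψS.memf (fun n => (hψnL n).1) hψnt
  have hφD : Tendsto (fun n => eLpNorm (gx (φ n) - chainGrad Z h h' f F) 2 volume) atTop (𝓝 0) := by
    have : ∀ n, gx (φ n) = mollify volume n (gx (ψn n)) := fun n =>
      funext fun z => gx_mollify_of_contDiff (hψn1 n) (hψnc n) n z
    simp only [this]
    exact tendsto_eLpNorm_mollify_seq hψS.memF (fun n => (hψnL n).2) hψnD
  have hsupp : ∀ᶠ n in atTop, tsupport (φ n) ⊆ S := by
    filter_upwards [eventually_tsupport_mollify_subset (X := ℝ) (volume : Measure (Gd d))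
      hZc.isCompact hSo hZt] with n hn
    refine hn _ fun z hz => subset_tsupport _ fun h0 => hz ?_
    simp only [hψn, h0, zero_mul]
  refine ⟨by rw [hψu, hcg]; exact hψS, ?_⟩
  have e1 : ∀ z, Z z * h (u z) = ψ z := congrFun hψu
  simp only [e1, hcg]
  have hchain0 : ∀ z ∉ S, chainGrad Z h h' f F z = 0 := fun z hz =>
    chainGrad_eq_zero fun h => hz (hZt h)
  have hψ0 : ∀ z ∉ S, ψ z = 0 := fun z hz => by simp only [hψ, hZ0 z hz, zero_mul]
  have hSm : MeasurableSet S := hSo.measurableSet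
  -- time derivative
  have htime : ∀ᶠ n in atTop, -(∫ z, v z * fderiv ℝ (φ n) z (1, 0))
      = -(∫ z, fderiv ℝ Z z (1, 0) * H (fn n z)) + ∫ z, g z.1 * φ n z := by
    filter_upwards [hsupp] with n hn
    have e0 : (fun z => v z * fderiv ℝ (φ n) z (1, 0)) = fun z => f z * fderiv ℝ (φ n) z (1, 0)
        + (∫ τ in Iic z.1, g τ) * fderiv ℝ (φ n) z (1, 0) := funext fun z => by
      by_cases hz : z ∈ S
      · rw [(hfB z (hSB hz)).1, hu]; ring
      · rw [fderiv_eq_zero_of_tsupport hn hz]; simp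
    have hcd : Continuous fun z => fderiv ℝ (φ n) z (1, 0) :=
      ((hφ1 n).continuous_fderiv (by simp)).clm_apply continuous_const
    have hcc : HasCompactSupport fun z => fderiv ℝ (φ n) z (1, 0) := (hφc n).fderiv_apply ℝ _
    have i1 : Integrable fun z => f z * fderiv ℝ (φ n) z (1, 0) :=
      MemLp.integrable_mul (q := 2) hf2 (hcd.memLp_of_hasCompactSupport hcc)
    rw [e0, integral_add i1 (integrable_primitive_mul hg hcd hcc),
      integral_primitive_mul_fderiv hg (hφ1 n) (hφc n),
      integral_mul_fderiv_mollify_comp hfl hZ hZc hhC hH n]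
    ring
  have hL1 : Tendsto (fun n => ∫ z, fderiv ℝ Z z (1, 0) * H (fn n z)) atTop
      (𝓝 (∫ z, fderiv ℝ Z z (1, 0) * H (u z))) := by
    have hcd : Continuous fun z => fderiv ℝ Z z (1, 0) :=
      (hZ.continuous_fderiv (by simp)).clm_apply continuous_const
    obtain ⟨C, -, hC⟩ := exists_norm_le_of_hasCompactSupport hcd (hZc.fderiv_apply ℝ _)
    have e0 : (fun z => fderiv ℝ Z z (1, 0) * H (u z)) = fun z => fderiv ℝ Z z (1, 0) * H (f z) :=
      funext fun z => by
        by_cases hz : z ∈ S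
        · rw [(hfB z (hSB hz)).1]
        · rw [fderiv_eq_zero_of_tsupport hZt hz]; simp
    rw [e0]
    exact tendsto_integral_mul_quadratic hH hhu hH0 hcd.aestronglyMeasurable hC hf2
      (fun n => memLp_mollify hf2 n) hfn2
  have hL2 : Tendsto (fun n => ∫ z, g z.1 * φ n z) atTop (𝓝 (∫ z, g z.1 * ψ z)) := by
    set S1 : Set (Gd d) := univ ×ˢ ball 0 ρ
    have hSS : S ⊆ S1 := Set.prod_mono (subset_univ _) subset_rfl
    have hm := memLp_fst_restrict (d := d) hg2 ρ
    have key := tendsto_integral_mul (ν := volume.restrict S1) (l := atTop) hm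
      (hψS.memf.restrict S1) (fun _ => hm) (fun n => (hφL n).1.restrict S1)
      (by simp) (tendsto_of_tendsto_of_tendsto_of_le_of_le tendsto_const_nhds hφt
        (fun _ => zero_le) fun n => eLpNorm_restrict_le _ _ _ _)
    have e : ∀ w : Gd d → ℝ, (∀ z ∉ S, w z = 0) →
        ∫ z in S1, g z.1 * w z = ∫ z, g z.1 * w z := fun w hw =>
      setIntegral_eq_integral_of_forall_compl_eq_zero fun z hz => by
        rw [hw z fun h => hz (hSS h), mul_zero]
    rw [e _ hψ0] at key
    refine key.congr' ?_
    filter_upwards [hsupp] with n hn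
    refine e _ fun z hz => image_eq_zero_of_notMem_tsupport fun h => hz (hn h)
  have hL3 : Tendsto (fun n => ∫ z, ⟪a z, gx (φ n) z⟫) atTop
      (𝓝 (∫ z, ⟪a z, chainGrad Z h h' f F z⟫)) := by
    have hm := U.memLp_a
    have key := tendsto_integral_inner (ν := volume.restrict B) (l := atTop) hm
      (hψS.memF.restrict B) (fun _ => hm) (fun n => (hφL n).2.restrict B)
      (by simp) (tendsto_of_tendsto_of_tendsto_of_le_of_le tendsto_const_nhds hφD
        (fun _ => zero_le) fun n => eLpNorm_restrict_le _ _ _ _)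
    have e : ∀ w : Gd d → Ed d, (∀ z ∉ S, w z = 0) →
        ∫ z in B, ⟪a z, w z⟫ = ∫ z, ⟪a z, w z⟫ := fun w hw =>
      setIntegral_eq_integral_of_forall_compl_eq_zero fun z hz => by
        rw [hw z fun h => hz (hSB h), inner_zero_right]
    rw [e _ hchain0] at key
    refine key.congr' ?_
    filter_upwards [hsupp] with n hn
    exact e _ fun z hz => by simp [gx, fderiv_eq_zero_of_tsupport hn hz]
  -- nonlocal terms
  have hνle : ν.restrict (nearA d r) ≤ ENNReal.ofReal Λ • nuS d s :=
    Measure.restrict_le_self.trans U.le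
  have hdf : ∀ p ∈ nearA d r, diffXY v p = diffXY f p ∧ diffXY u p = diffXY f p := fun p hp => by
    have h1 : (p.1, p.2.1) ∈ B := ⟨hp.1, ball_subset_ball hr hp.2.1⟩
    have h2 : (p.1, p.2.2) ∈ B := ⟨hp.1, ball_subset_ball hr hp.2.2⟩
    unfold diffXY
    rw [(hfB _ h1).1, (hfB _ h2).1, hu, hu]
    exact ⟨by ring, rfl⟩
  have hfd := (hfS.memLp_diffXY hd hs).of_measure_le_smul ENNReal.ofReal_ne_top hνle
  have hφd : ∀ n, MemLp (diffXY (φ n)) 2 (ν.restrict (nearA d r)) := fun n =>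
    ((⟨(hφ1 n).continuous.measurable, (hφL n).1, (hφL n).2, fun _ => φ n, fun _ => hφ1 n,
      fun _ => hφc n, by simp, by simp⟩ : SobW (φ n) (gx (φ n))).memLp_diffXY hd hs).of_measure_le_smul
      ENNReal.ofReal_ne_top hνle
  have hL4 : Tendsto (fun n => ∫ p in nearA d r, diffXY v p * diffXY (φ n) p ∂ν) atTop
      (𝓝 (∫ p in nearA d r, diffXY u p * diffXY ψ p ∂ν)) := by
    have key := tendsto_integral_mul (l := atTop) hfd
      ((hψS.memLp_diffXY hd hs).of_measure_le_smul ENNReal.ofReal_ne_top hνle) (fun _ => hfd) hφd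
      (by simp) (tendsto_eLpNorm_of_measure_le ENNReal.ofReal_ne_top hνle
        (hψS.tendsto_diffXY hd hs hφ1 hφc hφt hφD))
    rw [setIntegral_congr_fun (g := fun p => diffXY f p * diffXY ψ p) (measurableSet_nearA r)
      fun p hp => by simp only [(hdf p hp).2]]
    refine key.congr fun n => ?_
    exact setIntegral_congr_fun (measurableSet_nearA r) fun p hp => by simp only [(hdf p hp).1]
  have hW := lintegral_farW_sq_lt_top hs.1 U.mv hr0
    (U.memLp_v.mono_measure (Measure.restrict_mono hSB le_rfl)) (U.tail r hr0)
  have hψt0 : ∀ z : Gd d, z.1 ∉ Ioo (-1 : ℝ) 0 → ψ z = 0 := fun z hz => hψ0 z fun h => hz h.1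
  have hφS : ∀ᶠ n in atTop, ∀ z ∉ S, φ n z = 0 := by
    filter_upwards [hsupp] with n hn z hz
    exact image_eq_zero_of_notMem_tsupport fun h => hz (hn h)
  have hL5 := tendsto_integral_far U.le hs.1 hρr hr U.mv hψS.meas hψt0 hW hψS.memf.2
    (fun n => (hφ1 n).continuous.measurable)
    (hφS.mono fun n hn z hz => hn z fun h => hz h.1) (fun n => (hφL n).1.2) hφt
  have heq : ∀ᶠ n in atTop, -(∫ z, fderiv ℝ Z z (1, 0) * H (fn n z))
      + (∫ z, ⟪a z, gx (φ n) z⟫) + (∫ p in nearA d r, diffXY v p * diffXY (φ n) p ∂ν)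
      + 2 * (∫ p in farA d ρ r, diffXY v p * φ n (p.1, p.2.1) ∂ν) + ∫ z, g z.1 * φ n z = 0 := by
    filter_upwards [hsupp, htime, hφS] with n h1 h2 h3
    have h4 := U.weak (φ n) (hφs n) (hφc n)
      (h1.trans hSB)
    have hN : IntegrableOn (fun p => diffXY v p * diffXY (φ n) p) (nearA d r) ν := by
      refine IntegrableOn.congr_fun (f := fun p => diffXY f p * diffXY (φ n) p)
        (MemLp.integrable_mul (q := 2) hfd (hφd n)) (fun p hp => ?_) (measurableSet_nearA r)
      simp only [(hdf p hp).1]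
    have hF := integrableOn_far U.le hs.1 hρr hr U.mv (hφ1 n).continuous.measurable
      (fun z hz => h3 z fun h => hz h.1) hW (hφL n).1.2
    rw [(integral_diffXY_split U.symm U.mv (hφ1 n).continuous.measurable hρr.le h3 hN hF).2, h2] at h4
    linarith
  refine tendsto_nhds_unique ?_ (tendsto_const_nhds.congr' (heq.mono fun n hn => hn.symm))
  exact (((hL1.neg.add hL3).add hL4).add (hL5.const_mul 2)).add hL2

end WeakTruncated

section Cutoff

/-- A `C¹` step function, equal to `0` on `(-∞, 0]` and to `1` on `[2, ∞)`. -/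
def stepC (w : ℝ) : ℝ := rampT 1 w - rampT 1 (w - 1)

/-- The derivative of `stepC`. -/
def stepD (w : ℝ) : ℝ := heav 1 w - heav 1 (w - 1)

theorem hasDerivAt_stepC (w : ℝ) : HasDerivAt stepC (stepD w) w :=
  (hasDerivAt_rampT one_pos w).sub ((hasDerivAt_rampT one_pos (w - 1)).comp_sub_const w 1)

theorem contDiff_stepC : ContDiff ℝ 1 stepC :=
  (contDiff_rampT one_pos).sub ((contDiff_rampT one_pos).comp (contDiff_id.sub contDiff_const))

theorem stepC_of_nonpos {w : ℝ} (hw : w ≤ 0) : stepC w = 0 := by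
  simp [stepC, trunc_of_nonpos one_pos hw, trunc_of_nonpos one_pos (show w - 1 ≤ 0 by linarith)]

theorem stepC_of_two_le {w : ℝ} (hw : 2 ≤ w) : stepC w = 1 := by
  simp [stepC, trunc_of_ge one_pos (show 1 ≤ w by linarith),
    trunc_of_ge one_pos (show 1 ≤ w - 1 by linarith)]

theorem monotone_heav {δ : ℝ} (hδ : 0 < δ) : Monotone (heav δ) := by
  intro a b hab
  unfold heav
  refine div_le_div_of_nonneg_right ?_ hδ.le
  rcases max_cases a 0 with h1 | h1 <;> rcases max_cases b 0 with h2 | h2 <;>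
    rcases max_cases (a - δ) 0 with h3 | h3 <;> rcases max_cases (b - δ) 0 with h4 | h4 <;> linarith

theorem stepD_nonneg (w : ℝ) : 0 ≤ stepD w :=
  sub_nonneg.2 (monotone_heav one_pos (by linarith))

theorem stepD_le_one (w : ℝ) : stepD w ≤ 1 := by
  have := heav_le_one one_pos w
  have := heav_nonneg one_pos (w - 1)
  unfold stepD; linarith

theorem monotone_stepC : Monotone stepC :=
  monotone_of_deriv_nonneg (contDiff_stepC.differentiable (by simp)) fun w => by
    rw [(hasDerivAt_stepC w).deriv]; exact stepD_nonneg w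

theorem stepC_nonneg (w : ℝ) : 0 ≤ stepC w := by
  rw [← stepC_of_nonpos (min_le_right w 0)]
  exact monotone_stepC (min_le_left _ _)

theorem stepC_le_one (w : ℝ) : stepC w ≤ 1 := by
  rw [← stepC_of_two_le (le_max_right w 2)]
  exact monotone_stepC (le_max_left _ _)

/-- A `C¹` radial cutoff between concentric balls with a quantitative Lipschitz bound. -/
theorem exists_radial_cutoff {r₁ r₂ : ℝ} (h1 : 0 ≤ r₁) (h12 : r₁ < r₂) :
    ∃ η : Ed d → ℝ, ContDiff ℝ 1 η ∧ tsupport η ⊆ closedBall 0 r₂ ∧ (∀ x, η x ∈ Icc (0 : ℝ) 1) ∧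
      (∀ x ∈ ball (0 : Ed d) r₁, η x = 1) ∧ (∀ x, ‖fderiv ℝ η x‖ ≤ 4 / (r₂ - r₁)) := by
  have hr2 : 0 < r₂ := h1.trans_lt h12
  have hD : 0 < r₂ ^ 2 - r₁ ^ 2 := by nlinarith
  set c := 2 / (r₂ ^ 2 - r₁ ^ 2) with hc
  have hc0 : 0 < c := by positivity
  have hC : ContDiff ℝ 1 fun x : Ed d => c * (r₂ ^ 2 - ‖x‖ ^ 2) :=
    contDiff_const.mul (contDiff_const.sub (contDiff_norm_sq ℝ))
  have hz : ∀ x : Ed d, r₂ ≤ ‖x‖ → stepC (c * (r₂ ^ 2 - ‖x‖ ^ 2)) = 0 := fun x hx =>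
    stepC_of_nonpos (mul_nonpos_of_nonneg_of_nonpos hc0.le (by nlinarith))
  refine ⟨fun x => stepC (c * (r₂ ^ 2 - ‖x‖ ^ 2)), contDiff_stepC.comp hC, ?_,
    fun x => ⟨stepC_nonneg _, stepC_le_one _⟩, fun x hx => stepC_of_two_le ?_, fun x => ?_⟩
  · refine closure_minimal (fun x hx => ?_) isClosed_closedBall
    by_contra hne
    exact hx (hz x (by simpa using (not_le.1 fun h => hne (by simpa using h)).le))
  · have hx1 : ‖x‖ < r₁ := by simpa using hx
    rw [hc, div_mul_eq_mul_div, le_div_iff₀ hD]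
    have := pow_le_pow_left₀ (norm_nonneg x) hx1.le 2
    nlinarith
  · have hd := (hasDerivAt_stepC (c * (r₂ ^ 2 - ‖x‖ ^ 2))).comp_hasFDerivAt x
      (((hasStrictFDerivAt_norm_sq x).hasFDerivAt.const_sub (r₂ ^ 2)).const_mul c)
    have hd' : fderiv ℝ (fun x : Ed d => stepC (c * (r₂ ^ 2 - ‖x‖ ^ 2))) x = _ := hd.fderiv
    by_cases hx : r₂ < ‖x‖
    · have : (fun x : Ed d => stepC (c * (r₂ ^ 2 - ‖x‖ ^ 2))) =ᶠ[𝓝 x] fun _ => 0 :=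
        ((isOpen_lt continuous_const continuous_norm).eventually_mem hx).mono
          fun y hy => hz y (le_of_lt hy)
      rw [this.fderiv_eq]
      simp only [fderiv_fun_const, Pi.zero_apply, norm_zero]
      exact div_nonneg (by norm_num) (by linarith)
    · rw [hd', norm_smul, norm_smul, norm_neg, Real.norm_of_nonneg (stepD_nonneg _),
        Real.norm_of_nonneg hc0.le]
      have h3 : ‖(2 : ℕ) • (innerSL ℝ) x‖ ≤ 2 * r₂ := by
        have e : ‖(innerSL ℝ) x‖ = ‖x‖ := innerSL_apply_norm ℝ x
        rw [two_nsmul]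
        refine (norm_add_le _ _).trans ?_
        rw [e]; linarith [not_lt.1 hx]
      calc _ ≤ 1 * (c * (2 * r₂)) :=
            mul_le_mul (stepD_le_one _) (mul_le_mul_of_nonneg_left h3 hc0.le) (by positivity) (by norm_num)
        _ ≤ 4 / (r₂ - r₁) := by
            rw [hc, one_mul, div_mul_eq_mul_div, div_le_div_iff₀ hD (by linarith)]
            nlinarith

end Cutoff

section TailShift

theorem neg_le_integral_of_lintegral_le {α : Type*} [MeasurableSpace α] {μ : Measure α}
    {f : α → ℝ} {B : ℝ} (hB : 0 ≤ B)
    (h : ∫⁻ x, ENNReal.ofReal (-f x) ∂μ ≤ ENNReal.ofReal B) : -B ≤ ∫ x, f x ∂μ := by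
  by_cases hf : Integrable f μ
  · rw [integral_eq_lintegral_pos_part_sub_lintegral_neg_part hf]
    have := ENNReal.toReal_mono ENNReal.ofReal_ne_top h
    rw [ENNReal.toReal_ofReal hB] at this
    have h2 : 0 ≤ (∫⁻ x, ENNReal.ofReal (f x) ∂μ).toReal := ENNReal.toReal_nonneg
    linarith
  · rw [integral_undef hf]; linarith

/-- `v` minus a primitive in time of `g`. -/
def shiftT (v : Gd d → ℝ) (g : ℝ → ℝ) (z : Gd d) : ℝ := v z - ∫ τ in Iic z.1, g τ

/-- `g` dominates the contribution to the equation in `B_ρ` of the values of `v` outside `B_r`. -/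
structure TailShift (s : ℝ) (ν : Measure (ℝ × Ed d × Ed d)) (v : Gd d → ℝ) (ρ r : ℝ) (g : ℝ → ℝ) :
    Prop where
  int : Integrable g
  memLp : MemLp g 2 volume
  nonneg : ∀ t, 0 ≤ g t
  dom : ∃ J, 0 ≤ J ∧ ν ≤ ENNReal.ofReal J • nuS d s ∧ ∀ᵐ t, t ∈ Ioo (-1 : ℝ) 0 →
    ENNReal.ofReal (2 * J * (1 / (r - ρ) ^ ((d : ℝ) + 2 * s))) * tauS s v r t ≤ ENNReal.ofReal (g t)

variable {s Λ : ℝ} {ν : Measure (ℝ × Ed d × Ed d)} {v : Gd d → ℝ} {Dv a : Gd d → Ed d}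
  {ρ r : ℝ} {g : ℝ → ℝ}

theorem measurable_shiftT (hv : Measurable v) (hg : Integrable g) : Measurable (shiftT v g) :=
  hv.sub ((continuous_primitive_Iic hg).measurable.comp measurable_fst)

theorem TailShift.mono (S : TailShift s ν v ρ r g) (hs : 0 < s) {ρ' : ℝ} (h : ρ' ≤ ρ)
    (hρ : ρ < r) : TailShift s ν v ρ' r g where
  int := S.int
  memLp := S.memLp
  nonneg := S.nonneg
  dom := by
    obtain ⟨J, hJ, hJν, hdom⟩ := S.dom
    refine ⟨J, hJ, hJν, hdom.mono fun t ht hmem => ?_⟩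
    refine le_trans (mul_le_mul_left (ENNReal.ofReal_le_ofReal ?_) _) (ht hmem)
    have : 0 < r - ρ := by linarith
    gcongr

theorem TailShift.primitive_nonneg (S : TailShift s ν v ρ r g) (t : ℝ) : 0 ≤ ∫ τ in Iic t, g τ :=
  integral_nonneg S.nonneg

theorem TailShift.le_of_pos (S : TailShift s ν v ρ r g) (z : Gd d) : shiftT v g z ≤ v z :=
  sub_le_self _ (S.primitive_nonneg _)

theorem USol.exists_tailShift (U : USol s Λ v Dv a ν) {J : ℝ} (hJ : 0 ≤ J)
    (hJν : ν ≤ ENNReal.ofReal J • nuS d s) (hr : 0 < r) (hρr : ρ < r) :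
    ∃ g, TailShift s ν v ρ r g ∧ ∀ t, ENNReal.ofReal (∫ τ in Iic t, g τ) ≤
      ENNReal.ofReal (2 * J * (1 / (r - ρ) ^ ((d : ℝ) + 2 * s))) *
        ∫⁻ t in Ioo (-1) 0, tauS s v r t := by
  set c := 2 * J * (1 / (r - ρ) ^ ((d : ℝ) + 2 * s)) with hc
  have hρ : 0 < r - ρ := by linarith
  have hc0 : 0 ≤ c := by positivity
  have hm := measurable_tauS U.mv s r
  have hmem : MemLp (fun t => (tauS s v r t).toReal) 2 (volume.restrict (Ioo (-1) 0)) := by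
    refine ⟨hm.ennreal_toReal.aestronglyMeasurable, ?_⟩
    have h1 : eLpNorm (fun t => (tauS s v r t).toReal) 2 (volume.restrict (Ioo (-1) 0)) ^ 2 < ⊤ := by
      rw [eLpNorm_two_sq]
      refine lt_of_le_of_lt (lintegral_mono fun t => ?_) (U.tail r hr)
      gcongr
      rw [Real.enorm_of_nonneg ENNReal.toReal_nonneg]
      exact ENNReal.ofReal_toReal_le
    by_contra h
    rw [top_le_iff.1 (not_lt.1 h)] at h1
    simp at h1
  have hmem' : MemLp (fun t => c * (tauS s v r t).toReal) 2 (volume.restrict (Ioo (-1) 0)) :=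
    hmem.const_mul c
  have hfin : ∀ᵐ t, t ∈ Ioo (-1 : ℝ) 0 → tauS s v r t < ⊤ := by
    have := ae_lt_top (hm.pow_const 2) (U.tail r hr).ne
    rw [ae_restrict_iff' measurableSet_Ioo] at this
    filter_upwards [this] with t ht h1
    by_contra h
    have := ht h1
    rw [top_le_iff.1 (not_lt.1 h)] at this
    simp at this
  set g := (Ioo (-1 : ℝ) 0).indicator fun t => c * (tauS s v r t).toReal with hgdef
  have hg0 : ∀ t, 0 ≤ g t := fun t =>
    indicator_nonneg (fun t _ => mul_nonneg hc0 ENNReal.toReal_nonneg) t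
  have hgi : Integrable g :=
    (integrable_indicator_iff measurableSet_Ioo).2 (hmem'.integrable (by norm_num))
  refine ⟨g, ⟨hgi, (memLp_indicator_iff_restrict measurableSet_Ioo).2 hmem', hg0,
    J, hJ, hJν, ?_⟩, fun t => ?_⟩
  · filter_upwards [hfin] with t ht h1
    rw [hgdef, indicator_of_mem h1, ENNReal.ofReal_mul hc0, ENNReal.ofReal_toReal (ht h1).ne]
  · calc ENNReal.ofReal (∫ τ in Iic t, g τ) ≤ ENNReal.ofReal (∫ τ, g τ) :=
          ENNReal.ofReal_le_ofReal (setIntegral_le_integral hgi (ae_of_all _ hg0))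
      _ = ∫⁻ τ, ENNReal.ofReal (g τ) := ofReal_integral_eq_lintegral_ofReal hgi (ae_of_all _ hg0)
      _ ≤ ∫⁻ τ, (Ioo (-1 : ℝ) 0).indicator (fun τ => ENNReal.ofReal c * tauS s v r τ) τ := by
          refine lintegral_mono fun τ => ?_
          by_cases h : τ ∈ Ioo (-1 : ℝ) 0
          · rw [hgdef, indicator_of_mem h, indicator_of_mem h, ENNReal.ofReal_mul hc0]
            gcongr
            exact ENNReal.ofReal_toReal_le
          · rw [hgdef, indicator_of_notMem h, indicator_of_notMem h]; simp
      _ = _ := by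
          rw [lintegral_indicator measurableSet_Ioo, lintegral_const_mul _ hm]

/-- The tail shift absorbs the long-range interactions. -/
theorem USol.far_add_shift_nonneg (U : USol s Λ v Dv a ν) (hs : 0 < s)
    (S : TailShift s ν v ρ r g) (hρr : ρ < r) (hr : r ≤ 1) {ψ : Gd d → ℝ} (hψm : Measurable ψ)
    (hψ : MemLp ψ 2 volume) (hψ0 : ∀ z, 0 ≤ ψ z) (hψv : ∀ z, ψ z ≠ 0 → 0 ≤ v z)
    (hψs : ∀ z, z ∉ Ioo (-1 : ℝ) 0 ×ˢ ball (0 : Ed d) ρ → ψ z = 0) :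
    0 ≤ 2 * (∫ p in farA d ρ r, diffXY v p * ψ (p.1, p.2.1) ∂ν) + ∫ z, g z.1 * ψ z := by
  have hρ : 0 < r - ρ := by linarith
  set c := 1 / (r - ρ) ^ ((d : ℝ) + 2 * s) with hc
  have hc0 : 0 ≤ c := by positivity
  have hgi : Integrable fun z : Gd d => g z.1 * ψ z := by
    have h1 : IntegrableOn (fun z : Gd d => g z.1 * ψ z) (univ ×ˢ ball (0 : Ed d) ρ) :=
      MemLp.integrable_mul (q := 2) (memLp_fst_restrict S.memLp ρ) (hψ.restrict _)
    refine h1.of_forall_sdiff_eq_zero (MeasurableSet.univ) ?_ |>.integrable_of_forall_notMem_eq_zero ?_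
    · intro z hz
      rw [hψs z fun h => hz.2 ⟨mem_univ _, h.2⟩, mul_zero]
    · intro z hz; exact absurd (mem_univ z) hz
  have hg0 : ∀ z : Gd d, 0 ≤ g z.1 * ψ z := fun z => mul_nonneg (S.nonneg _) (hψ0 z)
  set B := ∫ z, g z.1 * ψ z with hB
  have hB0 : 0 ≤ B := integral_nonneg hg0
  have hBe : ENNReal.ofReal B = ∫⁻ z, ENNReal.ofReal (g z.1 * ψ z) :=
    ofReal_integral_eq_lintegral_ofReal hgi (ae_of_all _ hg0)
  obtain ⟨J, hJ, hJν, hdom₀⟩ := S.dom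
  have hdom : ∀ᵐ z : Gd d, z.1 ∈ Ioo (-1 : ℝ) 0 →
      ENNReal.ofReal (2 * J * c) * tauS s v r z.1 ≤ ENNReal.ofReal (g z.1) :=
    Measure.quasiMeasurePreserving_fst.ae hdom₀
  suffices h : -(B / 2) ≤ ∫ p in farA d ρ r, diffXY v p * ψ (p.1, p.2.1) ∂ν by linarith
  refine neg_le_integral_of_lintegral_le (by linarith) ?_
  have h2 : (2 : ℝ≥0∞) ≠ 0 := by norm_num
  rw [← ENNReal.mul_le_mul_iff_right h2 (by norm_num)]
  calc 2 * ∫⁻ p in farA d ρ r, ENNReal.ofReal (-(diffXY v p * ψ (p.1, p.2.1))) ∂ν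
      ≤ 2 * ∫⁻ p in farA d ρ r, ENNReal.ofReal (ψ (p.1, p.2.1)) * ‖v (p.1, p.2.2)‖ₑ ∂ν := by
        gcongr with p
        by_cases h : ψ (p.1, p.2.1) = 0
        · simp [h]
        · rw [← ofReal_norm, ← ENNReal.ofReal_mul (hψ0 _)]
          refine ENNReal.ofReal_le_ofReal ?_
          have h1 := hψv _ h
          have h3 := hψ0 (p.1, p.2.1)
          have h4 := le_abs_self (v (p.1, p.2.2))
          rw [Real.norm_eq_abs]
          unfold diffXY
          nlinarith
    _ ≤ 2 * (ENNReal.ofReal J * (ENNReal.ofReal c *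
          ∫⁻ z in univ ×ˢ ball (0 : Ed d) ρ, ENNReal.ofReal (ψ z) * tauS s v r z.1)) := by
        gcongr
        refine (lintegral_le_of_le hJν _ _).trans ?_
        gcongr
        exact lintegral_far_le hs hρr hr U.mv (w := fun z => ENNReal.ofReal (ψ z)) (by fun_prop)
    _ = ∫⁻ z in univ ×ˢ ball (0 : Ed d) ρ,
          ENNReal.ofReal (2 * J * c) * (ENNReal.ofReal (ψ z) * tauS s v r z.1) := by
        have hm : Measurable fun z : Gd d => ENNReal.ofReal (ψ z) * tauS s v r z.1 :=
          hψm.ennreal_ofReal.mul (measurable_tauS_fst U.mv s r)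
        rw [lintegral_const_mul _ hm,
          ENNReal.ofReal_mul (by positivity), ENNReal.ofReal_mul (by norm_num)]
        simp [mul_assoc]
    _ ≤ ∫⁻ z in univ ×ˢ ball (0 : Ed d) ρ, ENNReal.ofReal (g z.1 * ψ z) := by
        refine lintegral_mono_ae (ae_restrict_of_ae (hdom.mono fun z hz => ?_))
        by_cases h : z.1 ∈ Ioo (-1 : ℝ) 0
        · rw [mul_comm (ENNReal.ofReal (ψ z)), ← mul_assoc, ENNReal.ofReal_mul (S.nonneg _)]
          gcongr
          exact hz h
        · simp [hψs z fun h' => h h'.1]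
    _ ≤ ∫⁻ z, ENNReal.ofReal (g z.1 * ψ z) := setLIntegral_le_lintegral _ _
    _ = ENNReal.ofReal B := hBe.symm
    _ = 2 * ENNReal.ofReal (B / 2) := by
        rw [show B = 2 * (B / 2) by ring, ENNReal.ofReal_mul (by norm_num)]; simp

end TailShift

section Energy

variable {s Λ : ℝ} {ν : Measure (ℝ × Ed d × Ed d)} {v : Gd d → ℝ} {Dv a : Gd d → Ed d}
  {ρ r : ℝ} {g : ℝ → ℝ} {θ : ℝ → ℝ} {η : Ed d → ℝ}

/-- The product cutoff `θ(t) η(x)²`. -/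
def cutTX (θ : ℝ → ℝ) (η : Ed d → ℝ) (z : Gd d) : ℝ := θ z.1 * η z.2 ^ 2

theorem contDiff_cutTX (hθ : ContDiff ℝ 1 θ) (hη : ContDiff ℝ 1 η) : ContDiff ℝ 1 (cutTX θ η) :=
  (hθ.comp contDiff_fst).mul ((hη.comp contDiff_snd).pow 2)

theorem fderiv_cutTX (hθ : ContDiff ℝ 1 θ) (hη : ContDiff ℝ 1 η) (z : Gd d) (τ : ℝ) (e : Ed d) :
    fderiv ℝ (cutTX θ η) z (τ, e)
      = deriv θ z.1 * τ * η z.2 ^ 2 + θ z.1 * (2 * η z.2 * fderiv ℝ η z.2 e) := by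
  have h1 : HasFDerivAt (fun z : Gd d => θ z.1) _ z :=
    ((hθ.differentiable (by simp) z.1).hasDerivAt).comp_hasFDerivAt z
      (hasFDerivAt_fst (𝕜 := ℝ) (E := ℝ) (F := Ed d) (p := z))
  have h2 : HasFDerivAt (fun z : Gd d => η z.2) _ z :=
    ((hη.differentiable (by simp) z.2).hasFDerivAt).comp z
      (hasFDerivAt_snd (𝕜 := ℝ) (E := ℝ) (F := Ed d) (p := z))
  have h3 : HasFDerivAt (cutTX θ η) _ z := h1.mul (h2.pow 2)
  rw [h3.fderiv]
  simp
  ring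

theorem tsupport_cutTX_subset {I : Set ℝ} {O : Set (Ed d)} (hθ : tsupport θ ⊆ I)
    (hη : tsupport η ⊆ O) : tsupport (cutTX θ η) ⊆ I ×ˢ O := by
  have h1 : tsupport (cutTX θ η) ⊆ tsupport θ ×ˢ tsupport η := by
    refine closure_minimal (fun z hz => ⟨subset_tsupport _ ?_, subset_tsupport _ ?_⟩)
      ((isClosed_tsupport _).prod (isClosed_tsupport _))
    · intro h; exact hz (by simp [cutTX, h])
    · intro h; exact hz (by simp [cutTX, h])
  exact h1.trans (Set.prod_mono hθ hη)

theorem hasCompactSupport_of_tsupport_subset {X : Type*} [PseudoMetricSpace X] [ProperSpace X]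
    {f : X → ℝ} {O : Set X} (hO : Bornology.IsBounded O) (h : tsupport f ⊆ O) :
    HasCompactSupport f :=
  Metric.isCompact_of_isClosed_isBounded (isClosed_tsupport _) (hO.subset h)

variable (d) in
/-- The set of pairs of points in `B_r` at times in `(-b, 0)`. -/
def pairA (b r : ℝ) : Set (ℝ × Ed d × Ed d) := Ioo (-b) 0 ×ˢ (ball 0 r ×ˢ ball 0 r)

theorem measurableSet_pairA (b r : ℝ) : MeasurableSet (pairA d b r) :=
  measurableSet_Ioo.prod (measurableSet_ball.prod measurableSet_ball)

/-- The nonlocal error density in the energy inequality. -/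
def pairE (η : Ed d → ℝ) (u : Gd d → ℝ) (k : ℝ) (p : ℝ × Ed d × Ed d) : ℝ :=
  (η p.2.1 - η p.2.2) ^ 2 * (max (u (p.1, p.2.1) - k) 0 * max (u (p.1, p.2.2) - k) 0)

/-- The total error in the energy inequality. -/
def errE (s Λ L : ℝ) (η : Ed d → ℝ) (u : Gd d → ℝ) (k b ρ r : ℝ) : ℝ≥0∞ :=
  ENNReal.ofReal (2 * Λ ^ 3 * L ^ 2) *
      (∫⁻ z in Ioo (-b) 0 ×ˢ ball (0 : Ed d) ρ, ENNReal.ofReal (max (u z - k) 0 ^ 2))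
    + ENNReal.ofReal Λ * ∫⁻ p in pairA d b r, ENNReal.ofReal (pairE η u k p) ∂nuS d s

theorem pairE_nonneg (η : Ed d → ℝ) (u : Gd d → ℝ) (k : ℝ) (p : ℝ × Ed d × Ed d) :
    0 ≤ pairE η u k p := by
  unfold pairE; positivity

theorem USol.near_ge (U : USol s Λ v Dv a ν) {k δ : ℝ} (hδ : 0 < δ)
    {u : Gd d → ℝ} (hθ1 : ∀ t, θ t ∈ Icc (0 : ℝ) 1) {b : ℝ} (hθb : ∀ t ∉ Ioo (-b) 0, θ t = 0) {B : ℝ}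
    (hB0 : 0 ≤ B)
    (hB : ENNReal.ofReal Λ * ∫⁻ p in pairA d b r, ENNReal.ofReal (pairE η u k p) ∂nuS d s
      ≤ ENNReal.ofReal B) :
    -B ≤ ∫ p in nearA d r,
      diffXY u p * diffXY (fun z => cutTX θ η z * rampT δ (u z - k)) p ∂ν := by
  refine neg_le_integral_of_lintegral_le hB0 (le_trans ?_ hB)
  refine le_trans ?_ (lintegral_le_of_le U.le _ _)
  rw [← lintegral_indicator (measurableSet_nearA r), ← lintegral_indicator (measurableSet_pairA b r)]
  refine lintegral_mono fun p => ?_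
  by_cases hp : p ∈ nearA d r
  swap; · rw [indicator_of_notMem hp]; exact zero_le
  rw [indicator_of_mem hp]
  have key := sub_mul_sub_rampT_ge hδ (u (p.1, p.2.1) - k) (u (p.1, p.2.2) - k)
    (η p.2.1) (η p.2.2)
  have hθ0 := (hθ1 p.1).1
  have h1 : -(diffXY u p * diffXY (fun z => cutTX θ η z * rampT δ (u z - k)) p)
      ≤ θ p.1 * pairE η u k p := by
    have := mul_le_mul_of_nonneg_left key hθ0
    unfold diffXY cutTX pairE
    linarith
  by_cases hb : p.1 ∈ Ioo (-b) 0
  · rw [indicator_of_mem (show p ∈ pairA d b r from ⟨hb, hp.2⟩)]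
    refine ENNReal.ofReal_le_ofReal (h1.trans ?_)
    exact mul_le_of_le_one_left (pairE_nonneg _ _ _ _) (hθ1 _).2
  · rw [ENNReal.ofReal_of_nonpos]
    · exact zero_le
    · rw [hθb _ hb, zero_mul] at h1; exact h1

theorem inner_chainGrad_ge (hΛ : 1 ≤ Λ) (hθ : ContDiff ℝ 1 θ) (hη : ContDiff ℝ 1 η) {L : ℝ}
    (hL : ∀ x, ‖fderiv ℝ η x‖ ≤ L) {z : Gd d} (hθ0 : θ z.1 ∈ Icc (0 : ℝ) 1) (hη0 : η z.2 ∈ Icc (0 : ℝ) 1)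
    {A D : Gd d → Ed d} (hg : ‖A z‖ ≤ Λ * ‖D z‖) (he : Λ⁻¹ * ‖D z‖ ^ 2 ≤ ⟪A z, D z⟫)
    {δ k : ℝ} (hδ : 0 < δ) (u : Gd d → ℝ) :
    (2 * Λ)⁻¹ * (cutTX θ η z * (heav δ (u z - k) * ‖D z‖ ^ 2))
        - 2 * Λ ^ 3 * L ^ 2 * max (u z - k) 0 ^ 2 ≤
      ⟪A z, chainGrad (cutTX θ η) (fun u => rampT δ (u - k)) (fun u => heav δ (u - k)) u D z⟫ := by
  set w := max (u z - k) 0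
  set m := heav δ (u z - k)
  set X := ‖D z‖
  have hw : 0 ≤ w := le_max_right _ _
  have hm0 : 0 ≤ m := heav_nonneg hδ _
  have hm1 : m ≤ 1 := heav_le_one hδ _
  have hL0 : 0 ≤ L := (norm_nonneg _).trans (hL 0)
  have hX : 0 ≤ X := norm_nonneg _
  have hr := rampT_le_mul_heav hδ (u z - k)
  have hr0 := rampT_nonneg hδ (u z - k)
  have e1 : ⟪A z, gx (cutTX θ η) z⟫ = θ z.1 * (2 * η z.2 * fderiv ℝ η z.2 (A z)) := by
    rw [real_inner_comm, inner_gx, fderiv_cutTX hθ hη]; ring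
  have h2 : -(L * (Λ * X)) ≤ fderiv ℝ η z.2 (A z) := by
    have h3 : ‖fderiv ℝ η z.2 (A z)‖ ≤ L * (Λ * X) :=
      ((fderiv ℝ η z.2).le_opNorm _).trans (mul_le_mul (hL _) hg (norm_nonneg _) hL0)
    rw [Real.norm_eq_abs] at h3
    exact neg_le_of_abs_le h3
  have hp : 0 ≤ θ z.1 * (2 * η z.2) := mul_nonneg hθ0.1 (by linarith [hη0.1])
  have hq : 0 ≤ Λ * X * L := by positivity
  have h4 : -(rampT δ (u z - k) * (θ z.1 * (2 * η z.2) * (L * (Λ * X))))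
      ≤ rampT δ (u z - k) * ⟪A z, gx (cutTX θ η) z⟫ := by
    rw [e1, ← mul_neg]
    refine mul_le_mul_of_nonneg_left ?_ hr0
    have := mul_le_mul_of_nonneg_left h2 hp
    linarith
  have h5 : rampT δ (u z - k) * (θ z.1 * (2 * η z.2) * (L * (Λ * X)))
      ≤ w * m * (θ z.1 * (2 * η z.2) * (L * (Λ * X))) :=
    mul_le_mul_of_nonneg_right hr (by positivity)
  have h6 : θ z.1 * η z.2 ^ 2 * m * (Λ⁻¹ * X ^ 2) ≤ θ z.1 * η z.2 ^ 2 * m * ⟪A z, D z⟫ :=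
    mul_le_mul_of_nonneg_left he (mul_nonneg (mul_nonneg hθ0.1 (sq_nonneg _)) hm0)
  have hY : w * (2 * η z.2) * (L * (Λ * X)) ≤
      (2 * Λ)⁻¹ * (η z.2 ^ 2 * X ^ 2) + 2 * Λ ^ 3 * L ^ 2 * w ^ 2 := by
    have hΛ0 : 0 < Λ := by linarith
    have : (2 * Λ)⁻¹ * (η z.2 ^ 2 * X ^ 2) + 2 * Λ ^ 3 * L ^ 2 * w ^ 2
        - w * (2 * η z.2) * (L * (Λ * X)) = (2 * Λ)⁻¹ * (η z.2 * X - 2 * Λ ^ 2 * L * w) ^ 2 := by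
      field_simp; ring
    have h7 : 0 ≤ (2 * Λ)⁻¹ * (η z.2 * X - 2 * Λ ^ 2 * L * w) ^ 2 := by positivity
    linarith
  have h8 : w * m * (θ z.1 * (2 * η z.2) * (L * (Λ * X))) ≤
      θ z.1 * m * ((2 * Λ)⁻¹ * (η z.2 ^ 2 * X ^ 2)) + 2 * Λ ^ 3 * L ^ 2 * w ^ 2 := by
    have h9 := mul_le_mul_of_nonneg_left hY (mul_nonneg hθ0.1 hm0)
    have h10 : θ z.1 * m * (2 * Λ ^ 3 * L ^ 2 * w ^ 2) ≤ 2 * Λ ^ 3 * L ^ 2 * w ^ 2 :=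
      mul_le_of_le_one_left (by positivity) (mul_le_one₀ hθ0.2 hm0 hm1)
    linarith
  have e2 : (2 * Λ)⁻¹ = Λ⁻¹ / 2 := by rw [mul_inv]; ring
  rw [chainGrad, inner_add_right, real_inner_smul_right, real_inner_smul_right]
  change _ ≤ rampT δ (u z - k) * ⟪A z, gx (cutTX θ η) z⟫ + θ z.1 * η z.2 ^ 2 * m * ⟪A z, D z⟫
  rw [e2] at hY h8 ⊢
  unfold cutTX at h4 ⊢
  linarith

theorem USol.energy_of_cutoff (U : USol s Λ v Dv a ν) (hd : 1 ≤ d) (hs : s ∈ Ioo (0 : ℝ) 1)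
    (hΛ : 1 ≤ Λ) (S : TailShift s ν v ρ r g) (hr0 : 0 < r) (hρr : ρ < r) (hr : r ≤ 1)
    {k : ℝ} (hk : 0 ≤ k) {δ : ℝ} (hδ : 0 < δ) (hη : ContDiff ℝ 1 η) (hηt : tsupport η ⊆ ball 0 ρ)
    (hη1 : ∀ x, η x ∈ Icc (0 : ℝ) 1) {L : ℝ} (hL : ∀ x, ‖fderiv ℝ η x‖ ≤ L) {b B : ℝ}
    (hB0 : 0 ≤ B) (hB : errE s Λ L η (shiftT v g) k b ρ r ≤ ENNReal.ofReal B)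
    (hθ : ContDiff ℝ 1 θ) (hθt : tsupport θ ⊆ Ioo (-1) 0) (hθ1 : ∀ t, θ t ∈ Icc (0 : ℝ) 1)
    (hθb : ∀ t ∉ Ioo (-b) 0, θ t = 0) :
    Integrable (fun z => cutTX θ η z * (heav δ (shiftT v g z - k) * ‖Dv z‖ ^ 2)) ∧
    -(∫ z : Gd d, deriv θ z.1 * (η z.2 ^ 2 * quadT δ (shiftT v g z - k)))
      + (2 * Λ)⁻¹ * ∫ z, cutTX θ η z * (heav δ (shiftT v g z - k) * ‖Dv z‖ ^ 2) ≤ B := by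
  set u := shiftT v g with hu
  set h : ℝ → ℝ := fun u => rampT δ (u - k) with hh
  set h' : ℝ → ℝ := fun u => heav δ (u - k) with hh'
  set H : ℝ → ℝ := fun u => quadT δ (u - k) with hH
  set Z := cutTX θ η with hZ
  have hΛ0 : 0 ≤ Λ := by linarith
  have hρ1 : ρ ≤ 1 := by linarith
  have hZC : ContDiff ℝ 1 Z := contDiff_cutTX hθ hη
  have hZt : tsupport Z ⊆ Ioo (-1) 0 ×ˢ ball 0 ρ := tsupport_cutTX_subset hθt hηt
  have hZc : HasCompactSupport Z :=
    hasCompactSupport_of_tsupport_subset ((isBounded_Ioo _ _).prod isBounded_ball) hZt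
  have hZ0 : ∀ z, 0 ≤ Z z := fun z => mul_nonneg (hθ1 _).1 (sq_nonneg _)
  have hZ1 : ∀ z, Z z ≤ 1 := fun z => mul_le_one₀ (hθ1 _).2 (sq_nonneg _)
    (pow_le_one₀ (hη1 _).1 (hη1 _).2)
  obtain ⟨hW, hid⟩ := U.weak_truncated hd hs S.int S.memLp (u := u) (fun z => rfl)
    (h := h) (h' := h') (H := H)
    (fun u => by simpa [Function.comp_def] using (hasDerivAt_rampT hδ (u - k)).comp_sub_const u k)
    ((contDiff_rampT hδ).comp (contDiff_id.sub contDiff_const))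
    (fun u => abs_le.2 ⟨by linarith [heav_nonneg hδ (u - k)], heav_le_one hδ _⟩)
    (continuous_heav.comp (continuous_id.sub continuous_const))
    (fun u => by simpa [Function.comp_def] using (hasDerivAt_quadT hδ (u - k)).comp_sub_const u k)
    (fun u => by
      rw [abs_of_nonneg (rampT_nonneg hδ _)]
      exact (rampT_le hδ _).trans (max_le (by linarith [le_abs_self u]) (abs_nonneg _)))
    (trunc_of_nonpos hδ (by linarith)).2.2 hZC hZc hr0 hρr hr hZt
  have hZoff : ∀ z ∉ Ioo (-1 : ℝ) 0 ×ˢ ball (0 : Ed d) ρ, Z z = 0 := fun z hz =>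
    image_eq_zero_of_notMem_tsupport fun h => hz (hZt h)
  have hfar := U.far_add_shift_nonneg hs.1 S hρr hr hW.meas hW.memf
    (fun z => mul_nonneg (hZ0 z) (rampT_nonneg hδ _))
    (fun z hz => by
      by_contra hv
      have h1 := S.le_of_pos z
      refine hz ?_
      have : h (u z) = 0 := (trunc_of_nonpos hδ (by rw [← hu] at h1; linarith)).2.1
      rw [this, mul_zero])
    (fun z hz => by simp only [hZoff z hz, zero_mul])
  -- the two error terms
  set E₁ := ENNReal.ofReal (2 * Λ ^ 3 * L ^ 2) *
      ∫⁻ z in Ioo (-b) 0 ×ˢ ball (0 : Ed d) ρ, ENNReal.ofReal (max (u z - k) 0 ^ 2) with hE1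
  set E₂ := ENNReal.ofReal Λ * ∫⁻ p in pairA d b r, ENNReal.ofReal (pairE η u k p) ∂nuS d s with hE2
  have hBs : E₁ + E₂ ≤ ENNReal.ofReal B := hB
  have hE1t : E₁ ≠ ⊤ := ((le_self_add.trans hBs).trans_lt ENNReal.ofReal_lt_top).ne
  have hE2t : E₂ ≠ ⊤ := ((le_add_self.trans hBs).trans_lt ENNReal.ofReal_lt_top).ne
  have hsum : E₁.toReal + E₂.toReal ≤ B := by
    rw [← ENNReal.toReal_add hE1t hE2t]
    exact ENNReal.toReal_le_of_le_ofReal hB0 hBs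
  have hnear := U.near_ge (r := r) (η := η) (k := k) hδ (u := u) hθ1 hθb ENNReal.toReal_nonneg
    (ENNReal.ofReal_toReal hE2t).ge
  -- the gradient term
  have hQm : MeasurableSet (Ioo (-1 : ℝ) 0 ×ˢ ball (0 : Ed d) 1) :=
    measurableSet_Ioo.prod measurableSet_ball
  have hsub : Ioo (-1 : ℝ) 0 ×ˢ ball (0 : Ed d) ρ ⊆ Ioo (-1 : ℝ) 0 ×ˢ ball (0 : Ed d) 1 :=
    Set.prod_mono subset_rfl (ball_subset_ball hρ1)
  have hum : Measurable u := measurable_shiftT U.mv S.int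
  have hi1 : Integrable fun z => ⟪a z, chainGrad Z h h' u Dv z⟫ := by
    have h1 : IntegrableOn (fun z => ⟪a z, chainGrad Z h h' u Dv z⟫)
        (Ioo (-1 : ℝ) 0 ×ˢ ball (0 : Ed d) 1) :=
      MemLp.integrable_inner_two U.memLp_a (hW.memF.restrict _)
    refine h1.integrable_of_forall_notMem_eq_zero fun z hz => ?_
    rw [chainGrad_eq_zero fun h => hz (hsub (hZt h)), inner_zero_right]
  have hi2 : Integrable fun z => Z z * (heav δ (u z - k) * ‖Dv z‖ ^ 2) := by
    have h1 : IntegrableOn (fun z => ‖Dv z‖ ^ 2) (Ioo (-1 : ℝ) 0 ×ˢ ball (0 : Ed d) 1) :=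
      (memLp_two_iff_integrable_sq_norm U.memLp_Dv.1).1 U.memLp_Dv
    have h2 : IntegrableOn (fun z => Z z * (heav δ (u z - k) * ‖Dv z‖ ^ 2))
        (Ioo (-1 : ℝ) 0 ×ˢ ball (0 : Ed d) 1) := by
      refine Integrable.mono h1 ?_ (ae_of_all _ fun z => ?_)
      · have : Measurable fun z => heav δ (u z - k) :=
          continuous_heav.measurable.comp (hum.sub_const k)
        exact (hZC.continuous.measurable.mul
          (this.mul (U.mD.norm.pow_const 2))).aestronglyMeasurable
      · have h3 := heav_nonneg hδ (u z - k)
        rw [Real.norm_of_nonneg (mul_nonneg (hZ0 z) (mul_nonneg h3 (sq_nonneg _))),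
          Real.norm_of_nonneg (sq_nonneg _), ← mul_assoc]
        exact mul_le_of_le_one_left (sq_nonneg _) (mul_le_one₀ (hZ1 z) h3 (heav_le_one hδ _))
    refine h2.integrable_of_forall_notMem_eq_zero fun z hz => ?_
    rw [hZoff z fun h => hz (hsub h), zero_mul]
  have hgrad : -E₁.toReal ≤ (∫ z, ⟪a z, chainGrad Z h h' u Dv z⟫)
      - (2 * Λ)⁻¹ * ∫ z, Z z * (heav δ (u z - k) * ‖Dv z‖ ^ 2) := by
    have e : ∫ z, (⟪a z, chainGrad Z h h' u Dv z⟫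
        - (2 * Λ)⁻¹ * (Z z * (heav δ (u z - k) * ‖Dv z‖ ^ 2)))
        = (∫ z, ⟪a z, chainGrad Z h h' u Dv z⟫)
          - (2 * Λ)⁻¹ * ∫ z, Z z * (heav δ (u z - k) * ‖Dv z‖ ^ 2) := by
      rw [← integral_const_mul]
      exact integral_sub hi1 (hi2.const_mul _)
    rw [← e]
    refine neg_le_integral_of_lintegral_le ENNReal.toReal_nonneg ?_
    have hm2 : Measurable fun z => ENNReal.ofReal (max (u z - k) 0 ^ 2) := by fun_prop
    rw [ENNReal.ofReal_toReal hE1t, hE1, ← lintegral_const_mul _ hm2,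
      ← lintegral_indicator (measurableSet_Ioo.prod measurableSet_ball)]
    refine lintegral_mono fun z => ?_
    by_cases hz : z ∈ Ioo (-b) 0 ×ˢ ball (0 : Ed d) ρ
    · have h3 : 0 ≤ 2 * Λ ^ 3 * L ^ 2 := by positivity
      rw [indicator_of_mem hz, ← ENNReal.ofReal_mul h3]
      refine ENNReal.ofReal_le_ofReal ?_
      have := inner_chainGrad_ge (k := k) hΛ hθ hη hL (hθ1 z.1) (hη1 z.2) (U.grow z) (U.ell z) hδ u
      linarith
    · rw [indicator_of_notMem hz, ENNReal.ofReal_of_nonpos]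
      have hzero : Z z = 0 ∧ ⟪a z, gx Z z⟫ = 0 := by
        rw [real_inner_comm, inner_gx, hZ, fderiv_cutTX hθ hη]
        unfold cutTX
        by_cases hz1 : z.1 ∈ Ioo (-b) 0
        · have hη0 : η z.2 = 0 :=
            image_eq_zero_of_notMem_tsupport fun h => hz ⟨hz1, hηt h⟩
          simp [hη0]
        · simp [hθb _ hz1]
      rw [chainGrad, inner_add_right, real_inner_smul_right, real_inner_smul_right, hzero.1, hzero.2]
      simp
  have hT : ∫ z, fderiv ℝ Z z (1, 0) * H (u z)
      = ∫ z : Gd d, deriv θ z.1 * (η z.2 ^ 2 * quadT δ (u z - k)) := by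
    refine integral_congr_ae (ae_of_all _ fun z => ?_)
    simp only [hZ, fderiv_cutTX hθ hη, hH]
    simp; ring
  rw [hT] at hid
  exact ⟨hi2, by linarith⟩

end Energy

section Slices

theorem stepD_of_nonpos {w : ℝ} (hw : w ≤ 0) : stepD w = 0 := by
  simp [stepD, (trunc_of_nonpos one_pos hw).1,
    (trunc_of_nonpos one_pos (show w - 1 ≤ 0 by linarith)).1]

theorem continuous_stepD : Continuous stepD :=
  continuous_heav.sub (continuous_heav.comp (continuous_id.sub continuous_const))

variable {Q P : Gd d → ℝ} {a b c B C₀ : ℝ}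

theorem hasCompactSupport_of_Ioo {k : ℝ → ℝ} (h : ∀ t ∉ Ioo (-b) 0, k t = 0) :
    HasCompactSupport k :=
  HasCompactSupport.of_support_subset_isCompact (isCompact_Icc (a := -b) (b := 0)) fun t ht => by
    by_contra hne
    exact ht (h t fun h' => hne (Ioo_subset_Icc_self h'))

theorem integrable_time_mul (hQ : IntegrableOn Q (Ioo (-b) 0 ×ˢ univ)) {k : ℝ → ℝ}
    (hk : Continuous k) (hk0 : ∀ t ∉ Ioo (-b) 0, k t = 0) :
    Integrable fun z : Gd d => k z.1 * Q z := by
  obtain ⟨M, hM⟩ := hk.bounded_above_of_compact_support (hasCompactSupport_of_Ioo hk0)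
  have h1 : IntegrableOn (fun z : Gd d => k z.1 * Q z) (Ioo (-b) 0 ×ˢ univ) :=
    hQ.bdd_mul (c := M) (hk.measurable.comp measurable_fst).aestronglyMeasurable
      (ae_of_all _ fun z => hM z.1)
  refine h1.integrable_of_forall_notMem_eq_zero fun z hz => ?_
  rw [hk0 z.1 fun h => hz ⟨h, mem_univ _⟩, zero_mul]

/-- An energy inequality for all cutoffs in time yields bounds on almost every time slice. -/
theorem slices_of_cutoff (hQm : Measurable Q) (_hPm : Measurable P) (hQ0 : ∀ z, 0 ≤ Q z)
    (hP0 : ∀ z, 0 ≤ P z) (_ha : 0 < a) (hab : a < b) (hb : b < 1) (hc : 0 ≤ c)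
    (hC₀ : 0 ≤ C₀) (hQ : ∫⁻ z in Ioo (-b) 0 ×ˢ univ, ENNReal.ofReal (Q z) ≤ ENNReal.ofReal C₀)
    (key : ∀ θ : ℝ → ℝ, ContDiff ℝ 1 θ → tsupport θ ⊆ Ioo (-1) 0 → (∀ t, θ t ∈ Icc (0 : ℝ) 1) →
      (∀ t ∉ Ioo (-b) 0, θ t = 0) → Integrable (fun z : Gd d => θ z.1 * P z) ∧
        -(∫ z : Gd d, deriv θ z.1 * Q z) + c * ∫ z : Gd d, θ z.1 * P z ≤ B) :
    (∀ᵐ t, t ∈ Ioo (-a) 0 →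
      ∫⁻ x, ENNReal.ofReal (Q (t, x)) ≤ ENNReal.ofReal (B + 2 / (b - a) * C₀)) ∧
    ENNReal.ofReal c * ∫⁻ z in Ioo (-a) 0 ×ˢ univ, ENNReal.ofReal (P z)
      ≤ ENNReal.ofReal (B + 2 / (b - a) * C₀) := by
  have hba : 0 < b - a := by linarith
  set q := 2 / (b - a) with hq
  have hq0 : 0 < q := by positivity
  set e := B + q * C₀ with he
  have hQi : IntegrableOn Q (Ioo (-b) 0 ×ˢ univ) := by
    refine ⟨hQm.aestronglyMeasurable, ?_⟩
    rw [hasFiniteIntegral_iff_ofReal (ae_of_all _ hQ0)]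
    exact hQ.trans_lt ENNReal.ofReal_lt_top
  set R : ℝ → ℝ := fun t => stepC (q * (t + b)) with hR
  have hR' : ∀ t, HasDerivAt R (stepD (q * (t + b)) * q) t := fun t => by
    have h1 : HasDerivAt (fun t : ℝ => q * (t + b)) q t := by
      simpa using ((hasDerivAt_id t).add_const b).const_mul q
    exact (hasDerivAt_stepC _).comp t h1
  have hR01 : ∀ t, R t ∈ Icc (0 : ℝ) 1 := fun t => ⟨stepC_nonneg _, stepC_le_one _⟩
  have hRb : ∀ t, t ≤ -b → R t = 0 := fun t ht =>
    stepC_of_nonpos (mul_nonpos_of_nonneg_of_nonpos hq0.le (by linarith))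
  have hRb' : ∀ t, t ≤ -b → stepD (q * (t + b)) * q = 0 := fun t ht => by
    rw [stepD_of_nonpos (mul_nonpos_of_nonneg_of_nonpos hq0.le (by linarith)), zero_mul]
  have hRa : ∀ t, -a ≤ t → R t = 1 := fun t ht => stepC_of_two_le (by
    rw [hq, div_mul_eq_mul_div, le_div_iff₀ hba]; linarith)
  have hRC : ContDiff ℝ 1 R :=
    contDiff_stepC.comp (contDiff_const.mul (contDiff_id.add contDiff_const))
  have hR'c : Continuous fun t => stepD (q * (t + b)) * q :=
    (continuous_stepD.comp (by fun_prop)).mul continuous_const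
  have decay : ∀ F F' : ℝ → ℝ, (∀ t, HasDerivAt F (F' t) t) → Continuous F' →
      (∀ t, F t ∈ Icc (0 : ℝ) 1) → (∃ ε, 0 < ε ∧ ∀ t, -ε ≤ t → F t = 0) →
      Integrable (fun z : Gd d => R z.1 * F z.1 * P z) ∧
      (∫ z : Gd d, R z.1 * (-F' z.1) * Q z) + c * ∫ z : Gd d, R z.1 * F z.1 * P z ≤ e := by
    rintro F F' hF hFc hF1 ⟨ε, hε, hFε⟩
    have hF'0 : ∀ t, 0 ≤ t → F' t = 0 := fun t ht => by
      refine (hF t).unique ((hasDerivAt_const t (0 : ℝ)).congr_of_eventuallyEq ?_)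
      filter_upwards [Ioi_mem_nhds (show -ε < t by linarith)] with τ hτ
      exact hFε τ (le_of_lt hτ)
    have hFC : ContDiff ℝ 1 F := contDiff_one_iff_deriv.2 ⟨fun t => (hF t).differentiableAt, by
      rwa [show deriv F = F' from funext fun t => (hF t).deriv]⟩
    have hd : ∀ t, deriv (fun t => R t * F t) t
        = stepD (q * (t + b)) * q * F t - R t * (-F' t) := fun t => by
      have h1 : HasDerivAt (fun t => R t * F t) _ t := (hR' t).mul (hF t)
      rw [h1.deriv]; ring
    have hk := key (fun t => R t * F t) (hRC.mul hFC) ?_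
      (fun t => ⟨mul_nonneg (hR01 t).1 (hF1 t).1, mul_le_one₀ (hR01 t).2 (hF1 t).1 (hF1 t).2⟩) ?_
    rotate_left
    · refine (closure_minimal (t := Icc (-b) (-ε)) (fun t ht => ?_) isClosed_Icc).trans fun t ht =>
        ⟨by linarith [ht.1], by linarith [ht.2]⟩
      by_contra hne
      refine ht ?_
      rcases lt_or_ge t (-b) with h | h
      · simp only [hRb t h.le, zero_mul]
      · simp only [hFε t (le_of_lt (not_le.1 fun h' => hne ⟨h, h'⟩)), mul_zero]
    · intro t ht
      rcases le_or_gt t (-b) with h | h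
      · simp only [hRb t h, zero_mul]
      · simp only [hFε t (by linarith [not_lt.1 fun h' => ht ⟨h, h'⟩]), mul_zero]
    refine ⟨hk.1, ?_⟩
    have hi1 : Integrable fun z : Gd d => stepD (q * (z.1 + b)) * q * F z.1 * Q z := by
      refine integrable_time_mul (k := fun t => stepD (q * (t + b)) * q * F t) hQi
        (hR'c.mul hFC.continuous) fun t ht => ?_
      rcases le_or_gt t (-b) with h | h
      · rw [hRb' t h, zero_mul]
      · rw [hFε t (by linarith [not_lt.1 fun h' => ht ⟨h, h'⟩]), mul_zero]
    have hi2 : Integrable fun z : Gd d => R z.1 * (-F' z.1) * Q z := by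
      refine integrable_time_mul (k := fun t => R t * (-F' t)) hQi
        (hRC.continuous.mul hFc.neg) fun t ht => ?_
      rcases le_or_gt t (-b) with h | h
      · rw [hRb t h, zero_mul]
      · rw [hF'0 t (not_lt.1 fun h' => ht ⟨h, h'⟩), neg_zero, mul_zero]
    have h3 : ∫ z : Gd d, deriv (fun t => R t * F t) z.1 * Q z
        = (∫ z : Gd d, stepD (q * (z.1 + b)) * q * F z.1 * Q z)
          - ∫ z : Gd d, R z.1 * (-F' z.1) * Q z := by
      rw [← integral_sub hi1 hi2]
      refine integral_congr_ae (ae_of_all _ fun z => ?_)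
      simp only [hd]; ring
    have h4 : ∫ z : Gd d, stepD (q * (z.1 + b)) * q * F z.1 * Q z ≤ q * C₀ := by
      have h5 : ∫ z in Ioo (-b) 0 ×ˢ univ, Q z ≤ C₀ := by
        rw [integral_eq_lintegral_of_nonneg_ae (ae_of_all _ hQ0) hQm.aestronglyMeasurable]
        exact ENNReal.toReal_le_of_le_ofReal hC₀ hQ
      have h6 : ∫ z : Gd d, stepD (q * (z.1 + b)) * q * F z.1 * Q z
          = ∫ z in Ioo (-b) 0 ×ˢ univ, stepD (q * (z.1 + b)) * q * F z.1 * Q z := by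
        refine (setIntegral_eq_integral_of_forall_compl_eq_zero fun z hz => ?_).symm
        have ht : z.1 ∉ Ioo (-b) 0 := fun h => hz ⟨h, mem_univ _⟩
        rcases le_or_gt z.1 (-b) with h | h
        · rw [hRb' z.1 h]; simp
        · rw [hFε z.1 (by linarith [not_lt.1 fun h' => ht ⟨h, h'⟩])]; simp
      rw [h6]
      refine le_trans (setIntegral_mono hi1.integrableOn (hQi.const_mul q) fun z => ?_) ?_
      · refine mul_le_mul_of_nonneg_right ?_ (hQ0 z)
        have h7 := stepD_nonneg (q * (z.1 + b))
        calc _ ≤ 1 * q * 1 := by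
              have := hF1 z.1
              have := stepD_le_one (q * (z.1 + b))
              gcongr
              exacts [(hF1 z.1).1, (hF1 z.1).2]
          _ = q := by ring
      · rw [integral_const_mul]; exact mul_le_mul_of_nonneg_left h5 hq0.le
    have h8 := hk.2
    rw [h3] at h8
    linarith
  constructor
  · -- slice bounds, by differentiation
    set Φ : ℝ → ℝ := (Ioo (-b) 0).indicator fun t => ∫ x, Q (t, x) with hΦ
    have hQp : Integrable Q ((volume.restrict (Ioo (-b) 0)).prod (volume : Measure (Ed d))) := by
      have := hQi
      rwa [IntegrableOn, Measure.volume_eq_prod, ← Measure.prod_restrict,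
        Measure.restrict_univ] at this
    have hΦi : Integrable Φ := (integrable_indicator_iff measurableSet_Ioo).2 hQp.integral_prod_left
    have hsl : ∀ᵐ t, t ∈ Ioo (-b) 0 → Integrable fun x => Q (t, x) :=
      (ae_restrict_iff' measurableSet_Ioo).1 hQp.prod_right_ae
    filter_upwards [ae_tendsto_mollify hΦi.locallyIntegrable, hsl] with t₁ ht hsl₁ hmem
    have hmemb : t₁ ∈ Ioo (-b) 0 := ⟨by linarith [hmem.1], hmem.2⟩
    have hlim : Φ t₁ ≤ e := by
      refine le_of_tendsto ht ?_
      have hη : 0 < min (t₁ + a) (-t₁) := lt_min (by linarith [hmem.1]) (by linarith [hmem.2])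
      filter_upwards [(tendsto_order.1 (mollifier_rOut_tendsto (V := ℝ))).2 _ hη] with n hn
      set m : ℝ → ℝ := fun t => (mollifier ℝ n).normed volume (t₁ - t) with hm
      have hmc : Continuous m :=
        ((mollifier ℝ n).contDiff_normed (n := 0)).continuous.comp (by fun_prop)
      have hm0 : ∀ t, 0 ≤ m t := fun t => (mollifier ℝ n).nonneg_normed _
      have hms : ∀ t, m t ≠ 0 → |t₁ - t| < (mollifier ℝ n).rOut := fun t ht => by
        have : t₁ - t ∈ Function.support ((mollifier ℝ n).normed volume) := ht
        rw [ContDiffBump.support_normed_eq] at this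
        simpa using this
      have hm1 : ∫ t, m t = 1 := by
        rw [hm, integral_sub_left_eq_self (fun t => (mollifier ℝ n).normed volume t)]
        exact (mollifier ℝ n).integral_normed
      have hmi : Integrable m := by
        by_contra h
        rw [integral_undef h] at hm1; norm_num at hm1
      have hn1 := hn.trans_le (min_le_left _ _)
      have hn2 := hn.trans_le (min_le_right _ _)
      have hF : ∀ t, HasDerivAt (fun t => 1 - ∫ τ in Iic t, m τ) (-m t) t := fun t => by
        have h : (fun t => 1 - ∫ τ in Iic t, m τ)
            = fun t => (1 - ∫ s in Iic (0 : ℝ), m s) - ∫ s in (0 : ℝ)..t, m s := by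
          funext t
          rw [← intervalIntegral.integral_Iic_sub_Iic hmi.integrableOn hmi.integrableOn]; ring
        rw [h]
        exact (hmc.integral_hasStrictDerivAt 0 t).hasDerivAt.const_sub _
      have hdec := (decay _ _ hF hmc.neg (fun t => ?_) ?_).2
      · have hnn : 0 ≤ c * ∫ z : Gd d, R z.1 * (1 - ∫ τ in Iic z.1, m τ) * P z := by
          refine mul_nonneg hc (integral_nonneg fun z => mul_nonneg (mul_nonneg (hR01 _).1 ?_) (hP0 z))
          rw [sub_nonneg, ← hm1]
          exact setIntegral_le_integral hmi (ae_of_all _ hm0)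
        have heq : mollify volume n Φ t₁ = ∫ z : Gd d, R z.1 * (-(-m z.1)) * Q z := by
          have e1 : ∫ z : Gd d, R z.1 * (-(-m z.1)) * Q z
              = ∫ z in Ioo (-b) 0 ×ˢ univ, m z.1 * Q z := by
            rw [← integral_indicator (measurableSet_Ioo.prod MeasurableSet.univ)]
            refine integral_congr_ae (ae_of_all _ fun z => ?_)
            by_cases hz : m z.1 = 0
            · by_cases hz' : z ∈ Ioo (-b) 0 ×ˢ univ
              · simp only [indicator_of_mem hz', hz]; simp
              · simp only [indicator_of_notMem hz', hz]; simp
            · have h1 := abs_lt.1 (hms _ hz)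
              have h2 : z ∈ Ioo (-b) 0 ×ˢ (univ : Set (Ed d)) :=
                ⟨⟨by linarith [h1.2], by linarith [h1.1]⟩, mem_univ _⟩
              simp only [indicator_of_mem h2, hRa z.1 (by linarith [h1.2]), neg_neg, one_mul]
          have hmQ : Integrable (fun z : Gd d => m z.1 * Q z)
              ((volume.restrict (Ioo (-b) 0)).prod (volume : Measure (Ed d))) := by
            obtain ⟨M, hM⟩ := ((mollifier ℝ n).contDiff_normed (μ := volume)
              (n := 0)).continuous.bounded_above_of_compact_support
              (mollifier ℝ n).hasCompactSupport_normed
            exact hQp.bdd_mul (c := M) (hmc.measurable.comp measurable_fst).aestronglyMeasurable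
              (ae_of_all _ fun z => hM _)
          rw [e1, Measure.volume_eq_prod, ← Measure.prod_restrict, Measure.restrict_univ,
            integral_prod _ hmQ]
          simp only [integral_const_mul]
          rw [← integral_indicator measurableSet_Ioo]
          have e2 : mollify volume n Φ t₁ = ∫ t, m t * Φ t := by
            unfold mollify
            rw [convolution_def, ← integral_sub_left_eq_self _ volume t₁]
            simp [hm]
          rw [e2]
          refine integral_congr_ae (ae_of_all _ fun t => ?_)
          by_cases hz : t ∈ Ioo (-b) 0
          · simp only [hΦ, indicator_of_mem hz]
          · simp only [hΦ, indicator_of_notMem hz, mul_zero]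
        rw [heq]; linarith
      · have h0 : 0 ≤ ∫ τ in Iic t, m τ := integral_nonneg hm0
        have h1 : ∫ τ in Iic t, m τ ≤ 1 := by
          rw [← hm1]; exact setIntegral_le_integral hmi (ae_of_all _ hm0)
        exact ⟨by linarith, by linarith⟩
      · refine ⟨(-t₁ - (mollifier ℝ n).rOut), by linarith, fun t ht => ?_⟩
        rw [setIntegral_eq_integral_of_forall_compl_eq_zero, hm1, sub_self]
        intro τ hτ
        by_contra hne
        have h1 := abs_lt.1 (hms _ hne)
        have h2 : t < τ := by simpa using hτ
        linarith [h1.1]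
    have hΦt : Φ t₁ = ∫ x, Q (t₁, x) := indicator_of_mem hmemb _
    rw [← ofReal_integral_eq_lintegral_ofReal (hsl₁ hmemb) (ae_of_all _ fun x => hQ0 _), ← hΦt]
    exact ENNReal.ofReal_le_ofReal hlim
  · have hU : Ioo (-a) 0 ×ˢ (univ : Set (Ed d))
        = ⋃ n : ℕ, Ioo (-a) (-(3 * (1 / ((n : ℝ) + 1)))) ×ˢ univ := by
      rw [← Set.iUnion_prod_const]
      congr 1
      ext t
      simp only [mem_Ioo, mem_iUnion]
      constructor
      · rintro ⟨h1, h2⟩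
        obtain ⟨n, hn⟩ := exists_nat_one_div_lt (show 0 < -t / 3 by linarith)
        exact ⟨n, h1, by linarith⟩
      · rintro ⟨n, h1, h2⟩
        have : 0 < 1 / ((n : ℝ) + 1) := by positivity
        exact ⟨h1, by linarith⟩
    rw [hU, setLIntegral_iUnion_of_directed, ENNReal.mul_iSup]
    · refine iSup_le fun n => ?_
      set ε := 1 / ((n : ℝ) + 1) with hε
      have hε0 : 0 < ε := by positivity
      have hF : ∀ t, HasDerivAt (fun t => stepC (-t / ε - 1)) (stepD (-t / ε - 1) * (-1 / ε)) t :=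
        fun t => by
          have h1 : HasDerivAt (fun t : ℝ => -t / ε - 1) (-1 / ε) t := by
            simpa using ((hasDerivAt_id t).neg.div_const ε).sub_const 1
          exact (hasDerivAt_stepC _).comp t h1
      obtain ⟨h1, h2⟩ := decay _ _ hF ((continuous_stepD.comp (by fun_prop)).mul continuous_const)
        (fun t => ⟨stepC_nonneg _, stepC_le_one _⟩) ⟨ε, hε0, fun t ht => stepC_of_nonpos (by
          rw [sub_nonpos, div_le_one hε0]; linarith)⟩
      have h3 : 0 ≤ ∫ z : Gd d, R z.1 * (-(stepD (-z.1 / ε - 1) * (-1 / ε))) * Q z := by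
        refine integral_nonneg fun z => mul_nonneg (mul_nonneg (hR01 _).1 ?_) (hQ0 z)
        have := stepD_nonneg (-z.1 / ε - 1)
        have h5 : -(stepD (-z.1 / ε - 1) * (-1 / ε)) = stepD (-z.1 / ε - 1) * (1 / ε) := by ring
        rw [h5]; positivity
      have h4 : ∀ z : Gd d, 0 ≤ R z.1 * stepC (-z.1 / ε - 1) * P z := fun z =>
        mul_nonneg (mul_nonneg (hR01 _).1 (stepC_nonneg _)) (hP0 z)
      calc _ ≤ ENNReal.ofReal c * ∫⁻ z : Gd d, ENNReal.ofReal (R z.1 * stepC (-z.1 / ε - 1) * P z) := by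
            refine mul_le_mul_right ?_ _
            rw [← lintegral_indicator (measurableSet_Ioo.prod MeasurableSet.univ)]
            refine lintegral_mono fun z => ?_
            by_cases hz : z ∈ Ioo (-a) (-(3 * ε)) ×ˢ (univ : Set (Ed d))
            · rw [indicator_of_mem hz, hRa z.1 hz.1.1.le, stepC_of_two_le, one_mul, one_mul]
              rw [le_sub_iff_add_le, le_div_iff₀ hε0]
              linarith [hz.1.2]
            · rw [indicator_of_notMem hz]; exact zero_le
        _ = ENNReal.ofReal (c * ∫ z : Gd d, R z.1 * stepC (-z.1 / ε - 1) * P z) := by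
            rw [ENNReal.ofReal_mul hc, ofReal_integral_eq_lintegral_ofReal h1 (ae_of_all _ h4)]
        _ ≤ ENNReal.ofReal e := ENNReal.ofReal_le_ofReal (by linarith)
    · refine Monotone.directed_le fun m n hmn => Set.prod_mono (Ioo_subset_Ioo_right ?_) subset_rfl
      gcongr

end Slices

section NearBounds

variable {s : ℝ} {u : Gd d → ℝ} {η : Ed d → ℝ} {k L b r : ℝ}

theorem lintegral_nuS_mul_fst {F : Gd d → ℝ≥0∞} (hF : Measurable F) {m : Ed d → ℝ≥0∞}
    (hm : Measurable m) :
    ∫⁻ p, F (p.1, p.2.1) * m (p.2.2 - p.2.1) ∂nuS d s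
      = (∫⁻ z, F z) * ∫⁻ h, m h * ENNReal.ofReal (kerS s h) := by
  have hk := measurable_kerS (d := d) s
  have hM : Measurable fun p : ℝ × Ed d × Ed d => F (p.1, p.2.1) * m (p.2.2 - p.2.1) := by fun_prop
  have hM2 : Measurable fun p : ℝ × Ed d × Ed d =>
      ENNReal.ofReal (kerS s (p.2.2 - p.2.1)) * (F (p.1, p.2.1) * m (p.2.2 - p.2.1)) := by fun_prop
  have hM3 : Measurable fun h : Ed d => m h * ENNReal.ofReal (kerS s h) := by fun_prop
  rw [nuS, lintegral_withDensity_eq_lintegral_mul _ (by fun_prop) hM]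
  simp only [Pi.mul_apply]
  rw [Measure.volume_eq_prod, lintegral_prod _ hM2.aemeasurable,
    Measure.volume_eq_prod ℝ (Ed d), lintegral_prod _ hF.aemeasurable,
    ← lintegral_mul_const _ (by fun_prop)]
  refine lintegral_congr fun t => ?_
  have hM4 : Measurable fun q : Ed d × Ed d =>
      ENNReal.ofReal (kerS s (q.2 - q.1)) * (F (t, q.1) * m (q.2 - q.1)) := by fun_prop
  rw [Measure.volume_eq_prod, lintegral_prod _ hM4.aemeasurable, ← lintegral_mul_const _ (by fun_prop)]
  refine lintegral_congr fun x => ?_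
  rw [← lintegral_const_mul _ hM3, ← lintegral_add_left_eq_self _ x]
  refine lintegral_congr fun h => ?_
  simp only [add_sub_cancel_left]
  ring

theorem lintegral_nuS_mul_snd {F : Gd d → ℝ≥0∞} (hF : Measurable F) {m : Ed d → ℝ≥0∞}
    (hm : Measurable m) :
    ∫⁻ p, F (p.1, p.2.2) * m (p.2.2 - p.2.1) ∂nuS d s
      = (∫⁻ z, F z) * ∫⁻ h, m h * ENNReal.ofReal (kerS s h) := by
  have hk := measurable_kerS (d := d) s
  have hM : Measurable fun p : ℝ × Ed d × Ed d => F (p.1, p.2.2) * m (p.2.2 - p.2.1) := by fun_prop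
  have hM2 : Measurable fun p : ℝ × Ed d × Ed d =>
      ENNReal.ofReal (kerS s (p.2.2 - p.2.1)) * (F (p.1, p.2.2) * m (p.2.2 - p.2.1)) := by fun_prop
  have hM3 : Measurable fun h : Ed d => m h * ENNReal.ofReal (kerS s h) := by fun_prop
  rw [nuS, lintegral_withDensity_eq_lintegral_mul _ (by fun_prop) hM]
  simp only [Pi.mul_apply]
  rw [Measure.volume_eq_prod, lintegral_prod _ hM2.aemeasurable,
    Measure.volume_eq_prod ℝ (Ed d), lintegral_prod _ hF.aemeasurable,
    ← lintegral_mul_const _ (by fun_prop)]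
  refine lintegral_congr fun t => ?_
  have hM4 : Measurable fun q : Ed d × Ed d =>
      ENNReal.ofReal (kerS s (q.2 - q.1)) * (F (t, q.2) * m (q.2 - q.1)) := by fun_prop
  rw [Measure.volume_eq_prod, lintegral_prod_symm _ hM4.aemeasurable,
    ← lintegral_mul_const _ (by fun_prop)]
  refine lintegral_congr fun y => ?_
  rw [← lintegral_const_mul _ hM3, ← lintegral_sub_left_eq_self _ y]
  refine lintegral_congr fun h => ?_
  simp only [sub_sub_cancel]
  ring

theorem lintegral_min_kerS_le :
    ∫⁻ h : Ed d, ENNReal.ofReal (min (‖h‖ ^ 2) 1) * ENNReal.ofReal (kerS s h) ≤ cS d s := by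
  rw [cS, ← lintegral_add_compl _ (measurableSet_ball (x := (0 : Ed d)) (ε := 1))]
  refine add_le_add (lintegral_mono fun h => ?_) ?_
  · rw [ENNReal.ofReal_mul (by positivity)]
    exact mul_le_mul_left (ENNReal.ofReal_le_ofReal (min_le_left _ _)) _
  · refine le_trans (lintegral_mono fun h => ?_) (le_mul_of_one_le_left' (by norm_num))
    refine mul_le_of_le_one_left' ?_
    rw [← ENNReal.ofReal_one]
    exact ENNReal.ofReal_le_ofReal (min_le_right _ _)

theorem measurableSet_cyl (b r : ℝ) : MeasurableSet (Ioo (-b) 0 ×ˢ ball (0 : Ed d) r) :=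
  measurableSet_Ioo.prod measurableSet_ball

theorem pairE_le (hη : ContDiff ℝ 1 η) (hη1 : ∀ x, η x ∈ Icc (0 : ℝ) 1) (hL1 : 1 ≤ L)
    (hL : ∀ x, ‖fderiv ℝ η x‖ ≤ L) (p : ℝ × Ed d × Ed d) :
    pairE η u k p ≤ L ^ 2 * min (‖p.2.2 - p.2.1‖ ^ 2) 1 *
      ((max (u (p.1, p.2.1) - k) 0 ^ 2 + max (u (p.1, p.2.2) - k) 0 ^ 2) / 2) := by
  unfold pairE
  set w₁ := max (u (p.1, p.2.1) - k) 0
  set w₂ := max (u (p.1, p.2.2) - k) 0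
  have h0 : |η p.2.1 - η p.2.2| ≤ L * ‖p.2.2 - p.2.1‖ := by
    have := Convex.norm_image_sub_le_of_norm_fderiv_le (f := η) (s := univ) (C := L)
      (fun x _ => hη.differentiable (by simp) x) (fun x _ => hL x) convex_univ
      (mem_univ p.2.2) (mem_univ p.2.1)
    rwa [Real.norm_eq_abs, norm_sub_rev p.2.1] at this
  have h1 : (η p.2.1 - η p.2.2) ^ 2 ≤ L ^ 2 * min (‖p.2.2 - p.2.1‖ ^ 2) 1 := by
    rw [mul_min_of_nonneg _ _ (sq_nonneg L), le_min_iff]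
    constructor
    · rw [← sq_abs, ← mul_pow]
      exact pow_le_pow_left₀ (abs_nonneg _) h0 2
    · have := hη1 p.2.1
      have := hη1 p.2.2
      nlinarith [this.1, this.2, (hη1 p.2.1).1, (hη1 p.2.1).2]
  have h2 : w₁ * w₂ ≤ (w₁ ^ 2 + w₂ ^ 2) / 2 := by nlinarith [sq_nonneg (w₁ - w₂)]
  have h3 : 0 ≤ w₁ := le_max_right _ _
  have h4 : 0 ≤ w₂ := le_max_right _ _
  exact mul_le_mul h1 h2 (by positivity) (by positivity)

theorem lintegral_pairE_le (hu : Measurable u) (hη : ContDiff ℝ 1 η)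
    (hη1 : ∀ x, η x ∈ Icc (0 : ℝ) 1) (hL1 : 1 ≤ L) (hL : ∀ x, ‖fderiv ℝ η x‖ ≤ L) :
    ∫⁻ p in pairA d b r, ENNReal.ofReal (pairE η u k p) ∂nuS d s ≤
      ENNReal.ofReal (L ^ 2) * cS d s *
        ∫⁻ z in Ioo (-b) 0 ×ˢ ball (0 : Ed d) r, ENNReal.ofReal (max (u z - k) 0 ^ 2) := by
  set F : Gd d → ℝ≥0∞ := (Ioo (-b) 0 ×ˢ ball (0 : Ed d) r).indicator
    fun z => ENNReal.ofReal (max (u z - k) 0 ^ 2) with hF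
  have hFm : Measurable F := Measurable.indicator (by fun_prop) (measurableSet_cyl b r)
  set m : Ed d → ℝ≥0∞ := fun h => ENNReal.ofReal (min (‖h‖ ^ 2) 1) with hm
  have hmm : Measurable m := by fun_prop
  set c : ℝ≥0∞ := ENNReal.ofReal (L ^ 2) * ENNReal.ofReal (1 / 2) with hc
  have hpt : ∀ p : ℝ × Ed d × Ed d,
      (pairA d b r).indicator (fun p => ENNReal.ofReal (pairE η u k p)) p ≤
      c * (F (p.1, p.2.1) * m (p.2.2 - p.2.1)) + c * (F (p.1, p.2.2) * m (p.2.2 - p.2.1)) := by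
    intro p
    by_cases hp : p ∈ pairA d b r
    swap; · rw [indicator_of_notMem hp]; exact zero_le
    have hx : (p.1, p.2.1) ∈ Ioo (-b) 0 ×ˢ ball (0 : Ed d) r := ⟨hp.1, hp.2.1⟩
    have hy : (p.1, p.2.2) ∈ Ioo (-b) 0 ×ˢ ball (0 : Ed d) r := ⟨hp.1, hp.2.2⟩
    rw [indicator_of_mem hp, hF, indicator_of_mem hx, indicator_of_mem hy]
    refine (ENNReal.ofReal_le_ofReal (pairE_le hη hη1 hL1 hL p)).trans (le_of_eq ?_)
    rw [hc, hm, ← ENNReal.ofReal_mul (by positivity), ← ENNReal.ofReal_mul (by positivity),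
      ← ENNReal.ofReal_mul (by positivity), ← ENNReal.ofReal_mul (by positivity),
      ← ENNReal.ofReal_mul (by positivity), ← ENNReal.ofReal_add (by positivity) (by positivity)]
    congr 1
    ring
  have hpm : MeasurableSet (pairA d b r) := measurableSet_pairA b r
  have hM1 : Measurable fun p : ℝ × Ed d × Ed d => F (p.1, p.2.1) * m (p.2.2 - p.2.1) := by fun_prop
  have hM2 : Measurable fun p : ℝ × Ed d × Ed d => F (p.1, p.2.2) * m (p.2.2 - p.2.1) := by fun_prop
  have hI := lintegral_indicator (μ := volume)
    (measurableSet_cyl b r) fun z : Gd d => ENNReal.ofReal (max (u z - k) 0 ^ 2)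
  rw [← lintegral_indicator hpm, ← hI]
  refine (lintegral_mono hpt).trans ?_
  rw [lintegral_add_left (hM1.const_mul c), lintegral_const_mul _ hM1, lintegral_const_mul _ hM2,
    lintegral_nuS_mul_fst hFm hmm, lintegral_nuS_mul_snd hFm hmm, ← two_mul]
  have h2 : 2 * c = ENNReal.ofReal (L ^ 2) := by
    rw [hc, ← ENNReal.ofReal_mul (by positivity), show (2 : ℝ≥0∞) = ENNReal.ofReal 2 by simp,
      ← ENNReal.ofReal_mul (by positivity)]
    congr 1; ring
  rw [← mul_assoc, h2, mul_assoc, mul_comm (cS d s)]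
  gcongr
  exact lintegral_min_kerS_le

theorem lintegral_pairE_far_le (hs : 0 < s) (hu : Measurable u) (hη1 : ∀ x, η x ∈ Icc (0 : ℝ) 1) {ρ κ : ℝ}
    (hκ : 0 < κ) (hρ : ∀ x ∉ ball (0 : Ed d) ρ, η x = 0) {M : ℝ≥0∞}
    (hM : ∀ᵐ t, t ∈ Ioo (-b) 0 → ∫⁻ x in ball (0 : Ed d) r, ENNReal.ofReal (max (u (t, x) - k) 0) ≤ M) :
    ∫⁻ p in pairA d b r \ pairA d b (ρ + κ), ENNReal.ofReal (pairE η u k p) ∂nuS d s ≤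
      ENNReal.ofReal (2 / κ ^ ((d : ℝ) + 2 * s)) * M *
        ∫⁻ z in Ioo (-b) 0 ×ˢ ball (0 : Ed d) ρ, ENNReal.ofReal (max (u z - k) 0) := by
  set W : Gd d → ℝ≥0∞ := fun z => ENNReal.ofReal (max (u z - k) 0) with hW
  have hWm : Measurable W := by fun_prop
  set F : Gd d → ℝ≥0∞ := (Ioo (-b) 0 ×ˢ ball (0 : Ed d) ρ).indicator W with hF
  have hFm : Measurable F := hWm.indicator (measurableSet_cyl b ρ)
  set H : Gd d → ℝ≥0∞ := (Ioo (-b) 0 ×ˢ ball (0 : Ed d) r).indicator W with hH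
  have hHm : Measurable H := hWm.indicator (measurableSet_cyl b r)
  set c : ℝ≥0∞ := ENNReal.ofReal (1 / κ ^ ((d : ℝ) + 2 * s)) with hc
  have hpm : MeasurableSet (pairA d b r \ pairA d b (ρ + κ)) :=
    (measurableSet_pairA b r).diff (measurableSet_pairA b _)
  have hk := measurable_kerS (d := d) s
  have hηm : ∀ p : ℝ × Ed d × Ed d, pairE η u k p ≤
      max (u (p.1, p.2.1) - k) 0 * max (u (p.1, p.2.2) - k) 0 := fun p => by
    unfold pairE
    have h1 := hη1 p.2.1
    have h2 := hη1 p.2.2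
    refine mul_le_of_le_one_left (by positivity) ?_
    nlinarith [h1.1, h1.2, h2.1, h2.2]
  have hker : ∀ h : Ed d, κ ≤ ‖h‖ → ENNReal.ofReal (kerS s h) ≤ c := fun h hh => by
    refine ENNReal.ofReal_le_ofReal ?_
    unfold kerS
    gcongr
  have hpt : ∀ p : ℝ × Ed d × Ed d, ENNReal.ofReal (kerS s (p.2.2 - p.2.1)) *
      (pairA d b r \ pairA d b (ρ + κ)).indicator (fun p => ENNReal.ofReal (pairE η u k p)) p ≤
      c * (F (p.1, p.2.1) * H (p.1, p.2.2)) + c * (F (p.1, p.2.2) * H (p.1, p.2.1)) := by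
    intro p
    by_cases hp : p ∈ pairA d b r \ pairA d b (ρ + κ)
    swap; · rw [indicator_of_notMem hp, mul_zero]; exact zero_le
    have hx : (p.1, p.2.1) ∈ Ioo (-b) 0 ×ˢ ball (0 : Ed d) r := ⟨hp.1.1, hp.1.2.1⟩
    have hy : (p.1, p.2.2) ∈ Ioo (-b) 0 ×ˢ ball (0 : Ed d) r := ⟨hp.1.1, hp.1.2.2⟩
    rw [indicator_of_mem hp, hH, indicator_of_mem hx, indicator_of_mem hy]
    have hmul : ENNReal.ofReal (pairE η u k p) ≤ W (p.1, p.2.1) * W (p.1, p.2.2) := by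
      rw [hW, ← ENNReal.ofReal_mul (le_max_right _ _)]
      exact ENNReal.ofReal_le_ofReal (hηm p)
    by_cases hxρ : p.2.1 ∈ ball (0 : Ed d) ρ
    · by_cases hyρ : p.2.2 ∈ ball (0 : Ed d) ρ
      · exact absurd ⟨hp.1.1, ball_subset_ball (by linarith) hxρ, ball_subset_ball (by linarith) hyρ⟩ hp.2
      · have h1 : κ ≤ ‖p.2.2 - p.2.1‖ := by
          have h2 : p.2.2 ∉ ball (0 : Ed d) (ρ + κ) := fun h =>
            hp.2 ⟨hp.1.1, ball_subset_ball (by linarith) hxρ, h⟩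
          rw [mem_ball_zero_iff] at h2 hxρ
          linarith [norm_sub_norm_le p.2.2 p.2.1]
        rw [hF, indicator_of_mem (show (p.1, p.2.1) ∈ Ioo (-b) 0 ×ˢ ball (0 : Ed d) ρ from ⟨hp.1.1, hxρ⟩)]
        exact le_add_right (mul_le_mul' (hker _ h1) hmul)
    · by_cases hyρ : p.2.2 ∈ ball (0 : Ed d) ρ
      · have h1 : κ ≤ ‖p.2.2 - p.2.1‖ := by
          have h2 : p.2.1 ∉ ball (0 : Ed d) (ρ + κ) := fun h =>
            hp.2 ⟨hp.1.1, h, ball_subset_ball (by linarith) hyρ⟩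
          rw [mem_ball_zero_iff] at h2 hyρ
          linarith [norm_sub_norm_le p.2.1 p.2.2, norm_sub_rev p.2.1 p.2.2]
        rw [hF, indicator_of_mem (show (p.1, p.2.2) ∈ Ioo (-b) 0 ×ˢ ball (0 : Ed d) ρ from ⟨hp.1.1, hyρ⟩)]
        refine le_add_left (mul_le_mul' (hker _ h1) ?_)
        rwa [mul_comm]
      · have : pairE η u k p = 0 := by
          unfold pairE; rw [hρ _ hxρ, hρ _ hyρ]; ring
        rw [this, ENNReal.ofReal_zero, mul_zero]; exact zero_le
  have hpEm : Measurable fun p : ℝ × Ed d × Ed d =>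
      c * (F (p.1, p.2.1) * H (p.1, p.2.2)) := by fun_prop
  have hpEm2 : Measurable fun p : ℝ × Ed d × Ed d =>
      c * (F (p.1, p.2.2) * H (p.1, p.2.1)) := by fun_prop
  have hslice : ∀ᵐ t, ∫⁻ x, H (t, x) ≤ M := by
    filter_upwards [hM] with t ht
    by_cases hb : t ∈ Ioo (-b) 0
    · refine le_trans (le_of_eq ?_) (ht hb)
      rw [← lintegral_indicator measurableSet_ball]
      refine lintegral_congr fun x => ?_
      by_cases hx : x ∈ ball (0 : Ed d) r
      · rw [hH, indicator_of_mem hx, indicator_of_mem (show (t, x) ∈ Ioo (-b) 0 ×ˢ ball (0 : Ed d) r from ⟨hb, hx⟩)]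
      · rw [hH, indicator_of_notMem hx, indicator_of_notMem fun h => hx h.2]
    · have : ∀ x, H (t, x) = 0 := fun x => indicator_of_notMem (fun h => hb h.1) _
      simp [this]
  have hone : ∫⁻ p : ℝ × Ed d × Ed d, F (p.1, p.2.1) * H (p.1, p.2.2) ≤ M * ∫⁻ z, F z := by
    rw [Measure.volume_eq_prod, lintegral_prod _ (by fun_prop), Measure.volume_eq_prod ℝ (Ed d),
      lintegral_prod _ hFm.aemeasurable, ← lintegral_const_mul _ (by fun_prop)]
    refine lintegral_mono_ae (hslice.mono fun t ht => ?_)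
    rw [Measure.volume_eq_prod, lintegral_prod _ (by fun_prop), ← lintegral_const_mul _ (by fun_prop)]
    refine lintegral_mono fun x => ?_
    simp only
    rw [lintegral_const_mul _ (by fun_prop), mul_comm]
    gcongr
  have htwo : ∫⁻ p : ℝ × Ed d × Ed d, F (p.1, p.2.2) * H (p.1, p.2.1) ≤ M * ∫⁻ z, F z := by
    rw [Measure.volume_eq_prod, lintegral_prod _ (by fun_prop), Measure.volume_eq_prod ℝ (Ed d),
      lintegral_prod _ hFm.aemeasurable, ← lintegral_const_mul _ (by fun_prop)]
    refine lintegral_mono_ae (hslice.mono fun t ht => ?_)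
    rw [Measure.volume_eq_prod, lintegral_prod_symm _ (by fun_prop),
      ← lintegral_const_mul _ (by fun_prop)]
    refine lintegral_mono fun x => ?_
    simp only
    rw [lintegral_const_mul _ (by fun_prop), mul_comm]
    gcongr
  have hI := lintegral_indicator (μ := volume) (measurableSet_cyl (d := d) b ρ) W
  rw [← lintegral_indicator hpm, ← hI, nuS]
  refine (lintegral_withDensity_le_lintegral_mul _ (by fun_prop) _).trans ?_
  refine (lintegral_mono hpt).trans ?_
  rw [lintegral_add_left hpEm, lintegral_const_mul _ (by fun_prop), lintegral_const_mul _ (by fun_prop)]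
  have h2 : ENNReal.ofReal (2 / κ ^ ((d : ℝ) + 2 * s)) = c + c := by
    rw [hc, ← ENNReal.ofReal_add (by positivity) (by positivity)]
    congr 1; ring
  rw [h2, mul_assoc, add_mul]
  gcongr

end NearBounds

section EnergySlices

variable {s Λ : ℝ} {ν : Measure (ℝ × Ed d × Ed d)} {v : Gd d → ℝ} {Dv a : Gd d → Ed d}
  {ρ r : ℝ} {g : ℝ → ℝ} {η : Ed d → ℝ}

theorem USol.energy_slices (U : USol s Λ v Dv a ν) (hd : 1 ≤ d) (hs : s ∈ Ioo (0 : ℝ) 1)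
    (hΛ : 1 ≤ Λ) (S : TailShift s ν v ρ r g) (hr0 : 0 < r) (hρr : ρ < r) (hr : r ≤ 1)
    {k : ℝ} (hk : 0 ≤ k) {δ : ℝ} (hδ : 0 < δ) (hη : ContDiff ℝ 1 η) (hηt : tsupport η ⊆ ball 0 ρ)
    (hη1 : ∀ x, η x ∈ Icc (0 : ℝ) 1) {L : ℝ} (hL : ∀ x, ‖fderiv ℝ η x‖ ≤ L) {b b₁ : ℝ}
    (hb₁ : 0 < b₁) (hbb : b₁ < b) (hb : b < 1) {E : ℝ} (hE0 : 0 ≤ E)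
    (hE : errE s Λ L η (shiftT v g) k b ρ r + ENNReal.ofReal (1 / (b - b₁)) *
      (∫⁻ z in Ioo (-b) 0 ×ˢ ball (0 : Ed d) ρ, ENNReal.ofReal (max (shiftT v g z - k) 0 ^ 2))
      ≤ ENNReal.ofReal E) :
    (∀ᵐ t, t ∈ Ioo (-b₁) 0 →
      ∫⁻ x, ENNReal.ofReal (η x ^ 2 * quadT δ (shiftT v g (t, x) - k)) ≤ ENNReal.ofReal E) ∧
    ∫⁻ z in Ioo (-b₁) 0 ×ˢ univ,
        ENNReal.ofReal (η z.2 ^ 2 * (heav δ (shiftT v g z - k) * ‖Dv z‖ ^ 2))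
      ≤ ENNReal.ofReal (2 * Λ * E) := by
  set u := shiftT v g with hu
  have hum : Measurable u := measurable_shiftT U.mv S.int
  set W := ∫⁻ z in Ioo (-b) 0 ×ˢ ball (0 : Ed d) ρ, ENNReal.ofReal (max (u z - k) 0 ^ 2) with hW
  have hbb' : 0 < b - b₁ := by linarith
  have he1 : errE s Λ L η u k b ρ r ≠ ⊤ := ((le_self_add.trans hE).trans_lt ENNReal.ofReal_lt_top).ne
  have he2 : ENNReal.ofReal (1 / (b - b₁)) * W ≠ ⊤ :=
    ((le_add_self.trans hE).trans_lt ENNReal.ofReal_lt_top).ne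
  have hWt : W ≠ ⊤ := fun h => he2 (by
    rw [h, ENNReal.mul_top]
    simpa using hbb)
  set B := (errE s Λ L η u k b ρ r).toReal with hB
  have hsum : B + 2 / (b - b₁) * (W.toReal / 2) ≤ E := by
    have h1 := ENNReal.toReal_le_of_le_ofReal hE0 hE
    rw [ENNReal.toReal_add he1 he2, ENNReal.toReal_mul, ENNReal.toReal_ofReal (by positivity)] at h1
    refine le_trans (le_of_eq ?_) h1
    ring
  have hqm : Measurable fun z => quadT δ (u z - k) :=
    continuous_quadT.measurable.comp (hum.sub_const k)
  have hhm : Measurable fun z => heav δ (u z - k) :=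
    continuous_heav.measurable.comp (hum.sub_const k)
  have hηm : Measurable fun z : Gd d => η z.2 ^ 2 :=
    (hη.continuous.measurable.comp measurable_snd).pow_const 2
  have hQb : ∫⁻ z in Ioo (-b) 0 ×ˢ univ, ENNReal.ofReal (η z.2 ^ 2 * quadT δ (u z - k))
      ≤ ENNReal.ofReal (W.toReal / 2) := by
    have h2 : ENNReal.ofReal (W.toReal / 2) = ENNReal.ofReal (1 / 2) * W := by
      rw [div_eq_inv_mul, ENNReal.ofReal_mul (by norm_num), ENNReal.ofReal_toReal hWt, one_div]
    have hm : Measurable fun z => ENNReal.ofReal (max (u z - k) 0 ^ 2) := by fun_prop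
    rw [h2, hW, ← lintegral_const_mul _ hm, ← lintegral_indicator (measurableSet_cyl b ρ),
      ← lintegral_indicator (measurableSet_Ioo.prod MeasurableSet.univ)]
    refine lintegral_mono fun z => ?_
    by_cases hz : z ∈ Ioo (-b) 0 ×ˢ ball (0 : Ed d) ρ
    · rw [indicator_of_mem hz, indicator_of_mem (show z ∈ Ioo (-b) 0 ×ˢ (univ : Set (Ed d)) from
        ⟨hz.1, mem_univ _⟩), ← ENNReal.ofReal_mul (by norm_num)]
      refine ENNReal.ofReal_le_ofReal ?_
      have h3 := quadT_le hδ (u z - k)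
      have h4 := quadT_nonneg hδ (u z - k)
      have h5 : η z.2 ^ 2 ≤ 1 := pow_le_one₀ (hη1 _).1 (hη1 _).2
      nlinarith
    · by_cases hz1 : z ∈ Ioo (-b) 0 ×ˢ (univ : Set (Ed d))
      · have hη0 : η z.2 = 0 := image_eq_zero_of_notMem_tsupport fun h => hz ⟨hz1.1, hηt h⟩
        rw [indicator_of_mem hz1, hη0]; simp
      · rw [indicator_of_notMem hz1]; exact zero_le
  have hΛ0 : 0 < Λ := by linarith
  obtain ⟨h1, h2⟩ := slices_of_cutoff (Q := fun z : Gd d => η z.2 ^ 2 * quadT δ (u z - k))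
    (P := fun z : Gd d => η z.2 ^ 2 * (heav δ (u z - k) * ‖Dv z‖ ^ 2)) (a := b₁) (b := b)
    (c := (2 * Λ)⁻¹) (B := B) (hηm.mul hqm) (hηm.mul (hhm.mul (U.mD.norm.pow_const 2)))
    (fun z => mul_nonneg (sq_nonneg _) (quadT_nonneg hδ _))
    (fun z => mul_nonneg (sq_nonneg _) (mul_nonneg (heav_nonneg hδ _) (sq_nonneg _)))
    hb₁ hbb hb (by positivity) (by positivity) hQb fun θ hθ hθt hθ1 hθb => by
      obtain ⟨h3, h4⟩ := U.energy_of_cutoff hd hs hΛ S hr0 hρr hr hk hδ hη hηt hη1 hL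
        ENNReal.toReal_nonneg (ENNReal.ofReal_toReal he1).ge hθ hθt hθ1 hθb
      have e : ∀ z : Gd d, cutTX θ η z * (heav δ (u z - k) * ‖Dv z‖ ^ 2)
          = θ z.1 * (η z.2 ^ 2 * (heav δ (u z - k) * ‖Dv z‖ ^ 2)) := fun z => by
        unfold cutTX; ring
      rw [← hu] at h3 h4
      simp only [e] at h3 h4
      exact ⟨h3, h4⟩
  have hsumE := ENNReal.ofReal_le_ofReal hsum
  refine ⟨h1.mono fun t ht hm => (ht hm).trans hsumE, ?_⟩
  have h3 := h2.trans hsumE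
  rw [ENNReal.ofReal_mul (by positivity)]
  calc _ = ENNReal.ofReal (2 * Λ) * (ENNReal.ofReal (2 * Λ)⁻¹ * ∫⁻ z in Ioo (-b₁) 0 ×ˢ univ,
        ENNReal.ofReal (η z.2 ^ 2 * (heav δ (u z - k) * ‖Dv z‖ ^ 2))) := by
        rw [← mul_assoc, ← ENNReal.ofReal_mul (by positivity), mul_inv_cancel₀ (by positivity),
          ENNReal.ofReal_one, one_mul]
    _ ≤ _ := by gcongr

end EnergySlices

section TruncatedFaberKrahn

variable {s Λ : ℝ} {ν : Measure (ℝ × Ed d × Ed d)} {v : Gd d → ℝ} {Dv a : Gd d → Ed d}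
  {g : ℝ → ℝ} {η : Ed d → ℝ}

theorem sq_norm_smul_add_le {V : Type*} [NormedAddCommGroup V] [NormedSpace ℝ V] {w h m e L : ℝ}
    (hw : 0 ≤ w) (hh0 : 0 ≤ h) (hhw : h ≤ w) (hm0 : 0 ≤ m) (hm1 : m ≤ 1) {X Y : V}
    (hX : ‖X‖ ≤ L) :
    ‖h • X + (e * m) • Y‖ ^ 2 ≤ 2 * (L ^ 2 * w ^ 2) + 2 * (e ^ 2 * (m * ‖Y‖ ^ 2)) := by
  have h1 : ‖h • X + (e * m) • Y‖ ≤ w * L + |e| * m * ‖Y‖ := by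
    refine (norm_add_le _ _).trans (add_le_add ?_ (le_of_eq ?_))
    · rw [norm_smul, Real.norm_of_nonneg hh0]
      exact mul_le_mul hhw hX (norm_nonneg _) hw
    · rw [norm_smul, Real.norm_eq_abs, abs_mul, abs_of_nonneg hm0]
  have hm2 : m ^ 2 ≤ m := by nlinarith
  calc _ ≤ (w * L + |e| * m * ‖Y‖) ^ 2 := pow_le_pow_left₀ (norm_nonneg _) h1 2
    _ ≤ 2 * (L ^ 2 * w ^ 2) + 2 * (|e| ^ 2 * (m ^ 2 * ‖Y‖ ^ 2)) := by
        nlinarith [sq_nonneg (w * L - |e| * m * ‖Y‖)]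
    _ ≤ _ := by rw [sq_abs]; gcongr

theorem USol.lintegral_rampT_sq_le (U : USol s Λ v Dv a ν) (hd : 2 ≤ d) (hg : Integrable g)
    (hη : ContDiff ℝ 1 η) (hηt : tsupport η ⊆ ball 0 1) {L : ℝ} (hL : ∀ x, ‖fderiv ℝ η x‖ ≤ L)
    {k δ : ℝ} (hδ : 0 < δ) {b : ℝ} (hb : b ≤ 1) {m : ℝ≥0∞} (hmt : m ≠ ⊤)
    (hm : ∀ᵐ t, t ∈ Ioo (-b) 0 → volume {x | η x ≠ 0 ∧ k < shiftT v g (t, x)} ≤ m) :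
    ∫⁻ z in Ioo (-b) 0 ×ˢ univ, ENNReal.ofReal ((η z.2 * rampT δ (shiftT v g z - k)) ^ 2) ≤
      cFK d ^ 2 * m ^ (2 / (d : ℝ)) *
        (ENNReal.ofReal (2 * L ^ 2) * (∫⁻ z in Ioo (-b) 0 ×ˢ tsupport η,
            ENNReal.ofReal (max (shiftT v g z - k) 0 ^ 2))
          + ENNReal.ofReal 2 * ∫⁻ z in Ioo (-b) 0 ×ˢ univ,
            ENNReal.ofReal (η z.2 ^ 2 * (heav δ (shiftT v g z - k) * ‖Dv z‖ ^ 2))) := by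
  set u := shiftT v g with hu
  have hum : Measurable u := measurable_shiftT U.mv hg
  obtain ⟨f, F, hfm, hf2, hF2, hfc, hfw, hfK⟩ := U.exists_extension hg
  obtain ⟨θ, hθs, hθc, -, hθ1, -⟩ := exists_smooth_cutoff (V := ℝ) (isCompact_Icc (a := (-1 : ℝ))
    (b := 0)) isOpen_univ (subset_univ _)
  have hθ : ∀ t ∈ Icc (-1 : ℝ) 0, θ t = 1 := fun t ht => hθ1.self_of_nhdsSet t ht
  set Z : Gd d → ℝ := fun z => θ z.1 * η z.2 with hZ
  have hZC : ContDiff ℝ 1 Z :=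
    ((hθs.of_le (by exact_mod_cast le_top)).comp contDiff_fst).mul (hη.comp contDiff_snd)
  have hZt : tsupport Z ⊆ tsupport θ ×ˢ tsupport η := by
    refine closure_minimal (fun z hz => ⟨subset_tsupport _ ?_, subset_tsupport _ ?_⟩)
      ((isClosed_tsupport _).prod (isClosed_tsupport _))
    · intro h; exact hz (by simp [hZ, h])
    · intro h; exact hz (by simp [hZ, h])
  have hηc : HasCompactSupport η := hasCompactSupport_of_tsupport_subset isBounded_ball hηt
  have hZc : HasCompactSupport Z :=
    IsCompact.of_isClosed_subset (hθc.isCompact.prod hηc.isCompact) (isClosed_tsupport _) hZt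
  set h : ℝ → ℝ := fun u => rampT δ (u - k) with hh
  set h' : ℝ → ℝ := fun u => heav δ (u - k) with hh'
  have hfl := locallyIntegrable_of_memLp_two hf2
  have hFl := locallyIntegrable_of_memLp_two hF2
  have hgfn : ∀ n, gx (mollify volume n f) = mollify volume n F := fun n =>
    funext fun z => gx_mollify_of_weak hfl hFl hfw n z
  have hW : SobW (fun z => Z z * h (f z)) (chainGrad Z h h' f F) :=
    SobW.mul_comp hZC hZc
      (fun u => by simpa [Function.comp_def] using (hasDerivAt_rampT hδ (u - k)).comp_sub_const u k)
      (fun u => abs_le.2 ⟨by linarith [heav_nonneg hδ (u - k)], heav_le_one hδ _⟩)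
      (continuous_heav.comp (continuous_id.sub continuous_const)) hfm hF2
      (fun n => (contDiff_mollify hfl n).of_le (by exact_mod_cast le_top))
      (tendsto_eLpNorm_mollify_sub hf2)
      (by simp only [hgfn]; exact tendsto_eLpNorm_mollify_sub hF2) (ae_tendsto_mollify hfl)
  have hval : ∀ z : Gd d, z.1 ∈ Ioo (-b) 0 → Z z = η z.2 := fun z hz => by
    simp only [hZ]
    rw [hθ _ ⟨by linarith [hz.1], hz.2.le⟩, one_mul]
  have hfu : ∀ z : Gd d, z.1 ∈ Ioo (-b) 0 → z.2 ∈ tsupport η → f z = u z ∧ F z = Dv z :=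
    fun z hz hz2 => hfK z ⟨⟨by linarith [hz.1], hz.2.le⟩, ball_subset_closedBall (hηt hz2)⟩
  have hgxZ : ∀ z : Gd d, z.1 ∈ Ioo (-b) 0 → ‖gx Z z‖ ≤ L := fun z hz => by
    have h1 := fderiv_slice_enorm hZC z.1 z.2
    have h2 : (fun x => Z (z.1, x)) = η := funext fun x => hval (z.1, x) hz
    rw [h2] at h1
    have h3 : ‖gx Z z‖ = ‖fderiv ℝ η z.2‖ := by
      rw [← toReal_enorm, ← toReal_enorm, h1]
    rw [h3]; exact hL _
  have hmS : ∀ᵐ t ∂(volume.restrict (Ioo (-b) 0)),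
      volume {x | (fun z => Z z * h (f z)) (t, x) ≠ 0} ≤ m := by
    rw [ae_restrict_iff' measurableSet_Ioo]
    filter_upwards [hm] with t ht hmem
    refine (measure_mono fun x hx => ?_).trans (ht hmem)
    simp only [mem_ofPred_eq] at hx ⊢
    rw [hval (t, x) hmem] at hx
    have hη0 : η x ≠ 0 := left_ne_zero_of_mul hx
    refine ⟨hη0, ?_⟩
    rw [← (hfu (t, x) hmem (subset_tsupport _ hη0)).1]
    by_contra hle
    exact right_ne_zero_of_mul hx (trunc_of_nonpos hδ (by linarith)).2.1
  have key := hW.eLpNorm_le_of_volume_support_le hd hmt hmS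
  have key2 := pow_le_pow_left₀ zero_le key 2
  have hvol : (volume.restrict (Ioo (-b) 0)).prod (volume : Measure (Ed d))
      = (volume : Measure (Gd d)).restrict (Ioo (-b) 0 ×ˢ univ) := by
    rw [Measure.volume_eq_prod, ← Measure.prod_restrict, Measure.restrict_univ]
  have hSm : MeasurableSet (Ioo (-b) 0 ×ˢ (univ : Set (Ed d))) :=
    measurableSet_Ioo.prod MeasurableSet.univ
  rw [mul_pow, mul_pow, eLpNorm_two_sq, eLpNorm_two_sq, hvol, ← ENNReal.rpow_natCast (m ^ _),
    ← ENNReal.rpow_mul] at key2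
  have hexp : 1 / (d : ℝ) * ((2 : ℕ) : ℝ) = 2 / (d : ℝ) := by push_cast; ring
  rw [hexp] at key2
  have hleft : ∫⁻ z in Ioo (-b) 0 ×ˢ univ, ENNReal.ofReal ((η z.2 * rampT δ (u z - k)) ^ 2)
      = ∫⁻ z in Ioo (-b) 0 ×ˢ univ, ‖Z z * h (f z)‖ₑ ^ 2 := by
    refine setLIntegral_congr_fun hSm fun z hz => ?_
    rw [enorm_sq_eq, hval z hz.1]
    by_cases hη0 : η z.2 = 0
    · rw [hη0]; simp
    · rw [(hfu z hz.1 (subset_tsupport _ hη0)).1]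
  have hhm : Measurable fun z => ENNReal.ofReal (max (u z - k) 0 ^ 2) := by fun_prop
  have hTm : MeasurableSet (Ioo (-b) 0 ×ˢ tsupport η) :=
    measurableSet_Ioo.prod (isClosed_tsupport _).measurableSet
  rw [hleft]
  refine key2.trans (mul_le_mul_right ?_ _)
  have hPm : Measurable fun z : Gd d =>
      ENNReal.ofReal (η z.2 ^ 2 * (heav δ (u z - k) * ‖Dv z‖ ^ 2)) :=
    (((hη.continuous.measurable.comp measurable_snd).pow_const 2).mul
      ((continuous_heav.measurable.comp (hum.sub_const k)).mul (U.mD.norm.pow_const 2))).ennreal_ofReal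
  rw [← lintegral_const_mul _ hhm, ← lintegral_const_mul _ hPm, ← lintegral_indicator hTm,
    ← lintegral_indicator hSm, ← lintegral_indicator hSm,
    ← lintegral_add_right _ ((hPm.const_mul _).indicator hSm)]
  refine lintegral_mono fun z => ?_
  by_cases hz : z ∈ Ioo (-b) 0 ×ˢ (univ : Set (Ed d))
  swap; · rw [indicator_of_notMem hz]; exact zero_le
  rw [indicator_of_mem hz, indicator_of_mem hz]
  by_cases hz2 : z.2 ∈ tsupport η
  swap
  · rw [chainGrad_eq_zero fun h => hz2 (hZt h).2]; simp
  rw [indicator_of_mem (show z ∈ Ioo (-b) 0 ×ˢ tsupport η from ⟨hz.1, hz2⟩),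
    ← ENNReal.ofReal_mul (by positivity),
    ← ENNReal.ofReal_mul (by positivity), ← ofReal_norm, ← ENNReal.ofReal_pow (norm_nonneg _),
    ← ENNReal.ofReal_add (by positivity) (mul_nonneg (by norm_num) (mul_nonneg (sq_nonneg _)
      (mul_nonneg (heav_nonneg hδ _) (sq_nonneg _))))]
  refine ENNReal.ofReal_le_ofReal ?_
  rw [chainGrad, hval z hz.1, (hfu z hz.1 hz2).1, (hfu z hz.1 hz2).2]
  refine (sq_norm_smul_add_le (le_max_right _ _) (rampT_nonneg hδ _) (rampT_le hδ (u z - k))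
    (heav_nonneg hδ _) (heav_le_one hδ _) (hgxZ z hz.1)).trans (le_of_eq ?_)
  ring

end TruncatedFaberKrahn

section Step

variable {s Λ : ℝ} {ν : Measure (ℝ × Ed d × Ed d)} {v : Gd d → ℝ} {Dv a : Gd d → Ed d}
  {g : ℝ → ℝ} {η : Ed d → ℝ}

theorem one_div_rpow_le {κ D : ℝ} (hκ : 0 < κ) (hκ1 : κ ≤ 1) (hD : 1 / κ ≤ D) {s : ℝ}
    (hs : s ≤ 1) (n : ℕ) : 1 / κ ^ ((n : ℝ) + 2 * s) ≤ D ^ (n + 2) := by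
  have h1 : κ ^ (n + 2) ≤ κ ^ ((n : ℝ) + 2 * s) := by
    rw [← Real.rpow_natCast]
    refine Real.rpow_le_rpow_of_exponent_ge hκ hκ1 ?_
    push_cast; linarith
  calc 1 / κ ^ ((n : ℝ) + 2 * s) ≤ 1 / κ ^ (n + 2) := by gcongr
    _ = (1 / κ) ^ (n + 2) := by rw [div_pow, one_pow]
    _ ≤ D ^ (n + 2) := by gcongr

variable (d) in
/-- The constant in the Caccioppoli inequality. -/
def cCac (s Λ : ℝ) : ℝ := 2 * Λ ^ 3 + Λ * (cS d s).toReal + 2 * Λ + 1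

theorem cCac_nonneg (hΛ : 0 ≤ Λ) : 0 ≤ cCac d s Λ := by unfold cCac; positivity

theorem errE_add_le {u : Gd d → ℝ} (hu : Measurable u) (hd : 1 ≤ d) (hs : s ∈ Ioo (0 : ℝ) 1)
    (hΛ : 1 ≤ Λ) {ρ κ r b b₁ k δ D M Y : ℝ} (hκ : 0 < κ) (hκ1 : κ ≤ 1) (hδ : 0 < δ)
    (hη : ContDiff ℝ 1 η) (hη1 : ∀ x, η x ∈ Icc (0 : ℝ) 1) (hηρ : ∀ x ∉ ball (0 : Ed d) ρ, η x = 0)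
    (hD : 1 ≤ D) (hL : ∀ x, ‖fderiv ℝ η x‖ ≤ D) (hκD : 1 / κ ≤ D) (hbb : b₁ < b)
    (hbD : 1 / (b - b₁) ≤ D) (hM0 : 0 ≤ M) (hk : 0 ≤ k)
    (hM : ∀ᵐ t, t ∈ Ioo (-b) 0 →
      ∫⁻ x in ball (0 : Ed d) r, ENNReal.ofReal (max (u (t, x)) 0) ≤ ENNReal.ofReal M)
    (hMδ : M ≤ D * δ) (hY0 : 0 ≤ Y)
    (hY : ∫⁻ z in Ioo (-b) 0 ×ˢ ball (0 : Ed d) (ρ + κ), ENNReal.ofReal (max (u z - k) 0 ^ 2)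
      ≤ ENNReal.ofReal Y) :
    errE s Λ D η u (k + δ) b ρ r + ENNReal.ofReal (1 / (b - b₁)) *
      (∫⁻ z in Ioo (-b) 0 ×ˢ ball (0 : Ed d) ρ, ENNReal.ofReal (max (u z - (k + δ)) 0 ^ 2))
      ≤ ENNReal.ofReal (cCac d s Λ * D ^ (d + 3) * Y) := by
  have hΛ0 : 0 ≤ Λ := by linarith
  have hbb' : 0 < b - b₁ := by linarith
  have hsub : Ioo (-b) 0 ×ˢ ball (0 : Ed d) ρ ⊆ Ioo (-b) 0 ×ˢ ball (0 : Ed d) (ρ + κ) :=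
    Set.prod_mono subset_rfl (ball_subset_ball (by linarith))
  have hW1 : ∫⁻ z in Ioo (-b) 0 ×ˢ ball (0 : Ed d) (ρ + κ),
      ENNReal.ofReal (max (u z - (k + δ)) 0 ^ 2) ≤ ENNReal.ofReal Y := by
    refine (lintegral_mono fun z => ENNReal.ofReal_le_ofReal ?_).trans hY
    gcongr
    linarith
  have hW2 := (lintegral_mono_set (μ := volume)
    (f := fun z => ENNReal.ofReal (max (u z - (k + δ)) 0 ^ 2)) hsub).trans hW1
  have hW3 : ∫⁻ z in Ioo (-b) 0 ×ˢ ball (0 : Ed d) ρ, ENNReal.ofReal (max (u z - (k + δ)) 0)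
      ≤ ENNReal.ofReal (1 / δ * Y) := by
    have hm : Measurable fun z => ENNReal.ofReal (max (u z - k) 0 ^ 2) := by fun_prop
    refine (lintegral_mono_set hsub).trans ?_
    rw [ENNReal.ofReal_mul (by positivity)]
    refine le_trans ?_ (mul_le_mul_right hY _)
    rw [← lintegral_const_mul _ hm]
    refine lintegral_mono fun z => ?_
    rw [← ENNReal.ofReal_mul (by positivity)]
    refine ENNReal.ofReal_le_ofReal (max_le ?_ (by positivity))
    rw [one_div_mul_eq_div, le_div_iff₀ hδ]
    rcases le_total (u z) k with h | h
    · have h0 : max (u z - k) 0 = 0 := max_eq_right (by linarith)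
      rw [h0]; nlinarith
    · rw [max_eq_left (by linarith)]; nlinarith [sq_nonneg (u z - k - 2 * δ)]
  have hMk : ∀ᵐ t, t ∈ Ioo (-b) 0 →
      ∫⁻ x in ball (0 : Ed d) r, ENNReal.ofReal (max (u (t, x) - (k + δ)) 0) ≤ ENNReal.ofReal M := by
    filter_upwards [hM] with t ht hmem
    refine (lintegral_mono fun x => ENNReal.ofReal_le_ofReal ?_).trans (ht hmem)
    gcongr
    linarith
  have hcS : cS d s = ENNReal.ofReal (cS d s).toReal :=
    (ENNReal.ofReal_toReal (cS_lt_top hd hs).ne).symm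
  have hnear : ∫⁻ p in pairA d b r, ENNReal.ofReal (pairE η u (k + δ) p) ∂nuS d s ≤
      ENNReal.ofReal (D ^ 2 * (cS d s).toReal * Y + 2 * D ^ (d + 2) * M * (1 / δ * Y)) := by
    calc ∫⁻ p in pairA d b r, ENNReal.ofReal (pairE η u (k + δ) p) ∂nuS d s
        ≤ ∫⁻ p in pairA d b (ρ + κ) ∪ (pairA d b r \ pairA d b (ρ + κ)),
          ENNReal.ofReal (pairE η u (k + δ) p) ∂nuS d s :=
          lintegral_mono_set (by rw [union_sdiff_self]; exact subset_union_right)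
      _ ≤ _ := lintegral_union_le _ _ _
      _ ≤ ENNReal.ofReal (D ^ 2) * cS d s * ENNReal.ofReal Y
          + ENNReal.ofReal (2 / κ ^ ((d : ℝ) + 2 * s)) * ENNReal.ofReal M
            * ENNReal.ofReal (1 / δ * Y) := by
          refine add_le_add ((lintegral_pairE_le hu hη hη1 hD hL).trans ?_)
            ((lintegral_pairE_far_le hs.1 hu hη1 hκ hηρ hMk).trans ?_)
          · exact mul_le_mul_right hW1 _
          · exact mul_le_mul_right hW3 _
      _ = ENNReal.ofReal (D ^ 2 * (cS d s).toReal * Y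
          + 2 / κ ^ ((d : ℝ) + 2 * s) * M * (1 / δ * Y)) := by
          rw [hcS, ENNReal.toReal_ofReal ENNReal.toReal_nonneg, ← ENNReal.ofReal_mul (by positivity),
            ← ENNReal.ofReal_mul (by positivity), ← ENNReal.ofReal_mul (by positivity),
            ← ENNReal.ofReal_mul (by positivity),
            ← ENNReal.ofReal_add (by positivity) (by positivity)]
      _ ≤ _ := by
          refine ENNReal.ofReal_le_ofReal ?_
          have := one_div_rpow_le hκ hκ1 hκD hs.2.le d
          have h2 : 2 / κ ^ ((d : ℝ) + 2 * s) ≤ 2 * D ^ (d + 2) := by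
            rw [← mul_one_div]; gcongr
          gcongr
  unfold errE
  calc _ ≤ ENNReal.ofReal (2 * Λ ^ 3 * D ^ 2) * ENNReal.ofReal Y + ENNReal.ofReal Λ *
        ENNReal.ofReal (D ^ 2 * (cS d s).toReal * Y + 2 * D ^ (d + 2) * M * (1 / δ * Y))
        + ENNReal.ofReal (1 / (b - b₁)) * ENNReal.ofReal Y :=
        add_le_add (add_le_add (mul_le_mul_right hW2 _) (mul_le_mul_right hnear _))
          (mul_le_mul_right hW2 _)
    _ = ENNReal.ofReal (2 * Λ ^ 3 * D ^ 2 * Y + Λ * (D ^ 2 * (cS d s).toReal * Y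
        + 2 * D ^ (d + 2) * M * (1 / δ * Y)) + 1 / (b - b₁) * Y) := by
        rw [← ENNReal.ofReal_mul (by positivity), ← ENNReal.ofReal_mul (by positivity),
          ← ENNReal.ofReal_mul (by positivity), ← ENNReal.ofReal_add (by positivity) (by positivity),
          ← ENNReal.ofReal_add (by positivity) (by positivity)]
    _ ≤ _ := by
        refine ENNReal.ofReal_le_ofReal ?_
        have hc0 : 0 ≤ (cS d s).toReal := ENNReal.toReal_nonneg
        set c := (cS d s).toReal
        have h1 : D ^ 2 ≤ D ^ (d + 3) := pow_le_pow_right₀ hD (by omega)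
        have h2 : D ≤ D ^ (d + 3) := le_self_pow₀ hD (by omega)
        have h3 : M * (1 / δ * Y) ≤ D * Y := by
          have : M * (1 / δ) ≤ D := by rw [mul_one_div, div_le_iff₀ hδ]; exact hMδ
          calc M * (1 / δ * Y) = M * (1 / δ) * Y := by ring
            _ ≤ D * Y := by gcongr
        calc 2 * Λ ^ 3 * D ^ 2 * Y + Λ * (D ^ 2 * c * Y + 2 * D ^ (d + 2) * M * (1 / δ * Y))
              + 1 / (b - b₁) * Y
            = 2 * Λ ^ 3 * Y * D ^ 2 + Λ * c * Y * D ^ 2 + Λ * 2 * D ^ (d + 2) * (M * (1 / δ * Y))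
              + 1 / (b - b₁) * Y := by ring
          _ ≤ 2 * Λ ^ 3 * Y * D ^ (d + 3) + Λ * c * Y * D ^ (d + 3)
              + Λ * 2 * D ^ (d + 2) * (D * Y) + D ^ (d + 3) * Y := by
              gcongr
              exact hbD.trans h2
          _ = cCac d s Λ * D ^ (d + 3) * Y := by unfold cCac; ring

end Step

section DeGiorgiStep

variable {s Λ : ℝ} {ν : Measure (ℝ × Ed d × Ed d)} {v : Gd d → ℝ} {Dv a : Gd d → Ed d}
  {g : ℝ → ℝ}

theorem one_le_cCac (hΛ : 1 ≤ Λ) : 1 ≤ cCac d s Λ := by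
  have : 0 ≤ (cS d s).toReal := ENNReal.toReal_nonneg
  have : 0 ≤ Λ := by linarith
  unfold cCac
  have : 0 ≤ 2 * Λ ^ 3 + Λ * (cS d s).toReal + 2 * Λ := by positivity
  linarith

/-- One step of the De Giorgi iteration. -/
theorem USol.degiorgi_step (U : USol s Λ v Dv a ν) (hd : 2 ≤ d) (hs : s ∈ Ioo (0 : ℝ) 1)
    (hΛ : 1 ≤ Λ) {ρ r : ℝ} (S : TailShift s ν v ρ r g) (hr : r ≤ 1) (hρr : ρ < r) {ρ₀ ρ₁ : ℝ}
    (h1 : 0 < ρ₁) (h10 : ρ₁ < ρ₀) (h0 : ρ₀ ≤ ρ) {k δ D M Y : ℝ} (hk : 0 ≤ k) (hδ : 0 < δ)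
    (hD : 16 / (ρ₀ - ρ₁) ≤ D) (hM0 : 0 ≤ M)
    (hM : ∀ᵐ t, t ∈ Ioo (-ρ₀) 0 → ∫⁻ x in ball (0 : Ed d) r,
      ENNReal.ofReal (max (shiftT v g (t, x)) 0) ≤ ENNReal.ofReal M)
    (hMδ : M ≤ D * δ) (hY0 : 0 ≤ Y)
    (hY : ∫⁻ z in Ioo (-ρ₀) 0 ×ˢ ball (0 : Ed d) ρ₀,
      ENNReal.ofReal (max (shiftT v g z - k) 0 ^ 2) ≤ ENNReal.ofReal Y) :
    ∫⁻ z in Ioo (-ρ₁) 0 ×ˢ ball (0 : Ed d) ρ₁,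
        ENNReal.ofReal (max (shiftT v g z - (k + 4 * δ)) 0 ^ 2) ≤
      cFK d ^ 2 * ENNReal.ofReal (2 * (cCac d s Λ * D ^ (d + 3) * Y) / δ ^ 2) ^ (2 / (d : ℝ)) *
        ENNReal.ofReal ((8 + 4 * Λ) * (cCac d s Λ * D ^ (d + 3) * Y)) := by
  set Δ := ρ₀ - ρ₁ with hΔ
  have hΔ0 : 0 < Δ := by linarith
  have hΔ1 : Δ ≤ 1 := by linarith
  have hD16 : 16 ≤ D := by
    refine le_trans ?_ hD
    rw [le_div_iff₀ hΔ0]; linarith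
  have hD1 : 1 ≤ D := by linarith
  set E := cCac d s Λ * D ^ (d + 3) * Y with hE
  have hc1 := one_le_cCac (d := d) (s := s) hΛ
  have hE0 : 0 ≤ E := by positivity
  have hYE : D ^ 2 * Y ≤ E := by
    have : D ^ 2 ≤ D ^ (d + 3) := pow_le_pow_right₀ hD1 (by omega)
    have h2 : 1 * D ^ 2 ≤ cCac d s Λ * D ^ (d + 3) := by gcongr
    rw [hE]
    calc D ^ 2 * Y = 1 * D ^ 2 * Y := by ring
      _ ≤ _ := by gcongr
  obtain ⟨η, hη, hηt, hη1, hηb, hηL⟩ := exists_radial_cutoff (d := d)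
    (r₁ := ρ₁ + Δ / 4) (r₂ := ρ₁ + Δ / 2) (by linarith) (by linarith)
  obtain ⟨θ, hθ, hθt, hθ1, hθb, hθL⟩ := exists_radial_cutoff (d := d)
    (r₁ := ρ₁) (r₂ := ρ₁ + Δ / 8) (by linarith) (by linarith)
  have hηL' : ∀ x, ‖fderiv ℝ η x‖ ≤ D := fun x => (hηL x).trans (le_trans (le_of_eq (by
    rw [show ρ₁ + Δ / 2 - (ρ₁ + Δ / 4) = Δ / 4 by ring]; field_simp; norm_num)) hD)
  have hθL' : ∀ x, ‖fderiv ℝ θ x‖ ≤ 2 * D := fun x => (hθL x).trans (le_trans (le_of_eq (by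
    rw [show ρ₁ + Δ / 8 - ρ₁ = Δ / 8 by ring]; field_simp; norm_num))
      (mul_le_mul_of_nonneg_left hD zero_le_two))
  have hηρ : tsupport η ⊆ ball 0 (ρ₁ + 3 * Δ / 4) :=
    hηt.trans (closedBall_subset_ball (by linarith))
  have hu := measurable_shiftT U.mv S.int
  have hA := errE_add_le (s := s) (Λ := Λ) hu (by omega : 1 ≤ d) hs hΛ (ρ := ρ₁ + 3 * Δ / 4)
    (κ := Δ / 4) (r := r) (b := ρ₀) (b₁ := ρ₁) (k := k) (by positivity) (by linarith) hδ hη hη1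
    (fun x hx => image_eq_zero_of_notMem_tsupport fun h => hx (hηρ h)) hD1 hηL'
    (le_trans (by rw [div_div_eq_mul_div]; gcongr; norm_num) hD) h10
    (le_trans (by rw [← hΔ]; gcongr; norm_num) hD) hM0 hk hM hMδ hY0
    (by rw [show ρ₁ + 3 * Δ / 4 + Δ / 4 = ρ₀ by rw [hΔ]; ring]; exact hY)
  obtain ⟨hsl, hgr⟩ := U.energy_slices (by omega) hs hΛ (ρ := ρ₁ + 3 * Δ / 4)
    (S.mono hs.1 (by linarith) hρr) (by linarith) (by linarith) hr
    (by linarith : 0 ≤ k + δ) hδ hη hηρ hη1 hηL' h1 h10 (by linarith) hE0 hA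
  have hθη : ∀ x, θ x ≠ 0 → η x = 1 := fun x hx => hηb x <|
    closedBall_subset_ball (by linarith) (hθt (subset_tsupport _ hx))
  have hm : ∀ᵐ t, t ∈ Ioo (-ρ₁) 0 →
      volume {x | θ x ≠ 0 ∧ k + 3 * δ < shiftT v g (t, x)} ≤ ENNReal.ofReal (2 * E / δ ^ 2) := by
    filter_upwards [hsl] with t ht hmem
    have h2 := mul_meas_ge_le_lintegral (μ := (volume : Measure (Ed d)))
      (f := fun x => ENNReal.ofReal (η x ^ 2 * quadT δ (shiftT v g (t, x) - (k + δ))))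
      (by
        have := hη.continuous.measurable
        have := (continuous_quadT (δ := δ)).measurable.comp
          ((hu.comp (measurable_prodMk_left (x := t))).sub_const (k + δ))
        simp only [Function.comp_def] at this
        fun_prop) (ENNReal.ofReal (δ ^ 2 / 2))
    have h3 : volume {x | θ x ≠ 0 ∧ k + 3 * δ < shiftT v g (t, x)} ≤
        volume {x | ENNReal.ofReal (δ ^ 2 / 2) ≤
          ENNReal.ofReal (η x ^ 2 * quadT δ (shiftT v g (t, x) - (k + δ)))} := by
      refine measure_mono fun x hx => ?_
      rw [mem_ofPred_eq] at hx ⊢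
      refine ENNReal.ofReal_le_ofReal ?_
      rw [hθη x hx.1, one_pow, one_mul]
      refine le_trans ?_ (le_quadT hδ _)
      have : δ ≤ max (shiftT v g (t, x) - (k + δ) - δ) 0 := le_max_of_le_left (by linarith [hx.2])
      gcongr
    have h4 := (mul_le_mul_right h3 (ENNReal.ofReal (δ ^ 2 / 2))).trans (h2.trans (ht hmem))
    rw [mul_comm] at h4
    rw [← ENNReal.le_div_iff_mul_le (Or.inl (by simpa using by positivity))
      (Or.inl ENNReal.ofReal_ne_top), ← ENNReal.ofReal_div_of_pos (by positivity)] at h4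
    refine h4.trans (ENNReal.ofReal_le_ofReal (le_of_eq (by field_simp)))
  have hF := U.lintegral_rampT_sq_le hd S.int hθ (hθt.trans (closedBall_subset_ball
    (by linarith))) hθL' hδ (by linarith : ρ₁ ≤ 1) ENNReal.ofReal_ne_top hm
  have hB : Measurable fun z : Gd d => shiftT v g z := hu
  calc _ ≤ ∫⁻ z in Ioo (-ρ₁) 0 ×ˢ (univ : Set (Ed d)),
        ENNReal.ofReal ((θ z.2 * rampT δ (shiftT v g z - (k + 3 * δ))) ^ 2) := by
        refine (setLIntegral_mono' (measurableSet_Ioo.prod measurableSet_ball)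
          fun z hz => ?_).trans (lintegral_mono_set (Set.prod_mono subset_rfl (subset_univ _)))
        rw [hθb z.2 hz.2, one_mul]
        refine ENNReal.ofReal_le_ofReal ?_
        have := le_rampT hδ (shiftT v g z - (k + 3 * δ))
        rw [show shiftT v g z - (k + 3 * δ) - δ = shiftT v g z - (k + 4 * δ) by ring] at this
        gcongr
    _ ≤ _ := hF
    _ ≤ _ := by
        refine mul_le_mul_right ?_ _
        have e1 : ∫⁻ z in Ioo (-ρ₁) 0 ×ˢ tsupport θ,
            ENNReal.ofReal (max (shiftT v g z - (k + 3 * δ)) 0 ^ 2) ≤ ENNReal.ofReal Y := by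
          refine le_trans ?_ hY
          refine (lintegral_mono_set (Set.prod_mono (Ioo_subset_Ioo_left (by linarith))
            (hθt.trans (closedBall_subset_ball (by linarith))))).trans (lintegral_mono fun z => ?_)
          refine ENNReal.ofReal_le_ofReal ?_
          gcongr
          linarith
        have e2 : ∫⁻ z in Ioo (-ρ₁) 0 ×ˢ (univ : Set (Ed d)),
            ENNReal.ofReal (θ z.2 ^ 2 * (heav δ (shiftT v g z - (k + 3 * δ)) * ‖Dv z‖ ^ 2))
            ≤ ENNReal.ofReal (2 * Λ * E) := by
          refine le_trans (lintegral_mono fun z => ENNReal.ofReal_le_ofReal ?_) hgr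
          by_cases h : θ z.2 = 0
          · rw [h]
            have := heav_nonneg hδ (shiftT v g z - (k + δ))
            have : 0 ≤ η z.2 ^ 2 * (heav δ (shiftT v g z - (k + δ)) * ‖Dv z‖ ^ 2) := by positivity
            simpa using this
          · rw [hθη _ h]
            have h5 := (hθ1 z.2)
            have h6 : heav δ (shiftT v g z - (k + 3 * δ)) ≤ heav δ (shiftT v g z - (k + δ)) :=
              monotone_heav hδ (by linarith)
            have := heav_nonneg hδ (shiftT v g z - (k + 3 * δ))
            have h7 : θ z.2 ^ 2 ≤ 1 ^ 2 := pow_le_pow_left₀ h5.1 h5.2 2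
            gcongr
        refine (add_le_add (mul_le_mul_right e1 _) (mul_le_mul_right e2 _)).trans ?_
        rw [← ENNReal.ofReal_mul (by positivity), ← ENNReal.ofReal_mul (by positivity),
          ← ENNReal.ofReal_add (by positivity) (by positivity)]
        refine ENNReal.ofReal_le_ofReal ?_
        nlinarith

end DeGiorgiStep

section DeGiorgiIteration

variable {s Λ : ℝ} {ν : Measure (ℝ × Ed d × Ed d)} {v : Gd d → ℝ} {Dv a : Gd d → Ed d}
  {g : ℝ → ℝ}

variable (d) in
/-- The constant of the De Giorgi iteration. -/
def cDG (s Λ : ℝ) : ℝ :=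
  (1 + 4 * cCac d s Λ ^ 3 * (8 + 4 * Λ) * (cFK d).toReal ^ 2) * 2 ^ ((3 * d + 13) * d)

theorem one_le_cDG (hΛ : 1 ≤ Λ) : 1 ≤ cDG d s Λ := by
  have hc := one_le_cCac (d := d) (s := s) hΛ
  have hf : 0 ≤ (cFK d).toReal := ENNReal.toReal_nonneg
  have h1 : 0 ≤ 4 * cCac d s Λ ^ 3 * (8 + 4 * Λ) * (cFK d).toReal ^ 2 := by positivity
  have h2 : (1 : ℝ) ≤ 2 ^ ((3 * d + 13) * d) := one_le_pow₀ (by norm_num)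
  unfold cDG
  nlinarith

/-- The recursion of the De Giorgi iteration closes. -/
theorem degiorgi_recursion (hd : 2 ≤ d) (hΛ : 1 ≤ Λ) {δ D D₀ k X Z J : ℝ} (hJ : 1 ≤ J)
    (hD : D = D₀ * J) (hD₀ : 1 ≤ D₀) (hk : X ^ d ≤ k) (hX : X = cDG d s Λ * D₀ ^ (3 * d + 13))
    (hδ : k ≤ δ * D) (hZ : Z = (J ^ (3 * d + 13))⁻¹) :
    cFK d ^ 2 * ENNReal.ofReal (2 * (cCac d s Λ * D ^ (d + 3) * Z ^ d) / δ ^ 2) ^ (2 / (d : ℝ)) *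
        ENNReal.ofReal ((8 + 4 * Λ) * (cCac d s Λ * D ^ (d + 3) * Z ^ d)) ≤
      ENNReal.ofReal ((((2 * J) ^ (3 * d + 13))⁻¹) ^ d) := by
  set c := cCac d s Λ with hc
  have hc1 : 1 ≤ c := one_le_cCac hΛ
  set f := (cFK d).toReal with hf
  have hf0 : 0 ≤ f := ENNReal.toReal_nonneg
  have hDG := one_le_cDG (d := d) (s := s) hΛ
  have hD₀p : 1 ≤ D₀ ^ (3 * d + 13) := one_le_pow₀ hD₀
  have hX1 : 1 ≤ X := by rw [hX]; nlinarith
  have hXd : 1 ≤ X ^ d := one_le_pow₀ hX1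
  have hDD : 1 ≤ D := by rw [hD]; nlinarith
  have hZ0 : 0 < Z := by rw [hZ]; positivity
  have hδ0 : 0 < δ := by
    by_contra! h
    nlinarith
  have hdne : (d : ℝ) ≠ 0 := by positivity
  set B := 2 * c * D ^ (d + 5) with hB
  have hB1 : 1 ≤ B := by
    have : 1 ≤ D ^ (d + 5) := one_le_pow₀ hDD
    rw [hB]; nlinarith
  have hbase : 2 * (c * D ^ (d + 3) * Z ^ d) / δ ^ 2 ≤ (B * Z / X ^ 2) ^ d := by
    have h1 : X ^ d / D ≤ δ := by
      rw [div_le_iff₀ (by linarith)]; linarith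
    calc 2 * (c * D ^ (d + 3) * Z ^ d) / δ ^ 2 ≤ 2 * (c * D ^ (d + 3) * Z ^ d) / (X ^ d / D) ^ 2 := by
          gcongr
      _ = B * (Z / X ^ 2) ^ d := by
          rw [hB, div_pow, div_pow Z, ← pow_mul, ← pow_mul, mul_comm 2 d]
          field_simp
          ring
      _ ≤ B ^ d * (Z / X ^ 2) ^ d := by
          gcongr
          exact le_self_pow₀ hB1 (by omega)
      _ = _ := by rw [← mul_pow, mul_div_assoc]
  have hr : ENNReal.ofReal (2 * (c * D ^ (d + 3) * Z ^ d) / δ ^ 2) ^ (2 / (d : ℝ)) ≤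
      ENNReal.ofReal ((B * Z / X ^ 2) ^ 2) := by
    rw [ENNReal.ofReal_rpow_of_nonneg (by positivity) (by positivity)]
    refine ENNReal.ofReal_le_ofReal ?_
    refine (Real.rpow_le_rpow (by positivity) hbase (by positivity)).trans (le_of_eq ?_)
    rw [← Real.rpow_natCast, ← Real.rpow_mul (by positivity), mul_div_cancel₀ _ hdne]
    norm_num
  have hfe : cFK d ^ 2 = ENNReal.ofReal (f ^ 2) := by
    rw [ENNReal.ofReal_pow hf0, hf, ENNReal.ofReal_toReal (cFK_ne_top hd)]
  refine (mul_le_mul_left (mul_le_mul_right hr _) _).trans ?_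
  rw [hfe, ← ENNReal.ofReal_mul (by positivity), ← ENNReal.ofReal_mul (by positivity)]
  refine ENNReal.ofReal_le_ofReal ?_
  have hDp : D ^ (3 * d + 13) * Z = D₀ ^ (3 * d + 13) := by
    rw [hD, hZ, mul_pow]; field_simp
  have hfin : 4 * c ^ 3 * (8 + 4 * Λ) * f ^ 2 * D₀ ^ (3 * d + 13) * 2 ^ ((3 * d + 13) * d) ≤ X := by
    rw [hX, cDG]
    have : 0 ≤ D₀ ^ (3 * d + 13) * 2 ^ ((3 * d + 13) * d) := by positivity
    nlinarith
  have hZle : Z ≤ 1 := by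
    rw [hZ]; exact inv_le_one_of_one_le₀ (one_le_pow₀ hJ)
  calc f ^ 2 * (B * Z / X ^ 2) ^ 2 * ((8 + 4 * Λ) * (c * D ^ (d + 3) * Z ^ d))
      = 4 * c ^ 3 * (8 + 4 * Λ) * f ^ 2 * (D ^ (3 * d + 13) * Z) * Z ^ (d + 1) / X ^ 4 := by
        rw [hB]; field_simp; ring
    _ = (4 * c ^ 3 * (8 + 4 * Λ) * f ^ 2 * D₀ ^ (3 * d + 13) * 2 ^ ((3 * d + 13) * d)) *
          (Z ^ (d + 1) / X ^ 4 / 2 ^ ((3 * d + 13) * d)) := by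
        rw [hDp]; field_simp
    _ ≤ X * (Z ^ (d + 1) / X ^ 4 / 2 ^ ((3 * d + 13) * d)) := by gcongr
    _ = Z ^ (d + 1) / X ^ 3 / 2 ^ ((3 * d + 13) * d) := by field_simp
    _ ≤ Z ^ d / 1 / 2 ^ ((3 * d + 13) * d) := by
        have h1 : Z ^ (d + 1) ≤ Z ^ d := pow_le_pow_of_le_one hZ0.le hZle (by omega)
        have h2 : 1 ≤ X ^ 3 := one_le_pow₀ hX1
        exact div_le_div_of_nonneg_right (div_le_div₀ (by positivity) h1 one_pos h2)
          (by positivity)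
    _ = _ := by
        rw [hZ, mul_pow, mul_inv, mul_pow, div_one, pow_mul, inv_pow (2 ^ (3 * d + 13))]
        field_simp

/-- Boundedness from above of the shifted solution, by the De Giorgi iteration. -/
theorem USol.shiftT_le_of_iteration (U : USol s Λ v Dv a ν) (hd : 2 ≤ d)
    (hs : s ∈ Ioo (0 : ℝ) 1) (hΛ : 1 ≤ Λ) {ρ r : ℝ} (S : TailShift s ν v ρ r g) (hr : r ≤ 1)
    (hρr : ρ < r) {σ : ℝ} (hσ : 0 < σ) (hσρ : σ < ρ) {k M : ℝ} (hM0 : 0 ≤ M)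
    (hM : ∀ᵐ t, t ∈ Ioo (-ρ) 0 → ∫⁻ x in ball (0 : Ed d) r,
      ENNReal.ofReal (max (shiftT v g (t, x)) 0) ≤ ENNReal.ofReal M)
    (hMk : M ≤ k) (hk : (cDG d s Λ * (32 / (ρ - σ)) ^ (3 * d + 13)) ^ d ≤ k)
    (hY : ∫⁻ z in Ioo (-ρ) 0 ×ˢ ball (0 : Ed d) ρ,
      ENNReal.ofReal (max (shiftT v g z) 0 ^ 2) ≤ 1) :
    ∀ᵐ z, z ∈ Ioo (-σ) 0 ×ˢ ball (0 : Ed d) σ → shiftT v g z ≤ k := by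
  set G := ρ - σ with hG
  have hG0 : 0 < G := by linarith
  have hG1 : G ≤ 1 := by linarith
  have hDG := one_le_cDG (d := d) (s := s) hΛ
  have h32 : 32 ≤ 32 / G := by rw [le_div_iff₀ hG0]; linarith
  have hk0 : 0 < k := lt_of_lt_of_le (by positivity) hk
  have hu := measurable_shiftT U.mv S.int
  set p := 3 * d + 13 with hp
  have key : ∀ j : ℕ, ∫⁻ z in Ioo (-(σ + G / 2 ^ j)) 0 ×ˢ ball (0 : Ed d) (σ + G / 2 ^ j),
      ENNReal.ofReal (max (shiftT v g z - k * (1 - 1 / 2 ^ j)) 0 ^ 2) ≤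
        ENNReal.ofReal ((((2 ^ j) ^ p : ℝ)⁻¹) ^ d) := by
    intro j
    induction j with
    | zero => simpa [hG] using hY
    | succ j ih =>
      have hJ : (1 : ℝ) ≤ 2 ^ j := one_le_pow₀ one_le_two
      have hGj : G / 2 ^ j ≤ G := div_le_self hG0.le hJ
      have hδ0 : 0 < k / (8 * 2 ^ j) := by positivity
      have hD0 : 0 ≤ 32 / G * 2 ^ j := by positivity
      have hGj2 : G / 2 ^ (j + 1) = G / 2 ^ j / 2 := by rw [pow_succ]; field_simp
      have hGjp : 0 < G / 2 ^ j := by positivity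
      have hkD : k ≤ k / (8 * 2 ^ j) * (32 / G * 2 ^ j) := by
        rw [show k / (8 * 2 ^ j) * (32 / G * 2 ^ j) = k * (4 / G) by field_simp; norm_num]
        have : 1 ≤ 4 / G := by rw [le_div_iff₀ hG0]; linarith
        nlinarith
      have h := U.degiorgi_step hd hs hΛ S hr hρr (ρ₀ := σ + G / 2 ^ j)
        (ρ₁ := σ + G / 2 ^ (j + 1)) (by positivity) (by rw [hGj2]; linarith)
        (by linarith) (k := k * (1 - 1 / 2 ^ j)) (δ := k / (8 * 2 ^ j))
        (D := 32 / G * 2 ^ j) (M := M) (Y := ((((2 ^ j) ^ p : ℝ)⁻¹) ^ d))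
        (mul_nonneg hk0.le (by rw [sub_nonneg, div_le_one (by positivity)]; exact hJ)) hδ0
        (by rw [hGj2, show σ + G / 2 ^ j - (σ + G / 2 ^ j / 2) = G / 2 ^ j / 2 by ring]
            apply le_of_eq; field_simp; norm_num) hM0
        (hM.mono fun t ht hmem => ht ⟨by linarith [hmem.1], hmem.2⟩)
        (by linarith) (by positivity) ih
      rw [show k * (1 - 1 / 2 ^ j) + 4 * (k / (8 * 2 ^ j)) = k * (1 - 1 / 2 ^ (j + 1)) by
        rw [pow_succ]; field_simp; ring] at h
      refine h.trans ((degiorgi_recursion (s := s) hd hΛ hJ rfl (by linarith) hk rfl hkD rfl).trans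
        (le_of_eq ?_))
      rw [pow_succ' 2 j]
  have hlim : Tendsto (fun j : ℕ => ENNReal.ofReal ((((2 ^ j) ^ p : ℝ)⁻¹) ^ d)) atTop (𝓝 0) := by
    rw [← ENNReal.ofReal_zero]
    refine (ENNReal.continuous_ofReal.tendsto _).comp ?_
    have h2 : Tendsto (fun j : ℕ => ((2⁻¹ : ℝ) ^ (p * d)) ^ j) atTop (𝓝 0) :=
      tendsto_pow_atTop_nhds_zero_of_lt_one (by positivity)
        (pow_lt_one₀ (by norm_num) (by norm_num) (by positivity))
    refine h2.congr fun j => ?_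
    rw [← pow_mul, inv_pow, inv_pow, ← pow_mul, ← pow_mul]
    congr 2
    ring
  have hzero : ∫⁻ z in Ioo (-σ) 0 ×ˢ ball (0 : Ed d) σ,
      ENNReal.ofReal (max (shiftT v g z - k) 0 ^ 2) = 0 := by
    refine le_antisymm (ge_of_tendsto' hlim fun j => le_trans ?_ (key j)) zero_le
    have hj : 0 < G / 2 ^ j := by positivity
    refine (lintegral_mono_set (Set.prod_mono (Ioo_subset_Ioo_left (by linarith))
      (ball_subset_ball (by linarith)))).trans (lintegral_mono fun z => ?_)
    refine ENNReal.ofReal_le_ofReal ?_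
    have : k * (1 - 1 / 2 ^ j) ≤ k := by
      have : 0 ≤ k * (1 / 2 ^ j) := by positivity
      linarith
    gcongr
  rw [lintegral_eq_zero_iff (by fun_prop)] at hzero
  have h3 := (ae_restrict_iff' (measurableSet_Ioo.prod measurableSet_ball)).1 hzero
  filter_upwards [h3] with z hz hmem
  have h4 := hz hmem
  simp only [Pi.zero_apply, ENNReal.ofReal_eq_zero] at h4
  have h5 : max (shiftT v g z - k) 0 = 0 := by
    have := sq_nonneg (max (shiftT v g z - k) 0)
    exact pow_eq_zero_iff two_ne_zero |>.1 (le_antisymm h4 this)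
  have := max_eq_right_iff.1 h5
  linarith

end DeGiorgiIteration

section LocalSup

variable {s Λ : ℝ} {ν : Measure (ℝ × Ed d × Ed d)} {v : Gd d → ℝ} {Dv a : Gd d → Ed d}
  {g : ℝ → ℝ}

theorem tauS_anti {r r' : ℝ} (h : r ≤ r') (t : ℝ) : tauS s v r' t ≤ tauS s v r t :=
  lintegral_mono_set (compl_subset_compl.2 (ball_subset_ball h))

theorem tauS_const_mul (c : ℝ) (v : Gd d → ℝ) (r t : ℝ) :
    tauS s (fun z => c * v z) r t = ‖c‖ₑ * tauS s v r t := by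
  unfold tauS
  rw [← lintegral_const_mul' _ _ enorm_ne_top]
  simp only [enorm_mul, mul_assoc]

/-- The jumps of size at least `1 / 2` contribute at most `N`. -/
def TailLe (s Λ : ℝ) (ν : Measure (ℝ × Ed d × Ed d)) (v : Gd d → ℝ) (N : ℝ) : Prop :=
  ∃ θ, 0 ≤ θ ∧ ν ≤ ENNReal.ofReal (Λ * θ) • nuS d s ∧
    ENNReal.ofReal θ * ∫⁻ t in Ioo (-1) 0, tauS s v (1 / 2) t ≤ ENNReal.ofReal N

theorem TailLe.mono {N N' : ℝ} (h : TailLe s Λ ν v N) (hN : N ≤ N') : TailLe s Λ ν v N' := by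
  obtain ⟨θ, h1, h2, h3⟩ := h
  exact ⟨θ, h1, h2, h3.trans (ENNReal.ofReal_le_ofReal hN)⟩

theorem TailLe.const_mul {N : ℝ} (h : TailLe s Λ ν v N) (c : ℝ) :
    TailLe s Λ ν (fun z => c * v z) (|c| * N) := by
  obtain ⟨θ, h1, h2, h3⟩ := h
  refine ⟨θ, h1, h2, ?_⟩
  simp only [tauS_const_mul]
  rw [lintegral_const_mul' _ _ enorm_ne_top, mul_left_comm, ENNReal.ofReal_mul (abs_nonneg c),
    ← ofReal_norm, Real.norm_eq_abs]
  exact mul_le_mul_right h3 _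

theorem USol.exists_tailShift_le (U : USol s Λ v Dv a ν) (hΛ : 0 ≤ Λ) (hs : s ≤ 1) {ρ r D : ℝ}
    (hr : 1 / 2 ≤ r) (hρr : ρ < r) (hr1 : r - ρ ≤ 1) (hD : 1 / (r - ρ) ≤ D)
    (ht : TailLe s Λ ν v 1) :
    ∃ g, TailShift s ν v ρ r g ∧ ∀ t, ∫ τ in Iic t, g τ ≤ 2 * Λ * D ^ (d + 2) := by
  obtain ⟨θ, hθ, hθν, ht⟩ := ht
  obtain ⟨g, S, hg⟩ := U.exists_tailShift (mul_nonneg hΛ hθ) hθν (by linarith) hρr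
  have hκ : 0 < r - ρ := by linarith
  have hD0 : 0 ≤ D := le_trans (by positivity) hD
  refine ⟨g, S, fun t => ?_⟩
  rw [← ENNReal.ofReal_le_ofReal_iff (by positivity)]
  rw [show 2 * (Λ * θ) * (1 / (r - ρ) ^ ((d : ℝ) + 2 * s)) =
    2 * Λ * (1 / (r - ρ) ^ ((d : ℝ) + 2 * s)) * θ by ring, ENNReal.ofReal_mul (by positivity)] at hg
  refine (hg t).trans ?_
  rw [mul_assoc]
  refine (mul_le_mul_right ((mul_le_mul_right (lintegral_mono fun t => tauS_anti hr t) _).trans ht)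
    _).trans ?_
  rw [ENNReal.ofReal_one, mul_one]
  refine ENNReal.ofReal_le_ofReal ?_
  have := one_div_rpow_le hκ hr1 hD hs d
  gcongr

variable (d) in
/-- The constant in the bound for the `L¹` norm of time slices. -/
def cSl (s Λ : ℝ) : ℝ := cCac d s Λ + (2 + 2 * Λ) * (volume (ball (0 : Ed d) 1)).toReal

theorem cSl_nonneg (hΛ : 0 ≤ Λ) : 0 ≤ cSl d s Λ := by
  have := cCac_nonneg (d := d) (s := s) hΛ
  unfold cSl; positivity

theorem USol.slice_le (U : USol s Λ v Dv a ν) (hd : 2 ≤ d)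
    (hs : s ∈ Ioo (0 : ℝ) 1) (hΛ : 1 ≤ Λ) {σ σ' : ℝ} (hσ : 1 / 2 ≤ σ) (hσσ : σ < σ')
    (hσ' : σ' < 1)
    (hv : ∫⁻ z in Ioo (-σ') 0 ×ˢ ball (0 : Ed d) σ', ENNReal.ofReal (v z ^ 2) ≤ 1)
    (ht : TailLe s Λ ν v 1) :
    ∀ᵐ t, t ∈ Ioo (-(σ + (σ' - σ) / 2)) 0 → ∫⁻ x in ball (0 : Ed d) (σ + (σ' - σ) / 2),
      ENNReal.ofReal (max (v (t, x)) 0) ≤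
        ENNReal.ofReal (cSl d s Λ * (128 / (σ' - σ)) ^ (d + 2)) := by
  set G := σ' - σ with hG
  have hG0 : 0 < G := by linarith
  have hG1 : G ≤ 1 := by linarith
  set L := 128 / G with hL
  have hL1 : 1 ≤ L := by rw [hL, le_div_iff₀ hG0]; linarith
  have hcC := one_le_cCac (d := d) (s := s) hΛ
  obtain ⟨g, S, hg⟩ := U.exists_tailShift_le (by linarith) hs.2.le (ρ := σ + 3 * G / 4) (r := σ')
    (D := L) (by linarith) (by linarith) (by linarith)
    (by rw [show σ' - (σ + 3 * G / 4) = G / 4 by rw [hG]; ring, one_div_div, hL]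
        gcongr; norm_num) ht
  obtain ⟨η, hη, hηt, hη1, hηb, hηL⟩ := exists_radial_cutoff (d := d)
    (r₁ := σ + G / 2) (r₂ := σ + 5 * G / 8) (by linarith) (by linarith)
  have hηL' : ∀ x, ‖fderiv ℝ η x‖ ≤ L := fun x => (hηL x).trans (by
    rw [show σ + 5 * G / 8 - (σ + G / 2) = G / 8 by ring, hL, div_div_eq_mul_div]
    gcongr; norm_num)
  have hu := measurable_shiftT U.mv S.int
  have hle : ∀ A : Set (Gd d), A ⊆ Ioo (-σ') 0 ×ˢ ball (0 : Ed d) σ' →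
      ∫⁻ z in A, ENNReal.ofReal (max (shiftT v g z - 0) 0 ^ 2) ≤ 1 := by
    intro A hA
    refine ((lintegral_mono_set hA).trans (lintegral_mono fun z => ?_)).trans hv
    refine ENNReal.ofReal_le_ofReal ?_
    rw [← sq_abs (v z)]
    have h1 := S.le_of_pos z
    have h2 := le_abs_self (v z)
    have : max (shiftT v g z - 0) 0 ≤ |v z| := max_le (by linarith) (abs_nonneg _)
    gcongr
  have hcS : cS d s = ENNReal.ofReal (cS d s).toReal :=
    (ENNReal.ofReal_toReal (cS_lt_top (by omega) hs).ne).symm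
  have hE : errE s Λ L η (shiftT v g) 0 σ' (σ + 3 * G / 4) σ' +
      ENNReal.ofReal (1 / (σ' - (σ + G / 2))) *
      (∫⁻ z in Ioo (-σ') 0 ×ˢ ball (0 : Ed d) (σ + 3 * G / 4),
        ENNReal.ofReal (max (shiftT v g z - 0) 0 ^ 2)) ≤ ENNReal.ofReal (cCac d s Λ * L ^ 2) := by
    have h1 := hle (Ioo (-σ') 0 ×ˢ ball (0 : Ed d) (σ + 3 * G / 4))
      (Set.prod_mono subset_rfl (ball_subset_ball (by linarith)))
    have h2 := (lintegral_pairE_le (s := s) (b := σ') (r := σ') (k := 0) hu hη hη1 hL1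
      hηL').trans (mul_le_mul_right (hle _ subset_rfl) _)
    unfold errE
    refine (add_le_add (add_le_add (mul_le_mul_right h1 _) (mul_le_mul_right h2 _))
      (mul_le_mul_right h1 _)).trans ?_
    rw [mul_one, mul_one, mul_one, hcS, ← ENNReal.ofReal_mul (by positivity),
      ← ENNReal.ofReal_mul (by positivity), ← ENNReal.ofReal_add (by positivity) (by positivity),
      ← ENNReal.ofReal_add (by positivity)
        (by apply div_nonneg <;> linarith)]
    refine ENNReal.ofReal_le_ofReal ?_
    have h3 : 1 / (σ' - (σ + G / 2)) ≤ L := by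
      rw [show σ' - (σ + G / 2) = G / 2 by rw [hG]; ring, one_div_div, hL]
      gcongr; norm_num
    have h4 : 0 ≤ (cS d s).toReal := ENNReal.toReal_nonneg
    have h5 : 0 ≤ 2 * Λ * L ^ 2 := by positivity
    unfold cCac
    nlinarith
  obtain ⟨hsl, -⟩ := U.energy_slices (by omega) hs hΛ (b := σ') (b₁ := σ + G / 2) S (by linarith)
    (by linarith) hσ'.le le_rfl one_pos hη (hηt.trans (closedBall_subset_ball (by linarith))) hη1
    hηL' (by linarith) (by linarith) hσ' (by positivity) hE
  filter_upwards [hsl] with t hsl hmem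
  have hB : volume (ball (0 : Ed d) (σ + G / 2)) ≤
      ENNReal.ofReal (volume (ball (0 : Ed d) 1)).toReal := by
    rw [ENNReal.ofReal_toReal measure_ball_lt_top.ne]
    exact measure_mono (ball_subset_ball (by linarith))
  have hm : Measurable fun x => ENNReal.ofReal (η x ^ 2 * quadT 1 (shiftT v g (t, x) - 0)) := by
    have := hη.continuous.measurable
    have := (continuous_quadT (δ := 1)).measurable.comp
      ((hu.comp (measurable_prodMk_left (x := t))).sub_const 0)
    simp only [Function.comp_def] at this
    fun_prop
  calc _ ≤ ∫⁻ x in ball (0 : Ed d) (σ + G / 2),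
        (ENNReal.ofReal (η x ^ 2 * quadT 1 (shiftT v g (t, x) - 0)) +
          ENNReal.ofReal (2 + 2 * Λ * L ^ (d + 2))) := by
        refine setLIntegral_mono' measurableSet_ball fun x hx => ?_
        have hq := quadT_nonneg one_pos (shiftT v g (t, x) - 0)
        rw [hηb x hx, one_pow, one_mul, ← ENNReal.ofReal_add hq (by positivity)]
        refine ENNReal.ofReal_le_ofReal (max_le ?_ (by positivity))
        have h1 := le_quadT one_pos (shiftT v g (t, x) - 0)
        have h2 := hg t
        have h3 : shiftT v g (t, x) = v (t, x) - ∫ τ in Iic t, g τ := rfl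
        have h4 := le_max_left (shiftT v g (t, x) - 0 - 1) 0
        nlinarith [sq_nonneg (max (shiftT v g (t, x) - 0 - 1) 0 - 1)]
    _ = (∫⁻ x in ball (0 : Ed d) (σ + G / 2),
        ENNReal.ofReal (η x ^ 2 * quadT 1 (shiftT v g (t, x) - 0))) +
          ENNReal.ofReal (2 + 2 * Λ * L ^ (d + 2)) * volume (ball (0 : Ed d) (σ + G / 2)) := by
        rw [lintegral_add_left hm, setLIntegral_const]
    _ ≤ ENNReal.ofReal (cCac d s Λ * L ^ 2) + ENNReal.ofReal (2 + 2 * Λ * L ^ (d + 2)) *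
          ENNReal.ofReal (volume (ball (0 : Ed d) 1)).toReal :=
        add_le_add ((setLIntegral_le_lintegral _ _).trans (hsl hmem)) (mul_le_mul_right hB _)
    _ ≤ _ := by
        rw [← ENNReal.ofReal_mul (by positivity),
          ← ENNReal.ofReal_add (by positivity) (by positivity)]
        refine ENNReal.ofReal_le_ofReal ?_
        have h1 : L ^ 2 ≤ L ^ (d + 2) := pow_le_pow_right₀ hL1 (by omega)
        have h2 : 1 ≤ L ^ (d + 2) := one_le_pow₀ hL1
        have h3 : 0 ≤ (volume (ball (0 : Ed d) 1)).toReal := ENNReal.toReal_nonneg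
        have h4 : 2 + 2 * Λ * L ^ (d + 2) ≤ (2 + 2 * Λ) * L ^ (d + 2) := by linarith
        unfold cSl
        calc _ ≤ cCac d s Λ * L ^ (d + 2) +
              (2 + 2 * Λ) * L ^ (d + 2) * (volume (ball (0 : Ed d) 1)).toReal := by gcongr
          _ = _ := by ring

variable (d) in
/-- The constant in the normalised `L²`-to-`L^∞` estimate. -/
def cSup (s Λ : ℝ) : ℝ := cDG d s Λ ^ d + cSl d s Λ + 2 * Λ

theorem USol.le_of_normalised (U : USol s Λ v Dv a ν) (hd : 2 ≤ d)
    (hs : s ∈ Ioo (0 : ℝ) 1) (hΛ : 1 ≤ Λ) {σ σ' : ℝ} (hσ : 1 / 2 ≤ σ) (hσσ : σ < σ')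
    (hσ' : σ' < 1)
    (hv : ∫⁻ z in Ioo (-σ') 0 ×ˢ ball (0 : Ed d) σ', ENNReal.ofReal (v z ^ 2) ≤ 1)
    (ht : TailLe s Λ ν v 1) :
    ∀ᵐ z, z ∈ Ioo (-σ) 0 ×ˢ ball (0 : Ed d) σ →
      v z ≤ cSup d s Λ * (128 / (σ' - σ)) ^ ((3 * d + 13) * d) := by
  have hM := U.slice_le hd hs hΛ hσ hσσ hσ' hv ht
  set G := σ' - σ with hG
  have hG0 : 0 < G := by linarith
  have hG1 : G ≤ 1 := by linarith
  set L := 128 / G with hL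
  have hL1 : 1 ≤ L := by rw [hL, le_div_iff₀ hG0]; linarith
  obtain ⟨g, S, hg⟩ := U.exists_tailShift_le (by linarith) hs.2.le (ρ := σ + 3 * G / 8)
    (r := σ + G / 2) (D := L) (by linarith) (by linarith) (by linarith)
    (by rw [show σ + G / 2 - (σ + 3 * G / 8) = G / 8 by ring, one_div_div, hL]
        gcongr; norm_num) ht
  have hDG := one_le_cDG (d := d) (s := s) hΛ
  have hSl := cSl_nonneg (d := d) (s := s) (by linarith : 0 ≤ Λ)
  set q := (3 * d + 13) * d with hq
  have hLq : L ^ (d + 2) ≤ L ^ q := pow_le_pow_right₀ hL1 (by rw [hq]; nlinarith)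
  have hk : (cDG d s Λ * (32 / (σ + 3 * G / 8 - σ)) ^ (3 * d + 13)) ^ d ≤
      cDG d s Λ ^ d * L ^ q + cSl d s Λ * L ^ (d + 2) := by
    refine le_trans (le_of_eq (mul_pow _ _ _)) (le_add_of_le_of_nonneg ?_ (by positivity))
    rw [← pow_mul]
    have h1 : 32 / (σ + 3 * G / 8 - σ) ≤ L := by
      rw [show σ + 3 * G / 8 - σ = G * (3 / 8) by ring, ← div_div, hL, div_right_comm]
      gcongr; norm_num
    have h2 : 0 ≤ 32 / (σ + 3 * G / 8 - σ) := by
      apply div_nonneg <;> linarith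
    gcongr
  have h := U.shiftT_le_of_iteration hd hs hΛ S (by linarith) (by linarith) (σ := σ) (by linarith)
    (by linarith) (k := cDG d s Λ ^ d * L ^ q + cSl d s Λ * L ^ (d + 2))
    (M := cSl d s Λ * L ^ (d + 2)) (by positivity)
    (by
      filter_upwards [hM] with t ht hmem
      refine (lintegral_mono fun x => ?_).trans (ht ⟨by linarith [hmem.1], hmem.2⟩)
      have := S.le_of_pos (t, x)
      gcongr)
    (le_add_of_nonneg_left (by positivity)) hk
    (by
      refine ((lintegral_mono_set (Set.prod_mono (Ioo_subset_Ioo_left (by linarith))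
        (ball_subset_ball (by linarith)))).trans (lintegral_mono fun z => ?_)).trans hv
      refine ENNReal.ofReal_le_ofReal ?_
      rw [← sq_abs (v z)]
      have h1 := S.le_of_pos z
      have h2 := le_abs_self (v z)
      have : max (shiftT v g z) 0 ≤ |v z| := max_le (by linarith) (abs_nonneg _)
      gcongr)
  filter_upwards [h] with z hz hmem
  have h1 := hz hmem
  have h2 := hg z.1
  have h3 : shiftT v g z = v z - ∫ τ in Iic z.1, g τ := rfl
  have h4 : cSl d s Λ * L ^ (d + 2) ≤ cSl d s Λ * L ^ q := by gcongr
  have h5 : 2 * Λ * L ^ (d + 2) ≤ 2 * Λ * L ^ q := by gcongr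
  unfold cSup
  linarith

end LocalSup

section Interpolation

variable {s Λ : ℝ} {ν : Measure (ℝ × Ed d × Ed d)} {v : Gd d → ℝ} {Dv a : Gd d → Ed d}

theorem HasWeakGx.const_mul {O : Set (Gd d)} (h : HasWeakGx v Dv O) (c : ℝ) :
    HasWeakGx (fun z => c * v z) (fun z => c • Dv z) O := by
  intro φ h1 h2 h3 e
  have := h φ h1 h2 h3 e
  simp only [inner_smul_left, conj_trivial, mul_assoc, mul_left_comm _ c, integral_const_mul]
  linear_combination c * this

theorem USol.const_mul (U : USol s Λ v Dv a ν) (c : ℝ) :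
    USol s Λ (fun z => c * v z) (fun z => c • Dv z) (fun z => c • a z) ν where
  mv := U.mv.const_mul c
  mD := U.mD.const_smul c
  ma := U.ma.const_smul c
  loc := by
    obtain ⟨O, h1, h2, h3, h4, h5, h6⟩ := U.loc
    exact ⟨O, h1, h2, h3, h4.const_mul c, h5.const_smul c, h6.const_mul c⟩
  grow z := by
    rw [norm_smul, norm_smul]
    have := U.grow z
    nlinarith [norm_nonneg c]
  ell z := by
    rw [norm_smul, inner_smul_left, inner_smul_right, mul_pow, Real.norm_eq_abs, sq_abs]
    have := U.ell z
    simp only [conj_trivial]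
    nlinarith [sq_nonneg c]
  symm := U.symm
  le := U.le
  tail r hr := by
    simp only [tauS_const_mul, mul_pow]
    rw [lintegral_const_mul' _ _ (by simp)]
    exact ENNReal.mul_lt_top (by simp) (U.tail r hr)
  weak φ h1 h2 h3 := by
    have h := U.weak φ h1 h2 h3
    have e1 : ∀ p, diffXY (fun z => c * v z) p * diffXY φ p = c * (diffXY v p * diffXY φ p) := by
      intro p; unfold diffXY; ring
    simp only [e1, inner_smul_left, mul_assoc, integral_const_mul, conj_trivial]
    linear_combination c * h

theorem USol.abs_le_of_L2 (U : USol s Λ v Dv a ν) (hd : 2 ≤ d)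
    (hs : s ∈ Ioo (0 : ℝ) 1) (hΛ : 1 ≤ Λ) {σ σ' : ℝ} (hσ : 1 / 2 ≤ σ) (hσσ : σ < σ')
    (hσ' : σ' < 1) {N : ℝ} (hN : 0 < N)
    (hv : ∫⁻ z in Ioo (-σ') 0 ×ˢ ball (0 : Ed d) σ', ENNReal.ofReal (v z ^ 2) ≤
      ENNReal.ofReal (N ^ 2))
    (ht : TailLe s Λ ν v N) :
    ∀ᵐ z, z ∈ Ioo (-σ) 0 ×ˢ ball (0 : Ed d) σ →
      |v z| ≤ cSup d s Λ * (128 / (σ' - σ)) ^ ((3 * d + 13) * d) * N := by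
  have key : ∀ e : ℝ, |e| = 1 → ∀ᵐ z, z ∈ Ioo (-σ) 0 ×ˢ ball (0 : Ed d) σ →
      e / N * v z ≤ cSup d s Λ * (128 / (σ' - σ)) ^ ((3 * d + 13) * d) := by
    intro e he
    refine (U.const_mul (e / N)).le_of_normalised hd hs hΛ hσ hσσ hσ' ?_ ?_
    · have : ∀ z, ENNReal.ofReal ((e / N * v z) ^ 2) =
          ENNReal.ofReal ((N ^ 2)⁻¹) * ENNReal.ofReal (v z ^ 2) := by
        intro z
        rw [← ENNReal.ofReal_mul (by positivity), mul_pow, div_pow, ← sq_abs e, he, one_pow,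
          one_div]
      simp only [this]
      rw [lintegral_const_mul' _ _ ENNReal.ofReal_ne_top]
      refine (mul_le_mul_right hv _).trans ?_
      rw [← ENNReal.ofReal_mul (by positivity), inv_mul_cancel₀ (by positivity),
        ENNReal.ofReal_one]
    · refine (ht.const_mul _).mono ?_
      rw [abs_div, he, abs_of_pos hN, one_div, inv_mul_cancel₀ hN.ne']
  filter_upwards [key 1 (by simp), key (-1) (by simp)] with z h1 h2 hmem
  have h3 := mul_le_mul_of_nonneg_right (h1 hmem) hN.le
  have h4 := mul_le_mul_of_nonneg_right (h2 hmem) hN.le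
  rw [show 1 / N * v z * N = v z by field_simp] at h3
  rw [show -1 / N * v z * N = -v z by field_simp] at h4
  exact abs_le'.2 ⟨h3, h4⟩

variable (d) in
/-- The constant `K` in the interpolation argument. -/
def cInt (s Λ : ℝ) : ℝ := (cSup d s Λ + 1) * 1024 ^ ((3 * d + 13) * d)

theorem cSup_nonneg (hΛ : 1 ≤ Λ) : 0 ≤ cSup d s Λ := by
  have hDG := one_le_cDG (d := d) (s := s) hΛ
  have hSl := cSl_nonneg (d := d) (s := s) (by linarith : 0 ≤ Λ)
  unfold cSup; positivity

theorem one_le_cInt (hΛ : 1 ≤ Λ) : 1 ≤ cInt d s Λ := by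
  have := cSup_nonneg (d := d) (s := s) hΛ
  have h2 : (1 : ℝ) ≤ 1024 ^ ((3 * d + 13) * d) := one_le_pow₀ (by norm_num)
  unfold cInt; nlinarith

/-- One step of the interpolation between `L¹` and `L^∞`. -/
theorem USol.abs_le_sqrt (U : USol s Λ v Dv a ν) (hd : 2 ≤ d)
    (hs : s ∈ Ioo (0 : ℝ) 1) (hΛ : 1 ≤ Λ) {i : ℕ} {x : ℝ} (hx : 1 ≤ x)
    (hv : ∫⁻ z in Ioo (-(3 / 4)) 0 ×ˢ ball (0 : Ed d) (3 / 4), ‖v z‖ₑ ≤ 1)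
    (ht : TailLe s Λ ν v 1)
    (h : ∀ᵐ z, z ∈ Ioo (-(3 / 4 - 1 / (4 * 2 ^ (i + 1)))) 0 ×ˢ
      ball (0 : Ed d) (3 / 4 - 1 / (4 * 2 ^ (i + 1))) → |v z| ≤ x) :
    ∀ᵐ z, z ∈ Ioo (-(3 / 4 - 1 / (4 * 2 ^ i))) 0 ×ˢ
      ball (0 : Ed d) (3 / 4 - 1 / (4 * 2 ^ i)) →
        |v z| ≤ cInt d s Λ * (2 ^ ((3 * d + 13) * d)) ^ i * √x := by
  have hp : (1 : ℝ) ≤ 2 ^ i := one_le_pow₀ one_le_two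
  have hgap : (3 / 4 - 1 / (4 * 2 ^ (i + 1))) - (3 / 4 - 1 / (4 * 2 ^ i)) = 1 / (8 * 2 ^ i : ℝ) := by
    rw [pow_succ]; field_simp; ring
  have h4 : 1 / (4 * 2 ^ i) ≤ (1 / 4 : ℝ) := by gcongr; linarith
  have h5 : 0 < 1 / (8 * 2 ^ i : ℝ) := by positivity
  have h6 : 0 < 1 / (4 * 2 ^ (i + 1) : ℝ) := by positivity
  have hsx : 1 ≤ √x := Real.one_le_sqrt.2 hx
  have hL := U.abs_le_of_L2 hd hs hΛ (σ := 3 / 4 - 1 / (4 * 2 ^ i))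
    (σ' := 3 / 4 - 1 / (4 * 2 ^ (i + 1))) (by linarith) (by linarith) (by linarith)
    (N := √x) (by positivity)
    (by
      rw [Real.sq_sqrt (by linarith)]
      have hmS := (measurableSet_Ioo (a := -(3 / 4 - 1 / (4 * 2 ^ (i + 1)) : ℝ)) (b := 0)).prod
        (measurableSet_ball (x := (0 : Ed d)) (ε := 3 / 4 - 1 / (4 * 2 ^ (i + 1))))
      have h7 : ∫⁻ z in Ioo (-(3 / 4 - 1 / (4 * 2 ^ (i + 1)))) 0 ×ˢ
          ball (0 : Ed d) (3 / 4 - 1 / (4 * 2 ^ (i + 1))), ENNReal.ofReal (v z ^ 2) ≤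
          ∫⁻ z in Ioo (-(3 / 4 - 1 / (4 * 2 ^ (i + 1)))) 0 ×ˢ
          ball (0 : Ed d) (3 / 4 - 1 / (4 * 2 ^ (i + 1))), ENNReal.ofReal x * ‖v z‖ₑ := by
        refine setLIntegral_mono_ae' hmS (h.mono fun z hz hmem => ?_)
        rw [← ofReal_norm, ← ENNReal.ofReal_mul (by linarith), Real.norm_eq_abs]
        refine ENNReal.ofReal_le_ofReal ?_
        have := hz hmem
        rw [← sq_abs]
        nlinarith [abs_nonneg (v z)]
      refine h7.trans ?_
      rw [lintegral_const_mul' _ _ ENNReal.ofReal_ne_top]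
      refine (mul_le_mul_right ((lintegral_mono_set (Set.prod_mono
        (Ioo_subset_Ioo_left (by linarith)) (ball_subset_ball (by linarith)))).trans hv) _).trans ?_
      rw [mul_one])
    (ht.mono hsx)
  filter_upwards [hL] with z hz hmem
  refine (hz hmem).trans ?_
  rw [hgap, show (128 / (1 / (8 * 2 ^ i)) : ℝ) = 1024 * 2 ^ i by field_simp; norm_num, mul_pow,
    ← pow_mul, mul_comm i, pow_mul (2 : ℝ) ((3 * d + 13) * d) i, ← mul_assoc]
  have hc := cSup_nonneg (d := d) (s := s) hΛ
  unfold cInt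
  gcongr
  linarith

/-- Local boundedness, normalised in `L¹`. -/
theorem USol.abs_le_of_L1_one (U : USol s Λ v Dv a ν) (hd : 2 ≤ d)
    (hs : s ∈ Ioo (0 : ℝ) 1) (hΛ : 1 ≤ Λ)
    (hv : ∫⁻ z in Ioo (-(3 / 4)) 0 ×ˢ ball (0 : Ed d) (3 / 4), ‖v z‖ₑ ≤ 1)
    (ht : TailLe s Λ ν v 1) :
    ∀ᵐ z, z ∈ Ioo (-(1 / 2)) 0 ×ˢ ball (0 : Ed d) (1 / 2) →
      |v z| ≤ cInt d s Λ ^ 2 * (2 ^ ((3 * d + 13) * d)) ^ 2 := by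
  set K := cInt d s Λ with hK
  have hK1 : 1 ≤ K := one_le_cInt hΛ
  set B : ℝ := 2 ^ ((3 * d + 13) * d) with hB
  have hB1 : 1 ≤ B := one_le_pow₀ one_le_two
  obtain ⟨Y, hY1, hY⟩ : ∃ Y : ℝ, 1 ≤ Y ∧ ∀ᵐ z, z ∈ Ioo (-(3 / 4)) 0 ×ˢ ball (0 : Ed d) (3 / 4) →
      |v z| ≤ Y := by
    obtain ⟨O, hO1, hO2, hO3, hO4, -⟩ := U.loc
    have hfin : ∫⁻ z in Ioo (-(7 / 8)) 0 ×ˢ ball (0 : Ed d) (7 / 8), ENNReal.ofReal (v z ^ 2) ≠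
        ⊤ := by
      have h1 : ∫⁻ z in O, ‖v z‖ₑ ^ 2 ≠ ⊤ := by
        rw [← eLpNorm_two_sq]; exact ENNReal.pow_ne_top hO4.2.ne
      refine ne_top_of_le_ne_top h1 ?_
      simp only [enorm_sq_eq]
      refine lintegral_mono_set (subset_trans (Set.prod_mono ?_ ?_) hO3)
      · exact fun t ht => ⟨by linarith [ht.1], ht.2.le⟩
      · exact (ball_subset_ball (by norm_num)).trans ball_subset_closedBall
    set N : ℝ := (∫⁻ z in Ioo (-(7 / 8)) 0 ×ˢ ball (0 : Ed d) (7 / 8),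
      ENNReal.ofReal (v z ^ 2)).toReal + 1 with hN
    have hN1 : 1 ≤ N := le_add_of_nonneg_left ENNReal.toReal_nonneg
    have h := U.abs_le_of_L2 hd hs hΛ (σ := 3 / 4) (σ' := 7 / 8) (N := N) (by norm_num)
      (by norm_num) (by norm_num) (by linarith)
      (by
        rw [← ENNReal.ofReal_toReal hfin]
        refine ENNReal.ofReal_le_ofReal ?_
        nlinarith)
      (ht.mono hN1)
    exact ⟨_, le_max_right _ 1, h.mono fun z hz hmem => (hz hmem).trans (le_max_left _ _)⟩
  have key : ∀ m i : ℕ, ∀ᵐ z, z ∈ Ioo (-(3 / 4 - 1 / (4 * 2 ^ i))) 0 ×ˢ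
      ball (0 : Ed d) (3 / 4 - 1 / (4 * 2 ^ i)) →
        |v z| ≤ K ^ 2 * B ^ (2 * i + 2) * Y ^ ((1 / 2 : ℝ) ^ m) := by
    intro m
    induction m with
    | zero =>
      intro i
      have h6 : 0 < 1 / (4 * 2 ^ i : ℝ) := by positivity
      filter_upwards [hY] with z hz hmem
      refine (hz ⟨⟨by linarith [hmem.1.1], hmem.1.2⟩,
        ball_subset_ball (by linarith) hmem.2⟩).trans ?_
      rw [pow_zero, Real.rpow_one]
      have h7 : 1 ≤ K ^ 2 * B ^ (2 * i + 2) :=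
        one_le_mul_of_one_le_of_one_le (one_le_pow₀ hK1) (one_le_pow₀ hB1)
      nlinarith
    | succ m ih =>
      intro i
      have hYm : 1 ≤ Y ^ ((1 / 2 : ℝ) ^ m) := Real.one_le_rpow hY1 (by positivity)
      have h := U.abs_le_sqrt hd hs hΛ (one_le_mul_of_one_le_of_one_le
        (one_le_mul_of_one_le_of_one_le (one_le_pow₀ hK1 (n := 2))
          (one_le_pow₀ hB1 (n := 2 * (i + 1) + 2))) hYm) hv ht (ih (i + 1))
      filter_upwards [h] with z hz hmem
      refine (hz hmem).trans (le_of_eq ?_)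
      rw [show K ^ 2 * B ^ (2 * (i + 1) + 2) * Y ^ ((1 / 2 : ℝ) ^ m) =
        (K * B ^ (i + 2) * Y ^ ((1 / 2 : ℝ) ^ (m + 1))) ^ 2 by
          rw [mul_pow, mul_pow, ← Real.rpow_natCast (Y ^ _) 2, ← Real.rpow_mul (by linarith),
            pow_succ (1 / 2 : ℝ) m, ← pow_mul B (i + 2) 2,
            show (i + 2) * 2 = 2 * (i + 1) + 2 by ring]
          norm_num [mul_assoc], Real.sqrt_sq (by positivity)]
      ring
  have h0 := ae_all_iff.2 fun m => key m 0
  filter_upwards [h0] with z hz hmem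
  have hlim : Tendsto (fun m : ℕ => K ^ 2 * B ^ (2 * 0 + 2) * Y ^ ((1 / 2 : ℝ) ^ m)) atTop
      (𝓝 (K ^ 2 * B ^ (2 * 0 + 2) * Y ^ (0 : ℝ))) := by
    refine Tendsto.const_mul _ ?_
    exact (Real.continuousAt_const_rpow (by linarith)).tendsto.comp
      (tendsto_pow_atTop_nhds_zero_of_lt_one (by norm_num) (by norm_num))
  refine (ge_of_tendsto' hlim fun m => hz m ?_).trans (by simp)
  norm_num at hmem ⊢
  exact hmem

/-- Local boundedness in the unit cylinder. -/
theorem USol.abs_le_of_L1 (U : USol s Λ v Dv a ν) (hd : 2 ≤ d)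
    (hs : s ∈ Ioo (0 : ℝ) 1) (hΛ : 1 ≤ Λ) {N : ℝ} (hN : 0 < N)
    (hv : ∫⁻ z in Ioo (-(3 / 4)) 0 ×ˢ ball (0 : Ed d) (3 / 4), ‖v z‖ₑ ≤ ENNReal.ofReal N)
    (ht : TailLe s Λ ν v N) :
    ∀ᵐ z, z ∈ Ioo (-(1 / 2)) 0 ×ˢ ball (0 : Ed d) (1 / 2) →
      |v z| ≤ cInt d s Λ ^ 2 * (2 ^ ((3 * d + 13) * d)) ^ 2 * N := by
  have hNN : ‖N⁻¹‖ₑ * ENNReal.ofReal N = 1 := by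
    rw [← ofReal_norm, Real.norm_eq_abs, abs_of_pos (by positivity),
      ← ENNReal.ofReal_mul (by positivity), inv_mul_cancel₀ hN.ne', ENNReal.ofReal_one]
  have h := (U.const_mul N⁻¹).abs_le_of_L1_one hd hs hΛ
    (by
      simp only [enorm_mul]
      rw [lintegral_const_mul' _ _ enorm_ne_top, ← hNN]
      exact mul_le_mul_right hv _)
    ((ht.const_mul _).mono (by rw [abs_of_pos (by positivity), inv_mul_cancel₀ hN.ne']))
  filter_upwards [h] with z hz hmem
  have := hz hmem
  rw [abs_mul, abs_of_pos (by positivity), inv_mul_le_iff₀ hN] at this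
  linarith

end Interpolation

section Affine

theorem map_affine_volume {E : Type*} [NormedAddCommGroup E] [NormedSpace ℝ E]
    [FiniteDimensional ℝ E] [MeasurableSpace E] [BorelSpace E] (μ : Measure E) [μ.IsAddHaarMeasure]
    (x₀ : E) {R : ℝ} (hR : 0 < R) :
    μ.map (fun x => x₀ + R • x) =
      ENNReal.ofReal ((R ^ Module.finrank ℝ E)⁻¹) • μ := by
  rw [show (fun x => x₀ + R • x) = (fun x => x₀ + x) ∘ fun x => R • x from rfl,
    ← Measure.map_map (by fun_prop) (by fun_prop), Measure.map_addHaar_smul _ hR.ne',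
    Measure.map_smul, map_add_left_eq_self, abs_of_pos (by positivity)]

/-- The parabolic affine map sending the unit cylinder to the one of radius `R` at `z₀`. -/
def affP (R : ℝ) (z₀ z : Gd d) : Gd d := (z₀.1 + R ^ 2 * z.1, z₀.2 + R • z.2)

variable {R : ℝ} {z₀ : Gd d}

theorem measurable_affP : Measurable (affP R z₀) := by unfold affP; fun_prop

theorem measurableEmbedding_affP (hR : 0 < R) : MeasurableEmbedding (affP R z₀) := by
  refine Continuous.measurableEmbedding (by unfold affP; fun_prop) ?_
  intro z w h
  simp only [affP, Prod.mk.injEq, add_right_inj] at h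
  refine Prod.ext ?_ ?_
  · exact mul_left_cancel₀ (by positivity : R ^ 2 ≠ 0) h.1
  · exact smul_right_injective _ hR.ne' h.2

variable (d) in
/-- The volume of the unit cylinder relative to that of radius `R`. -/
def jacP (R : ℝ) : ℝ := (R ^ 2)⁻¹ * (R ^ d)⁻¹

theorem jacP_pos (hR : 0 < R) : 0 < jacP d R := by unfold jacP; positivity

theorem map_affP (hR : 0 < R) :
    (volume : Measure (Gd d)).map (affP R z₀) = ENNReal.ofReal (jacP d R) • volume := by
  have h1 := map_affine_volume (volume : Measure ℝ) z₀.1 (by positivity : 0 < R ^ 2)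
  have h2 := map_affine_volume (volume : Measure (Ed d)) z₀.2 hR
  simp only [Module.finrank_self, pow_one, smul_eq_mul, finrank_euclideanSpace,
    Fintype.card_fin] at h1 h2
  rw [Measure.volume_eq_prod]
  rw [show affP R z₀ = Prod.map (fun t => z₀.1 + R ^ 2 * t) (fun x => z₀.2 + R • x) from rfl,
    ← Measure.map_prod_map _ _ (by fun_prop) (by fun_prop), h1, h2, Measure.prod_smul_left,
    Measure.prod_smul_right, smul_smul, ← ENNReal.ofReal_mul (by positivity)]
  rfl

theorem lintegral_comp_affP (hR : 0 < R) (f : Gd d → ℝ≥0∞) :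
    ∫⁻ z, f (affP R z₀ z) = ENNReal.ofReal (jacP d R) * ∫⁻ z, f z := by
  rw [← (measurableEmbedding_affP hR).lintegral_map, map_affP hR, lintegral_smul_measure,
    smul_eq_mul]

theorem setLIntegral_comp_affP (hR : 0 < R) (f : Gd d → ℝ≥0∞) {S T : Set (Gd d)}
    (hS : MeasurableSet S) (hT : MeasurableSet T) (hST : ∀ z ∈ S, affP R z₀ z ∈ T) :
    ∫⁻ z in S, f (affP R z₀ z) ≤ ENNReal.ofReal (jacP d R) * ∫⁻ z in T, f z := by
  rw [← lintegral_indicator hS, ← lintegral_indicator hT, ← lintegral_comp_affP hR (z₀ := z₀)]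
  refine lintegral_mono fun z => ?_
  by_cases h : z ∈ S
  · rw [indicator_of_mem h, indicator_of_mem (hST z h)]
  · rw [indicator_of_notMem h]; exact zero_le

theorem ae_of_ae_affP (hR : 0 < R) {p : Gd d → Prop} (h : ∀ᵐ z, p (affP R z₀ z)) : ∀ᵐ z, p z := by
  have h1 := (measurableEmbedding_affP hR (z₀ := z₀)).ae_map_iff.2 h
  rw [map_affP hR] at h1
  exact (Measure.ae_ennreal_smul_measure_iff (by simpa using jacP_pos hR)).1 h1

theorem integral_comp_time (hR : 0 < R) (t₀ : ℝ) (f : ℝ → ℝ) :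
    ∫ t, f (t₀ + R ^ 2 * t) = (R ^ 2)⁻¹ * ∫ t, f t := by
  rw [Measure.integral_comp_mul_left (fun t => f (t₀ + t)), integral_add_left_eq_self,
    abs_of_pos (by positivity), smul_eq_mul]

theorem integral_comp_space (hR : 0 < R) (x₀ : Ed d) (f : Ed d → ℝ) :
    ∫ x, f (x₀ + R • x) = (R ^ d)⁻¹ * ∫ x, f x := by
  rw [Measure.integral_comp_smul volume (fun x => f (x₀ + x)), integral_add_left_eq_self,
    abs_of_pos (by positivity), smul_eq_mul]
  simp

theorem lintegral_comp_time (hR : 0 < R) (t₀ : ℝ) (f : ℝ → ℝ≥0∞) :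
    ∫⁻ t, f (t₀ + R ^ 2 * t) = ENNReal.ofReal ((R ^ 2)⁻¹) * ∫⁻ t, f t := by
  have h1 := map_affine_volume (volume : Measure ℝ) t₀ (by positivity : 0 < R ^ 2)
  simp only [Module.finrank_self, pow_one, smul_eq_mul] at h1
  rw [← smul_eq_mul (ENNReal.ofReal _), ← lintegral_smul_measure, ← h1,
    MeasurableEmbedding.lintegral_map]
  refine Continuous.measurableEmbedding (by fun_prop) fun t t' h => ?_
  exact mul_left_cancel₀ (by positivity : R ^ 2 ≠ 0) (add_left_cancel h)

theorem lintegral_comp_space (hR : 0 < R) (x₀ : Ed d) (f : Ed d → ℝ≥0∞) :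
    ∫⁻ x, f (x₀ + R • x) = ENNReal.ofReal ((R ^ d)⁻¹) * ∫⁻ x, f x := by
  have h1 := map_affine_volume (volume : Measure (Ed d)) x₀ hR
  simp only [finrank_euclideanSpace, Fintype.card_fin] at h1
  rw [← smul_eq_mul (ENNReal.ofReal _), ← lintegral_smul_measure, ← h1,
    MeasurableEmbedding.lintegral_map]
  refine Continuous.measurableEmbedding (by fun_prop) fun t t' h => ?_
  exact smul_right_injective _ hR.ne' (add_left_cancel h)

end Affine

section Rescale

variable {s Λ R ε : ℝ} {z₀ : Gd d} {J : Set ℝ} {Ω : Set (Ed d)} {v : ℝ → Ed d → ℝ}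
  {Dv : ℝ → Ed d → Ed d} {A : ℝ → Ed d → Ed d → Ed d} {K : ℝ → Ed d → Ed d → ℝ}

/-- The rescaled solution. -/
def vS (v : ℝ → Ed d → ℝ) (R : ℝ) (z₀ z : Gd d) : ℝ := Function.uncurry v (affP R z₀ z)

/-- The rescaled gradient. -/
def DvS (Dv : ℝ → Ed d → Ed d) (R : ℝ) (z₀ z : Gd d) : Ed d :=
  R • Function.uncurry Dv (affP R z₀ z)

/-- The rescaled flux. -/
def aS (A : ℝ → Ed d → Ed d → Ed d) (Dv : ℝ → Ed d → Ed d) (R : ℝ) (z₀ z : Gd d) : Ed d :=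
  R • A (affP R z₀ z).1 (affP R z₀ z).2 (Function.uncurry Dv (affP R z₀ z))

/-- The rescaled kernel. -/
def kS (K : ℝ → Ed d → Ed d → ℝ) (R : ℝ) (z₀ : Gd d) (p : ℝ × Ed d × Ed d) : ℝ :=
  R ^ (d + 2) * K (z₀.1 + R ^ 2 * p.1) (z₀.2 + R • p.2.1) (z₀.2 + R • p.2.2)

theorem measurable_flux (hA : VectorFieldHyp d Λ A) (hD : Measurable (Function.uncurry Dv)) :
    Measurable fun z : Gd d => A z.1 z.2 (Function.uncurry Dv z) := by
  have h := measurable_uncurry_of_continuous_of_measurable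
    (u := fun (ξ : Ed d) (z : Gd d) => A z.1 z.2 ξ) (fun z => hA.cont z.1 z.2) (fun ξ => hA.meas ξ)
  exact h.comp (hD.prodMk measurable_id)

theorem VectorFieldHyp.zero (hA : VectorFieldHyp d Λ A) (t : ℝ) (x : Ed d) : A t x 0 = 0 := by
  simpa using hA.growth t x 0

theorem norm_aS_le (hA : VectorFieldHyp d Λ A) (z : Gd d) :
    ‖aS A Dv R z₀ z‖ ≤ Λ * ‖DvS Dv R z₀ z‖ := by
  unfold aS DvS
  rw [norm_smul, norm_smul]
  have := hA.growth (affP R z₀ z).1 (affP R z₀ z).2 (Function.uncurry Dv (affP R z₀ z))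
  nlinarith [norm_nonneg R]

theorem le_inner_aS (hA : VectorFieldHyp d Λ A) (z : Gd d) :
    Λ⁻¹ * ‖DvS Dv R z₀ z‖ ^ 2 ≤ ⟪aS A Dv R z₀ z, DvS Dv R z₀ z⟫ := by
  unfold aS DvS
  rw [norm_smul, inner_smul_left, inner_smul_right, mul_pow, Real.norm_eq_abs, sq_abs]
  have := hA.monotone (affP R z₀ z).1 (affP R z₀ z).2 0 (Function.uncurry Dv (affP R z₀ z))
  rw [hA.zero, sub_zero, sub_zero] at this
  simp only [conj_trivial]
  nlinarith [sq_nonneg R]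

theorem contDiff_comp_inv {φ : Ed d → ℝ} (hφ : ContDiff ℝ (⊤ : ℕ∞) φ) (R : ℝ) (x₀ : Ed d) :
    ContDiff ℝ (⊤ : ℕ∞) fun y => φ (R⁻¹ • (y - x₀)) :=
  hφ.comp (contDiff_const_smul _ |>.comp (contDiff_id.sub contDiff_const))

theorem fderiv_comp_inv {φ : Ed d → ℝ} (hφ : ContDiff ℝ (⊤ : ℕ∞) φ) (R : ℝ) (x₀ y e : Ed d) :
    fderiv ℝ (fun y => φ (R⁻¹ • (y - x₀))) y e = R⁻¹ * fderiv ℝ φ (R⁻¹ • (y - x₀)) e := by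
  have h1 : HasFDerivAt (fun y : Ed d => R⁻¹ • (y - x₀)) (R⁻¹ • ContinuousLinearMap.id ℝ (Ed d)) y :=
    ((hasFDerivAt_id y).sub_const x₀).const_smul R⁻¹
  have h2 := ((hφ.differentiable (by simp)) (R⁻¹ • (y - x₀))).hasFDerivAt.comp y h1
  have h3 : fderiv ℝ (fun y => φ (R⁻¹ • (y - x₀))) y =
      (fderiv ℝ φ (R⁻¹ • (y - x₀))).comp (R⁻¹ • ContinuousLinearMap.id ℝ (Ed d)) := h2.fderiv
  rw [h3]
  simp

/-- Scaling of the weak gradient on time slices. -/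
theorem LocalWeakReg.grad_scaled (hv : LocalWeakReg d s J Ω v Dv) (hR : 0 < R) {t : ℝ}
    (ht : t ∈ J) (x₀ : Ed d) {φ : Ed d → ℝ} (hφ : ContDiff ℝ (⊤ : ℕ∞) φ) (hc : HasCompactSupport φ)
    (hΩ : ∀ x ∈ tsupport φ, x₀ + R • x ∈ Ω) (e : Ed d) :
    ∫ x, v t (x₀ + R • x) * fderiv ℝ φ x e = -∫ x, φ x * ⟪R • Dv t (x₀ + R • x), e⟫ := by
  have hinv : ∀ x : Ed d, R⁻¹ • (x₀ + R • x - x₀) = x := fun x => by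
    rw [add_sub_cancel_left, inv_smul_smul₀ hR.ne']
  have hinv' : ∀ y : Ed d, x₀ + R • R⁻¹ • (y - x₀) = y := fun y => by
    rw [smul_inv_smul₀ hR.ne']; abel
  have hsub : tsupport (fun y => φ (R⁻¹ • (y - x₀))) ⊆ (fun x => x₀ + R • x) '' tsupport φ := by
    refine closure_minimal (fun y hy => ⟨R⁻¹ • (y - x₀), subset_tsupport φ hy, hinv' y⟩) ?_
    exact (hc.isCompact.image (by fun_prop)).isClosed
  have h := hv.grad t ht _ (contDiff_comp_inv hφ R x₀)
    (HasCompactSupport.of_support_subset_isCompact (hc.isCompact.image (by fun_prop))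
      ((subset_tsupport _).trans hsub))
    (hsub.trans (by rintro _ ⟨x, hx, rfl⟩; exact hΩ x hx)) e
  simp only [fderiv_comp_inv hφ] at h
  have hd : (0 : ℝ) < (R ^ d)⁻¹ := by positivity
  have e1 := integral_comp_space hR x₀ fun y => v t y * (R⁻¹ * fderiv ℝ φ (R⁻¹ • (y - x₀)) e)
  have e2 := integral_comp_space hR x₀ fun y => φ (R⁻¹ • (y - x₀)) * ⟪Dv t y, e⟫
  simp only [hinv] at e1 e2
  simp only [inner_smul_left, conj_trivial]
  have e3 : ∫ x, φ x * (R * ⟪Dv t (x₀ + R • x), e⟫) =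
      R * ∫ x, φ x * ⟪Dv t (x₀ + R • x), e⟫ := by
    rw [← integral_const_mul]; congr 1; ext x; ring
  have e4 : ∫ x, v t (x₀ + R • x) * (R⁻¹ * fderiv ℝ φ x e) =
      R⁻¹ * ∫ x, v t (x₀ + R • x) * fderiv ℝ φ x e := by
    rw [← integral_const_mul]; congr 1; ext x; ring
  rw [h, e4] at e1
  rw [e3, e2]
  field_simp at e1 ⊢
  linarith

theorem LocalWeakReg.measurable_vS (hv : LocalWeakReg d s J Ω v Dv) : Measurable (vS v R z₀) :=
  hv.meas.comp measurable_affP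

theorem LocalWeakReg.measurable_DvS (hv : LocalWeakReg d s J Ω v Dv) :
    Measurable (DvS Dv R z₀) := (hv.measD.comp measurable_affP).const_smul R

theorem LocalWeakReg.memLp_scaled (hv : LocalWeakReg d s J Ω v Dv) (hR : 0 < R)
    (hJ : Icc (z₀.1 - 2 * R ^ 2) (z₀.1 + R ^ 2 * ε) ⊆ J) (hΩ : closedBall z₀.2 (2 * R) ⊆ Ω) :
    MemLp (vS v R z₀) 2 (volume.restrict (Ioo (-2) ε ×ˢ ball (0 : Ed d) 2)) ∧
      MemLp (DvS Dv R z₀) 2 (volume.restrict (Ioo (-2) ε ×ˢ ball (0 : Ed d) 2)) := by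
  have hI := hv.l2w12 _ _ hJ _ (isCompact_closedBall _ _) hΩ
  have hmem : ∀ z ∈ Ioo (-2) ε ×ˢ ball (0 : Ed d) 2, affP R z₀ z ∈
      Ioo (z₀.1 - 2 * R ^ 2) (z₀.1 + R ^ 2 * ε) ×ˢ closedBall z₀.2 (2 * R) := by
    rintro ⟨t, x⟩ ⟨ht, hx⟩
    have hR2 : 0 < R ^ 2 := by positivity
    refine ⟨⟨?_, ?_⟩, ?_⟩
    · simp only [affP]; nlinarith [ht.1]
    · simp only [affP]; nlinarith [ht.2]
    · have : ‖x‖ < 2 := by simpa using hx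
      simp only [affP, mem_closedBall, dist_self_add_left, norm_smul, Real.norm_eq_abs,
        abs_of_pos hR]
      nlinarith
  have hfin : ∀ {X : Type} [NormedAddCommGroup X] (f : Gd d → X),
      (∀ z, ‖f z‖ ^ 2 ≤ (v z.1 z.2) ^ 2 + ‖Dv z.1 z.2‖ ^ 2) →
      ∫⁻ z in Ioo (-2) ε ×ˢ ball (0 : Ed d) 2, ‖f (affP R z₀ z)‖ₑ ^ 2 < ⊤ := by
    intro X _ f hf
    refine lt_of_le_of_lt (setLIntegral_comp_affP hR (fun z => ‖f z‖ₑ ^ 2)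
      (measurableSet_Ioo.prod measurableSet_ball)
      (measurableSet_Ioo.prod isClosed_closedBall.measurableSet) hmem) ?_
    refine ENNReal.mul_lt_top ENNReal.ofReal_lt_top (lt_of_le_of_lt ?_ hI.2)
    refine lintegral_mono fun z => ?_
    rw [← ofReal_norm, ← ofReal_norm, ← ENNReal.ofReal_pow (norm_nonneg _)]
    exact ENNReal.ofReal_le_ofReal ((hf z).trans (le_abs_self _))
  have h1 := hfin (fun z => v z.1 z.2) fun z => by
    rw [Real.norm_eq_abs, sq_abs]; exact le_add_of_nonneg_right (sq_nonneg _)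
  have h2 := hfin (fun z => Dv z.1 z.2) fun z => le_add_of_nonneg_left (sq_nonneg _)
  refine ⟨⟨hv.measurable_vS.aestronglyMeasurable, ?_⟩, ?_⟩
  · by_contra h
    have h3 := eLpNorm_two_sq (ν := volume.restrict (Ioo (-2) ε ×ˢ ball (0 : Ed d) 2)) (vS v R z₀)
    rw [top_le_iff.1 (not_lt.1 h)] at h3
    rw [ENNReal.top_pow (by norm_num)] at h3
    exact h1.ne h3.symm
  · refine MemLp.const_smul (f := fun z => Function.uncurry Dv (affP R z₀ z)) ⟨(hv.measD.comp measurable_affP).aestronglyMeasurable, ?_⟩ R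
    by_contra h
    have h3 := eLpNorm_two_sq (ν := volume.restrict (Ioo (-2) ε ×ˢ ball (0 : Ed d) 2))
      (fun z => Function.uncurry Dv (affP R z₀ z))
    rw [top_le_iff.1 (not_lt.1 h)] at h3
    rw [ENNReal.top_pow (by norm_num)] at h3
    exact h2.ne h3.symm

end Rescale

section RescaleLoc

variable {s Λ R ε : ℝ} {z₀ : Gd d} {J : Set ℝ} {Ω : Set (Ed d)} {v : ℝ → Ed d → ℝ}
  {Dv : ℝ → Ed d → Ed d}

theorem contDiff_slice {φ : Gd d → ℝ} (hφ : ContDiff ℝ (⊤ : ℕ∞) φ) (t : ℝ) :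
    ContDiff ℝ (⊤ : ℕ∞) fun x => φ (t, x) := hφ.comp (contDiff_prodMk_right t)

theorem tsupport_slice_subset (φ : Gd d → ℝ) (t : ℝ) :
    tsupport (fun x => φ (t, x)) ⊆ (fun x => (t, x)) ⁻¹' tsupport φ :=
  closure_minimal (fun _ hx => subset_tsupport φ hx)
    ((isClosed_tsupport φ).preimage (by fun_prop))

theorem hasCompactSupport_slice {φ : Gd d → ℝ} (hφ : HasCompactSupport φ) (t : ℝ) :
    HasCompactSupport fun x => φ (t, x) := by
  refine HasCompactSupport.of_support_subset_isCompact (hφ.isCompact.image continuous_snd) ?_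
  exact fun x hx => ⟨(t, x), subset_tsupport φ hx, rfl⟩

theorem fderiv_slice {φ : Gd d → ℝ} (hφ : ContDiff ℝ (⊤ : ℕ∞) φ) (t : ℝ) (x e : Ed d) :
    fderiv ℝ (fun x => φ (t, x)) x e = fderiv ℝ φ (t, x) (0, e) := by
  have h1 : HasFDerivAt (fun x : Ed d => (t, x)) (ContinuousLinearMap.inr ℝ ℝ (Ed d)) x :=
    hasFDerivAt_prodMk_right t x
  have h2 := ((hφ.differentiable (by simp)) (t, x)).hasFDerivAt.comp x h1
  have h3 : fderiv ℝ (fun x => φ (t, x)) x =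
      (fderiv ℝ φ (t, x)).comp (ContinuousLinearMap.inr ℝ ℝ (Ed d)) := h2.fderiv
  rw [h3]; rfl

theorem affP_mem (hR : 0 < R) (hJ : Icc (z₀.1 - 2 * R ^ 2) (z₀.1 + R ^ 2 * ε) ⊆ J)
    (hΩ : closedBall z₀.2 (2 * R) ⊆ Ω) {z : Gd d} (hz : z ∈ Ioo (-2) ε ×ˢ ball (0 : Ed d) 2) :
    z₀.1 + R ^ 2 * z.1 ∈ J ∧ z₀.2 + R • z.2 ∈ Ω := by
  have hR2 : 0 < R ^ 2 := by positivity
  refine ⟨hJ ⟨by nlinarith [hz.1.1], by nlinarith [hz.1.2]⟩, hΩ ?_⟩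
  have : ‖z.2‖ < 2 := by simpa using hz.2
  rw [mem_closedBall, dist_self_add_left, norm_smul, Real.norm_eq_abs, abs_of_pos hR]
  nlinarith

theorem LocalWeakReg.hasWeakGx_scaled (hv : LocalWeakReg d s J Ω v Dv) (hR : 0 < R)
    (hJ : Icc (z₀.1 - 2 * R ^ 2) (z₀.1 + R ^ 2 * ε) ⊆ J) (hΩ : closedBall z₀.2 (2 * R) ⊆ Ω) :
    HasWeakGx (vS v R z₀) (DvS Dv R z₀) (Ioo (-2) ε ×ˢ ball (0 : Ed d) 2) := by
  intro φ h1 h2 h3 e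
  obtain ⟨m1, m2⟩ := hv.memLp_scaled hR hJ hΩ
  have hφ1 : ContDiff ℝ 1 φ := h1.of_le (by simp)
  have i1 : Integrable fun z => vS v R z₀ z * fderiv ℝ φ z (0, e) :=
    MemLp.integrable_mul_of_eq_zero m1 ((hφ1.continuous_fderiv (by simp)).clm_apply continuous_const)
      (h2.fderiv_apply ℝ _) fun z hz => by rw [fderiv_eq_zero_of_tsupport h3 hz]; rfl
  have m3 : MemLp (fun z => ⟪DvS Dv R z₀ z, e⟫) 2
      (volume.restrict (Ioo (-2) ε ×ˢ ball (0 : Ed d) 2)) := m2.inner_const e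
  have i2 : Integrable fun z => φ z * ⟪DvS Dv R z₀ z, e⟫ := by
    refine (MemLp.integrable_mul_of_eq_zero m3 hφ1.continuous h2 fun z hz => ?_).congr
      (ae_of_all _ fun z => mul_comm _ _)
    exact image_eq_zero_of_notMem_tsupport fun h => hz (h3 h)
  rw [Measure.volume_eq_prod] at i1 i2 ⊢
  rw [integral_prod _ i1, integral_prod _ i2, ← integral_neg]
  congr 1
  ext t
  by_cases ht : t ∈ Ioo (-2) ε
  · have htJ := (affP_mem hR hJ hΩ (z := (t, 0)) ⟨ht, by simp⟩).1
    have h := hv.grad_scaled hR htJ z₀.2 (contDiff_slice h1 t) (hasCompactSupport_slice h2 t)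
      (fun x hx => (affP_mem hR hJ hΩ (h3 (tsupport_slice_subset φ t hx))).2) e
    simp only [fderiv_slice h1] at h
    exact h
  · have e1 : ∀ x, φ (t, x) = 0 := fun x =>
      image_eq_zero_of_notMem_tsupport fun h => ht (h3 h).1
    have e2 : ∀ x, fderiv ℝ φ (t, x) = 0 := fun x =>
      fderiv_eq_zero_of_tsupport h3 fun h => ht h.1
    simp [e1, e2]

theorem LocalWeakReg.loc_scaled (hv : LocalWeakReg d s J Ω v Dv) (hR : 0 < R) (hε : 0 < ε)
    (hJ : Icc (z₀.1 - 2 * R ^ 2) (z₀.1 + R ^ 2 * ε) ⊆ J) (hΩ : closedBall z₀.2 (2 * R) ⊆ Ω) :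
    ∃ O, IsOpen O ∧ volume O ≠ ⊤ ∧ Icc (-1) 0 ×ˢ closedBall (0 : Ed d) 1 ⊆ O ∧
      MemLp (vS v R z₀) 2 (volume.restrict O) ∧ MemLp (DvS Dv R z₀) 2 (volume.restrict O) ∧
      HasWeakGx (vS v R z₀) (DvS Dv R z₀) O := by
  obtain ⟨m1, m2⟩ := hv.memLp_scaled hR hJ hΩ
  refine ⟨Ioo (-2) ε ×ˢ ball (0 : Ed d) 2, isOpen_Ioo.prod isOpen_ball, ?_, ?_, m1, m2,
    hv.hasWeakGx_scaled hR hJ hΩ⟩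
  · rw [Measure.volume_eq_prod, Measure.prod_prod]
    exact ENNReal.mul_ne_top measure_Ioo_lt_top.ne measure_ball_lt_top.ne
  · refine Set.prod_mono ?_ (closedBall_subset_ball (by norm_num))
    exact fun t ht => ⟨by linarith [ht.1], by linarith [ht.2]⟩

end RescaleLoc

section RescaleKernel

variable {s Λ R : ℝ} {z₀ : Gd d} {K : ℝ → Ed d → Ed d → ℝ}

/-- The rescaled jump measure. -/
def nuK (K : ℝ → Ed d → Ed d → ℝ) (R : ℝ) (z₀ : Gd d) : Measure (ℝ × Ed d × Ed d) :=
  volume.withDensity fun p => ENNReal.ofReal (kS K R z₀ p)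

theorem KernelHyp.measurable_kS (hK : KernelHyp d s Λ K) : Measurable (kS K R z₀) := by
  unfold kS
  refine measurable_const.mul (hK.meas.comp (g := fun p : ℝ × Ed d × Ed d => K p.1 p.2.1 p.2.2)
    (f := fun p : ℝ × Ed d × Ed d => (z₀.1 + R ^ 2 * p.1, z₀.2 + R • p.2.1, z₀.2 + R • p.2.2)) ?_)
  fun_prop

theorem map_swapXY_volume :
    (volume : Measure (ℝ × Ed d × Ed d)).map swapXY = volume := by
  have h1 : (volume : Measure (Ed d × Ed d)).map Prod.swap = volume := Measure.prod_swap
  rw [show (swapXY : ℝ × Ed d × Ed d → _) = Prod.map id Prod.swap from rfl, Measure.volume_eq_prod,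
    ← Measure.map_prod_map _ _ measurable_id measurable_swap, Measure.map_id, h1]

theorem KernelHyp.map_nuK (hK : KernelHyp d s Λ K) :
    (nuK K R z₀).map swapXY = nuK K R z₀ := by
  have hsw : MeasurePreserving (swapXY : ℝ × Ed d × Ed d → _) volume volume :=
    ⟨measurable_swapXY, map_swapXY_volume⟩
  ext S hS
  rw [Measure.map_apply measurable_swapXY hS, nuK, withDensity_apply _ (measurable_swapXY hS),
    withDensity_apply _ hS, ← hsw.setLIntegral_comp_preimage hS hK.measurable_kS.ennreal_ofReal]
  refine lintegral_congr fun p => ?_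
  unfold kS swapXY
  rw [hK.symm]

theorem kS_le (hK : KernelHyp d s Λ K) (hR : 0 < R) {p : ℝ × Ed d × Ed d} (hp : p.2.1 ≠ p.2.2) :
    kS K R z₀ p ≤ Λ * R ^ (2 - 2 * s) * kerS s (p.2.2 - p.2.1) := by
  have hne : z₀.2 + R • p.2.1 ≠ z₀.2 + R • p.2.2 := fun h =>
    hp (smul_right_injective _ hR.ne' (add_left_cancel h))
  have h := hK.upper (z₀.1 + R ^ 2 * p.1) _ _ hne
  rw [add_sub_add_left_eq_sub, ← smul_sub, norm_smul, Real.norm_eq_abs, abs_of_pos hR,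
    Real.mul_rpow hR.le (norm_nonneg _)] at h
  unfold kS kerS
  rw [← norm_sub_rev p.2.1]
  have hn : 0 < ‖p.2.1 - p.2.2‖ := norm_pos_iff.2 (sub_ne_zero.2 hp)
  have hn' := Real.rpow_pos_of_pos hn ((d : ℝ) + 2 * s)
  have hR' := Real.rpow_pos_of_pos hR ((d : ℝ) + 2 * s)
  have e : R ^ (d + 2) = R ^ (2 - 2 * s) * R ^ ((d : ℝ) + 2 * s) := by
    rw [← Real.rpow_add hR, ← Real.rpow_natCast]
    congr 1
    push_cast; ring
  calc _ ≤ R ^ (d + 2) * (Λ / (R ^ ((d : ℝ) + 2 * s) * ‖p.2.1 - p.2.2‖ ^ ((d : ℝ) + 2 * s))) := by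
        gcongr
    _ = _ := by rw [e]; field_simp

theorem ae_fst_ne_snd (hd : 1 ≤ d) : ∀ᵐ p : ℝ × Ed d × Ed d, p.2.1 ≠ p.2.2 := by
  have : Nonempty (Fin d) := ⟨⟨0, hd⟩⟩
  have hm : MeasurableSet {q : Ed d × Ed d | q.1 ≠ q.2} :=
    (measurableSet_eq_fun measurable_fst measurable_snd).compl
  have h1 : ∀ᵐ q : Ed d × Ed d, q.1 ≠ q.2 := by
    rw [Measure.volume_eq_prod, Measure.ae_prod_iff_ae_ae hm]
    refine ae_of_all _ fun x => ?_
    have : ({x}ᶜ : Set (Ed d)) ∈ ae volume := compl_mem_ae_iff.2 (measure_singleton x)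
    filter_upwards [this] with y hy h
    exact hy h.symm
  exact Measure.quasiMeasurePreserving_snd.ae h1

theorem KernelHyp.nuK_le (hK : KernelHyp d s Λ K) (hd : 1 ≤ d) (hΛ : 0 ≤ Λ) (hR : 0 < R) :
    nuK K R z₀ ≤ ENNReal.ofReal (Λ * R ^ (2 - 2 * s)) • nuS d s := by
  unfold nuK nuS
  rw [← withDensity_smul' _ _ ENNReal.ofReal_ne_top]
  refine withDensity_mono ((ae_fst_ne_snd hd).mono fun p hp => ?_)
  rw [Pi.smul_apply, smul_eq_mul, ← ENNReal.ofReal_mul (by positivity)]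
  exact ENNReal.ofReal_le_ofReal (kS_le hK hR hp)

theorem KernelHyp.nuK_le_nuS (hK : KernelHyp d s Λ K) (hd : 1 ≤ d) (hs : s ≤ 1) (hΛ : 0 ≤ Λ)
    (hR : 0 < R) (hR1 : R ≤ 1) : nuK K R z₀ ≤ ENNReal.ofReal Λ • nuS d s := by
  refine (hK.nuK_le hd hΛ hR).trans (Measure.le_iff'.2 fun S => ?_)
  rw [Measure.smul_apply, Measure.smul_apply, smul_eq_mul, smul_eq_mul]
  refine mul_le_mul_left (ENNReal.ofReal_le_ofReal (mul_le_of_le_one_right hΛ ?_)) _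
  exact Real.rpow_le_one hR.le hR1 (by linarith)

end RescaleKernel

section RescaleTail

variable {s Λ R ε r : ℝ} {z₀ : Gd d} {J : Set ℝ} {Ω : Set (Ed d)} {v : ℝ → Ed d → ℝ}
  {Dv : ℝ → Ed d → Ed d}

theorem kerS_le_weight (hs : 0 ≤ s) (hR : 0 ≤ R) (hr : 0 < r) (x₀ : Ed d) {y : Ed d}
    (hy : r ≤ ‖y‖) :
    kerS s y ≤ ((1 / r) ^ ((d : ℝ) + 2 * s) + (‖x₀‖ / r + R) ^ ((d : ℝ) + 2 * s)) *
      (1 / (1 + ‖x₀ + R • y‖ ^ ((d : ℝ) + 2 * s))) := by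
  have hp : 0 ≤ (d : ℝ) + 2 * s := by positivity
  have hy0 : 0 < ‖y‖ := by linarith
  have h1 : 1 ≤ (1 / r) ^ ((d : ℝ) + 2 * s) * ‖y‖ ^ ((d : ℝ) + 2 * s) := by
    rw [← Real.mul_rpow (by positivity) hy0.le]
    refine Real.one_le_rpow ?_ hp
    rw [one_div, inv_mul_eq_div, le_div_iff₀ hr]; linarith
  have h2 : ‖x₀ + R • y‖ ^ ((d : ℝ) + 2 * s) ≤
      (‖x₀‖ / r + R) ^ ((d : ℝ) + 2 * s) * ‖y‖ ^ ((d : ℝ) + 2 * s) := by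
    rw [← Real.mul_rpow (by positivity) hy0.le]
    refine Real.rpow_le_rpow (norm_nonneg _) ?_ hp
    refine (norm_add_le _ _).trans ?_
    rw [norm_smul, Real.norm_eq_abs, abs_of_nonneg hR, add_mul]
    refine add_le_add_left ?_ _
    rw [div_mul_eq_mul_div, le_div_iff₀ hr]
    gcongr
  have h3 : 0 < ‖y‖ ^ ((d : ℝ) + 2 * s) := Real.rpow_pos_of_pos hy0 _
  have h4 : 0 ≤ ‖x₀ + R • y‖ ^ ((d : ℝ) + 2 * s) := by positivity
  unfold kerS
  rw [mul_one_div, div_le_div_iff₀ h3 (by linarith)]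
  nlinarith

/-- The weighted `L¹` norm of a time slice. -/
def wgt (s : ℝ) (v : ℝ → Ed d → ℝ) (t : ℝ) : ℝ≥0∞ :=
  ∫⁻ y, ‖v t y‖ₑ * ENNReal.ofReal (1 / (1 + ‖y‖ ^ ((d : ℝ) + 2 * s)))

theorem tauS_vS_le (hs : 0 ≤ s) (hR : 0 < R) (hr : 0 < r) (t : ℝ) :
    tauS s (vS v R z₀) r t ≤ ENNReal.ofReal (((1 / r) ^ ((d : ℝ) + 2 * s) +
      (‖z₀.2‖ / r + R) ^ ((d : ℝ) + 2 * s)) * (R ^ d)⁻¹) * wgt s v (z₀.1 + R ^ 2 * t) := by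
  set C := (1 / r) ^ ((d : ℝ) + 2 * s) + (‖z₀.2‖ / r + R) ^ ((d : ℝ) + 2 * s) with hC
  have hC0 : 0 ≤ C := by positivity
  calc tauS s (vS v R z₀) r t ≤ ∫⁻ y in (ball (0 : Ed d) r)ᶜ, ENNReal.ofReal C *
        (‖v (z₀.1 + R ^ 2 * t) (z₀.2 + R • y)‖ₑ *
          ENNReal.ofReal (1 / (1 + ‖z₀.2 + R • y‖ ^ ((d : ℝ) + 2 * s)))) := by
        refine setLIntegral_mono' measurableSet_ball.compl fun y hy => ?_
        rw [mul_left_comm, ← ENNReal.ofReal_mul hC0]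
        refine mul_le_mul_right (ENNReal.ofReal_le_ofReal ?_) _
        exact kerS_le_weight hs hR.le hr _ (by simpa using hy)
    _ ≤ ∫⁻ y, ENNReal.ofReal C * (‖v (z₀.1 + R ^ 2 * t) (z₀.2 + R • y)‖ₑ *
          ENNReal.ofReal (1 / (1 + ‖z₀.2 + R • y‖ ^ ((d : ℝ) + 2 * s)))) :=
        setLIntegral_le_lintegral _ _
    _ = _ := by
        rw [lintegral_const_mul' _ _ ENNReal.ofReal_ne_top,
          lintegral_comp_space hR z₀.2 (fun y => ‖v (z₀.1 + R ^ 2 * t) y‖ₑ *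
            ENNReal.ofReal (1 / (1 + ‖y‖ ^ ((d : ℝ) + 2 * s)))), ← mul_assoc,
          ← ENNReal.ofReal_mul hC0]
        rfl

theorem setLIntegral_comp_time (hR : 0 < R) (t₀ : ℝ) (f : ℝ → ℝ≥0∞) :
    ∫⁻ t in Ioo (-1) 0, f (t₀ + R ^ 2 * t) =
      ENNReal.ofReal ((R ^ 2)⁻¹) * ∫⁻ t in Ioo (t₀ - R ^ 2) t₀, f t := by
  rw [← lintegral_indicator measurableSet_Ioo, ← lintegral_indicator measurableSet_Ioo,
    ← lintegral_comp_time hR t₀]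
  refine lintegral_congr fun t => ?_
  have hR2 : 0 < R ^ 2 := by positivity
  have : t₀ + R ^ 2 * t ∈ Ioo (t₀ - R ^ 2) t₀ ↔ t ∈ Ioo (-1) 0 := by
    simp only [mem_Ioo]
    constructor <;> intro h <;> constructor <;> nlinarith [h.1, h.2]
  simp only [indicator, this]

theorem LocalWeakReg.wgt_eq (hv : LocalWeakReg d s J Ω v Dv) : ∀ᵐ t : ℝ, t ∈ J →
    wgt s v t = ENNReal.ofReal (∫ y : Ed d, |v t y| / (1 + ‖y‖ ^ ((d : ℝ) + 2 * s))) := by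
  filter_upwards [hv.tail_ae] with t ht hJ
  rw [ofReal_integral_eq_lintegral_ofReal (ht hJ) (ae_of_all _ fun y => by positivity)]
  refine lintegral_congr fun y => ?_
  rw [← ofReal_norm, ← ENNReal.ofReal_mul (norm_nonneg _), Real.norm_eq_abs, mul_one_div]

theorem LocalWeakReg.lintegral_wgt_sq_lt_top (hv : LocalWeakReg d s J Ω v Dv) {t₁ t₂ : ℝ}
    (hJ : Icc t₁ t₂ ⊆ J) : ∫⁻ t in Ioo t₁ t₂, wgt s v t ^ 2 < ⊤ := by
  refine lt_of_le_of_lt ?_ (hv.tail_l2 t₁ t₂ hJ).2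
  refine setLIntegral_mono_ae' measurableSet_Ioo (hv.wgt_eq.mono fun t ht hmem => ?_)
  rw [ht (hJ ⟨hmem.1.le, hmem.2.le⟩), enorm_pow, Real.enorm_eq_ofReal]
  exact integral_nonneg fun y => by positivity

theorem LocalWeakReg.tail_scaled (hv : LocalWeakReg d s J Ω v Dv) (hs : 0 ≤ s) (hR : 0 < R)
    (hJ : Icc (z₀.1 - R ^ 2) z₀.1 ⊆ J) (hr : 0 < r) :
    ∫⁻ t in Ioo (-1) 0, tauS s (vS v R z₀) r t ^ 2 < ⊤ := by
  refine lt_of_le_of_lt (lintegral_mono fun t => pow_le_pow_left₀ zero_le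
    (tauS_vS_le hs hR hr t) 2) ?_
  simp only [mul_pow]
  rw [lintegral_const_mul' _ _ (by simp), setLIntegral_comp_time hR z₀.1 fun t => wgt s v t ^ 2]
  exact ENNReal.mul_lt_top (by simp) (ENNReal.mul_lt_top (by simp) (hv.lintegral_wgt_sq_lt_top hJ))

end RescaleTail

section RescaleWeak

variable {s Λ R : ℝ} {z₀ : Gd d} {Ω : Set (Ed d)} {v : ℝ → Ed d → ℝ}
  {Dv : ℝ → Ed d → Ed d} {A : ℝ → Ed d → Ed d → Ed d} {K : ℝ → Ed d → Ed d → ℝ} {φ : Gd d → ℝ}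

theorem integral_eq_time (hR : 0 < R) (t₀ : ℝ) (f : ℝ → ℝ) :
    ∫ t, f t = R ^ 2 * ∫ t, f (t₀ + R ^ 2 * t) := by
  rw [integral_comp_time hR, mul_inv_cancel_left₀ (by positivity)]

theorem integral_eq_space (hR : 0 < R) (x₀ : Ed d) (f : Ed d → ℝ) :
    ∫ x, f x = R ^ d * ∫ x, f (x₀ + R • x) := by
  rw [integral_comp_space hR, mul_inv_cancel_left₀ (by positivity)]

theorem exists_time_coord (hR : 0 < R) (t₀ t : ℝ) : ∃ τ, t = t₀ + R ^ 2 * τ :=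
  ⟨(R ^ 2)⁻¹ * (t - t₀), by field_simp; ring⟩

theorem exists_space_coord (hR : 0 < R) (x₀ x : Ed d) : ∃ ξ, x = x₀ + R • ξ :=
  ⟨R⁻¹ • (x - x₀), by rw [smul_inv_smul₀ hR.ne']; abel⟩

theorem setIntegral_time (hR : 0 < R) {F : ℝ → ℝ}
    (hF : ∀ τ ∉ Ioo (-1 : ℝ) 0, F (z₀.1 + R ^ 2 * τ) = 0) :
    ∫ t in Ioc (z₀.1 - R ^ 2) z₀.1, F t = R ^ 2 * ∫ τ, F (z₀.1 + R ^ 2 * τ) := by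
  rw [← integral_eq_time hR]
  refine setIntegral_eq_integral_of_forall_compl_eq_zero fun t ht => ?_
  obtain ⟨τ, rfl⟩ := exists_time_coord hR z₀.1 t
  refine hF τ fun h => ht ?_
  have : 0 < R ^ 2 := by positivity
  exact ⟨by nlinarith [h.1], by nlinarith [h.2]⟩

theorem setIntegral_space (hR : 0 < R) (hΩ : ball z₀.2 R ⊆ Ω) {F : Ed d → ℝ}
    (hF : ∀ ξ ∉ ball (0 : Ed d) 1, F (z₀.2 + R • ξ) = 0) :
    ∫ x in Ω, F x = R ^ d * ∫ ξ, F (z₀.2 + R • ξ) := by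
  rw [← integral_eq_space hR]
  refine setIntegral_eq_integral_of_forall_compl_eq_zero fun x hx => ?_
  obtain ⟨ξ, rfl⟩ := exists_space_coord hR z₀.2 x
  refine hF ξ fun h => hx (hΩ ?_)
  have : ‖ξ‖ < 1 := by simpa using h
  rw [mem_ball, dist_self_add_left, norm_smul, Real.norm_eq_abs, abs_of_pos hR]
  nlinarith

theorem setIntegral_time_space (hR : 0 < R) (hΩ : ball z₀.2 R ⊆ Ω) {F : ℝ → Ed d → ℝ}
    (hF : ∀ τ ξ, (τ, ξ) ∉ Ioo (-1 : ℝ) 0 ×ˢ ball (0 : Ed d) 1 →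
      F (z₀.1 + R ^ 2 * τ) (z₀.2 + R • ξ) = 0) :
    ∫ t in Ioc (z₀.1 - R ^ 2) z₀.1, ∫ x in Ω, F t x =
      R ^ 2 * R ^ d * ∫ τ, ∫ ξ, F (z₀.1 + R ^ 2 * τ) (z₀.2 + R • ξ) := by
  have h1 : ∀ τ, ∫ x in Ω, F (z₀.1 + R ^ 2 * τ) x =
      R ^ d * ∫ ξ, F (z₀.1 + R ^ 2 * τ) (z₀.2 + R • ξ) := fun τ =>
    setIntegral_space hR hΩ fun ξ hξ => hF τ ξ fun h => hξ h.2
  rw [setIntegral_time hR]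
  · simp only [h1]
    rw [integral_const_mul, mul_assoc]
  · intro τ hτ
    rw [h1]
    simp [hF τ _ fun h => hτ h.1]

theorem setIntegral_time_space_space (hR : 0 < R) {F : ℝ → Ed d → Ed d → ℝ}
    (hF : ∀ τ ∉ Ioo (-1 : ℝ) 0, ∀ ξ η : Ed d,
      F (z₀.1 + R ^ 2 * τ) (z₀.2 + R • ξ) (z₀.2 + R • η) = 0) :
    ∫ t in Ioc (z₀.1 - R ^ 2) z₀.1, ∫ x, ∫ y, F t x y =
      R ^ 2 * R ^ d * R ^ d *
        ∫ τ, ∫ ξ, ∫ η, F (z₀.1 + R ^ 2 * τ) (z₀.2 + R • ξ) (z₀.2 + R • η) := by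
  have h1 : ∀ τ, ∫ x, ∫ y, F (z₀.1 + R ^ 2 * τ) x y =
      R ^ d * (R ^ d * ∫ ξ, ∫ η, F (z₀.1 + R ^ 2 * τ) (z₀.2 + R • ξ) (z₀.2 + R • η)) := fun τ => by
    rw [integral_eq_space hR z₀.2]
    congr 1
    rw [← integral_const_mul]
    congr 1
    funext ξ
    exact integral_eq_space hR z₀.2 _
  rw [setIntegral_time hR]
  · simp only [h1]
    rw [integral_const_mul, integral_const_mul]
    ring
  · intro τ hτ
    rw [h1]
    simp [hF τ hτ]

/-- The test function in the original variables. -/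
def testS (φ : Gd d → ℝ) (R : ℝ) (z₀ : Gd d) (t : ℝ) (x : Ed d) : ℝ :=
  φ ((R ^ 2)⁻¹ * (t - z₀.1), R⁻¹ • (x - z₀.2))

theorem testS_apply (hR : 0 < R) (τ : ℝ) (ξ : Ed d) :
    testS φ R z₀ (z₀.1 + R ^ 2 * τ) (z₀.2 + R • ξ) = φ (τ, ξ) := by
  unfold testS
  rw [add_sub_cancel_left, add_sub_cancel_left, inv_smul_smul₀ hR.ne',
    inv_mul_cancel_left₀ (by positivity)]

theorem isTestFunction_testS (hφ : ContDiff ℝ (⊤ : ℕ∞) φ) (hφt : tsupport φ ⊆ Ioo (-1) 0 ×ˢ ball 0 1)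
    (hR : 0 < R) (hΩ : closedBall z₀.2 R ⊆ Ω) : IsTestFunction Ω (testS φ R z₀) := by
  refine ⟨?_, closedBall z₀.2 R, isCompact_closedBall _ _, hΩ, fun t => ?_⟩
  · refine hφ.comp (ContDiff.prodMk ?_ ?_)
    · exact contDiff_const.mul (contDiff_fst.sub contDiff_const)
    · exact (contDiff_snd.sub contDiff_const).const_smul R⁻¹
  · refine closure_minimal (fun x hx => ?_) isClosed_closedBall
    obtain ⟨τ, rfl⟩ := exists_time_coord hR z₀.1 t
    obtain ⟨ξ, rfl⟩ := exists_space_coord hR z₀.2 x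
    rw [Function.mem_support, testS_apply hR] at hx
    have h := (hφt (subset_tsupport φ hx)).2
    have : ‖ξ‖ < 1 := by simpa using h
    rw [mem_closedBall, dist_self_add_left, norm_smul, Real.norm_eq_abs, abs_of_pos hR]
    nlinarith

theorem deriv_testS (hφ : ContDiff ℝ (⊤ : ℕ∞) φ) (hR : 0 < R) (τ : ℝ) (ξ : Ed d) :
    deriv (fun t => testS φ R z₀ t (z₀.2 + R • ξ)) (z₀.1 + R ^ 2 * τ) =
      (R ^ 2)⁻¹ * fderiv ℝ φ (τ, ξ) (1, 0) := by
  have h1 : HasDerivAt (fun t : ℝ => (R ^ 2)⁻¹ * (t - z₀.1)) (R ^ 2)⁻¹ (z₀.1 + R ^ 2 * τ) := by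
    simpa using ((hasDerivAt_id (z₀.1 + R ^ 2 * τ)).sub_const z₀.1).const_mul (R ^ 2)⁻¹
  have e : (R ^ 2)⁻¹ * (z₀.1 + R ^ 2 * τ - z₀.1) = τ := by
    rw [add_sub_cancel_left, inv_mul_cancel_left₀ (by positivity)]
  have h2 := hasDerivAt_slice_fst (hφ.of_le (by simp)) τ ξ
  have h3 := HasDerivAt.scomp (h := fun t : ℝ => (R ^ 2)⁻¹ * (t - z₀.1)) (z₀.1 + R ^ 2 * τ)
    (g₁ := fun t => φ (t, ξ)) (by rw [e]; exact h2) h1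
  rw [smul_eq_mul] at h3
  rw [← h3.deriv]
  unfold testS
  simp only [add_sub_cancel_left, inv_smul_smul₀ hR.ne']
  rfl

theorem gradient_testS (hφ : ContDiff ℝ (⊤ : ℕ∞) φ) (hR : 0 < R) (τ : ℝ) (ξ : Ed d) :
    gradient (testS φ R z₀ (z₀.1 + R ^ 2 * τ)) (z₀.2 + R • ξ) = R⁻¹ • gx φ (τ, ξ) := by
  have e : testS φ R z₀ (z₀.1 + R ^ 2 * τ) = fun y => (fun x => φ (τ, x)) (R⁻¹ • (y - z₀.2)) := by
    funext y
    unfold testS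
    rw [add_sub_cancel_left, inv_mul_cancel_left₀ (by positivity)]
  refine ext_inner_right ℝ fun a => ?_
  rw [inner_smul_left, inner_gx, gradient, InnerProductSpace.toDual_symm_apply, e,
    fderiv_comp_inv (contDiff_slice hφ τ), fderiv_slice hφ, add_sub_cancel_left,
    inv_smul_smul₀ hR.ne']
  rfl

/-- The weak formulation in the rescaled variables, in iterated form. -/
theorem IsLocalWeakSolutionHom.weak_iterated {J : Set ℝ}
    (h : IsLocalWeakSolutionHom A K J Ω v Dv) (hR : 0 < R)
    (hJ : Icc (z₀.1 - R ^ 2) z₀.1 ⊆ J) (hΩ : closedBall z₀.2 R ⊆ Ω)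
    (hφ : ContDiff ℝ (⊤ : ℕ∞) φ) (hφt : tsupport φ ⊆ Ioo (-1) 0 ×ˢ ball 0 1) :
    -(∫ τ, ∫ ξ, vS v R z₀ (τ, ξ) * fderiv ℝ φ (τ, ξ) (1, 0))
      + (∫ τ, ∫ ξ, ⟪aS A Dv R z₀ (τ, ξ), gx φ (τ, ξ)⟫)
      + ∫ τ, ∫ ξ, ∫ η, diffXY (vS v R z₀) (τ, ξ, η) * diffXY φ (τ, ξ, η) * kS K R z₀ (τ, ξ, η)
      = 0 := by
  have hΩ' : ball z₀.2 R ⊆ Ω := ball_subset_closedBall.trans hΩ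
  have hR2 : 0 < R ^ 2 := by positivity
  have hRd : 0 < R ^ d := by positivity
  have hφ0 : ∀ τ ξ, (τ, ξ) ∉ Ioo (-1 : ℝ) 0 ×ˢ ball (0 : Ed d) 1 → φ (τ, ξ) = 0 := fun τ ξ hz =>
    image_eq_zero_of_notMem_tsupport fun h => hz (hφt h)
  have hf0 : ∀ τ ξ, (τ, ξ) ∉ Ioo (-1 : ℝ) 0 ×ˢ ball (0 : Ed d) 1 → fderiv ℝ φ (τ, ξ) = 0 :=
    fun τ ξ hz => fderiv_eq_zero_of_tsupport hφt hz
  have key := h (z₀.1 - R ^ 2) z₀.1 (by linarith) hJ _ (isTestFunction_testS hφ hφt hR hΩ)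
  have hb : ∀ τ ∉ Ioo (-1 : ℝ) 0, ∀ x, testS φ R z₀ (z₀.1 + R ^ 2 * τ) x = 0 := fun τ hτ x => by
    obtain ⟨ξ, rfl⟩ := exists_space_coord hR z₀.2 x
    rw [testS_apply hR]
    exact hφ0 τ ξ fun h => hτ h.1
  have hb0 : ∀ x, testS φ R z₀ z₀.1 x = 0 := fun x => by
    have := hb 0 (by simp) x
    rwa [mul_zero, add_zero] at this
  have hb1 : ∀ x, testS φ R z₀ (z₀.1 - R ^ 2) x = 0 := fun x => by
    have := hb (-1) (by simp) x
    rwa [mul_neg, mul_one, ← sub_eq_add_neg] at this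
  unfold mixedLHS at key
  simp only [hb0, hb1, mul_zero, integral_zero, add_zero, sub_zero] at key
  rw [setIntegral_time_space hR hΩ', setIntegral_time_space hR hΩ',
    setIntegral_time_space_space hR] at key
  · simp only [deriv_testS hφ hR, gradient_testS hφ hR, testS_apply hR] at key
    have e1 : ∫ τ, ∫ ξ, v (z₀.1 + R ^ 2 * τ) (z₀.2 + R • ξ) *
        ((R ^ 2)⁻¹ * fderiv ℝ φ (τ, ξ) (1, 0)) =
        (R ^ 2)⁻¹ * ∫ τ, ∫ ξ, vS v R z₀ (τ, ξ) * fderiv ℝ φ (τ, ξ) (1, 0) := by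
      simp only [← integral_const_mul]
      congr 1; ext τ; congr 1; ext ξ
      simp only [vS, affP, Function.uncurry]
      ring
    have e2 : ∫ τ, ∫ ξ, ⟪A (z₀.1 + R ^ 2 * τ) (z₀.2 + R • ξ)
        (Dv (z₀.1 + R ^ 2 * τ) (z₀.2 + R • ξ)), R⁻¹ • gx φ (τ, ξ)⟫ =
        (R ^ 2)⁻¹ * ∫ τ, ∫ ξ, ⟪aS A Dv R z₀ (τ, ξ), gx φ (τ, ξ)⟫ := by
      simp only [← integral_const_mul]
      congr 1; ext τ; congr 1; ext ξ
      simp only [aS, affP, Function.uncurry, inner_smul_left, inner_smul_right, conj_trivial]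
      field_simp
    have e3 : ∫ τ, ∫ ξ, ∫ η, (v (z₀.1 + R ^ 2 * τ) (z₀.2 + R • ξ)
          - v (z₀.1 + R ^ 2 * τ) (z₀.2 + R • η)) * (φ (τ, ξ) - φ (τ, η)) *
          K (z₀.1 + R ^ 2 * τ) (z₀.2 + R • ξ) (z₀.2 + R • η) =
        (R ^ (d + 2))⁻¹ * ∫ τ, ∫ ξ, ∫ η, diffXY (vS v R z₀) (τ, ξ, η) * diffXY φ (τ, ξ, η) *
          kS K R z₀ (τ, ξ, η) := by
      simp only [← integral_const_mul]
      congr 1; ext τ; congr 1; ext ξ; congr 1; ext η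
      simp only [vS, affP, Function.uncurry, diffXY, kS]
      field_simp
    rw [e1, e2, e3] at key
    set X := ∫ τ, ∫ ξ, vS v R z₀ (τ, ξ) * fderiv ℝ φ (τ, ξ) (1, 0)
    set Y := ∫ τ, ∫ ξ, ⟪aS A Dv R z₀ (τ, ξ), gx φ (τ, ξ)⟫
    set Z := ∫ τ, ∫ ξ, ∫ η, diffXY (vS v R z₀) (τ, ξ, η) * diffXY φ (τ, ξ, η) *
      kS K R z₀ (τ, ξ, η)
    have e4 : R ^ d * (-X + Y + Z) = 0 := by
      rw [← key, pow_add]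
      field_simp
    exact (mul_eq_zero.1 e4).resolve_left hRd.ne'
  · intro τ hτ ξ η
    rw [hb τ hτ, hb τ hτ]
    simp
  · intro τ ξ hz
    rw [gradient_testS hφ hR, gx, hf0 τ ξ hz]
    simp
  · intro τ ξ hz
    rw [deriv_testS hφ hR, hf0 τ ξ hz]
    simp

end RescaleWeak

section RescaleSol

variable {s Λ R ε : ℝ} {z₀ : Gd d} {J : Set ℝ} {Ω : Set (Ed d)} {v : ℝ → Ed d → ℝ}
  {Dv : ℝ → Ed d → Ed d} {A : ℝ → Ed d → Ed d → Ed d} {K : ℝ → Ed d → Ed d → ℝ} {φ : Gd d → ℝ}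

theorem integrable_diffXY_mul_of_loc {w : Gd d → ℝ} {Dw : Gd d → Ed d}
    {ν : Measure (ℝ × Ed d × Ed d)} (hd : 1 ≤ d) (hs : s ∈ Ioo (0 : ℝ) 1) (hm : Measurable w)
    (hloc : ∃ O, IsOpen O ∧ volume O ≠ ⊤ ∧ Icc (-1) 0 ×ˢ closedBall 0 1 ⊆ O ∧
      MemLp w 2 (volume.restrict O) ∧ MemLp Dw 2 (volume.restrict O) ∧ HasWeakGx w Dw O)
    (hsymm : ν.map swapXY = ν) (hle : ν ≤ ENNReal.ofReal Λ • nuS d s)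
    (htail : ∀ r, 0 < r → ∫⁻ t in Ioo (-1) 0, tauS s w r t ^ 2 < ⊤)
    (hφ : ContDiff ℝ (⊤ : ℕ∞) φ) (hφc : HasCompactSupport φ)
    (hφt : tsupport φ ⊆ Ioo (-1) 0 ×ˢ ball 0 1) :
    Integrable (fun p => diffXY w p * diffXY φ p) ν := by
  have hφ1 : ContDiff ℝ 1 φ := hφ.of_le (by simp)
  obtain ⟨f, F, hfm, hf2, hF2, hfc, hfw, hfK⟩ :=
    exists_extension_of_loc hm hloc (g := fun _ => 0) (integrable_zero _ _ _)
  simp only [integral_zero, sub_zero] at hfK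
  have hsub : Ioo (-1 : ℝ) 0 ×ˢ ball (0 : Ed d) 1 ⊆ Icc (-1) 0 ×ˢ closedBall (0 : Ed d) 1 :=
    Set.prod_mono Ioo_subset_Icc_self ball_subset_closedBall
  obtain ⟨ρ, hρ1, hρ⟩ := exists_lt_subset_ball (s := Prod.snd '' tsupport φ)
    (hφc.isCompact.image continuous_snd).isClosed
    (by rintro _ ⟨z, hz, rfl⟩; exact (hφt hz).2)
  have hφ0 : ∀ z : Gd d, z ∉ Ioo (-1) 0 ×ˢ ball (0 : Ed d) ρ → φ z = 0 := fun z hz =>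
    image_eq_zero_of_notMem_tsupport fun h => hz ⟨(hφt h).1, hρ ⟨z, h, rfl⟩⟩
  have hw2 : MemLp w 2 (volume.restrict (Ioo (-1) 0 ×ˢ ball (0 : Ed d) ρ)) := by
    obtain ⟨O, -, -, hKO, hv, -, -⟩ := hloc
    exact hv.mono_measure (Measure.restrict_mono
      ((Set.prod_mono subset_rfl (ball_subset_ball hρ1.le)).trans (hsub.trans hKO)) le_rfl)
  have hφL := memLp_of_contDiff hφ1 hφc
  have hνle : ν.restrict (nearA d 1) ≤ ENNReal.ofReal Λ • nuS d s :=
    Measure.restrict_le_self.trans hle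
  have hfd := ((sobW_of_weak hfm hf2 hF2 hfc hfw).memLp_diffXY hd hs).of_measure_le_smul
    ENNReal.ofReal_ne_top hνle
  have hφd : MemLp (diffXY φ) 2 (ν.restrict (nearA d 1)) :=
    ((⟨hφ1.continuous.measurable, hφL.1, hφL.2, fun _ => φ, fun _ => hφ1,
      fun _ => hφc, by simp, by simp⟩ : SobW φ (gx φ)).memLp_diffXY hd hs).of_measure_le_smul
      ENNReal.ofReal_ne_top hνle
  have hN : IntegrableOn (fun p => diffXY w p * diffXY φ p) (nearA d 1) ν := by
    refine IntegrableOn.congr_fun (f := fun p => diffXY f p * diffXY φ p)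
      (MemLp.integrable_mul (q := 2) hfd hφd) (fun p hp => ?_) (measurableSet_nearA 1)
    simp only [diffXY, (hfK (p.1, p.2.1) (hsub ⟨hp.1, hp.2.1⟩)).1,
      (hfK (p.1, p.2.2) (hsub ⟨hp.1, hp.2.2⟩)).1]
  have hW := lintegral_farW_sq_lt_top hs.1 hm one_pos hw2 (htail 1 one_pos)
  have hF := integrableOn_far hle hs.1 hρ1 le_rfl hm hφ1.continuous.measurable
    (fun z hz => hφ0 z fun h => hz h.1) hW hφL.1.2
  exact (integral_diffXY_split hsymm hm hφ1.continuous.measurable hρ1.le hφ0 hN hF).1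

/-- Integrals against the rescaled jump measure as iterated integrals. -/
theorem KernelHyp.integral_nuK (hK : KernelHyp d s Λ K) (hΛ : 0 ≤ Λ) (hR : 0 < R)
    {g h : Gd d → ℝ} (hi : Integrable (fun p => diffXY g p * diffXY h p) (nuK K R z₀)) :
    ∫ p, diffXY g p * diffXY h p ∂nuK K R z₀ = ∫ τ, ∫ ξ, ∫ η,
      diffXY g (τ, ξ, η) * diffXY h (τ, ξ, η) * kS K R z₀ (τ, ξ, η) := by
  have hm : Measurable fun p => ENNReal.ofReal (kS K R z₀ p) := hK.measurable_kS.ennreal_ofReal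
  have e : ∀ p, (ENNReal.ofReal (kS K R z₀ p)).toReal • (diffXY g p * diffXY h p) =
      diffXY g p * diffXY h p * kS K R z₀ p := fun p => by
    rw [smul_eq_mul, mul_comm]
    by_cases hp : p.2.1 = p.2.2
    · simp [diffXY, hp]
    · rw [ENNReal.toReal_ofReal]
      have hne : z₀.2 + R • p.2.1 ≠ z₀.2 + R • p.2.2 := fun h =>
        hp (smul_right_injective _ hR.ne' (add_left_cancel h))
      exact mul_nonneg (by positivity) (le_trans (by positivity) (hK.lower _ _ _ hne))
  rw [nuK, integrable_withDensity_iff_integrable_smul' hm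
    (ae_of_all _ fun _ => ENNReal.ofReal_lt_top)] at hi
  rw [nuK, integral_withDensity_eq_integral_toReal_smul hm
    (ae_of_all _ fun _ => ENNReal.ofReal_lt_top)]
  simp only [e] at hi ⊢
  rw [Measure.volume_eq_prod] at hi ⊢
  rw [integral_prod _ hi]
  refine integral_congr_ae (hi.prod_right_ae.mono fun τ hτ => ?_)
  simp only
  rw [Measure.volume_eq_prod] at hτ ⊢
  rw [integral_prod _ hτ]

theorem USol.of_rescale (hd : 1 ≤ d) (hs : s ∈ Ioo (0 : ℝ) 1) (hΛ : 1 ≤ Λ)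
    (hA : VectorFieldHyp d Λ A) (hK : KernelHyp d s Λ K) (hv : LocalWeakReg d s J Ω v Dv)
    (h : IsLocalWeakSolutionHom A K J Ω v Dv) (hR : 0 < R) (hR1 : R ≤ 1) (hε : 0 < ε)
    (hJ : Icc (z₀.1 - 2 * R ^ 2) (z₀.1 + R ^ 2 * ε) ⊆ J) (hΩ : closedBall z₀.2 (2 * R) ⊆ Ω) :
    USol s Λ (vS v R z₀) (DvS Dv R z₀) (aS A Dv R z₀) (nuK K R z₀) := by
  have hΛ0 : 0 ≤ Λ := zero_le_one.trans hΛ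
  have hR2 : 0 < R ^ 2 := by positivity
  have hJ' : Icc (z₀.1 - R ^ 2) z₀.1 ⊆ J :=
    (Icc_subset_Icc (by linarith) (by nlinarith)).trans hJ
  have hloc := hv.loc_scaled hR hε hJ hΩ
  have hle := hK.nuK_le_nuS (z₀ := z₀) hd hs.2.le hΛ0 hR hR1
  have htail : ∀ r, 0 < r → ∫⁻ t in Ioo (-1) 0, tauS s (vS v R z₀) r t ^ 2 < ⊤ := fun r hr =>
    hv.tail_scaled hs.1.le hR hJ' hr
  have ha : Measurable (aS A Dv R z₀) :=
    ((measurable_flux hA hv.measD).comp measurable_affP).const_smul R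
  refine ⟨hv.measurable_vS, hv.measurable_DvS, ha, hloc, norm_aS_le hA, le_inner_aS hA, hK.map_nuK,
    hle, htail, fun φ hφ hφc hφt => ?_⟩
  have hφ1 : ContDiff ℝ 1 φ := hφ.of_le (by simp)
  have hi := integrable_diffXY_mul_of_loc hd hs hv.measurable_vS hloc hK.map_nuK hle htail hφ hφc hφt
  rw [hK.integral_nuK hΛ0 hR hi, ← h.weak_iterated hR hJ'
    ((closedBall_subset_closedBall (by linarith)).trans hΩ) hφ hφt]
  obtain ⟨m1, m2⟩ := hv.memLp_scaled hR hJ hΩ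
  have hsub : Ioo (-1 : ℝ) 0 ×ˢ ball (0 : Ed d) 1 ⊆ Ioo (-2) ε ×ˢ ball (0 : Ed d) 2 :=
    Set.prod_mono (Ioo_subset_Ioo (by norm_num) hε.le) (ball_subset_ball (by norm_num))
  have i1 : Integrable fun z => vS v R z₀ z * fderiv ℝ φ z (1, 0) :=
    MemLp.integrable_mul_of_eq_zero m1
      ((hφ1.continuous_fderiv (by simp)).clm_apply continuous_const) (hφc.fderiv_apply ℝ _)
      fun z hz => by rw [fderiv_eq_zero_of_tsupport hφt fun h => hz (hsub h)]; rfl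
  have m3 : MemLp (aS A Dv R z₀) 2 (volume.restrict (Ioo (-2) ε ×ˢ ball (0 : Ed d) 2)) :=
    m2.of_le_mul ha.aestronglyMeasurable (Eventually.of_forall (norm_aS_le hA))
  have i2 : Integrable fun z => ⟪aS A Dv R z₀ z, gx φ z⟫ := by
    rw [← integrableOn_univ]
    refine IntegrableOn.of_forall_sdiff_eq_zero (s := Ioo (-2) ε ×ˢ ball (0 : Ed d) 2)
      (MemLp.integrable_inner_two m3 ((memLp_of_contDiff hφ1 hφc).2.restrict _))
      MeasurableSet.univ fun z hz => ?_
    simp [gx, fderiv_eq_zero_of_tsupport hφt fun h => hz.2 (hsub h)]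
  rw [Measure.volume_eq_prod] at i1 i2 ⊢
  rw [integral_prod _ i1, integral_prod _ i2]

end RescaleSol

section RescaleBound

variable {s Λ R ε : ℝ} {z₀ : Gd d} {J : Set ℝ} {Ω : Set (Ed d)} {v : ℝ → Ed d → ℝ}
  {Dv : ℝ → Ed d → Ed d}

theorem measurable_tail_integrand (hm : Measurable (Function.uncurry v)) (s : ℝ) (x₀ : Ed d) :
    Measurable fun z : Gd d => |v z.1 z.2| / ‖x₀ - z.2‖ ^ ((d : ℝ) + 2 * s) :=
  Measurable.div (hm.norm) ((measurable_const.sub measurable_snd).norm.pow_const _)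

theorem measurable_tail (hm : Measurable (Function.uncurry v)) (s : ℝ) (x₀ : Ed d) (R : ℝ) :
    Measurable fun t => Tail s (v t) x₀ R := by
  unfold Tail
  refine measurable_const.mul (StronglyMeasurable.measurable ?_)
  exact StronglyMeasurable.integral_prod_right (ν := volume.restrict (ball x₀ R)ᶜ)
    (f := fun t y => |v t y| / ‖x₀ - y‖ ^ ((d : ℝ) + 2 * s))
    (measurable_tail_integrand hm s x₀).stronglyMeasurable

theorem tail_nonneg (s : ℝ) (f : Ed d → ℝ) (x₀ : Ed d) (R : ℝ) : 0 ≤ Tail s f x₀ R :=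
  mul_nonneg (sq_nonneg R) (integral_nonneg fun y => by positivity)

theorem tauS_vS_eq (hR : 0 < R) (t : ℝ) :
    tauS s (vS v R z₀) 1 t = ENNReal.ofReal (R ^ ((d : ℝ) + 2 * s) * (R ^ d)⁻¹) *
      ∫⁻ x in (ball z₀.2 R)ᶜ, ENNReal.ofReal
        (|v (z₀.1 + R ^ 2 * t) x| / ‖z₀.2 - x‖ ^ ((d : ℝ) + 2 * s)) := by
  have hRp := Real.rpow_pos_of_pos hR ((d : ℝ) + 2 * s)
  unfold tauS
  rw [← lintegral_indicator measurableSet_ball.compl, ← lintegral_indicator measurableSet_ball.compl,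
    ENNReal.ofReal_mul hRp.le, mul_assoc, ← lintegral_comp_space hR z₀.2,
    ← lintegral_const_mul' _ _ ENNReal.ofReal_ne_top]
  refine lintegral_congr fun y => ?_
  have hmem : z₀.2 + R • y ∈ (ball z₀.2 R)ᶜ ↔ y ∈ (ball (0 : Ed d) 1)ᶜ := by
    simp only [mem_compl_iff, mem_ball, dist_self_add_left, norm_smul, Real.norm_eq_abs,
      abs_of_pos hR, dist_zero_right, not_lt]
    exact le_mul_iff_one_le_right hR
  by_cases hy : y ∈ (ball (0 : Ed d) 1)ᶜ
  · rw [indicator_of_mem hy, indicator_of_mem (hmem.2 hy), ← ofReal_norm,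
      ← ENNReal.ofReal_mul (norm_nonneg _), ← ENNReal.ofReal_mul hRp.le]
    congr 1
    rw [sub_add_cancel_left, norm_neg, norm_smul, Real.norm_eq_abs R, abs_of_pos hR,
      Real.mul_rpow hR.le (norm_nonneg _), kerS, Real.norm_eq_abs]
    simp only [vS, affP, Function.uncurry]
    rw [mul_one_div]
    have : 0 < ‖y‖ := by
      have : 1 ≤ ‖y‖ := by simpa using hy
      linarith
    have := Real.rpow_pos_of_pos this ((d : ℝ) + 2 * s)
    field_simp
  · rw [indicator_of_notMem hy, indicator_of_notMem fun h => hy (hmem.1 h), mul_zero]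

theorem tail_eq_tauS (hm : Measurable (Function.uncurry v)) (hR : 0 < R) {t : ℝ}
    (ht : tauS s (vS v R z₀) 1 t < ⊤) :
    ENNReal.ofReal (R ^ (2 - 2 * s)) * tauS s (vS v R z₀) 1 t =
      ENNReal.ofReal (Tail s (v (z₀.1 + R ^ 2 * t)) z₀.2 R) := by
  have hRp := Real.rpow_pos_of_pos hR ((d : ℝ) + 2 * s)
  have hRd : 0 < R ^ d := by positivity
  rw [tauS_vS_eq hR] at ht ⊢
  set E := ∫⁻ x in (ball z₀.2 R)ᶜ, ENNReal.ofReal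
        (|v (z₀.1 + R ^ 2 * t) x| / ‖z₀.2 - x‖ ^ ((d : ℝ) + 2 * s)) with hE
  have hEt : E < ⊤ := by
    refine lt_top_iff_ne_top.2 fun h => ht.ne ?_
    rw [h, ENNReal.mul_top (by simpa using by positivity)]
  have hmm : Measurable fun x =>
      |v (z₀.1 + R ^ 2 * t) x| / ‖z₀.2 - x‖ ^ ((d : ℝ) + 2 * s) :=
    (measurable_tail_integrand hm s z₀.2).comp (measurable_prodMk_left (x := z₀.1 + R ^ 2 * t))
  have hI : IntegrableOn (fun x => |v (z₀.1 + R ^ 2 * t) x| / ‖z₀.2 - x‖ ^ ((d : ℝ) + 2 * s))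
      (ball z₀.2 R)ᶜ := by
    refine ⟨hmm.aestronglyMeasurable, ?_⟩
    rw [hasFiniteIntegral_iff_ofReal (ae_of_all _ fun x => by positivity)]
    exact hEt
  unfold Tail
  rw [ENNReal.ofReal_mul (sq_nonneg R),
    ofReal_integral_eq_lintegral_ofReal hI (ae_of_all _ fun x => by positivity), ← mul_assoc,
    ← ENNReal.ofReal_mul (by positivity)]
  congr 2
  rw [← Real.rpow_natCast R d, ← Real.rpow_natCast R 2, ← Real.rpow_neg hR.le, ← Real.rpow_add hR,
    ← Real.rpow_add hR]
  congr 1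
  push_cast
  ring

/-- The part of the rescaled tail outside the unit ball. -/
theorem LocalWeakReg.lintegral_tail_far (hv : LocalWeakReg d s J Ω v Dv) (hs : 0 ≤ s) (hR : 0 < R)
    (hJ : Icc (z₀.1 - R ^ 2) z₀.1 ⊆ J) :
    ENNReal.ofReal (R ^ (2 - 2 * s)) * ∫⁻ t in Ioo (-1) 0, tauS s (vS v R z₀) 1 t =
      ENNReal.ofReal (⨍ t in Iminus z₀.1 R, Tail s (v t) z₀.2 R) := by
  have hR2 : 0 < R ^ 2 := by positivity
  have hτm := measurable_tauS (hv.measurable_vS (R := R) (z₀ := z₀)) s 1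
  have h2 := hv.tail_scaled (r := 1) hs hR hJ one_pos
  have h1 : ∫⁻ t in Ioo (-1) 0, tauS s (vS v R z₀) 1 t < ⊤ := by
    have hle : ∀ x : ℝ≥0∞, x ≤ 1 + x ^ 2 := fun x => by
      rcases le_total x 1 with h | h
      · exact h.trans le_self_add
      · exact (le_self_pow₀ h two_ne_zero).trans le_add_self
    refine lt_of_le_of_lt (lintegral_mono fun t => hle _) ?_
    rw [lintegral_add_left measurable_const]
    exact ENNReal.add_lt_top.2 ⟨by simp, h2⟩
  have hae : ∀ᵐ t ∂(volume.restrict (Ioo (-1 : ℝ) 0)), tauS s (vS v R z₀) 1 t < ⊤ :=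
    ae_lt_top hτm h1.ne
  have h3 : ENNReal.ofReal (R ^ (2 - 2 * s)) * ∫⁻ t in Ioo (-1) 0, tauS s (vS v R z₀) 1 t =
      ENNReal.ofReal ((R ^ 2)⁻¹) *
        ∫⁻ t in Iminus z₀.1 R, ENNReal.ofReal (Tail s (v t) z₀.2 R) := by
    rw [← lintegral_const_mul' _ _ ENNReal.ofReal_ne_top, Iminus,
      ← setLIntegral_comp_time hR z₀.1 fun t => ENNReal.ofReal (Tail s (v t) z₀.2 R)]
    exact lintegral_congr_ae (hae.mono fun t ht => tail_eq_tauS hv.meas hR ht)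
  have hI : IntegrableOn (fun t => Tail s (v t) z₀.2 R) (Iminus z₀.1 R) := by
    refine ⟨(measurable_tail hv.meas s z₀.2 R).aestronglyMeasurable, ?_⟩
    rw [hasFiniteIntegral_iff_ofReal (ae_of_all _ fun t => tail_nonneg s _ _ _)]
    refine lt_top_iff_ne_top.2 fun h => ?_
    rw [h, ENNReal.mul_top (by simpa using hR.ne')] at h3
    exact (ENNReal.mul_lt_top ENNReal.ofReal_lt_top h1).ne h3
  rw [h3, setAverage_eq, smul_eq_mul, ENNReal.ofReal_mul (by positivity),
    ofReal_integral_eq_lintegral_ofReal hI (ae_of_all _ fun t => tail_nonneg s _ _ _)]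
  congr 2
  simp [Iminus, Measure.real, hR2.le]

/-- The rescaled `L¹` norm on the unit cylinder. -/
theorem LocalWeakReg.lintegral_vS_le (hv : LocalWeakReg d s J Ω v Dv) (hR : 0 < R)
    (hJ : Icc (z₀.1 - R ^ 2) z₀.1 ⊆ J) (hΩ : closedBall z₀.2 R ⊆ Ω) :
    ∫⁻ z in Ioo (-1) 0 ×ˢ ball (0 : Ed d) 1, ‖vS v R z₀ z‖ₑ ≤
      ENNReal.ofReal (volume.real (ball (0 : Ed d) 1) * ⨍ z in pCyl z₀.1 z₀.2 R, |v z.1 z.2|) := by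
  have hR2 : 0 < R ^ 2 := by positivity
  have hI := hv.l2w12 _ _ hJ _ (isCompact_closedBall _ _) hΩ
  have hvol : volume (pCyl z₀.1 z₀.2 R) =
      ENNReal.ofReal (R ^ 2 * R ^ d) * volume (ball (0 : Ed d) 1) := by
    rw [pCyl, Measure.volume_eq_prod, Measure.prod_prod, Iminus, Real.volume_Ioo,
      Measure.addHaar_ball_of_pos _ _ hR, finrank_euclideanSpace, Fintype.card_fin,
      ENNReal.ofReal_mul hR2.le, mul_assoc, sub_sub_cancel]
  have hvolt : volume (pCyl z₀.1 z₀.2 R) < ⊤ := by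
    rw [hvol]; exact ENNReal.mul_lt_top ENNReal.ofReal_lt_top measure_ball_lt_top
  have hfin : IsFiniteMeasure (volume.restrict (pCyl z₀.1 z₀.2 R)) := ⟨by simpa using hvolt⟩
  have hI1 : IntegrableOn (fun z : Gd d => |v z.1 z.2|) (pCyl z₀.1 z₀.2 R) := by
    have hI2 : IntegrableOn (fun z : Gd d => 1 + (v z.1 z.2 ^ 2 + ‖Dv z.1 z.2‖ ^ 2))
        (pCyl z₀.1 z₀.2 R) := (integrable_const 1).add
      (hI.mono_set (Set.prod_mono subset_rfl ball_subset_closedBall))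
    refine hI2.mono' (hv.meas.norm.aestronglyMeasurable) (ae_of_all _ fun z => ?_)
    rw [Real.norm_eq_abs, abs_abs]
    nlinarith [sq_abs (v z.1 z.2), sq_nonneg (|v z.1 z.2| - 1), sq_nonneg ‖Dv z.1 z.2‖]
  have hω : 0 < volume.real (ball (0 : Ed d) 1) :=
    ENNReal.toReal_pos (measure_ball_pos _ _ one_pos).ne' measure_ball_lt_top.ne
  calc _ ≤ ENNReal.ofReal (jacP d R) * ∫⁻ z in pCyl z₀.1 z₀.2 R, ‖Function.uncurry v z‖ₑ := by
        refine setLIntegral_comp_affP hR (fun z => ‖Function.uncurry v z‖ₑ)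
          (measurableSet_Ioo.prod measurableSet_ball) (measurableSet_Ioo.prod measurableSet_ball) ?_
        rintro ⟨t, x⟩ ⟨ht, hx⟩
        have hx1 : ‖x‖ < 1 := by simpa using hx
        refine ⟨⟨?_, ?_⟩, ?_⟩
        · simp only [affP]; nlinarith [ht.1]
        · simp only [affP]; nlinarith [ht.2]
        · simp only [affP, mem_ball, dist_self_add_left, norm_smul, Real.norm_eq_abs,
            abs_of_pos hR]
          nlinarith
    _ = ENNReal.ofReal (jacP d R) * ENNReal.ofReal (∫ z in pCyl z₀.1 z₀.2 R, |v z.1 z.2|) := by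
        rw [ofReal_integral_eq_lintegral_ofReal hI1 (ae_of_all _ fun z => abs_nonneg _)]
        congr 1
        refine lintegral_congr fun z => ?_
        rw [← ofReal_norm]
        rfl
    _ = _ := by
        rw [← ENNReal.ofReal_mul (jacP_pos hR).le, setAverage_eq, smul_eq_mul]
        congr 1
        have : volume.real (pCyl z₀.1 z₀.2 R) =
            R ^ 2 * R ^ d * volume.real (ball (0 : Ed d) 1) := by
          rw [Measure.real, hvol, ENNReal.toReal_mul, ENNReal.toReal_ofReal (by positivity)]
          rfl
        rw [this, jacP]
        field_simp

end RescaleBound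

section RescaleFinal

variable {s Λ R ε : ℝ} {z₀ : Gd d} {J : Set ℝ} {Ω : Set (Ed d)} {v : ℝ → Ed d → ℝ}
  {Dv : ℝ → Ed d → Ed d} {A : ℝ → Ed d → Ed d → Ed d} {K : ℝ → Ed d → Ed d → ℝ}

theorem kerS_le_of_half_le (hs : s ∈ Ioo (0 : ℝ) 1) {y : Ed d} (hy : 1 / 2 ≤ ‖y‖) :
    kerS s y ≤ 2 ^ (d + 2) := by
  have hp : 0 ≤ (d : ℝ) + 2 * s := by have := hs.1; positivity
  have h1 : (1 / 2 : ℝ) ^ ((d : ℝ) + 2 * s) ≤ ‖y‖ ^ ((d : ℝ) + 2 * s) :=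
    Real.rpow_le_rpow (by norm_num) hy hp
  calc kerS s y ≤ 1 / (1 / 2 : ℝ) ^ ((d : ℝ) + 2 * s) :=
        one_div_le_one_div_of_le (by positivity) h1
    _ = 2 ^ ((d : ℝ) + 2 * s) := by
        rw [one_div, one_div, Real.inv_rpow zero_le_two, inv_inv]
    _ ≤ 2 ^ (((d + 2 : ℕ) : ℝ)) := by
        refine Real.rpow_le_rpow_of_exponent_le one_le_two ?_
        push_cast
        linarith [hs.2]
    _ = 2 ^ (d + 2) := Real.rpow_natCast _ _

theorem lintegral_tauS_half_le (hs : s ∈ Ioo (0 : ℝ) 1) {w : Gd d → ℝ} (hw : Measurable w) :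
    ∫⁻ t in Ioo (-1) 0, tauS s w (1 / 2) t ≤
      ENNReal.ofReal (2 ^ (d + 2)) * (∫⁻ z in Ioo (-1) 0 ×ˢ ball (0 : Ed d) 1, ‖w z‖ₑ) +
        ∫⁻ t in Ioo (-1) 0, tauS s w 1 t := by
  have h1 : ∀ t, tauS s w (1 / 2) t ≤
      ENNReal.ofReal (2 ^ (d + 2)) * (∫⁻ y in ball (0 : Ed d) 1, ‖w (t, y)‖ₑ) + tauS s w 1 t := by
    intro t
    have hsub : (ball (0 : Ed d) (1 / 2))ᶜ ⊆ (ball 0 1 \ ball 0 (1 / 2)) ∪ (ball (0 : Ed d) 1)ᶜ := by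
      intro y hy
      by_cases h : y ∈ ball (0 : Ed d) 1
      · exact Or.inl ⟨h, hy⟩
      · exact Or.inr h
    refine (lintegral_mono_set hsub).trans ((lintegral_union_le _ _ _).trans (add_le_add ?_ le_rfl))
    calc _ ≤ ∫⁻ y in ball (0 : Ed d) 1 \ ball 0 (1 / 2),
          ENNReal.ofReal (2 ^ (d + 2)) * ‖w (t, y)‖ₑ := by
          refine setLIntegral_mono' (measurableSet_ball.diff measurableSet_ball) fun y hy => ?_
          rw [mul_comm]
          refine mul_le_mul_left (ENNReal.ofReal_le_ofReal (kerS_le_of_half_le hs ?_)) _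
          simpa using hy.2
      _ ≤ _ := by
          rw [← lintegral_const_mul' _ _ ENNReal.ofReal_ne_top]
          exact lintegral_mono_set sdiff_subset
  refine (lintegral_mono fun t => h1 t).trans ?_
  rw [lintegral_add_right _ (measurable_tauS hw s 1),
    lintegral_const_mul' _ _ ENNReal.ofReal_ne_top]
  refine le_of_eq ?_
  congr 2
  rw [Measure.volume_eq_prod, ← Measure.prod_restrict, lintegral_prod _ (by fun_prop)]

theorem KernelHyp.tailLe (hK : KernelHyp d s Λ K) (hd : 1 ≤ d) (hs : s ∈ Ioo (0 : ℝ) 1)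
    (hΛ : 0 ≤ Λ) (hv : LocalWeakReg d s J Ω v Dv) (hR : 0 < R) (hR1 : R ≤ 1)
    (hJ : Icc (z₀.1 - R ^ 2) z₀.1 ⊆ J) (hΩ : closedBall z₀.2 R ⊆ Ω) :
    TailLe s Λ (nuK K R z₀) (vS v R z₀) (2 ^ (d + 2) * (volume.real (ball (0 : Ed d) 1) *
      ⨍ z in pCyl z₀.1 z₀.2 R, |v z.1 z.2|) + ⨍ t in Iminus z₀.1 R, Tail s (v t) z₀.2 R) := by
  have hθ : R ^ (2 - 2 * s) ≤ 1 := Real.rpow_le_one hR.le hR1 (by linarith [hs.2])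
  refine ⟨R ^ (2 - 2 * s), by positivity, hK.nuK_le hd hΛ hR, ?_⟩
  have ha : 0 ≤ ⨍ z in pCyl z₀.1 z₀.2 R, |v z.1 z.2| := by
    rw [setAverage_eq]
    exact smul_nonneg (by positivity) (integral_nonneg fun z => abs_nonneg _)
  have hb : 0 ≤ ⨍ t in Iminus z₀.1 R, Tail s (v t) z₀.2 R := by
    rw [setAverage_eq]
    exact smul_nonneg (by positivity) (integral_nonneg fun t => tail_nonneg s _ _ _)
  rw [ENNReal.ofReal_add (by positivity) hb, ENNReal.ofReal_mul (by positivity),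
    ← hv.lintegral_tail_far hs.1.le hR hJ]
  refine (mul_le_mul_right (lintegral_tauS_half_le hs hv.measurable_vS) _).trans ?_
  rw [mul_add]
  refine add_le_add ?_ le_rfl
  refine (mul_le_of_le_one_left zero_le ?_).trans (mul_le_mul_right (hv.lintegral_vS_le hR hJ hΩ) _)
  simpa using hθ

/-- The constant in the local boundedness estimate. -/
def cLoc (d : ℕ) (s Λ : ℝ) : ℝ :=
  cInt d s Λ ^ 2 * (2 ^ ((3 * d + 13) * d)) ^ 2 *
    (2 ^ (d + 2) * volume.real (ball (0 : Ed d) 1) + 1)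

theorem cLoc_pos (hΛ : 1 ≤ Λ) : 0 < cLoc d s Λ := by
  have := one_le_cInt (d := d) (s := s) hΛ
  unfold cLoc
  positivity

theorem IsLocalWeakSolutionHom.abs_le (hd : 2 ≤ d) (hs : s ∈ Ioo (0 : ℝ) 1) (hΛ : 1 ≤ Λ)
    (hA : VectorFieldHyp d Λ A) (hK : KernelHyp d s Λ K) (hv : LocalWeakReg d s J Ω v Dv)
    (h : IsLocalWeakSolutionHom A K J Ω v Dv) (hR : 0 < R) (hR1 : R ≤ 1) (hε : 0 < ε)
    (hJ : Icc (z₀.1 - 2 * R ^ 2) (z₀.1 + R ^ 2 * ε) ⊆ J) (hΩ : closedBall z₀.2 (2 * R) ⊆ Ω) :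
    ∀ᵐ z : Gd d, z ∈ pCyl z₀.1 z₀.2 (R / 2) → |v z.1 z.2| ≤
      cLoc d s Λ * ((⨍ z in pCyl z₀.1 z₀.2 R, |v z.1 z.2|)
        + ⨍ t in Iminus z₀.1 R, Tail s (v t) z₀.2 R) := by
  have hR2 : 0 < R ^ 2 := by positivity
  have hd1 : 1 ≤ d := by omega
  have hΛ0 : 0 ≤ Λ := zero_le_one.trans hΛ
  have hJ' : Icc (z₀.1 - R ^ 2) z₀.1 ⊆ J :=
    (Icc_subset_Icc (by linarith) (by nlinarith)).trans hJ
  have hΩ' : closedBall z₀.2 R ⊆ Ω := (closedBall_subset_closedBall (by linarith)).trans hΩ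
  set X := ⨍ z in pCyl z₀.1 z₀.2 R, |v z.1 z.2| with hX
  set Y := ⨍ t in Iminus z₀.1 R, Tail s (v t) z₀.2 R with hY
  have hX0 : 0 ≤ X := by
    rw [hX, setAverage_eq]
    exact smul_nonneg (by positivity) (integral_nonneg fun z => abs_nonneg _)
  have hY0 : 0 ≤ Y := by
    rw [hY, setAverage_eq]
    exact smul_nonneg (by positivity) (integral_nonneg fun t => tail_nonneg s _ _ _)
  set ω := volume.real (ball (0 : Ed d) 1) with hω
  have hω0 : 0 ≤ ω := measureReal_nonneg
  have U := USol.of_rescale hd1 hs hΛ hA hK hv h hR hR1 hε hJ hΩ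
  have h2 : (1 : ℝ) ≤ 2 ^ (d + 2) := one_le_pow₀ one_le_two
  have hL : 2 ^ (d + 2) * (ω * X) + Y ≤ (2 ^ (d + 2) * ω + 1) * (X + Y) := by
    have : 0 ≤ 2 ^ (d + 2) * ω := by positivity
    nlinarith [mul_nonneg this hY0]
  have hL' : ω * X ≤ (2 ^ (d + 2) * ω + 1) * (X + Y) := by
    refine le_trans ?_ hL
    nlinarith [mul_nonneg hω0 hX0]
  set M := cInt d s Λ ^ 2 * (2 ^ ((3 * d + 13) * d)) ^ 2 with hM
  have key : ∀ n : ℕ, ∀ᵐ z : Gd d, z ∈ Ioo (-(1 / 2)) 0 ×ˢ ball (0 : Ed d) (1 / 2) →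
      |vS v R z₀ z| ≤ M * ((2 ^ (d + 2) * ω + 1) * (X + Y) + 1 / ((n : ℝ) + 1)) := fun n => by
    have hn : 0 < 1 / ((n : ℝ) + 1) := by positivity
    refine U.abs_le_of_L1 hd hs hΛ (by positivity) ?_
      ((hK.tailLe hd1 hs hΛ0 hv hR hR1 hJ' hΩ').mono (by linarith))
    refine (lintegral_mono_set (Set.prod_mono (Ioo_subset_Ioo (by norm_num) le_rfl)
      (ball_subset_ball (by norm_num)))).trans ((hv.lintegral_vS_le hR hJ' hΩ').trans
      (ENNReal.ofReal_le_ofReal (by linarith)))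
  refine ae_of_ae_affP hR (z₀ := z₀) ?_
  filter_upwards [ae_all_iff.2 key] with z hz hmem
  have hz' : z ∈ Ioo (-(1 / 2)) 0 ×ˢ ball (0 : Ed d) (1 / 2) := by
    obtain ⟨⟨h1, h2⟩, h3⟩ := hmem
    simp only [affP] at h1 h2 h3
    rw [mem_ball, dist_self_add_left, norm_smul, Real.norm_eq_abs, abs_of_pos hR] at h3
    refine ⟨⟨?_, ?_⟩, ?_⟩
    · by_contra hc
      nlinarith
    · by_contra hc
      nlinarith
    · rw [mem_ball, dist_zero_right]
      by_contra hc
      nlinarith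
  have hlim : Tendsto (fun n : ℕ => M * ((2 ^ (d + 2) * ω + 1) * (X + Y) + 1 / ((n : ℝ) + 1))) atTop
      (𝓝 (M * ((2 ^ (d + 2) * ω + 1) * (X + Y) + 0))) :=
    (tendsto_const_nhds.add tendsto_one_div_add_atTop_nhds_zero_nat).const_mul M
  have := ge_of_tendsto' hlim fun n => hz n hz'
  rw [add_zero, ← mul_assoc] at this
  exact this

end RescaleFinal

/-- **Lemma 3.2: local boundedness with `L¹` tail.** -/
theorem local_boundedness_with_L1_tail
    (d : ℕ) (hd : 2 ≤ d) (s Λ : ℝ) (hs : s ∈ Set.Ioo (0 : ℝ) 1) (hΛ : 1 ≤ Λ) :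
    ∃ C : ℝ, 0 < C ∧
      ∀ (T : ℝ), 0 < T → ∀ (Ω : Set (Ed d)), IsOpen Ω → Bornology.IsBounded Ω →
      ∀ (A : ℝ → Ed d → Ed d → Ed d), VectorFieldHyp d Λ A →
      ∀ (K : ℝ → Ed d → Ed d → ℝ), KernelHyp d s Λ K →
      ∀ (v : ℝ → Ed d → ℝ) (Dv : ℝ → Ed d → Ed d),
        LocalWeakReg d s (Set.Ioo 0 T) Ω v Dv →
        IsLocalWeakSolutionHom A K (Set.Ioo 0 T) Ω v Dv →
        ∀ R ∈ Set.Ioc (0 : ℝ) 1, ∀ (t₀ : ℝ) (x₀ : Ed d),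
          closure ((Iminus t₀ (2 * R)) ×ˢ Metric.ball x₀ (2 * R)) ⊆ (Set.Ioo 0 T) ×ˢ Ω →
          ∀ᵐ p ∂(volume : Measure (ℝ × Ed d)),
            p ∈ pCyl t₀ x₀ (R / 2) →
            |v p.1 p.2| ≤
              C * ((⨍ z in pCyl t₀ x₀ R, |v z.1 z.2|)
                + ⨍ t in Iminus t₀ R, Tail s (v t) x₀ R) := by
  refine ⟨cLoc d s Λ, cLoc_pos hΛ, fun T _ Ω _ _ A hA K hK v Dv hv h R hR t₀ x₀ hcl => ?_⟩
  have hR0 : 0 < R := hR.1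
  have hR2 : 0 < R ^ 2 := by positivity
  rw [closure_prod_eq, Iminus, closure_Ioo (by nlinarith), closure_ball _ (by positivity)] at hcl
  have hx : x₀ ∈ closedBall x₀ (2 * R) := mem_closedBall_self (by positivity)
  have h0 : (t₀ - (2 * R) ^ 2, x₀) ∈ Ioo 0 T ×ˢ Ω := hcl ⟨⟨le_rfl, by nlinarith⟩, hx⟩
  have h1 : (t₀, x₀) ∈ Ioo 0 T ×ˢ Ω := hcl ⟨⟨by nlinarith, le_rfl⟩, hx⟩
  have hT : t₀ < T := h1.1.2
  have h00 : 0 < t₀ - (2 * R) ^ 2 := h0.1.1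
  refine h.abs_le (z₀ := (t₀, x₀)) (ε := (T - t₀) / 2) hd hs hΛ hA hK hv hR0 hR.2
    (by linarith) ?_ fun y hy => ?_
  · intro t ht
    have hR1 : R ^ 2 ≤ 1 := pow_le_one₀ hR0.le hR.2
    exact ⟨by nlinarith [ht.1], by nlinarith [ht.2]⟩
  · exact (hcl (show (t₀, y) ∈ _ from ⟨⟨by nlinarith, le_rfl⟩, hy⟩)).2
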